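/- Let d ≥ 2 and let Ω be a homogeneous function of degree zero on ℝ^d∖{0} satisfying the cancellation condition and Ω ∈ L log L(S^{d-1}). Then the maximal dyadic truncated operator T_* is of weak type (1,1): there is a constant C depending only on d such that for every f ∈ L¹(ℝ^d) and every λ > 0, λ·|{x ∈ ℝ^d : T_* f(x) > λ}| ≤ C·C_Ω·‖f‖_{L¹(ℝ^d)}. -/

import Mathlib

open MeasureTheory Metric Set FourierTransform
open scoped ENNReal RealInnerProductSpace

noncomputable section

abbrev Rd (d : ℕ) : Type := EuclideanSpace ℝ (Fin d)

/-- Surface measure on the unit sphere `S^{d-1}`. -/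
def sphereMeasure (d : ℕ) : Measure (sphere (0 : Rd d) 1) :=
  (volume : Measure (Rd d)).toSphere

/-- Integral over the sphere of a function defined on `ℝ^d`. -/
def sphInt (d : ℕ) (g : Rd d → ℝ) : ℝ :=
  ∫ θ : sphere (0 : Rd d) 1, g (θ : Rd d) ∂(sphereMeasure d)

/-- `‖Ω‖₁`, the `L¹(S^{d-1})` norm of `Ω`. -/
def omegaL1 (d : ℕ) (Ω : Rd d → ℝ) : ℝ := sphInt d (fun x => |Ω x|)

/-- `‖Ω‖_{LlogL(S^{d-1})}`. -/
def omegaLlogL (d : ℕ) (Ω : Rd d → ℝ) : ℝ :=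
  sphInt d (fun x => |Ω x| * Real.log (2 + |Ω x|))

/-- The constant `C_Ω`. -/
def constCOmega (d : ℕ) (Ω : Rd d → ℝ) : ℝ :=
  omegaLlogL d Ω +
    sphInt d (fun x => |Ω x| * (1 + max (Real.log (|Ω x| / omegaL1 d Ω)) 0))

/-- `Ω` is homogeneous of degree zero on `ℝ^d ∖ {0}`. -/
def Homogeneous0 (d : ℕ) (Ω : Rd d → ℝ) : Prop :=
  ∀ x : Rd d, x ≠ 0 → ∀ r : ℝ, 0 < r → Ω (r • x) = Ω x

/-- The hypotheses on `Ω`: homogeneity of degree `0`, integrability on the sphere,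
the cancellation condition, and `Ω ∈ L log L(S^{d-1})`. -/
def OmegaHyp (d : ℕ) (Ω : Rd d → ℝ) : Prop :=
  Homogeneous0 d Ω ∧
  Integrable (fun θ : sphere (0 : Rd d) 1 => Ω (θ : Rd d)) (sphereMeasure d) ∧
  (∫ θ : sphere (0 : Rd d) 1, Ω (θ : Rd d) ∂(sphereMeasure d)) = 0 ∧
  Integrable (fun θ : sphere (0 : Rd d) 1 => |Ω (θ : Rd d)| * Real.log (2 + |Ω (θ : Rd d)|))
    (sphereMeasure d)

/-- `φ` is smooth, supported in the annulus `{2^{-4} < |x| < 2^{-2}}` and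
satisfies the partition of unity condition `Σ_j φ(2^{-j} x) = 1` for `x ≠ 0`. -/
def AdmissiblePhi (d : ℕ) (φ : Rd d → ℝ) : Prop :=
  ContDiff ℝ (⊤ : ℕ∞) φ ∧
  tsupport φ ⊆ {x : Rd d | (2:ℝ) ^ (-4 : ℤ) < ‖x‖ ∧ ‖x‖ < (2:ℝ) ^ (-2 : ℤ)} ∧
  ∀ x : Rd d, x ≠ 0 → HasSum (fun j : ℤ => φ ((2:ℝ) ^ (-j) • x)) 1

/-- The kernel `𝒦_j(x) = φ(2^{-j}x) Ω(x) |x|^{-d}`. -/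
def Kker (d : ℕ) (φ Om : Rd d → ℝ) (j : ℤ) (x : Rd d) : ℝ :=
  φ ((2:ℝ) ^ (-j) • x) * Om x * ‖x‖ ^ (-(d : ℤ))

/-- The dyadic operator `T_j f = 𝒦_j * f`. -/
def Tj (d : ℕ) (φ Om : Rd d → ℝ) (j : ℤ) (f : Rd d → ℝ) (x : Rd d) : ℝ :=
  ∫ y, Kker d φ Om j (x - y) * f y

/-- The maximal dyadic truncated operator `T_* f(x) = sup_l |Σ_{j ≥ l} T_j f(x)|`. -/
def TStar (d : ℕ) (φ Om f : Rd d → ℝ) (x : Rd d) : ℝ≥0∞ :=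
  ⨆ l : ℤ, ENNReal.ofReal |∑' j : {j : ℤ // l ≤ j}, Tj d φ Om (j : ℤ) f x|

section FourierBasics

variable {d : ℕ}

/-- Plancherel's identity for functions in `L¹ ∩ L²`. -/
theorem eLpNorm_fourier_eq {f : Rd d → ℂ} (hf : Integrable f) (hf2 : MemLp f 2) :
    eLpNorm (𝓕 f) 2 volume = eLpNorm f 2 volume := by
  set F : Lp ℂ 2 (volume : Measure (Rd d)) := hf2.toLp f with hF
  have hcont : Continuous (𝓕 f) :=
    VectorFourier.fourierIntegral_continuous Real.continuous_fourierChar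
      (by exact continuous_inner) hf
  have key : ∀ᵐ x, (𝓕 F : Lp ℂ 2 (volume : Measure (Rd d))) x = 𝓕 f x := by
    apply ae_eq_of_integral_contDiff_smul_eq
    · exact (Lp.memLp _).locallyIntegrable (by norm_num)
    · exact hcont.locallyIntegrable
    · intro g g_smooth g_cpt
      have hg₁ : HasCompactSupport (Complex.ofRealCLM ∘ g) := g_cpt.comp_left rfl
      have hg₂ : ContDiff ℝ (⊤ : ℕ∞) (Complex.ofRealCLM ∘ g) := by fun_prop
      have h1 := congrArg (fun T => T (hg₁.toSchwartzMap hg₂))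
        (Lp.fourier_toTemperedDistribution_eq F)
      simp only [TemperedDistribution.fourier_apply, Lp.toTemperedDistribution_apply] at h1
      have h2 : ∫ x, g x • (𝓕 F : Lp ℂ 2 (volume : Measure (Rd d))) x
          = ∫ x, (hg₁.toSchwartzMap hg₂) x • (𝓕 F : Lp ℂ 2 (volume : Measure (Rd d))) x := by
        simp
      rw [h2, ← h1]
      have h3 : ∫ x, (𝓕 (hg₁.toSchwartzMap hg₂)) x • F x
          = ∫ x, (𝓕 (hg₁.toSchwartzMap hg₂)) x • f x := by
        apply integral_congr_ae
        filter_upwards [hf2.coeFn_toLp] with x hx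
        rw [hF, hx]
      rw [h3]
      have h4 := VectorFourier.integral_fourierIntegral_smul_eq_flip (𝕜 := ℝ)
        (μ := (volume : Measure (Rd d))) (ν := (volume : Measure (Rd d)))
        (L := innerₗ (Rd d)) Real.continuous_fourierChar continuous_inner
        (f := (hg₁.toSchwartzMap hg₂)) (g := f) (SchwartzMap.integrable _) hf
      rw [flip_innerₗ] at h4
      have h5 : ∫ x, g x • 𝓕 f x = ∫ x, (hg₁.toSchwartzMap hg₂) x • 𝓕 f x := by simp
      rw [h5]
      exact h4
  have h6 : eLpNorm (𝓕 f) 2 volume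
      = eLpNorm (𝓕 F : Lp ℂ 2 (volume : Measure (Rd d))) 2 volume :=
    eLpNorm_congr_ae (key.mono fun x hx => hx.symm)
  rw [h6, ← Lp.enorm_def, ← eLpNorm_congr_ae hf2.coeFn_toLp, ← Lp.enorm_def,
    ← ofReal_norm, ← ofReal_norm, Lp.norm_fourier_eq]

end FourierBasics

section ConvBasics

variable {d : ℕ}

/-- Convolution of two real functions. -/
def cv (k b : Rd d → ℝ) (x : Rd d) : ℝ := ∫ y, k (x - y) * b y

/-- Fourier transform of a real function. -/
def ftr (f : Rd d → ℝ) : Rd d → ℂ := 𝓕 (fun x => (f x : ℂ))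

/-- The `L¹`-normalised dyadic dilation. -/
def dil (j : ℤ) (k : Rd d → ℝ) (x : Rd d) : ℝ := ((2:ℝ) ^ (-j)) ^ d * k ((2:ℝ) ^ (-j) • x)

/-- Squared `L²` norm. -/
def sqR (f : Rd d → ℝ) : ℝ≥0∞ := ∫⁻ x, ENNReal.ofReal (f x ^ 2)

/-- Squared `L²` norm, complex valued functions. -/
def sqC (f : Rd d → ℂ) : ℝ≥0∞ := ∫⁻ x, ENNReal.ofReal (‖f x‖ ^ 2)

/-- Measurable integrable functions. -/
structure IM (f : Rd d → ℝ) : Prop where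
  meas : Measurable f
  int : Integrable f

/-- Measurable integrable bounded functions. -/
structure Nice (f : Rd d → ℝ) : Prop extends IM f where
  bdd : ∃ C, ∀ x, |f x| ≤ C

theorem IM.add {f g : Rd d → ℝ} (hf : IM f) (hg : IM g) : IM (fun x => f x + g x) :=
  ⟨hf.meas.add hg.meas, hf.int.add hg.int⟩

theorem IM.sub {f g : Rd d → ℝ} (hf : IM f) (hg : IM g) : IM (fun x => f x - g x) :=
  ⟨hf.meas.sub hg.meas, hf.int.sub hg.int⟩

theorem IM.const_mul {f : Rd d → ℝ} (hf : IM f) (c : ℝ) : IM (fun x => c * f x) :=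
  ⟨hf.meas.const_mul c, hf.int.const_mul c⟩

theorem Nice.add {f g : Rd d → ℝ} (hf : Nice f) (hg : Nice g) : Nice (fun x => f x + g x) := by
  refine ⟨hf.toIM.add hg.toIM, ?_⟩
  obtain ⟨C, hC⟩ := hf.bdd
  obtain ⟨D, hD⟩ := hg.bdd
  exact ⟨C + D, fun x => (abs_add_le _ _).trans (add_le_add (hC x) (hD x))⟩

theorem Nice.const_mul {f : Rd d → ℝ} (hf : Nice f) (c : ℝ) : Nice (fun x => c * f x) := by
  refine ⟨hf.toIM.const_mul c, ?_⟩
  obtain ⟨C, hC⟩ := hf.bdd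
  refine ⟨|c| * C, fun x => ?_⟩
  rw [abs_mul]
  exact mul_le_mul_of_nonneg_left (hC x) (abs_nonneg _)

theorem Nice.sub {f g : Rd d → ℝ} (hf : Nice f) (hg : Nice g) : Nice (fun x => f x - g x) := by
  simpa [sub_eq_add_neg] using hf.add (hg.const_mul (-1))

theorem Nice.sum {ι : Type*} {s : Finset ι} {f : ι → Rd d → ℝ} (hf : ∀ i ∈ s, Nice (f i)) :
    Nice (fun x => ∑ i ∈ s, f i x) := by
  classical
  induction s using Finset.induction_on with
  | empty => exact ⟨⟨by simp, by simp⟩, 0, by simp⟩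
  | insert a s ha ih =>
    simp only [Finset.sum_insert ha]
    exact (hf a (by simp)).add (ih fun i hi => hf i (by simp [hi]))

theorem Nice.memLp_two {f : Rd d → ℝ} (hf : Nice f) : MemLp f 2 := by
  rw [memLp_two_iff_integrable_sq hf.int.aestronglyMeasurable]
  obtain ⟨C, hC⟩ := hf.bdd
  have := Integrable.bdd_mul hf.int hf.int.aestronglyMeasurable (ae_of_all _ hC)
  simpa [sq] using this

theorem sqC_eq_eLpNorm (f : Rd d → ℂ) : sqC f = eLpNorm f 2 volume ^ 2 := by
  rw [eLpNorm_eq_lintegral_rpow_enorm_toReal (by norm_num) (by norm_num)]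
  rw [← ENNReal.rpow_natCast, ← ENNReal.rpow_mul]
  simp only [ENNReal.toReal_ofNat, Nat.cast_ofNat, one_div, ne_eq, OfNat.ofNat_ne_zero,
    not_false_eq_true, inv_mul_cancel₀, ENNReal.rpow_one]
  unfold sqC
  congr 1
  ext x
  rw [ENNReal.ofReal_pow (norm_nonneg _), ofReal_norm]
  norm_cast

theorem sqR_eq_sqC (f : Rd d → ℝ) : sqR f = sqC (fun x => (f x : ℂ)) := by
  simp [sqR, sqC]

theorem sqC_ftr {f : Rd d → ℝ} (hf : Nice f) : sqC (ftr f) = sqR f := by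
  rw [sqR_eq_sqC, sqC_eq_eLpNorm, sqC_eq_eLpNorm, ftr, eLpNorm_fourier_eq]
  · exact hf.int.ofReal
  · exact hf.memLp_two.ofReal

theorem continuous_ftr {f : Rd d → ℝ} (hf : Integrable f) : Continuous (ftr f) :=
  VectorFourier.fourierIntegral_continuous Real.continuous_fourierChar
      (by exact continuous_inner) hf.ofReal

theorem norm_ftr_le (f : Rd d → ℝ) (ξ : Rd d) : ‖ftr f ξ‖ ≤ ∫ x, |f x| := by
  refine (VectorFourier.norm_fourierIntegral_le_integral_norm _ _ _ _ _).trans ?_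
  simp

theorem ftr_apply (f : Rd d → ℝ) (ξ : Rd d) :
    ftr f ξ = ∫ x, Complex.exp (↑(-2 * Real.pi * inner ℝ x ξ) * Complex.I) * f x := by
  rw [ftr, Real.fourier_eq']
  rfl

theorem integrable_exp_mul {f : Rd d → ℝ} (hf : Integrable f) (ξ : Rd d) :
    Integrable (fun x => Complex.exp (↑(-2 * Real.pi * inner ℝ x ξ) * Complex.I) * (f x : ℂ)) := by
  refine Integrable.bdd_mul (c := 1) hf.ofReal ?_ ?_
  · exact (by fun_prop : Continuous fun x : Rd d =>
      Complex.exp (↑(-2 * Real.pi * inner ℝ x ξ) * Complex.I)).aestronglyMeasurable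
  · exact ae_of_all _ fun x => (Complex.norm_exp_ofReal_mul_I _).le

theorem ftr_add {f g : Rd d → ℝ} (hf : Integrable f) (hg : Integrable g) (ξ : Rd d) :
    ftr (fun x => f x + g x) ξ = ftr f ξ + ftr g ξ := by
  simp only [ftr_apply]
  rw [← integral_add (integrable_exp_mul hf ξ) (integrable_exp_mul hg ξ)]
  congr 1; ext x; push_cast; ring

theorem ftr_const_mul (c : ℝ) (f : Rd d → ℝ) (ξ : Rd d) :
    ftr (fun x => c * f x) ξ = c * ftr f ξ := by
  simp only [ftr_apply]
  rw [← integral_const_mul]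
  congr 1; ext x; push_cast; ring

theorem ftr_sub {f g : Rd d → ℝ} (hf : Integrable f) (hg : Integrable g) (ξ : Rd d) :
    ftr (fun x => f x - g x) ξ = ftr f ξ - ftr g ξ := by
  simp only [ftr_apply]
  rw [← integral_sub (integrable_exp_mul hf ξ) (integrable_exp_mul hg ξ)]
  congr 1; ext x; push_cast; ring

theorem ftr_sum {ι : Type*} {s : Finset ι} {f : ι → Rd d → ℝ} (hf : ∀ i ∈ s, Integrable (f i))
    (ξ : Rd d) : ftr (fun x => ∑ i ∈ s, f i x) ξ = ∑ i ∈ s, ftr (f i) ξ := by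
  simp only [ftr_apply]
  rw [← integral_finsetSum s fun i hi => integrable_exp_mul (hf i hi) ξ]
  congr 1; ext x; push_cast; rw [Finset.mul_sum]

theorem cv_comm (k b : Rd d → ℝ) : cv k b = cv b k := by
  ext x
  unfold cv
  rw [← integral_sub_left_eq_self (fun y => k (x - y) * b y) volume x]
  simp [mul_comm]

theorem ftr_cv {k b : Rd d → ℝ} (hk : Integrable k) (hb : Integrable b) (ξ : Rd d) :
    ftr (cv k b) ξ = ftr k ξ * ftr b ξ := by
  unfold ftr
  have h := Real.fourier_mul_convolution_eq (R := ℂ) (hb.ofReal (𝕜 := ℂ)) (hk.ofReal (𝕜 := ℂ)) ξ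
  rw [mul_comm]
  refine Eq.trans ?_ h
  refine congrArg (fun F : Rd d → ℂ => 𝓕 F ξ) ?_
  funext x
  simp only [convolution_def, cv, ContinuousLinearMap.mul_apply']
  rw [← integral_complex_ofReal]
  congr 1; funext y; push_cast; exact mul_comm _ _

theorem measurable_cv {k b : Rd d → ℝ} (hk : Measurable k) (hb : Measurable b) :
    Measurable (cv k b) := by
  have : StronglyMeasurable (fun p : Rd d × Rd d => k (p.1 - p.2) * b p.2) :=
    ((hk.comp (measurable_fst.sub measurable_snd)).mul (hb.comp measurable_snd)).stronglyMeasurable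
  exact this.integral_prod_right.measurable

theorem integrable_cv {k b : Rd d → ℝ} (hk : Integrable k) (hb : Integrable b) :
    Integrable (cv k b) := by
  have := Integrable.integrable_convolution (ContinuousLinearMap.mul ℝ ℝ)
    (μ := (volume : Measure (Rd d))) hb hk
  refine this.congr (ae_of_all _ fun x => ?_)
  simp only [convolution_def, cv, ContinuousLinearMap.mul_apply']
  congr 1; ext y; ring

theorem IM.cv {k b : Rd d → ℝ} (hk : IM k) (hb : IM b) : IM (cv k b) :=
  ⟨measurable_cv hk.meas hb.meas, integrable_cv hk.int hb.int⟩

theorem integrable_cv_integrand {k g : Rd d → ℝ} (hk : Integrable k) (hg : Nice g) (x : Rd d) :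
    Integrable (fun y => k (x - y) * g y) := by
  obtain ⟨C, hC⟩ := hg.bdd
  have := Integrable.bdd_mul (hk.comp_sub_left x) hg.int.aestronglyMeasurable (ae_of_all _ hC)
  simpa [mul_comm] using this

theorem abs_cv_le {k g : Rd d → ℝ} (hk : Integrable k) {C : ℝ} (hC : ∀ x, |g x| ≤ C) (x : Rd d) :
    |cv k g x| ≤ (∫ y, |k y|) * C := by
  unfold cv
  refine (abs_integral_le_integral_abs).trans ?_
  rw [← integral_sub_left_eq_self (fun y => |k y|) volume x, ← integral_mul_const]
  refine integral_mono_of_nonneg (ae_of_all _ fun y => abs_nonneg _)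
    ((hk.comp_sub_left x).abs.mul_const C) (ae_of_all _ fun y => ?_)
  simp only [abs_mul]
  exact mul_le_mul_of_nonneg_left (hC y) (abs_nonneg _)

theorem Nice.cv_right {k g : Rd d → ℝ} (hk : IM k) (hg : Nice g) : Nice (cv k g) := by
  refine ⟨hk.cv hg.toIM, ?_⟩
  obtain ⟨C, hC⟩ := hg.bdd
  exact ⟨_, abs_cv_le hk.int hC⟩

theorem Nice.cv_left {k g : Rd d → ℝ} (hk : Nice k) (hg : IM g) : Nice (cv k g) := by
  rw [cv_comm]; exact Nice.cv_right hg hk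

theorem cv_add_left {k l g : Rd d → ℝ} (hk : Integrable k) (hl : Integrable l) (hg : Nice g)
    (x : Rd d) : cv (fun y => k y + l y) g x = cv k g x + cv l g x := by
  unfold cv
  rw [← integral_add (integrable_cv_integrand hk hg x) (integrable_cv_integrand hl hg x)]
  congr 1; ext y; ring

theorem cv_add_right {k g h : Rd d → ℝ} (hk : Integrable k) (hg : Nice g) (hh : Nice h)
    (x : Rd d) : cv k (fun y => g y + h y) x = cv k g x + cv k h x := by
  unfold cv
  rw [← integral_add (integrable_cv_integrand hk hg x) (integrable_cv_integrand hk hh x)]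
  congr 1; ext y; ring

theorem cv_sum_right {ι : Type*} {s : Finset ι} {k : Rd d → ℝ} {g : ι → Rd d → ℝ}
    (hk : Integrable k) (hg : ∀ i ∈ s, Nice (g i))
    (x : Rd d) : cv k (fun y => ∑ i ∈ s, g i y) x = ∑ i ∈ s, cv k (g i) x := by
  unfold cv
  rw [← integral_finsetSum s fun i hi => integrable_cv_integrand hk (hg i hi) x]
  congr 1; ext y; rw [Finset.mul_sum]

theorem cv_sum_left {ι : Type*} {s : Finset ι} {k : ι → Rd d → ℝ} {g : Rd d → ℝ}
    (hk : ∀ i ∈ s, Integrable (k i)) (hg : Nice g)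
    (x : Rd d) : cv (fun y => ∑ i ∈ s, k i y) g x = ∑ i ∈ s, cv (k i) g x := by
  unfold cv
  rw [← integral_finsetSum s fun i hi => integrable_cv_integrand (hk i hi) hg x]
  congr 1; ext y; rw [Finset.sum_mul]

/-- The `ℝ≥0∞`-valued convolution. -/
def lcv (k h : Rd d → ℝ≥0∞) (x : Rd d) : ℝ≥0∞ := ∫⁻ y, k (x - y) * h y

theorem measurable_lcv {k h : Rd d → ℝ≥0∞} (hk : Measurable k) (hh : Measurable h) :
    Measurable (lcv k h) := by
  have : Measurable (fun p : Rd d × Rd d => k (p.1 - p.2) * h p.2) :=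
    (hk.comp (measurable_fst.sub measurable_snd)).mul (hh.comp measurable_snd)
  exact this.lintegral_prod_right'

theorem lintegral_lcv {k h : Rd d → ℝ≥0∞} (hk : Measurable k) (hh : Measurable h) :
    ∫⁻ x, lcv k h x = (∫⁻ x, k x) * ∫⁻ x, h x := by
  unfold lcv
  have : Measurable (fun p : Rd d × Rd d => k (p.1 - p.2) * h p.2) :=
    (hk.comp (measurable_fst.sub measurable_snd)).mul (hh.comp measurable_snd)
  rw [lintegral_lintegral_swap this.aemeasurable, ← lintegral_const_mul _ hh]
  congr 1; ext y
  have h2 : Measurable fun x => k (x - y) := hk.comp (measurable_id.sub_const y)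
  rw [lintegral_mul_const _ h2, lintegral_sub_right_eq_self]

theorem enorm_cv_le (k b : Rd d → ℝ) (x : Rd d) :
    ‖cv k b x‖ₑ ≤ lcv (fun y => ‖k y‖ₑ) (fun y => ‖b y‖ₑ) x := by
  unfold cv lcv
  refine (enorm_integral_le_lintegral_enorm _).trans (le_of_eq ?_)
  congr 1; ext y; rw [enorm_mul]

theorem lintegral_enorm_cv_le {k b : Rd d → ℝ} (hk : Measurable k) (hb : Measurable b) :
    ∫⁻ x, ‖cv k b x‖ₑ ≤ (∫⁻ x, ‖k x‖ₑ) * ∫⁻ x, ‖b x‖ₑ := by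
  rw [← lintegral_lcv hk.enorm hb.enorm]
  exact lintegral_mono fun x => enorm_cv_le k b x

theorem measurable_dil {k : Rd d → ℝ} (hk : Measurable k) (j : ℤ) : Measurable (dil j k) :=
  (hk.comp (measurable_const_smul _)).const_mul _

theorem integral_scale {E : Type*} [NormedAddCommGroup E] [NormedSpace ℝ E] (f : Rd d → E)
    {c : ℝ} (hc : 0 < c) : (c ^ d) • ∫ x, f (c • x) = ∫ x, f x := by
  rw [Measure.integral_comp_smul, finrank_euclideanSpace_fin, abs_of_pos (by positivity),
    smul_smul, mul_inv_cancel₀ (by positivity), one_smul]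

theorem lintegral_scale (f : Rd d → ℝ≥0∞) {c : ℝ} (hc : 0 < c) :
    ENNReal.ofReal (c ^ d) * ∫⁻ x, f (c • x) = ∫⁻ x, f x := by
  have h1 := Measure.map_addHaar_smul (volume : Measure (Rd d)) hc.ne'
  have h2 : ∫⁻ x, f (c • x) = ∫⁻ x, f x ∂(Measure.map (fun x => c • x) volume) :=
    (lintegral_map_equiv f (MeasurableEquiv.smul₀ c hc.ne')).symm
  rw [h2, show Measure.map (fun x : Rd d => c • x) volume = _ from h1, lintegral_smul_measure,
    finrank_euclideanSpace_fin, abs_of_pos (by positivity), smul_eq_mul, ← mul_assoc,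
    ← ENNReal.ofReal_mul (by positivity), mul_inv_cancel₀ (by positivity)]
  simp

theorem IM.dil {k : Rd d → ℝ} (hk : IM k) (j : ℤ) : IM (dil j k) := by
  refine ⟨measurable_dil hk.meas j, ?_⟩
  exact ((integrable_comp_smul_iff volume k (R := (2:ℝ) ^ (-j)) (by positivity)).2
    hk.int).const_mul _

theorem integral_dil (k : Rd d → ℝ) (j : ℤ) : ∫ x, dil j k x = ∫ x, k x := by
  unfold dil
  rw [integral_const_mul, ← integral_scale k (c := (2:ℝ) ^ (-j)) (by positivity)]
  rfl

theorem abs_dil (k : Rd d → ℝ) (j : ℤ) (x : Rd d) : |dil j k x| = dil j (fun y => |k y|) x := by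
  unfold dil
  rw [abs_mul, abs_of_pos (by positivity)]

theorem integral_abs_dil (k : Rd d → ℝ) (j : ℤ) : ∫ x, |dil j k x| = ∫ x, |k x| := by
  simp only [abs_dil, integral_dil]

theorem lintegral_enorm_dil (k : Rd d → ℝ) (j : ℤ) : ∫⁻ x, ‖dil j k x‖ₑ = ∫⁻ x, ‖k x‖ₑ := by
  unfold dil
  rw [← lintegral_scale (fun x => ‖k x‖ₑ) (c := (2:ℝ) ^ (-j)) (by positivity),
    ← lintegral_const_mul' _ _ ENNReal.ofReal_ne_top]
  congr 1; ext x
  rw [enorm_mul, Real.enorm_of_nonneg (by positivity)]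

theorem Nice.dil {k : Rd d → ℝ} (hk : Nice k) (j : ℤ) : Nice (dil j k) := by
  refine ⟨hk.toIM.dil j, ?_⟩
  obtain ⟨C, hC⟩ := hk.bdd
  refine ⟨((2:ℝ) ^ (-j)) ^ d * C, fun x => ?_⟩
  unfold _root_.dil
  rw [abs_mul, abs_of_pos (by positivity)]
  exact mul_le_mul_of_nonneg_left (hC _) (by positivity)

theorem ftr_dil (k : Rd d → ℝ) (j : ℤ) (ξ : Rd d) :
    ftr (dil j k) ξ = ftr k ((2:ℝ) ^ j • ξ) := by
  simp only [ftr_apply]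
  rw [← integral_scale (fun x => Complex.exp (↑(-2 * Real.pi * inner ℝ x ((2:ℝ) ^ j • ξ)) *
    Complex.I) * (k x : ℂ)) (c := (2:ℝ) ^ (-j)) (by positivity), ← integral_smul]
  congr 1; ext x
  have : inner ℝ ((2:ℝ) ^ (-j) • x) ((2:ℝ) ^ j • ξ) = inner ℝ x ξ := by
    rw [real_inner_smul_left, real_inner_smul_right, ← mul_assoc, ← zpow_add₀ (by norm_num)]
    simp
  rw [this]
  simp only [dil, Complex.real_smul]
  push_cast
  ring

end ConvBasics

section Kernels

variable {d : ℕ}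

theorem Nice.of_bounded_support {k : Rd d → ℝ} (hk : Measurable k) {C R : ℝ}
    (hC : ∀ x, |k x| ≤ C) (hR : ∀ x, k x ≠ 0 → ‖x‖ ≤ R) : Nice k := by
  refine ⟨⟨hk, ?_⟩, C, hC⟩
  have h1 : IntegrableOn k (closedBall 0 R) :=
    Measure.integrableOn_of_bounded (M := C) (measure_closedBall_lt_top).ne
      hk.aestronglyMeasurable (ae_of_all _ hC)
  refine (integrableOn_iff_integrable_of_support_subset fun x hx => ?_).1 h1
  simpa using hR x hx

theorem integral_abs_le_of_bounded_support {k : Rd d → ℝ} {C R : ℝ}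
    (hC : ∀ x, |k x| ≤ C) (hR : ∀ x, k x ≠ 0 → ‖x‖ ≤ R) :
    ∫ x, |k x| ≤ C * (volume (closedBall (0 : Rd d) R)).toReal := by
  have h1 : ∫ x, |k x| = ∫ x in closedBall (0 : Rd d) R, |k x| := by
    refine (setIntegral_eq_integral_of_forall_compl_eq_zero fun x hx => ?_).symm
    by_contra h
    exact hx (by simpa using hR x (by simpa using h))
  have h2 := norm_setIntegral_le_of_norm_le_const (f := fun x => |k x|) (C := C)
    (measure_closedBall_lt_top (μ := (volume : Measure (Rd d))) (x := 0) (r := R))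
    (fun x _ => by simpa using hC x)
  rw [h1]
  refine (le_abs_self _).trans (h2.trans (le_of_eq rfl))

/-- Integral of the radial derivative against a homogeneous function. -/
theorem integral_homogeneous_mul_radial {m : Rd d → ℝ} (hm : Measurable m) {M : ℝ}
    (hM : ∀ x, |m x| ≤ M) (hom : Homogeneous0 d m) {H : Rd d → ℂ} (hH : ContDiff ℝ 1 H)
    (hs : ∀ x, 1 / 4 ≤ ‖x‖ → H x = 0) :
    ∫ x, (m x : ℂ) * (fderiv ℝ H x x + d * H x) = 0 := by
  have hcs : HasCompactSupport H := by
    refine HasCompactSupport.intro (isCompact_closedBall (0 : Rd d) (1 / 4)) fun x hx => ?_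
    exact hs x (by simp at hx; linarith)
  have hM0 : 0 ≤ M := (abs_nonneg _).trans (hM 0)
  have hdc : Continuous (fderiv ℝ H) := hH.continuous_fderiv (by norm_num)
  obtain ⟨L, hL⟩ := hdc.bounded_above_of_compact_support (hcs.fderiv (𝕜 := ℝ))
  have hL0 : 0 ≤ L := (norm_nonneg _).trans (hL 0)
  have hd0 : ∀ x, 1 / 4 < ‖x‖ → fderiv ℝ H x = 0 := by
    intro x hx
    have : H =ᶠ[nhds x] fun _ => 0 := by
      have : {y : Rd d | 1 / 4 < ‖y‖} ∈ nhds x :=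
        (isOpen_lt continuous_const continuous_norm).mem_nhds hx
      filter_upwards [this] with y hy using hs y (le_of_lt hy)
    rw [this.fderiv_eq]; simp
  have hmH : Integrable fun x => (m x : ℂ) * H x :=
    Integrable.bdd_mul (c := M) (hH.continuous.integrable_of_hasCompactSupport hcs)
      (Complex.measurable_ofReal.comp hm).aestronglyMeasurable
      (ae_of_all _ fun x => by simpa using hM x)
  set G : ℝ → ℂ := fun t => ∫ x, (m x : ℂ) * H (t • x) with hG
  have hderiv : HasDerivAt G (∫ x, (m x : ℂ) * (fderiv ℝ H ((1:ℝ) • x) x)) 1 := by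
    refine (hasDerivAt_integral_of_dominated_loc_of_deriv_le
      (F' := fun t x => (m x : ℂ) * (fderiv ℝ H (t • x) x))
      (s := ball (1:ℝ) (1 / 2)) (bound := (closedBall (0 : Rd d) 1).indicator fun _ => M * L)
      (ball_mem_nhds _ (by norm_num)) ?_ ?_ ?_ ?_ ?_ ?_).2
    · filter_upwards with t
      exact ((Complex.measurable_ofReal.comp hm).mul
        (hH.continuous.comp (continuous_const_smul t)).measurable).aestronglyMeasurable
    · simpa using hmH
    · refine ((Complex.measurable_ofReal.comp hm).mul ?_).aestronglyMeasurable
      have : Continuous fun x : Rd d => fderiv ℝ H ((1:ℝ) • x) x :=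
        (hdc.comp (continuous_const_smul (1:ℝ))).clm_apply continuous_id
      exact this.measurable
    · refine ae_of_all _ fun x t ht => ?_
      rw [mem_ball, Real.dist_eq, abs_lt] at ht
      by_cases hx : ‖x‖ ≤ 1
      · rw [indicator_of_mem (by simpa using hx), norm_mul]
        refine mul_le_mul (by simpa using hM x) ?_ (norm_nonneg _) hM0
        calc _ ≤ ‖fderiv ℝ H (t • x)‖ * ‖x‖ := ContinuousLinearMap.le_opNorm _ _
          _ ≤ L * 1 := mul_le_mul (hL _) hx (norm_nonneg _) hL0
          _ = L := mul_one _
      · rw [indicator_of_notMem (by simpa using hx), hd0 (t • x)]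
        · simp
        · rw [norm_smul, Real.norm_eq_abs, abs_of_pos (by linarith)]
          push Not at hx
          nlinarith
    · exact (integrable_indicator_iff measurableSet_closedBall).2
        (integrableOn_const (measure_closedBall_lt_top).ne)
    · refine ae_of_all _ fun x t _ => ?_
      refine HasDerivAt.const_mul _ ?_
      have h1 : HasFDerivAt H (fderiv ℝ H (t • x)) (t • x) :=
        (hH.differentiable (by norm_num) _).hasFDerivAt
      have h2 : HasDerivAt (fun t : ℝ => t • x) x t := by
        simpa using (hasDerivAt_id t).smul_const x
      exact h1.comp_hasDerivAt t h2
  have hscale : ∀ t : ℝ, 0 < t → G t = ((t ^ d)⁻¹ : ℝ) • G 1 := by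
    intro t ht
    have := integral_scale (fun x => (m x : ℂ) * H x) ht
    simp only [hG, one_smul]
    rw [← this, smul_smul, inv_mul_cancel₀ (by positivity), one_smul]
    refine integral_congr_ae ?_
    by_cases hd : d = 0
    · subst hd
      refine ae_of_all _ fun x => ?_
      have : t • x = x := Subsingleton.elim _ _
      simp [this]
    · have : Nontrivial (Rd d) := by
        have : Nonempty (Fin d) := ⟨⟨0, Nat.pos_of_ne_zero hd⟩⟩
        infer_instance
      filter_upwards [Measure.ae_ne volume (0 : Rd d)] with x hx
      rw [hom x hx t ht]
  have hderiv2 : HasDerivAt G (((-(d:ℝ)) : ℝ) • G 1) 1 := by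
    have h1 : HasDerivAt (fun t : ℝ => (t ^ d)⁻¹) (-(d:ℝ)) 1 := by
      have := (hasDerivAt_pow d (1:ℝ)).fun_inv (by simp)
      simpa using this
    refine (h1.smul_const (G 1)).congr_of_eventuallyEq ?_
    filter_upwards [lt_mem_nhds (show (0:ℝ) < 1 by norm_num)] with t ht using hscale t ht
  have heq := hderiv.unique hderiv2
  simp only [one_smul] at heq
  have hi1 : Integrable fun x => (m x : ℂ) * (fderiv ℝ H x x) := by
    refine Integrable.bdd_mul (c := M) ?_ (Complex.measurable_ofReal.comp hm).aestronglyMeasurable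
      (ae_of_all _ fun x => by simpa using hM x)
    refine (hdc.clm_apply continuous_id).integrable_of_hasCompactSupport ?_
    refine HasCompactSupport.intro (isCompact_closedBall (0 : Rd d) (1 / 4)) fun x hx => ?_
    rw [hd0 x (by simpa using hx)]; simp
  have e2 : ∀ x, (m x : ℂ) * (fderiv ℝ H x x + d * H x)
      = (m x : ℂ) * (fderiv ℝ H x x) + (d : ℂ) * ((m x : ℂ) * H x) := fun x => by ring
  simp only [e2]
  rw [integral_add hi1 (hmH.const_mul _), heq, integral_const_mul]
  simp [hG]

end Kernels

section Profile

variable {d : ℕ}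

/-- The radial profile data of the kernel: `P = φ |x|^{-d-1}` and `Ψ = x·∇P + dP`. -/
structure Prof (d : ℕ) (P Ψ : Rd d → ℝ) (B : ℝ) : Prop where
  contP : Continuous P
  contΨ : Continuous Ψ
  bddP : ∀ x, |P x| ≤ B
  bddΨ : ∀ x, |Ψ x| ≤ B
  suppP : ∀ x, P x ≠ 0 → 1 / 16 < ‖x‖ ∧ ‖x‖ < 1 / 4
  suppΨ : ∀ x, Ψ x ≠ 0 → 1 / 16 < ‖x‖ ∧ ‖x‖ < 1 / 4
  rip : ∀ (m : Rd d → ℝ) (M : ℝ), Measurable m → (∀ x, |m x| ≤ M) → Homogeneous0 d m → ∀ ξ,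
    2 * Real.pi * Complex.I * ftr (fun x => m x * P x * inner ℝ x ξ) ξ
      = ftr (fun x => m x * Ψ x) ξ

theorem exists_prof {φ : Rd d → ℝ} (hφ : AdmissiblePhi d φ) :
    ∃ Ψ B, 0 < B ∧ Prof d (fun x => φ x * ‖x‖ ^ (-(d : ℤ) - 1)) Ψ B := by
  obtain ⟨hs, ht, -⟩ := hφ
  set P : Rd d → ℝ := fun x => φ x * ‖x‖ ^ (-(d : ℤ) - 1) with hP
  have hzero : ∀ x : Rd d, ¬ (1 / 16 < ‖x‖ ∧ ‖x‖ < 1 / 4) → x ∉ tsupport φ := by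
    intro x hx h
    have := ht h
    norm_num at this
    exact hx this
  have hPc : ContDiff ℝ 1 P := by
    rw [contDiff_iff_contDiffAt]
    intro x
    by_cases hx : x ∈ tsupport φ
    · have hx0 : x ≠ 0 := by
        rintro rfl
        have := ht hx
        norm_num at this
      have h1 : ContDiffAt ℝ 1 φ x := (hs.of_le (by exact_mod_cast le_top)).contDiffAt
      refine h1.mul ?_
      have h2 : ContDiffAt ℝ 1 (fun x : Rd d => ‖x‖) x := contDiffAt_norm ℝ hx0
      have e : (fun x : Rd d => ‖x‖ ^ (-(d : ℤ) - 1)) = fun x => (‖x‖ ^ (d + 1))⁻¹ := by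
        ext y
        rw [show (-(d:ℤ) - 1) = -((d + 1 : ℕ) : ℤ) by push_cast; ring, zpow_neg, zpow_natCast]
      rw [e]
      exact (h2.pow _).inv (by positivity)
    · have : φ =ᶠ[nhds x] fun _ => 0 := notMem_tsupport_iff_eventuallyEq.1 hx
      have : P =ᶠ[nhds x] fun _ => 0 := by
        filter_upwards [this] with y hy
        simp [hP, hy]
      exact contDiffAt_const.congr_of_eventuallyEq this
  have hP0 : ∀ x, ¬ (1 / 16 < ‖x‖ ∧ ‖x‖ < 1 / 4) → P x = 0 := by
    intro x hx
    have := image_eq_zero_of_notMem_tsupport (hzero x hx)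
    simp [hP, this]
  have hdP0 : ∀ x, ¬ (1 / 16 < ‖x‖ ∧ ‖x‖ < 1 / 4) → fderiv ℝ P x = 0 := by
    intro x hx
    have : φ =ᶠ[nhds x] fun _ => 0 := notMem_tsupport_iff_eventuallyEq.1 (hzero x hx)
    have : P =ᶠ[nhds x] fun _ => 0 := by
      filter_upwards [this] with y hy
      simp [hP, hy]
    rw [this.fderiv_eq]; simp
  set Ψ : Rd d → ℝ := fun x => fderiv ℝ P x x + d * P x with hΨ
  have hdc : Continuous (fderiv ℝ P) := hPc.continuous_fderiv (by norm_num)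
  have hΨc : Continuous Ψ :=
    (hdc.clm_apply continuous_id).add (continuous_const.mul hPc.continuous)
  have hΨ0 : ∀ x, ¬ (1 / 16 < ‖x‖ ∧ ‖x‖ < 1 / 4) → Ψ x = 0 := by
    intro x hx
    simp [hΨ, hdP0 x hx, hP0 x hx]
  have hcsP : HasCompactSupport P :=
    HasCompactSupport.intro (isCompact_closedBall (0 : Rd d) 1) fun x hx =>
      hP0 x fun h => hx (by simp; linarith [h.2])
  have hcsΨ : HasCompactSupport Ψ :=
    HasCompactSupport.intro (isCompact_closedBall (0 : Rd d) 1) fun x hx =>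
      hΨ0 x fun h => hx (by simp; linarith [h.2])
  obtain ⟨B1, hB1⟩ := hPc.continuous.bounded_above_of_compact_support hcsP
  obtain ⟨B2, hB2⟩ := hΨc.bounded_above_of_compact_support hcsΨ
  refine ⟨Ψ, max 1 (max B1 B2), by positivity, hPc.continuous, hΨc, fun x => ?_, fun x => ?_,
    fun x hx => ?_, fun x hx => ?_, ?_⟩
  · exact (hB1 x).trans (by simp)
  · exact (hB2 x).trans (by simp)
  · by_contra h; exact hx (hP0 x h)
  · by_contra h; exact hx (hΨ0 x h)
  intro m M hm hM hom ξ
  set e : Rd d → ℂ := fun x => Complex.exp (↑(-2 * Real.pi * inner ℝ x ξ) * Complex.I) with he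
  have hPof : ContDiff ℝ 1 fun x => (P x : ℂ) := Complex.ofRealCLM.contDiff.comp hPc
  have hec : ContDiff ℝ 1 e := by
    refine Complex.contDiff_exp.comp ?_
    refine ContDiff.mul ?_ contDiff_const
    refine Complex.ofRealCLM.contDiff.comp ?_
    exact contDiff_const.mul (contDiff_id.inner ℝ contDiff_const)
  have key := integral_homogeneous_mul_radial hm hM hom (H := fun x => (P x : ℂ) * e x)
    (hPof.mul hec) (fun x hx => by
      rw [hP0 x (fun h => by linarith [h.2])]; simp)
  have hfd : ∀ x, fderiv ℝ (fun x => (P x : ℂ) * e x) x x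
      = (fderiv ℝ P x x : ℂ) * e x
        + (P x : ℂ) * (-(2 * Real.pi * Complex.I) * inner ℝ x ξ * e x) := by
    intro x
    have h1 : HasFDerivAt (fun x => (P x : ℂ)) (Complex.ofRealCLM.comp (fderiv ℝ P x)) x :=
      Complex.ofRealCLM.hasFDerivAt.comp x
        (hPc.differentiable (by norm_num) x).hasFDerivAt
    have h2 : HasDerivAt (fun t : ℝ => e (x + t • x))
        (-(2 * Real.pi * Complex.I) * inner ℝ x ξ * e x) 0 := by
      have h3 : HasDerivAt (fun t : ℝ => ((-2 * Real.pi * inner ℝ (x + t • x) ξ : ℝ) : ℂ)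
          * Complex.I) (((-2 * Real.pi * inner ℝ x ξ : ℝ) : ℂ) * Complex.I) 0 := by
        refine HasDerivAt.mul_const ?_ _
        refine HasDerivAt.ofReal_comp ?_
        have : (fun t : ℝ => -2 * Real.pi * inner ℝ (x + t • x) ξ)
            = fun t : ℝ => -2 * Real.pi * inner ℝ x ξ + t * (-2 * Real.pi * inner ℝ x ξ) := by
          ext t
          rw [inner_add_left, real_inner_smul_left]; ring
        rw [this]
        simpa using ((hasDerivAt_id (0:ℝ)).mul_const (-2 * Real.pi * inner ℝ x ξ)).const_add
          (-2 * Real.pi * inner ℝ x ξ)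
      have h4 := h3.cexp
      refine h4.congr_deriv ?_
      simp only [he]
      simp
      ring
    have h5 : HasFDerivAt e (fderiv ℝ e x) x := (hec.differentiable (by norm_num) x).hasFDerivAt
    have h6 : fderiv ℝ e x x = -(2 * Real.pi * Complex.I) * inner ℝ x ξ * e x := by
      have h7 : HasDerivAt (fun t : ℝ => x + t • x) x 0 := by
        simpa using ((hasDerivAt_id (0:ℝ)).smul_const x).const_add x
      have h8 : HasFDerivAt e (fderiv ℝ e x) (x + (0:ℝ) • x) := by simpa using h5
      have h9 : HasDerivAt (fun t : ℝ => e (x + t • x)) (fderiv ℝ e x x) 0 :=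
        HasFDerivAt.comp_hasDerivAt (f := fun t : ℝ => x + t • x) (0:ℝ) h8 h7
      exact h9.unique h2
    have h10 : fderiv ℝ (fun x => (P x : ℂ) * e x) x = _ := (h1.mul h5).fderiv
    rw [h10]
    simp only [add_apply, smul_apply, h6, smul_eq_mul, ContinuousLinearMap.comp_apply,
      Complex.ofRealCLM_apply]
    ring
  have hnice : ∀ Q : Rd d → ℝ, Continuous Q → (∀ x, ¬ (1 / 16 < ‖x‖ ∧ ‖x‖ < 1 / 4) → Q x = 0) →
      Integrable (fun x => m x * Q x) := by
    intro Q hQ h0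
    refine Integrable.bdd_mul (c := M) ?_ hm.aestronglyMeasurable (ae_of_all _ hM)
    refine hQ.integrable_of_hasCompactSupport ?_
    exact HasCompactSupport.intro (isCompact_closedBall (0 : Rd d) 1) fun x hx =>
      h0 x fun h => hx (by simp; linarith [h.2])
  have i1 := integrable_exp_mul (hnice Ψ hΨc hΨ0) ξ
  have i2 := integrable_exp_mul (hnice (fun x => P x * inner ℝ x ξ)
    (hPc.continuous.mul (continuous_id.inner continuous_const))
    (fun x hx => by simp [hP0 x hx])) ξ
  rw [← sub_eq_zero, ← neg_eq_zero, neg_sub, ← key]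
  simp only [ftr_apply]
  rw [← integral_const_mul]
  have e3 : ∀ x, 2 * Real.pi * Complex.I * (Complex.exp (↑(-2 * Real.pi * inner ℝ x ξ) * Complex.I)
      * ((m x * P x * inner ℝ x ξ : ℝ) : ℂ)) = 2 * Real.pi * Complex.I *
      (Complex.exp (↑(-2 * Real.pi * inner ℝ x ξ) * Complex.I)
      * ((m x * (P x * inner ℝ x ξ) : ℝ) : ℂ)) := fun x => by rw [mul_assoc (m x)]
  simp only [e3]
  rw [← integral_sub i1 (i2.const_mul _)]
  congr 1
  ext x
  rw [hfd]
  simp only [hΨ, he]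
  push_cast
  ring

end Profile

section Decay

variable {d : ℕ}

/-- Volume of the closed ball of radius `r`, as a real number. -/
def vb (d : ℕ) (r : ℝ) : ℝ := (volume (closedBall (0 : Rd d) r)).toReal

theorem vb_nonneg (r : ℝ) : 0 ≤ vb d r := ENNReal.toReal_nonneg

theorem ofReal_vb (r : ℝ) : ENNReal.ofReal (vb d r) = volume (closedBall (0 : Rd d) r) :=
  ENNReal.ofReal_toReal (measure_closedBall_lt_top).ne

theorem vb_eq {r : ℝ} (hr : 0 ≤ r) : vb d r = r ^ d * vb d 1 := by
  unfold vb
  rw [Measure.addHaar_closedBall' _ _ hr, finrank_euclideanSpace_fin, ENNReal.toReal_mul,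
    ENNReal.toReal_ofReal (by positivity)]

theorem volume_closedBall_eq (x : Rd d) {r : ℝ} (hr : 0 ≤ r) :
    volume (closedBall x r) = ENNReal.ofReal (r ^ d * vb d 1) := by
  rw [← vb_eq hr, ofReal_vb, Measure.addHaar_closedBall_center]

theorem volume_band_le {θ : Rd d} (hθ : ‖θ‖ = 1) {ρ : ℝ} (hρ : 0 < ρ) :
    volume {x : Rd d | ‖x‖ ≤ 1 ∧ |inner ℝ x θ| ≤ ρ} ≤ ENNReal.ofReal (6 * ρ * vb d 2) := by
  set W := {x : Rd d | ‖x‖ ≤ 1 ∧ |inner ℝ x θ| ≤ ρ} with hW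
  have hWm : MeasurableSet W := by
    apply MeasurableSet.inter
    · exact measurableSet_le measurable_norm measurable_const
    · exact measurableSet_le (by fun_prop : Measurable fun x : Rd d => |inner ℝ x θ|) measurable_const
  have hWs : W ⊆ closedBall 0 2 := fun x hx => by simp; linarith [hx.1]
  by_cases h3 : 1 / 3 < ρ
  · refine (measure_mono hWs).trans ?_
    rw [← ofReal_vb]
    apply ENNReal.ofReal_le_ofReal
    nlinarith [vb_nonneg (d := d) 2]
  push Not at h3
  set K : ℕ := ⌊1 / (3 * ρ)⌋₊ with hK
  have hK1 : (K : ℝ) ≤ 1 / (3 * ρ) := Nat.floor_le (by positivity)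
  have hK2 : 1 / (3 * ρ) < K + 1 := Nat.lt_floor_add_one _
  have hK3 : 1 ≤ 1 / (3 * ρ) := by rw [le_div_iff₀ (by positivity)]; linarith
  have hK4 : 1 / (6 * ρ) ≤ K := by
    have : 1 ≤ K := Nat.le_floor (by simpa using hK3)
    have h1 : (1:ℝ) ≤ K := by exact_mod_cast this
    have : 1 / (6 * ρ) = (1 / (3 * ρ)) / 2 := by field_simp; norm_num
    rw [this]; linarith
  have hsum : (K : ℝ≥0∞) * volume W ≤ volume (closedBall (0 : Rd d) 2) := by
    have h1 : ∀ k : ℕ, volume ((fun x => (-(3 * ρ * k)) • θ + x) ⁻¹' W) = volume W := fun k => by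
      rw [measure_preimage_add]
    calc (K : ℝ≥0∞) * volume W = ∑ k ∈ Finset.range K, volume W := by simp
      _ = ∑ k ∈ Finset.range K, volume ((fun x => (-(3 * ρ * k)) • θ + x) ⁻¹' W) := by
        simp only [h1]
      _ = volume (⋃ k ∈ Finset.range K, (fun x => (-(3 * ρ * k)) • θ + x) ⁻¹' W) := by
        rw [measure_biUnion_finset]
        · intro i _ j _ hij
          refine Set.disjoint_left.2 fun x hxi hxj => hij ?_
          have hi := hxi.2
          have hj := hxj.2
          simp only [inner_add_left, real_inner_smul_left, real_inner_self_eq_norm_sq, hθ] at hi hj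
          rw [abs_le] at hi hj
          have e1 : ρ * (3 * ((i:ℝ) - j)) ≤ ρ * 2 := by nlinarith
          have e2 : ρ * (3 * ((j:ℝ) - i)) ≤ ρ * 2 := by nlinarith
          have e3 := le_of_mul_le_mul_left e1 hρ
          have e4 := le_of_mul_le_mul_left e2 hρ
          have e5 : (i:ℝ) < j + 1 := by linarith
          have e6 : (j:ℝ) < i + 1 := by linarith
          have e7 : i < j + 1 := by exact_mod_cast e5
          have e8 : j < i + 1 := by exact_mod_cast e6
          omega
        · intro k _
          exact hWm.preimage (measurable_const_add _)
      _ ≤ _ := by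
        refine measure_mono (iUnion₂_subset fun k hk x hx => ?_)
        have hk' : (k : ℝ) ≤ K := by exact_mod_cast (Finset.mem_range.1 hk).le
        have h2 : ‖(-(3 * ρ * k)) • θ + x‖ ≤ 1 := hx.1
        have h3 : ‖(3 * ρ * k) • θ‖ ≤ 1 := by
          rw [norm_smul, hθ, Real.norm_eq_abs, abs_of_nonneg (by positivity), mul_one]
          calc 3 * ρ * k ≤ 3 * ρ * (1 / (3 * ρ)) := by gcongr; linarith
            _ = 1 := by field_simp
        have h4 : x = (3 * ρ * k) • θ + ((-(3 * ρ * k)) • θ + x) := by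
          rw [neg_smul]; abel
        rw [mem_closedBall_zero_iff, h4]
        exact (norm_add_le _ _).trans (by linarith)
  have hWf : volume W ≠ ⊤ := ((measure_mono hWs).trans_lt measure_closedBall_lt_top).ne
  rw [← ofReal_vb, ← ENNReal.ofReal_toReal hWf, ← ENNReal.ofReal_natCast,
    ← ENNReal.ofReal_mul (by positivity), ENNReal.ofReal_le_ofReal_iff (vb_nonneg _)] at hsum
  rw [← ENNReal.ofReal_toReal hWf]
  apply ENNReal.ofReal_le_ofReal
  have h0 : 0 ≤ (volume W).toReal := ENNReal.toReal_nonneg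
  have h5 : 1 / (6 * ρ) * (volume W).toReal ≤ vb d 2 :=
    (mul_le_mul_of_nonneg_right hK4 h0).trans hsum
  have h6 : (volume W).toReal = 6 * ρ * (1 / (6 * ρ) * (volume W).toReal) := by field_simp
  rw [h6]
  gcongr

theorem Prof.nice_mul {P Ψ : Rd d → ℝ} {B : ℝ} (hP : Prof d P Ψ B) {m : Rd d → ℝ}
    (hm : Measurable m) {M : ℝ} (hM : ∀ x, |m x| ≤ M) :
    Nice (fun x => m x * Ψ x) := by
  refine Nice.of_bounded_support (C := M * B) (R := 1) (hm.mul hP.contΨ.measurable) (fun x => ?_)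
    fun x hx => ?_
  · rw [abs_mul]
    exact mul_le_mul (hM x) (hP.bddΨ x) (abs_nonneg _) ((abs_nonneg _).trans (hM x))
  · have := (hP.suppΨ x (right_ne_zero_of_mul hx)).2
    linarith

theorem Prof.B_nonneg {P Ψ : Rd d → ℝ} {B : ℝ} (hP : Prof d P Ψ B) : 0 ≤ B :=
  (abs_nonneg _).trans (hP.bddP 0)

/-- The truncated kernel `Ω(x) |x| P(x)`. -/
def kOm (P Om : Rd d → ℝ) (x : Rd d) : ℝ := Om x * (‖x‖ * P x)

theorem Prof.abs_kOm_le {P Ψ : Rd d → ℝ} {B : ℝ} (hP : Prof d P Ψ B) (Om : Rd d → ℝ) (x : Rd d) :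
    |kOm P Om x| ≤ |Om x| * B := by
  unfold kOm
  rw [abs_mul]
  refine mul_le_mul_of_nonneg_left ?_ (abs_nonneg _)
  by_cases h : P x = 0
  · simpa [h] using hP.B_nonneg
  · rw [abs_mul, abs_norm]
    calc ‖x‖ * |P x| ≤ 1 * B := mul_le_mul (by linarith [(hP.suppP x h).2]) (hP.bddP x)
          (abs_nonneg _) zero_le_one
      _ = B := one_mul _

theorem Prof.kOm_supp {P Ψ : Rd d → ℝ} {B : ℝ} (hP : Prof d P Ψ B) {Om : Rd d → ℝ} {x : Rd d}
    (h : kOm P Om x ≠ 0) : 1 / 16 < ‖x‖ ∧ ‖x‖ < 1 / 4 :=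
  hP.suppP x (right_ne_zero_of_mul (right_ne_zero_of_mul h))

theorem Prof.measurable_kOm {P Ψ : Rd d → ℝ} {B : ℝ} (hP : Prof d P Ψ B) {Om : Rd d → ℝ}
    (hm : Measurable Om) : Measurable (kOm P Om) :=
  hm.mul (measurable_norm.mul hP.contP.measurable)

theorem Prof.nice_kOm {P Ψ : Rd d → ℝ} {B : ℝ} (hP : Prof d P Ψ B) {Om : Rd d → ℝ}
    (hm : Measurable Om) {M : ℝ} (hM : ∀ x, |Om x| ≤ M) : Nice (kOm P Om) := by
  refine Nice.of_bounded_support (C := M * B) (R := 1) (hP.measurable_kOm hm) (fun x => ?_)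
    fun x hx => ?_
  · exact (hP.abs_kOm_le Om x).trans (mul_le_mul_of_nonneg_right (hM x) hP.B_nonneg)
  · linarith [(hP.kOm_supp hx).2]

/-- Fourier decay of the truncated kernel. -/
theorem Prof.norm_ftr_kOm_le {P Ψ : Rd d → ℝ} {B : ℝ} (hP : Prof d P Ψ B) {Om : Rd d → ℝ}
    (hm : Measurable Om) {M : ℝ} (hM : ∀ x, |Om x| ≤ M) (hom : Homogeneous0 d Om)
    {ξ : Rd d} (hξ : ξ ≠ 0) :
    ‖ftr (kOm P Om) ξ‖ ≤ (6 * vb d 2 + vb d 1) * B * M / Real.sqrt ‖ξ‖ := by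
  have hB := hP.B_nonneg
  have hM0 : 0 ≤ M := (abs_nonneg _).trans (hM 0)
  have hξ0 : 0 < ‖ξ‖ := norm_pos_iff.2 hξ
  set s := Real.sqrt ‖ξ‖ with hs
  have hs0 : 0 < s := Real.sqrt_pos.2 hξ0
  have hss : s * s = ‖ξ‖ := Real.mul_self_sqrt hξ0.le
  set ρ := 1 / s with hρ
  have hρ0 : 0 < ρ := by positivity
  set θ := ‖ξ‖⁻¹ • ξ with hθ
  have hθ1 : ‖θ‖ = 1 := by
    rw [hθ, norm_smul, norm_inv, norm_norm, inv_mul_cancel₀ hξ0.ne']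
  have hξθ : ∀ x, inner ℝ x ξ = ‖ξ‖ * inner ℝ x θ := fun x => by
    rw [hθ, real_inner_smul_right, ← mul_assoc, mul_inv_cancel₀ hξ0.ne', one_mul]
  set S : Set (Rd d) := {x | |inner ℝ x θ| ≤ ρ * ‖x‖} with hS
  have hSm : MeasurableSet S := measurableSet_le (by fun_prop) (by fun_prop)
  set m1 : Rd d → ℝ := S.indicator Om with hm1
  set m2 : Rd d → ℝ := Sᶜ.indicator Om with hm2
  have hm1m : Measurable m1 := hm.indicator hSm
  have hm2m : Measurable m2 := hm.indicator hSm.compl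
  have hind : ∀ (T : Set (Rd d)) x, |T.indicator Om x| ≤ M := fun T x => by
    by_cases h : x ∈ T
    · rw [indicator_of_mem h]; exact hM x
    · rw [indicator_of_notMem h]; simpa using hM0
  have hsplit : kOm P Om = fun x => kOm P m1 x + kOm P m2 x := by
    ext x
    have : Om x = m1 x + m2 x := (congrFun (indicator_self_add_compl S Om) x).symm
    simp only [kOm]; rw [this]; ring
  have h1 : ‖ftr (kOm P m1) ξ‖ ≤ 6 * vb d 2 * B * M / s := by
    refine (norm_ftr_le _ _).trans ?_
    set W := {x : Rd d | ‖x‖ ≤ 1 ∧ |inner ℝ x θ| ≤ ρ} with hW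
    have hWs : W ⊆ closedBall 0 1 := fun x hx => by simpa using hx.1
    have hWf : volume W < ⊤ := (measure_mono hWs).trans_lt measure_closedBall_lt_top
    have e1 : ∫ x, |kOm P m1 x| = ∫ x in W, |kOm P m1 x| := by
      refine (setIntegral_eq_integral_of_forall_compl_eq_zero fun x hx => ?_).symm
      by_contra h
      have h' : kOm P m1 x ≠ 0 := by simpa using h
      have h2 := (hP.kOm_supp h').2
      have h3 : x ∈ S := by
        by_contra h3
        exact h' (by simp [kOm, hm1, h3])
      exact hx ⟨by linarith, h3.trans (by nlinarith)⟩
    have e2 := norm_setIntegral_le_of_norm_le_const (f := fun x => |kOm P m1 x|) (C := M * B)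
      hWf (fun x _ => by
        simpa using (hP.abs_kOm_le m1 x).trans (mul_le_mul_of_nonneg_right (hind _ x) hB))
    rw [e1]
    refine (le_abs_self _).trans (e2.trans ?_)
    have e3 : (volume W).toReal ≤ 6 * ρ * vb d 2 := by
      have := vb_nonneg (d := d) 2
      refine ENNReal.toReal_le_of_le_ofReal (by positivity) (volume_band_le hθ1 hρ0)
    calc M * B * (volume W).toReal ≤ M * B * (6 * ρ * vb d 2) := by gcongr
      _ = _ := by rw [hρ]; ring
  have h2 : ‖ftr (kOm P m2) ξ‖ ≤ vb d 1 * B * M / s := by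
    set m : Rd d → ℝ := fun x => m2 x * (‖x‖ / inner ℝ x θ) with hmdef
    have hmm : Measurable m := hm2m.mul (measurable_norm.div (by fun_prop))
    have hmb : ∀ x, |m x| ≤ M * s := fun x => by
      by_cases h : x ∈ S
      · simp only [hmdef, hm2]
        rw [indicator_of_notMem (by simpa using h)]
        simp; positivity
      · have h' : ρ * ‖x‖ < |inner ℝ x θ| := by simpa [hS] using h
        have hp : 0 < |inner ℝ x θ| := lt_of_le_of_lt (by positivity) h'
        simp only [hmdef]
        rw [abs_mul, abs_div, abs_norm]
        refine mul_le_mul (hind _ x) ?_ (by positivity) hM0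
        rw [div_le_iff₀ hp]
        have : ‖x‖ = s * (ρ * ‖x‖) := by rw [hρ]; field_simp
        rw [this]
        gcongr
    have hmh : Homogeneous0 d m := by
      intro x hx r hr
      have e1 : r • x ∈ S ↔ x ∈ S := by
        simp only [hS, mem_ofPred_eq, real_inner_smul_left, norm_smul, abs_mul, Real.norm_eq_abs]
        rw [show ρ * (|r| * ‖x‖) = |r| * (ρ * ‖x‖) by ring,
          mul_le_mul_iff_right₀ (abs_pos.2 hr.ne')]
      have e2 : m2 (r • x) = m2 x := by
        by_cases h : x ∈ S
        · rw [hm2, indicator_of_notMem (by simpa using e1.2 h), indicator_of_notMem (by simpa using h)]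
        · have h' : r • x ∉ S := fun h' => h (e1.1 h')
          rw [hm2, indicator_of_mem (by simpa using h'), indicator_of_mem (by simpa using h),
            hom x hx r hr]
      simp only [hmdef, e2, real_inner_smul_left, norm_smul, Real.norm_eq_abs, abs_of_pos hr]
      rw [mul_div_mul_left _ _ hr.ne']
    have key := hP.rip m (M * s) hmm hmb hmh ξ
    have e1 : (fun x => m x * P x * inner ℝ x ξ) = fun x => ‖ξ‖ * kOm P m2 x := by
      ext x
      rw [hξθ]
      by_cases h : x ∈ S
      · have : m2 x = 0 := indicator_of_notMem (by simpa using h) _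
        simp [hmdef, kOm, this]
      · have h' : ρ * ‖x‖ < |inner ℝ x θ| := by simpa [hS] using h
        have hp : inner ℝ x θ ≠ 0 := abs_pos.1 (lt_of_le_of_lt (by positivity) h')
        simp only [hmdef, kOm]
        field_simp
    rw [e1, ftr_const_mul] at key
    have e2 : ‖ftr (fun x => m x * Ψ x) ξ‖ ≤ M * s * B * vb d 1 := by
      refine (norm_ftr_le _ _).trans ?_
      refine integral_abs_le_of_bounded_support (fun x => ?_) (fun x hx => ?_)
      · rw [abs_mul]
        exact mul_le_mul (hmb x) (hP.bddΨ x) (abs_nonneg _) (by positivity)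
      · linarith [(hP.suppΨ x (right_ne_zero_of_mul hx)).2]
    rw [← key] at e2
    simp only [norm_mul, Complex.norm_real, Complex.norm_I, Complex.norm_ofNat, abs_norm,
      Real.norm_eq_abs, abs_of_pos Real.pi_pos] at e2
    have e3 : ‖ξ‖ * ‖ftr (kOm P m2) ξ‖ ≤ 2 * Real.pi * 1 * (‖ξ‖ * ‖ftr (kOm P m2) ξ‖) := by
      have : 0 ≤ ‖ξ‖ * ‖ftr (kOm P m2) ξ‖ := by positivity
      nlinarith [Real.pi_gt_three]
    have e4 := e3.trans e2
    rw [← hss] at e4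
    rw [le_div_iff₀ hs0]
    have e5 : s * (‖ftr (kOm P m2) ξ‖ * s) ≤ s * (vb d 1 * B * M) := by
      calc _ = s * s * ‖ftr (kOm P m2) ξ‖ := by ring
        _ ≤ _ := e4
        _ = _ := by ring
    exact le_of_mul_le_mul_left e5 hs0
  rw [hsplit, ftr_add (hP.nice_kOm hm1m (hind _)).int (hP.nice_kOm hm2m (hind _)).int]
  refine (norm_add_le _ _).trans ((add_le_add h1 h2).trans (le_of_eq ?_))
  ring

end Decay

section Tube

variable {d : ℕ}

/-- A family of disjoint cube-like sets. -/
structure Fam {ι : Type*} (s : Finset ι) (q : ι → ℤ) (Q : ι → Set (Rd d)) (c : ι → Rd d)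
    (ρ : ℝ) : Prop where
  ρ_nonneg : 0 ≤ ρ
  meas : ∀ i ∈ s, MeasurableSet (Q i)
  disj : (s : Set ι).PairwiseDisjoint Q
  vol : ∀ i ∈ s, volume (Q i) = ENNReal.ofReal (((2:ℝ) ^ q i) ^ d)
  sub : ∀ i ∈ s, Q i ⊆ closedBall (c i) (ρ * (2:ℝ) ^ q i)

theorem Fam.mono {ι : Type*} {s t : Finset ι} {q : ι → ℤ} {Q : ι → Set (Rd d)} {c : ι → Rd d}
    {ρ : ℝ} (h : Fam s q Q c ρ) (ht : t ⊆ s) : Fam t q Q c ρ :=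
  ⟨h.ρ_nonneg, fun i hi => h.meas i (ht hi), h.disj.subset (by exact_mod_cast ht),
    fun i hi => h.vol i (ht hi), fun i hi => h.sub i (ht hi)⟩

/-- A union of `2N+1` balls covering a tube around the segment `[-e, e]`. -/
def tube (e : Rd d) (N : ℕ) (r : ℝ) : Set (Rd d) :=
  ⋃ k ∈ Finset.Icc (-(N : ℤ)) N, closedBall (((k : ℝ) / N) • e) r

theorem measurableSet_tube (e : Rd d) (N : ℕ) (r : ℝ) : MeasurableSet (tube e N r) :=
  Finset.measurableSet_biUnion _ fun _ _ => isClosed_closedBall.measurableSet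

theorem volume_tube_le (e : Rd d) {N : ℕ} (hN : 1 ≤ N) {r : ℝ} (hr : 0 ≤ r) :
    volume (tube e N r) ≤ ENNReal.ofReal (3 * N * (r ^ d * vb d 1)) := by
  refine (measure_biUnion_finset_le _ _).trans ?_
  simp only [volume_closedBall_eq _ hr, Finset.sum_const, Int.card_Icc, nsmul_eq_mul]
  rw [ENNReal.ofReal_mul (p := 3 * (N : ℝ)) (by positivity)]
  refine mul_le_mul' ?_ le_rfl
  rw [← ENNReal.ofReal_natCast]
  apply ENNReal.ofReal_le_ofReal
  have : ((N : ℤ) + 1 - -(N : ℤ)).toNat = 2 * N + 1 := by omega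
  rw [this]
  push_cast
  have : (1:ℝ) ≤ N := by exact_mod_cast hN
  linarith

theorem mem_tube {e x : Rd d} {N : ℕ} (hN : 1 ≤ N) {r R : ℝ} {t : ℝ} (ht : |t| ≤ 1)
    (hx : ‖x - t • e‖ ≤ r) (hR : r + ‖e‖ / N ≤ R) : x ∈ tube e N R := by
  have hN0 : (0:ℝ) < N := by exact_mod_cast hN
  obtain ⟨h1, h2⟩ := abs_le.1 ht
  simp only [tube, mem_iUnion, Finset.mem_Icc, mem_closedBall, dist_eq_norm]
  refine ⟨⌊t * N⌋, ⟨?_, ?_⟩, ?_⟩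
  · rw [Int.le_floor]; push_cast; nlinarith
  · have h3 : (⌊t * N⌋ : ℝ) ≤ (N : ℝ) := (Int.floor_le _).trans (by nlinarith)
    exact_mod_cast h3
  · have h3 := Int.floor_le (t * N)
    have h4 := Int.lt_floor_add_one (t * N)
    have h5 : |t - (⌊t * N⌋ : ℝ) / N| ≤ 1 / N := by
      rw [abs_of_nonneg]
      · rw [sub_le_iff_le_add, ← add_div, le_div_iff₀ hN0]; linarith
      · rw [sub_nonneg, div_le_iff₀ hN0]; linarith
    have h6 : x - ((⌊t * N⌋ : ℝ) / N) • e = (x - t • e) + (t - (⌊t * N⌋ : ℝ) / N) • e := by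
      rw [sub_smul]; abel
    rw [h6]
    refine (norm_add_le _ _).trans ((add_le_add hx ?_).trans hR)
    rw [norm_smul, Real.norm_eq_abs, show ‖e‖ / N = 1 / N * ‖e‖ by ring]
    exact mul_le_mul_of_nonneg_right h5 (norm_nonneg e)

/-- Dilation of an `ℝ≥0∞` valued kernel. -/
def ldil (j : ℤ) (k : Rd d → ℝ≥0∞) (x : Rd d) : ℝ≥0∞ :=
  ENNReal.ofReal (((2:ℝ) ^ (-j)) ^ d) * k ((2:ℝ) ^ (-j) • x)

theorem measurable_ldil {k : Rd d → ℝ≥0∞} (hk : Measurable k) (j : ℤ) : Measurable (ldil j k) :=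
  (hk.comp (measurable_const_smul _)).const_mul _

theorem lintegral_ldil {k : Rd d → ℝ≥0∞} (hk : Measurable k) (j : ℤ) :
    ∫⁻ x, ldil j k x = ∫⁻ x, k x := by
  unfold ldil
  have h : Measurable fun x : Rd d => k ((2:ℝ) ^ (-j) • x) := hk.comp (measurable_const_smul _)
  rw [lintegral_const_mul _ h, lintegral_scale _ (by positivity)]

theorem enorm_dil (j : ℤ) (k : Rd d → ℝ) (x : Rd d) : ‖dil j k x‖ₑ = ldil j (fun y => ‖k y‖ₑ) x := by
  unfold dil ldil
  rw [enorm_mul, Real.enorm_eq_ofReal (by positivity)]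

set_option maxHeartbeats 2000000 in
theorem lintegral_sq_sum_lcv_le {ι : Type*} {s : Finset ι} {q : ι → ℤ} {Q : ι → Set (Rd d)}
    {c : ι → Rd d} {ρ : ℝ} (hF : Fam s q Q c ρ) (m : ℕ) {e : Rd d} {ρ' : ℝ}
    {k : Rd d → ℝ≥0∞} (hkm : Measurable k) {B : ℝ≥0∞} (hkB : ∀ x, k x ≤ B)
    (hkT : ∀ x, k x ≠ 0 → ∃ t : ℝ, 0 ≤ t ∧ t ≤ 1 ∧ ‖x - t • e‖ ≤ ρ' / 2 ^ m)
    {h : ι → Rd d → ℝ≥0∞} (hhm : ∀ i ∈ s, Measurable (h i))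
    (hhs : ∀ i ∈ s, ∀ x, h i x ≠ 0 → x ∈ closedBall (c i) (ρ * (2:ℝ) ^ q i)) {β : ℝ≥0∞}
    (hβ : ∀ i ∈ s, ∫⁻ x, h i x ≤ β * volume (Q i)) :
    ∫⁻ x, (∑ i ∈ s, lcv (ldil (q i + m) k) (h i) x) ^ 2 ≤
      2 * B ^ 2 * volume (tube e (2 ^ m) ((2 * ρ' + 2 * ρ + ‖e‖) / 2 ^ m)) ^ 2 * β *
        ∑ i ∈ s, ∫⁻ x, h i x := by
  classical
  set V := volume (tube e (2 ^ m) ((2 * ρ' + 2 * ρ + ‖e‖) / 2 ^ m)) with hV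
  set a : ι → Rd d → ℝ≥0∞ := fun i => lcv (ldil (q i + m) k) (h i) with ha
  have hρ := hF.ρ_nonneg
  have ham : ∀ i ∈ s, Measurable (a i) := fun i hi =>
    measurable_lcv (measurable_ldil hkm _) (hhm i hi)
  have h2m : (0:ℝ) < 2 ^ m := by positivity
  have hN1 : 1 ≤ 2 ^ m := Nat.one_le_two_pow
  -- the integral of the kernel
  have hkV : ∫⁻ x, k x ≤ B * V := by
    by_cases hρ' : ρ' < 0
    · have : ∀ x, k x = 0 := by
        intro x
        by_contra hx
        obtain ⟨t, -, -, h3⟩ := hkT x hx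
        have : ρ' / 2 ^ m < 0 := div_neg_of_neg_of_pos hρ' h2m
        linarith [norm_nonneg (x - t • e)]
      simp [this]
    push Not at hρ'
    rw [hV, ← setLIntegral_const, ← lintegral_indicator (measurableSet_tube _ _ _)]
    refine lintegral_mono fun x => ?_
    by_cases hx : k x = 0
    · simp [hx]
    · obtain ⟨t, h1, h2, h3⟩ := hkT x hx
      rw [indicator_of_mem]
      · exact hkB x
      · have ht2 : |t| ≤ 1 := abs_le.2 ⟨by linarith, h2⟩
        refine mem_tube (N := 2 ^ m) (t := t) (r := ρ' / 2 ^ m) hN1 ht2 h3 ?_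
        push_cast
        rw [← add_div]
        gcongr
        linarith
  -- main estimate for a fixed index
  have key : ∀ i ∈ s, ∀ y, ∑ i' ∈ s with q i' ≤ q i, ∫⁻ x, ldil (q i + m) k (x - y) * a i' x ≤
      B ^ 2 * V ^ 2 * β := by
    intro i hi y
    set j := q i + m with hj
    set T' : Set (Rd d) := (fun w => (2:ℝ) ^ (-j) • (w - y)) ⁻¹'
      (tube e (2 ^ m) ((2 * ρ' + 2 * ρ + ‖e‖) / 2 ^ m)) with hT'
    have hvT' : ENNReal.ofReal (((2:ℝ) ^ (-j)) ^ d) * volume T' = V := by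
      have h1 : volume T' =
          volume ((fun w => (2:ℝ) ^ (-j) • w) ⁻¹' (tube e (2 ^ m) ((2 * ρ' + 2 * ρ + ‖e‖) / 2 ^ m))) := by
        have : T' = (fun w => w + (-y)) ⁻¹' ((fun w => (2:ℝ) ^ (-j) • w) ⁻¹'
          (tube e (2 ^ m) ((2 * ρ' + 2 * ρ + ‖e‖) / 2 ^ m))) := by
          ext w; simp [hT', sub_eq_add_neg]
        rw [this, measure_preimage_add_right]
      rw [h1, Measure.addHaar_preimage_smul _ (by positivity), finrank_euclideanSpace_fin,
        abs_of_pos (by positivity), ← mul_assoc, ← ENNReal.ofReal_mul (by positivity),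
        mul_inv_cancel₀ (by positivity), ENNReal.ofReal_one, one_mul]
    have hsub : ∀ i' ∈ s, q i' ≤ q i → (∫⁻ x, ldil j k (x - y) * a i' x) ≠ 0 → Q i' ⊆ T' := by
      intro i' hi' hq hne w hw
      have h1 : ∃ x, ldil j k (x - y) * a i' x ≠ 0 := by
        by_contra hcon
        push Not at hcon
        exact hne (by simp [hcon])
      obtain ⟨x, hx⟩ := h1
      have h2 : ∃ z, ldil (q i' + m) k (x - z) * h i' z ≠ 0 := by
        by_contra hcon
        push Not at hcon
        exact right_ne_zero_of_mul hx (by simp [ha, lcv, hcon])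
      obtain ⟨z, hz⟩ := h2
      obtain ⟨t, ht0, ht1, ht⟩ := hkT _ (right_ne_zero_of_mul (left_ne_zero_of_mul hx))
      obtain ⟨t', ht0', ht1', ht'⟩ := hkT _ (right_ne_zero_of_mul (left_ne_zero_of_mul hz))
      have hzs := hhs i' hi' z (right_ne_zero_of_mul hz)
      have hws := hF.sub i' hi' hw
      rw [mem_closedBall, dist_eq_norm] at hzs hws
      set δ : ℝ := (2:ℝ) ^ (q i' - q i) with hδ
      have hδ0 : 0 < δ := by positivity
      have hδ1 : δ ≤ 1 := zpow_le_one_of_nonpos₀ (by norm_num) (by omega)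
      have e1 : (2:ℝ) ^ (-j) = δ * (2:ℝ) ^ (-(q i' + m)) := by
        rw [hδ, ← zpow_add₀ (by norm_num)]; congr 1; omega
      have e2 : (2:ℝ) ^ (-j) * (2:ℝ) ^ (q i') = δ / 2 ^ m := by
        rw [hδ, ← zpow_add₀ (by norm_num), div_eq_mul_inv, ← zpow_natCast, ← zpow_neg,
          ← zpow_add₀ (by norm_num)]
        congr 1; omega
      have hρ'0 : 0 ≤ ρ' / 2 ^ m := (norm_nonneg _).trans ht
      have ht2 : |t - δ * t'| ≤ 1 := abs_le.2 ⟨by nlinarith, by nlinarith⟩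
      change (2:ℝ) ^ (-j) • (w - y) ∈ tube e (2 ^ m) ((2 * ρ' + 2 * ρ + ‖e‖) / 2 ^ m)
      refine mem_tube (N := 2 ^ m) (t := t - δ * t')
        (r := ρ' / 2 ^ m + ρ' / 2 ^ m + 2 * ρ / 2 ^ m) hN1 ht2 ?_ ?_
      · have e3 : (2:ℝ) ^ (-j) • (w - y) - (t - δ * t') • e =
            ((2:ℝ) ^ (-j) • (x - y) - t • e) - δ • ((2:ℝ) ^ (-(q i' + m)) • (x - z) - t' • e) +
            (2:ℝ) ^ (-j) • ((w - c i') - (z - c i')) := by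
          rw [smul_sub δ, smul_smul, ← e1]
          module
        rw [e3]
        refine (norm_add_le _ _).trans (add_le_add ((norm_sub_le _ _).trans (add_le_add ht ?_)) ?_)
        · rw [norm_smul, Real.norm_eq_abs, abs_of_pos hδ0]
          exact (mul_le_mul hδ1 ht' (norm_nonneg _) zero_le_one).trans (by simp)
        · rw [norm_smul, Real.norm_eq_abs, abs_of_pos (by positivity)]
          calc (2:ℝ) ^ (-j) * ‖(w - c i') - (z - c i')‖
              ≤ (2:ℝ) ^ (-j) * (ρ * (2:ℝ) ^ q i' + ρ * (2:ℝ) ^ q i') := by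
                gcongr
                exact (norm_sub_le _ _).trans (add_le_add hws hzs)
            _ = 2 * ρ * (δ / 2 ^ m) := by rw [← e2]; ring
            _ ≤ 2 * ρ * (1 / 2 ^ m) := by gcongr
            _ = 2 * ρ / 2 ^ m := by ring
      · push_cast
        rw [← add_div, ← add_div, ← add_div]
        gcongr
        linarith
    set I := s.filter fun i' => q i' ≤ q i ∧ Q i' ⊆ T' with hI
    have hIs : I ⊆ s := Finset.filter_subset _ _
    calc ∑ i' ∈ s with q i' ≤ q i, ∫⁻ x, ldil j k (x - y) * a i' x
        = ∑ i' ∈ I, ∫⁻ x, ldil j k (x - y) * a i' x := by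
          refine (Finset.sum_subset (fun i' hi' => ?_) fun i' hi' hn => ?_).symm
          · simp only [hI, Finset.mem_filter] at hi' ⊢
            exact ⟨hi'.1, hi'.2.1⟩
          · by_contra hne
            simp only [Finset.mem_filter] at hi'
            exact hn (by simp only [hI, Finset.mem_filter]; exact ⟨hi'.1, hi'.2, hsub i' hi'.1 hi'.2 hne⟩)
      _ ≤ ∑ i' ∈ I, ENNReal.ofReal (((2:ℝ) ^ (-j)) ^ d) * B * (B * V * (β * volume (Q i'))) := by
          refine Finset.sum_le_sum fun i' hi' => ?_
          calc ∫⁻ x, ldil j k (x - y) * a i' x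
              ≤ ∫⁻ x, ENNReal.ofReal (((2:ℝ) ^ (-j)) ^ d) * B * a i' x := by
                refine lintegral_mono fun x => ?_
                unfold ldil
                gcongr
                exact hkB _
            _ = ENNReal.ofReal (((2:ℝ) ^ (-j)) ^ d) * B * ∫⁻ x, a i' x :=
                lintegral_const_mul _ (ham i' (hIs hi'))
            _ ≤ _ := by
                gcongr
                rw [ha]
                simp only
                rw [lintegral_lcv (measurable_ldil hkm _) (hhm i' (hIs hi')), lintegral_ldil hkm]
                exact mul_le_mul' hkV (hβ i' (hIs hi'))
      _ = ENNReal.ofReal (((2:ℝ) ^ (-j)) ^ d) * B * (B * V * (β * ∑ i' ∈ I, volume (Q i'))) := by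
          simp only [Finset.mul_sum]
      _ = ENNReal.ofReal (((2:ℝ) ^ (-j)) ^ d) * B * (B * V * (β * volume (⋃ i' ∈ I, Q i'))) := by
          rw [measure_biUnion_finset (hF.disj.subset (by exact_mod_cast hIs))
            fun i' hi' => hF.meas i' (hIs hi')]
      _ ≤ ENNReal.ofReal (((2:ℝ) ^ (-j)) ^ d) * B * (B * V * (β * volume T')) := by
          gcongr
          exact iUnion₂_subset fun i' hi' => (Finset.mem_filter.1 hi').2.2
      _ = B * B * V * β * (ENNReal.ofReal (((2:ℝ) ^ (-j)) ^ d) * volume T') := by ring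
      _ = _ := by rw [hvT']; ring
  have hsym : ∀ x, (∑ i ∈ s, a i x) ^ 2 ≤
      2 * ∑ i ∈ s, ∑ i' ∈ s with q i' ≤ q i, a i x * a i' x := by
    intro x
    have h1 : (∑ i ∈ s, a i x) ^ 2 = ∑ i ∈ s, ∑ i' ∈ s, a i x * a i' x := by
      rw [sq, Finset.sum_mul_sum]
    have h2 : ∑ i ∈ s, ∑ i' ∈ s, a i x * a i' x ≤
        ∑ i ∈ s, ∑ i' ∈ s, ((if q i' ≤ q i then a i x * a i' x else 0) +
          if q i ≤ q i' then a i' x * a i x else 0) := by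
      refine Finset.sum_le_sum fun i _ => Finset.sum_le_sum fun i' _ => ?_
      rcases le_total (q i') (q i) with h | h
      · rw [if_pos h]; exact le_self_add
      · rw [if_pos h, mul_comm (a i' x)]; exact le_add_self
    rw [h1]
    refine h2.trans (le_of_eq ?_)
    simp only [Finset.sum_add_distrib]
    rw [Finset.sum_comm (f := fun i i' => if q i ≤ q i' then a i' x * a i x else 0), two_mul]
    simp only [Finset.sum_filter]
  calc ∫⁻ x, (∑ i ∈ s, a i x) ^ 2
      ≤ ∫⁻ x, 2 * ∑ i ∈ s, ∑ i' ∈ s with q i' ≤ q i, a i x * a i' x := lintegral_mono hsym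
    _ = 2 * ∑ i ∈ s, ∑ i' ∈ s with q i' ≤ q i, ∫⁻ x, a i x * a i' x := by
        have hmm : ∀ i ∈ s, ∀ i' ∈ s.filter fun i' => q i' ≤ q i,
            Measurable fun x => a i x * a i' x := fun i hi i' hi' =>
          (ham i hi).mul (ham i' (Finset.mem_filter.1 hi').1)
        rw [lintegral_const_mul' _ _ (by norm_num), lintegral_finsetSum' _ fun i hi =>
          (Finset.measurable_fun_sum _ (hmm i hi)).aemeasurable]
        congr 1
        refine Finset.sum_congr rfl fun i hi => ?_
        rw [lintegral_finsetSum' _ fun i' hi' => (hmm i hi i' hi').aemeasurable]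
    _ ≤ 2 * ∑ i ∈ s, (B ^ 2 * V ^ 2 * β) * ∫⁻ y, h i y := by
        gcongr 2 * ?_
        refine Finset.sum_le_sum fun i hi => ?_
        have h1 : ∀ i' ∈ s, ∫⁻ x, a i x * a i' x =
            ∫⁻ y, (∫⁻ x, ldil (q i + m) k (x - y) * a i' x) * h i y := by
          intro i' hi'
          have hmm1 : Measurable fun p : Rd d × Rd d =>
              ldil (q i + m) k (p.1 - p.2) * h i p.2 :=
            ((measurable_ldil hkm _).comp (measurable_fst.sub measurable_snd)).mul
              ((hhm i hi).comp measurable_snd)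
          have hmm2 : Measurable fun p : Rd d × Rd d => ldil (q i + m) k (p.1 - p.2) * a i' p.1 :=
            ((measurable_ldil hkm _).comp (measurable_fst.sub measurable_snd)).mul
              ((ham i' hi').comp measurable_fst)
          have hmm3 : Measurable (Function.uncurry fun x y : Rd d =>
              ldil (q i + m) k (x - y) * h i y * a i' x) :=
            Measurable.mul hmm1 ((ham i' hi').comp measurable_fst)
          have hmm4 := hmm3.aemeasurable (μ := (volume : Measure (Rd d)).prod volume)
          calc ∫⁻ x, a i x * a i' x
              = ∫⁻ x, ∫⁻ y, ldil (q i + m) k (x - y) * h i y * a i' x := by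
                refine lintegral_congr fun x => ?_
                have h' : Measurable fun y => ldil (q i + m) k (x - y) * h i y :=
                  ((measurable_ldil hkm _).comp (measurable_id.const_sub x)).mul (hhm i hi)
                rw [lintegral_mul_const _ h']
                simp only [ha, lcv]
            _ = ∫⁻ y, ∫⁻ x, ldil (q i + m) k (x - y) * h i y * a i' x :=
                lintegral_lintegral_swap hmm4
            _ = _ := by
                refine lintegral_congr fun y => ?_
                have h' : Measurable fun x => ldil (q i + m) k (x - y) * a i' x :=
                  ((measurable_ldil hkm _).comp (measurable_id.sub_const y)).mul (ham i' hi')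
                rw [← lintegral_mul_const _ h']
                refine lintegral_congr fun x => ?_
                ring
        calc ∑ i' ∈ s with q i' ≤ q i, ∫⁻ x, a i x * a i' x
            = ∑ i' ∈ s with q i' ≤ q i, ∫⁻ y, (∫⁻ x, ldil (q i + m) k (x - y) * a i' x) * h i y :=
              Finset.sum_congr rfl fun i' hi' => h1 i' (Finset.mem_filter.1 hi').1
          _ = ∫⁻ y, ∑ i' ∈ s with q i' ≤ q i, (∫⁻ x, ldil (q i + m) k (x - y) * a i' x) * h i y := by
              rw [lintegral_finsetSum']
              intro i' hi'
              have hmm2 : Measurable fun p : Rd d × Rd d => ldil (q i + m) k (p.1 - p.2) * a i' p.1 :=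
                ((measurable_ldil hkm _).comp (measurable_fst.sub measurable_snd)).mul
                  ((ham i' (Finset.mem_filter.1 hi').1).comp measurable_fst)
              exact (hmm2.lintegral_prod_left'.mul (hhm i hi)).aemeasurable
          _ ≤ ∫⁻ y, (B ^ 2 * V ^ 2 * β) * h i y := by
              refine lintegral_mono fun y => ?_
              rw [← Finset.sum_mul]
              exact mul_le_mul' (key i hi y) le_rfl
          _ = _ := lintegral_const_mul _ (hhm i hi)
    _ = _ := by rw [← Finset.mul_sum]; ring

/-- Square function bound for sums of tube kernels against a family of atoms. -/
theorem sqR_sum_cv_le_of_tube {ι : Type*} {s : Finset ι} {q : ι → ℤ} {Q : ι → Set (Rd d)}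
    {c : ι → Rd d} {ρ : ℝ} (hF : Fam s q Q c ρ) (m : ℕ) {e : Rd d} {ρ' ρ'' : ℝ} (hρ' : 0 ≤ ρ')
    (he : ‖e‖ ≤ ρ'')
    {k : Rd d → ℝ} (hkm : Measurable k) {B : ℝ} (hkB : ∀ x, |k x| ≤ B)
    (hkT : ∀ x, k x ≠ 0 → ∃ t : ℝ, 0 ≤ t ∧ t ≤ 1 ∧ ‖x - t • e‖ ≤ ρ' / 2 ^ m)
    {b : ι → Rd d → ℝ} (hbm : ∀ i ∈ s, Measurable (b i))
    (hbs : ∀ i ∈ s, ∀ x, b i x ≠ 0 → x ∈ closedBall (c i) (ρ * (2:ℝ) ^ q i)) {β : ℝ≥0∞}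
    (hβ : ∀ i ∈ s, ∫⁻ x, ‖b i x‖ₑ ≤ β * volume (Q i)) :
    sqR (fun x => ∑ i ∈ s, cv (dil (q i + m) k) (b i) x) ≤
      ENNReal.ofReal (2 * B ^ 2 * (3 * 2 ^ m * (((2 * ρ' + 2 * ρ + ρ'') / 2 ^ m) ^ d * vb d 1)) ^ 2)
        * β * ∑ i ∈ s, ∫⁻ x, ‖b i x‖ₑ := by
  have hB0 : 0 ≤ B := (abs_nonneg _).trans (hkB 0)
  have hρ := hF.ρ_nonneg
  have hV := volume_tube_le e (N := 2 ^ m) Nat.one_le_two_pow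
    (r := (2 * ρ' + 2 * ρ + ‖e‖) / 2 ^ m) (by positivity)
  have key := lintegral_sq_sum_lcv_le hF m (k := fun x => ‖k x‖ₑ) hkm.enorm
    (B := ENNReal.ofReal B) (fun x => by
      rw [← ofReal_norm]; exact ENNReal.ofReal_le_ofReal (hkB x))
    (fun x hx => hkT x (by simpa using hx)) (h := fun i x => ‖b i x‖ₑ)
    (fun i hi => (hbm i hi).enorm) (fun i hi x hx => hbs i hi x (by simpa using hx)) hβ
  have hv0 := vb_nonneg (d := d) 1
  calc sqR (fun x => ∑ i ∈ s, cv (dil (q i + m) k) (b i) x)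
      ≤ ∫⁻ x, (∑ i ∈ s, lcv (ldil (q i + m) fun x => ‖k x‖ₑ) (fun x => ‖b i x‖ₑ) x) ^ 2 := by
        refine lintegral_mono fun x => ?_
        rw [← sq_abs, ENNReal.ofReal_pow (abs_nonneg _), ← Real.norm_eq_abs, ofReal_norm]
        gcongr
        refine (enorm_sum_le _ _).trans (Finset.sum_le_sum fun i _ => ?_)
        refine (enorm_cv_le _ _ x).trans (le_of_eq ?_)
        simp only [enorm_dil]
    _ ≤ _ := key
    _ ≤ 2 * ENNReal.ofReal B ^ 2 *
        (ENNReal.ofReal (3 * 2 ^ m * (((2 * ρ' + 2 * ρ + ρ'') / 2 ^ m) ^ d * vb d 1))) ^ 2 * β *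
        ∑ i ∈ s, ∫⁻ x, ‖b i x‖ₑ := by
        gcongr
        refine hV.trans (ENNReal.ofReal_le_ofReal ?_)
        push_cast
        gcongr
    _ = _ := by
        rw [← ENNReal.ofReal_pow hB0, ← ENNReal.ofReal_pow (by
          have : 0 ≤ ρ'' := (norm_nonneg _).trans he
          positivity), ENNReal.ofReal_mul (by positivity), ENNReal.ofReal_mul (by positivity)]
        simp

end Tube

section Potential

variable {d : ℕ}

theorem ftr_translate (f : Rd d → ℝ) (c ξ : Rd d) :
    ftr (fun y => f (y - c)) ξ =
      Complex.exp (↑(-2 * Real.pi * inner ℝ c ξ) * Complex.I) * ftr f ξ := by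
  simp only [ftr_apply]
  rw [← integral_sub_right_eq_self _ c, ← integral_const_mul]
  · conv_rhs => rw [← integral_sub_right_eq_self _ c]
    rw [← integral_sub_right_eq_self _ (-c)]
    congr 1; ext x
    rw [← mul_assoc, ← Complex.exp_add]
    congr 2
    · rw [← add_mul, ← Complex.ofReal_add, ← mul_add, ← inner_add_left]
      congr 4
      abel
    · congr 2
      abel

/-- The average of dilates `∫₀¹ t^{-d} g(t^{-1} x) dt`. -/
def avgDil (g : Rd d → ℝ) (z : Rd d) : ℝ :=
  ∫ t : ℝ in Ioc 0 1, (t⁻¹) ^ d * g (t⁻¹ • z)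

theorem measurable_avgDil_kernel {g : Rd d → ℝ} (hg : Measurable g) :
    Measurable (fun p : ℝ × Rd d => (p.1⁻¹) ^ d * g (p.1⁻¹ • p.2)) :=
  ((measurable_fst.inv).pow_const d).mul (hg.comp ((measurable_fst.inv).smul measurable_snd))

theorem lintegral_avgDil_kernel (g : Rd d → ℝ) {t : ℝ} (ht : 0 < t) :
    ∫⁻ z, ‖(t⁻¹) ^ d * g (t⁻¹ • z)‖ₑ = ∫⁻ z, ‖g z‖ₑ := by
  rw [← lintegral_scale (fun z => ‖g z‖ₑ) (inv_pos.2 ht), ← lintegral_const_mul']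
  · refine lintegral_congr fun z => ?_
    rw [enorm_mul, Real.enorm_eq_ofReal (by positivity)]
  · exact ENNReal.ofReal_ne_top

theorem integrable_avgDil_kernel {g : Rd d → ℝ} (hg : IM g) :
    Integrable (fun p : ℝ × Rd d => (p.1⁻¹) ^ d * g (p.1⁻¹ • p.2))
      ((volume.restrict (Ioc (0:ℝ) 1)).prod volume) := by
  have hm := measurable_avgDil_kernel hg.meas
  refine ⟨hm.aestronglyMeasurable, ?_⟩
  rw [HasFiniteIntegral, lintegral_prod _ hm.enorm.aemeasurable]
  have : ∫⁻ t in Ioc (0:ℝ) 1, ∫⁻ z, ‖(t⁻¹) ^ d * g (t⁻¹ • z)‖ₑ =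
      ∫⁻ t in Ioc (0:ℝ) 1, ∫⁻ z, ‖g z‖ₑ :=
    setLIntegral_congr_fun measurableSet_Ioc fun t ht => lintegral_avgDil_kernel g ht.1
  rw [this]
  have h2 : ∫⁻ z, ‖g z‖ₑ < ∞ := hg.int.2
  simpa using h2

theorem IM.avgDil {g : Rd d → ℝ} (hg : IM g) : IM (avgDil g) := by
  refine ⟨?_, (integrable_avgDil_kernel hg).integral_prod_right⟩
  have h1 : StronglyMeasurable fun p : ℝ × Rd d => (p.1⁻¹) ^ d * g (p.1⁻¹ • p.2) :=
    (measurable_avgDil_kernel hg.meas).stronglyMeasurable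
  exact (h1.integral_prod_left' (μ := volume.restrict (Ioc (0:ℝ) 1))).measurable

theorem lintegral_enorm_avgDil_le {g : Rd d → ℝ} (hg : IM g) :
    ∫⁻ z, ‖avgDil g z‖ₑ ≤ ∫⁻ z, ‖g z‖ₑ := by
  have hm := measurable_avgDil_kernel hg.meas
  have hm' : Measurable (Function.uncurry fun (z : Rd d) (t : ℝ) => ‖(t⁻¹) ^ d * g (t⁻¹ • z)‖ₑ) :=
    (hm.comp measurable_swap).enorm
  calc ∫⁻ z, ‖avgDil g z‖ₑ
      ≤ ∫⁻ z, ∫⁻ t in Ioc (0:ℝ) 1, ‖(t⁻¹) ^ d * g (t⁻¹ • z)‖ₑ :=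
        lintegral_mono fun z => enorm_integral_le_lintegral_enorm _
    _ = ∫⁻ t in Ioc (0:ℝ) 1, ∫⁻ z, ‖(t⁻¹) ^ d * g (t⁻¹ • z)‖ₑ :=
        lintegral_lintegral_swap hm'.aemeasurable
    _ = ∫⁻ t in Ioc (0:ℝ) 1, ∫⁻ z, ‖g z‖ₑ :=
        setLIntegral_congr_fun measurableSet_Ioc fun t ht => lintegral_avgDil_kernel g ht.1
    _ = _ := by simp

theorem avgDil_supp {g : Rd d → ℝ} {r : ℝ} (hg : ∀ x, g x ≠ 0 → ‖x‖ ≤ r) {z : Rd d}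
    (hz : avgDil g z ≠ 0) : ‖z‖ ≤ r := by
  by_contra hcon
  push Not at hcon
  apply hz
  unfold avgDil
  refine setIntegral_eq_zero_of_forall_eq_zero fun t ht => ?_
  by_contra h
  have h1 := hg _ (right_ne_zero_of_mul h)
  rw [norm_smul, norm_inv, Real.norm_eq_abs, abs_of_pos ht.1] at h1
  have h2 : ‖z‖ ≤ t⁻¹ * ‖z‖ := le_mul_of_one_le_left (norm_nonneg _) ((one_le_inv₀ ht.1).2 ht.2)
  linarith

theorem ftr_avgDil {g : Rd d → ℝ} (hg : IM g) (ξ : Rd d) :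
    ftr (avgDil g) ξ = ∫ t : ℝ in Ioc 0 1, ftr g (t • ξ) := by
  have hint := integrable_avgDil_kernel hg
  set E : Rd d → ℂ := fun z => Complex.exp (↑(-2 * Real.pi * inner ℝ z ξ) * Complex.I) with hE
  have hEc : Continuous E := by fun_prop
  have hint2 : Integrable (Function.uncurry fun (t : ℝ) (z : Rd d) =>
      E z * (((t⁻¹) ^ d * g (t⁻¹ • z) : ℝ) : ℂ)) ((volume.restrict (Ioc (0:ℝ) 1)).prod volume) := by
    refine Integrable.bdd_mul (c := 1) hint.ofReal
      (hEc.measurable.comp measurable_snd).aestronglyMeasurable (ae_of_all _ fun p => ?_)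
    simp [hE, Complex.norm_exp]
  rw [ftr_apply]
  calc ∫ z, E z * (avgDil g z : ℂ)
      = ∫ z, ∫ t in Ioc (0:ℝ) 1, E z * (((t⁻¹) ^ d * g (t⁻¹ • z) : ℝ) : ℂ) := by
        congr 1; ext z
        rw [integral_const_mul]
        congr 1
        exact (integral_ofReal (𝕜 := ℂ)).symm
    _ = ∫ t in Ioc (0:ℝ) 1, ∫ z, E z * (((t⁻¹) ^ d * g (t⁻¹ • z) : ℝ) : ℂ) :=
        (integral_integral_swap hint2).symm
    _ = _ := by
        refine setIntegral_congr_fun measurableSet_Ioc fun t ht => ?_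
        rw [ftr_apply]
        refine Eq.trans ?_ (integral_scale (d := d) _ (inv_pos.2 ht.1))
        rw [← integral_smul]
        congr 1; ext z
        rw [hE]
        simp only
        rw [real_inner_smul_left, real_inner_smul_right, ← mul_assoc (t⁻¹), inv_mul_cancel₀ ht.1.ne',
          one_mul, Complex.real_smul]
        push_cast
        ring

theorem integral_exp_segment (a : ℝ) :
    ∫ t : ℝ in Ioc 0 1, (-2 * Real.pi * Complex.I * a) *
      Complex.exp (↑(-2 * Real.pi * (t * a)) * Complex.I) =
      Complex.exp (↑(-2 * Real.pi * a) * Complex.I) - 1 := by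
  rw [← intervalIntegral.integral_of_le zero_le_one]
  have h : ∀ t ∈ uIcc (0:ℝ) 1, HasDerivAt
      (fun t : ℝ => Complex.exp (↑(-2 * Real.pi * (t * a)) * Complex.I))
      ((-2 * Real.pi * Complex.I * a) * Complex.exp (↑(-2 * Real.pi * (t * a)) * Complex.I)) t := by
    intro t _
    have h1 : HasDerivAt (fun t : ℝ => ((-2 * Real.pi * (t * a) : ℝ) : ℂ) * Complex.I)
        (((-2 * Real.pi * (1 * a) : ℝ) : ℂ) * Complex.I) t :=
      ((((hasDerivAt_id t).mul_const a).const_mul (-2 * Real.pi)).ofReal_comp).mul_const _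
    have h2 := h1.cexp
    convert h2 using 1
    push_cast; ring
  rw [intervalIntegral.integral_eq_sub_of_hasDerivAt h]
  · simp
  · exact (by fun_prop : Continuous fun t : ℝ => (-2 * Real.pi * Complex.I * a) *
      Complex.exp (↑(-2 * Real.pi * (t * a)) * Complex.I)).intervalIntegrable _ _

theorem inner_eq_sum_coord (x ξ : Rd d) : inner ℝ x ξ = ∑ m, ξ m * x m := by
  simp [PiLp.inner_apply]

theorem ftr_eq_sum_of_mean_zero {u : Rd d → ℝ} (hu : Nice u) {r : ℝ}
    (hs : ∀ x, u x ≠ 0 → ‖x‖ ≤ r) (h0 : ∫ x, u x = 0) (ξ : Rd d) :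
    ftr u ξ = ∑ m, 2 * Real.pi * Complex.I * (ξ m : ℂ) *
      ftr (fun x => -1 * avgDil (fun y => y m * u y) x) ξ := by
  have hg : ∀ m, IM fun y : Rd d => y m * u y := by
    intro m
    obtain ⟨C, hC⟩ := hu.bdd
    refine (Nice.of_bounded_support (C := |r| * C) (R := r)
      ((by fun_prop : Measurable fun y : Rd d => y m).mul hu.meas) (fun x => ?_) fun x hx => ?_).toIM
    · change |x m * u x| ≤ |r| * C
      by_cases hx : u x = 0
      · simp only [hx, mul_zero, abs_zero]
        exact mul_nonneg (abs_nonneg _) ((abs_nonneg _).trans (hC 0))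
      · rw [abs_mul]
        refine mul_le_mul ?_ (hC x) (abs_nonneg _) (abs_nonneg _)
        exact (PiLp.norm_apply_le x m).trans ((hs x hx).trans (le_abs_self r))
    · exact hs x (right_ne_zero_of_mul hx)
  have hsum : ∀ t : ℝ, ∫ x, (-2 * Real.pi * Complex.I * (inner ℝ x ξ : ℝ)) *
      Complex.exp (↑(-2 * Real.pi * (t * inner ℝ x ξ)) * Complex.I) * (u x : ℂ) =
      ∑ m, (-2 * Real.pi * Complex.I * (ξ m : ℂ)) * ftr (fun y => y m * u y) (t • ξ) := by
    intro t
    simp only [ftr_apply, ← integral_const_mul]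
    rw [← integral_finsetSum]
    · congr 1; ext x
      simp only [real_inner_smul_right]
      conv_lhs => rw [inner_eq_sum_coord x ξ]
      push_cast
      simp only [Finset.mul_sum, Finset.sum_mul]
      refine Finset.sum_congr rfl fun m _ => ?_
      rw [inner_eq_sum_coord x ξ]
      push_cast
      simp only [Finset.mul_sum, Finset.sum_mul]
      ring
    · intro m _
      exact (integrable_exp_mul (hg m).int (t • ξ)).const_mul _
  have hint : Integrable (Function.uncurry fun (x : Rd d) (t : ℝ) =>
      (-2 * Real.pi * Complex.I * (inner ℝ x ξ : ℝ)) *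
      Complex.exp (↑(-2 * Real.pi * (t * inner ℝ x ξ)) * Complex.I) * (u x : ℂ))
      ((volume : Measure (Rd d)).prod (volume.restrict (Ioc (0:ℝ) 1))) := by
    have h1 : Integrable (fun p : Rd d × ℝ => u p.1 * (1:ℝ))
        ((volume : Measure (Rd d)).prod (volume.restrict (Ioc (0:ℝ) 1))) :=
      hu.int.mul_prod (integrable_const 1)
    refine (h1.norm.const_mul (2 * Real.pi * (|r| * ‖ξ‖))).mono' ?_ (ae_of_all _ fun p => ?_)
    · refine AEStronglyMeasurable.mul ?_ ?_
      · exact (by fun_prop : Continuous fun p : Rd d × ℝ =>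
          (-2 * Real.pi * Complex.I * (inner ℝ p.1 ξ : ℝ)) *
          Complex.exp (↑(-2 * Real.pi * (p.2 * inner ℝ p.1 ξ)) * Complex.I)).aestronglyMeasurable
      · exact (Complex.measurable_ofReal.comp (hu.meas.comp measurable_fst)).aestronglyMeasurable
    · obtain ⟨x, t⟩ := p
      simp only [Function.uncurry]
      by_cases hx : u x = 0
      · simp [hx]
      · have h2 : |inner ℝ x ξ| ≤ |r| * ‖ξ‖ :=
          (abs_real_inner_le_norm x ξ).trans
            (mul_le_mul_of_nonneg_right ((hs x hx).trans (le_abs_self r)) (norm_nonneg _))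
        rw [norm_mul, norm_mul, Complex.norm_exp_ofReal_mul_I]
        simp only [norm_mul, norm_neg, Complex.norm_ofNat, Complex.norm_real, Complex.norm_I,
          Real.norm_eq_abs, abs_of_pos Real.pi_pos, mul_one]
        gcongr
  calc ftr u ξ = ∫ x, (Complex.exp (↑(-2 * Real.pi * inner ℝ x ξ) * Complex.I) - 1) * (u x : ℂ) := by
        rw [ftr_apply]
        simp only [sub_mul, one_mul]
        have h1 : ∫ x, (u x : ℂ) = 0 := by
          rw [show ∫ x, (u x : ℂ) = ((∫ x, u x : ℝ) : ℂ) from integral_ofReal (𝕜 := ℂ), h0]; simp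
        have h2 : Integrable (fun x => (u x : ℂ)) := hu.int.ofReal
        rw [integral_sub (integrable_exp_mul hu.int ξ) h2, h1, sub_zero]
    _ = ∫ x, ∫ t : ℝ in Ioc 0 1, (-2 * Real.pi * Complex.I * (inner ℝ x ξ : ℝ)) *
          Complex.exp (↑(-2 * Real.pi * (t * inner ℝ x ξ)) * Complex.I) * (u x : ℂ) := by
        congr 1; ext x
        rw [← integral_exp_segment, integral_mul_const]
    _ = ∫ t : ℝ in Ioc 0 1, ∫ x, (-2 * Real.pi * Complex.I * (inner ℝ x ξ : ℝ)) *
          Complex.exp (↑(-2 * Real.pi * (t * inner ℝ x ξ)) * Complex.I) * (u x : ℂ) :=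
        integral_integral_swap hint
    _ = ∫ t : ℝ in Ioc 0 1, ∑ m, (-2 * Real.pi * Complex.I * (ξ m : ℂ)) *
          ftr (fun y => y m * u y) (t • ξ) := by simp only [hsum]
    _ = ∑ m, (-2 * Real.pi * Complex.I * (ξ m : ℂ)) *
          ∫ t : ℝ in Ioc 0 1, ftr (fun y => y m * u y) (t • ξ) := by
        rw [integral_finsetSum]
        · simp only [integral_const_mul]
        · intro m _
          have hc : Continuous fun t : ℝ => ftr (fun y => y m * u y) (t • ξ) :=
            (continuous_ftr (hg m).int).comp (by fun_prop)
          exact ((hc.integrableOn_Icc (a := 0) (b := 1)).mono_set Ioc_subset_Icc_self).const_mul _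
    _ = _ := by
        refine Finset.sum_congr rfl fun m _ => ?_
        rw [ftr_const_mul, ftr_avgDil (hg m)]
        push_cast; ring

/-- A mean zero function supported in a ball is the divergence of an integrable vector field. -/
theorem exists_potential {b : Rd d → ℝ} (hb : Nice b) {c : Rd d} {r : ℝ}
    (hs : ∀ x, b x ≠ 0 → x ∈ closedBall c r) (h0 : ∫ x, b x = 0) :
    ∃ h : Fin d → Rd d → ℝ, (∀ m, IM (h m)) ∧ (∀ m x, h m x ≠ 0 → x ∈ closedBall c r) ∧
      (∀ m, ∫⁻ x, ‖h m x‖ₑ ≤ ENNReal.ofReal r * ∫⁻ x, ‖b x‖ₑ) ∧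
      ∀ ξ, ftr b ξ = ∑ m, 2 * Real.pi * Complex.I * (ξ m : ℂ) * ftr (h m) ξ := by
  set u : Rd d → ℝ := fun x => b (x + c) with hu
  have hun : Nice u := by
    obtain ⟨C, hC⟩ := hb.bdd
    exact ⟨⟨hb.meas.comp (measurable_id.add_const c), hb.int.comp_add_right c⟩, C, fun x => hC _⟩
  have hus : ∀ x, u x ≠ 0 → ‖x‖ ≤ r := fun x hx => by simpa using hs _ hx
  have hu0 : ∫ x, u x = 0 := by rw [← h0]; exact integral_add_right_eq_self b c
  have hgs : ∀ m, ∀ y : Rd d, y m * u y ≠ 0 → ‖y‖ ≤ r := fun m y hy => hus y (right_ne_zero_of_mul hy)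
  have hgb : ∀ m, ∀ y : Rd d, ‖y m * u y‖ₑ ≤ ENNReal.ofReal r * ‖u y‖ₑ := by
    intro m y
    by_cases hy : u y = 0
    · simp [hy]
    · rw [enorm_mul]
      gcongr
      rw [← ofReal_norm]
      exact ENNReal.ofReal_le_ofReal ((PiLp.norm_apply_le y m).trans (hus y hy))
  have hg : ∀ m, IM fun y : Rd d => y m * u y := by
    intro m
    have hm : Measurable fun y : Rd d => y m * u y :=
      (by fun_prop : Measurable fun y : Rd d => y m).mul hun.meas
    refine ⟨hm, hm.aestronglyMeasurable, ?_⟩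
    refine (lintegral_mono (hgb m)).trans_lt ?_
    rw [lintegral_const_mul _ hun.meas.enorm]
    exact ENNReal.mul_lt_top ENNReal.ofReal_lt_top hun.int.2
  have hbu : b = fun x => u (x - c) := by ext x; simp [hu]
  refine ⟨fun m x => -1 * avgDil (fun y => y m * u y) (x - c), fun m => ?_, fun m x hx => ?_,
    fun m => ?_, fun ξ => ?_⟩
  · exact IM.const_mul ⟨(hg m).avgDil.meas.comp (measurable_id.sub_const c),
      (hg m).avgDil.int.comp_sub_right c⟩ _
  · rw [mem_closedBall, dist_eq_norm]
    exact avgDil_supp (hgs m) (right_ne_zero_of_mul hx)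
  · simp only [enorm_mul, enorm_neg, enorm_one, one_mul]
    rw [lintegral_sub_right_eq_self (fun x => ‖avgDil (fun y => y m * u y) x‖ₑ) c]
    refine (lintegral_enorm_avgDil_le (hg m)).trans ((lintegral_mono (hgb m)).trans ?_)
    rw [lintegral_const_mul _ hun.meas.enorm, hu,
      lintegral_add_right_eq_self (fun x => ‖b x‖ₑ) c]
  · rw [hbu, ftr_translate, ftr_eq_sum_of_mean_zero hun hus hu0, Finset.mul_sum]
    refine Finset.sum_congr rfl fun m _ => ?_
    rw [ftr_translate (fun x => -1 * avgDil (fun y => y m * u y) x)]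
    ring

end Potential

section Lattice

theorem exists_sum_inv_one_add_sq_le : ∃ S : ℝ, 0 ≤ S ∧ ∀ (T : Finset ℤ) (α : ℝ),
    ∑ t ∈ T, 1 / (1 + ((t : ℝ) + α) ^ 2) ≤ S := by
  have hsum : Summable fun n : ℤ => 1 / (1 + (n : ℝ) ^ 2) := by
    have h := (Real.summable_one_div_int_pow (p := 2)).2 (by norm_num)
    refine Summable.of_norm_bounded_eventually h ?_
    rw [Filter.eventually_cofinite]
    refine (Set.finite_singleton (0:ℤ)).subset fun n hn => ?_
    by_contra h0
    apply hn
    have h1 : (0:ℝ) < (n:ℝ) ^ 2 := by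
      have : (n:ℝ) ≠ 0 := by exact_mod_cast h0
      positivity
    rw [Real.norm_of_nonneg (by positivity)]
    exact one_div_le_one_div_of_le h1 (by linarith)
  refine ⟨3 * ∑' n : ℤ, 1 / (1 + (n : ℝ) ^ 2),
    mul_nonneg (by norm_num) (tsum_nonneg fun n => by positivity), fun T α => ?_⟩
  calc ∑ t ∈ T, 1 / (1 + ((t : ℝ) + α) ^ 2)
      ≤ ∑ t ∈ T, 3 * (1 / (1 + (((t + ⌊α⌋ : ℤ)) : ℝ) ^ 2)) := by
        refine Finset.sum_le_sum fun t _ => ?_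
        have h1 := Int.floor_le α
        have h2 := Int.lt_floor_add_one α
        rw [mul_one_div, div_le_div_iff₀ (by positivity) (by positivity)]
        push_cast
        set u := (t : ℝ) + α
        have h3 : (t:ℝ) + ⌊α⌋ = u - (α - ⌊α⌋) := by simp only [u]; ring
        rw [h3]
        set δ := α - ⌊α⌋
        have h4 : 0 ≤ δ := by simp only [δ]; linarith
        have h5 : δ ≤ 1 := by simp only [δ]; linarith
        nlinarith [sq_nonneg (u + δ)]
    _ = 3 * ∑ t ∈ T.map (addRightEmbedding ⌊α⌋), 1 / (1 + (t : ℝ) ^ 2) := by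
        rw [← Finset.mul_sum, Finset.sum_map]; simp
    _ ≤ _ := by
        gcongr
        exact hsum.sum_le_tsum _ fun n _ => by positivity

variable {d : ℕ}

theorem sum_biUnion_le_sum {ι κ : Type*} [DecidableEq κ] (s : Finset ι) (t : ι → Finset κ)
    {f : κ → ℝ} (hf : ∀ x, 0 ≤ f x) :
    ∑ x ∈ s.biUnion t, f x ≤ ∑ i ∈ s, ∑ x ∈ t i, f x := by
  classical
  induction s using Finset.induction_on with
  | empty => simp
  | insert a s ha ih =>
    rw [Finset.biUnion_insert, Finset.sum_insert ha]
    have h := Finset.sum_union_inter (s₁ := t a) (s₂ := s.biUnion t) (f := f)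
    have h2 : 0 ≤ ∑ x ∈ t a ∩ s.biUnion t, f x := Finset.sum_nonneg fun x _ => hf x
    linarith

/-- Lattice points on the boundary of the cube `[-N, N]^d`. -/
def bdry (d N : ℕ) : Finset (Fin d → ℤ) :=
  (Fintype.piFinset fun _ => Finset.Icc (-(N : ℤ)) N).filter fun v => ∃ k, |v k| = N

/-- Lattice points in the cube with fixed `k`-th coordinate. -/
def face (d N : ℕ) (k : Fin d) (a : ℤ) : Finset (Fin d → ℤ) :=
  (Fintype.piFinset fun _ => Finset.Icc (-(N : ℤ)) N).filter fun v => v k = a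

theorem bdry_subset (d N : ℕ) :
    bdry d N ⊆ Finset.univ.biUnion fun k => face d N k N ∪ face d N k (-N) := by
  intro v hv
  simp only [bdry, Finset.mem_filter] at hv
  obtain ⟨hv, k, hk⟩ := hv
  simp only [Finset.mem_biUnion, Finset.mem_univ, true_and, Finset.mem_union, face,
    Finset.mem_filter]
  refine ⟨k, ?_⟩
  rcases abs_choice (v k) with h | h
  · left; exact ⟨hv, by omega⟩
  · right; exact ⟨hv, by omega⟩

theorem card_Icc_le {N : ℕ} (hN : 1 ≤ N) : ((Finset.Icc (-(N : ℤ)) N).card : ℝ) ≤ 3 * N := by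
  rw [Int.card_Icc]
  have : ((N : ℤ) + 1 - -(N : ℤ)).toNat = 2 * N + 1 := by omega
  rw [this]
  push_cast
  have : (1:ℝ) ≤ N := by exact_mod_cast hN
  linarith

theorem card_face_le {N : ℕ} (hN : 1 ≤ N) (k : Fin d) (a : ℤ) :
    ((face d N k a).card : ℝ) ≤ (3 * N : ℝ) ^ (d - 1) := by
  have hsub : face d N k a ⊆
      Fintype.piFinset fun i => if i = k then {a} else Finset.Icc (-(N : ℤ)) N := by
    intro v hv
    simp only [face, Finset.mem_filter, Fintype.mem_piFinset] at hv ⊢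
    intro i
    split_ifs with h
    · subst h; simp [hv.2]
    · exact hv.1 i
  have h1 := Finset.card_le_card hsub
  rw [Fintype.card_piFinset] at h1
  calc ((face d N k a).card : ℝ)
      ≤ ∏ i, ((if i = k then ({a} : Finset ℤ) else Finset.Icc (-(N : ℤ)) N).card : ℝ) := by
        exact_mod_cast h1
    _ ≤ ∏ i, (if i = k then (1:ℝ) else 3 * N) := by
        refine Finset.prod_le_prod (fun _ _ => by positivity) fun i _ => ?_
        split_ifs
        · simp
        · exact card_Icc_le hN
    _ = _ := by
        rw [Finset.prod_ite]
        simp only [Finset.prod_const_one, one_mul, Finset.prod_const]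
        congr 1
        rw [Finset.filter_ne' Finset.univ k, Finset.card_erase_of_mem (Finset.mem_univ _)]
        simp

theorem card_bdry_le {N : ℕ} (hN : 1 ≤ N) :
    ((bdry d N).card : ℝ) ≤ 2 * d * (3 * N : ℝ) ^ (d - 1) := by
  have h1 := (Finset.card_le_card (bdry_subset d N)).trans Finset.card_biUnion_le
  calc ((bdry d N).card : ℝ)
      ≤ ∑ k : Fin d, ((face d N k N ∪ face d N k (-N)).card : ℝ) := by exact_mod_cast h1
    _ ≤ ∑ k : Fin d, 2 * (3 * N : ℝ) ^ (d - 1) := by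
        refine Finset.sum_le_sum fun k _ => ?_
        have h2 : ((face d N k N ∪ face d N k (-N)).card : ℝ) ≤
            (face d N k N).card + (face d N k (-N)).card := by
          exact_mod_cast Finset.card_union_le _ _
        linarith [card_face_le (d := d) hN k N, card_face_le (d := d) hN k (-N)]
    _ = _ := by simp; ring

/-- Sum of the weights over a face, in the presence of a transversal direction. -/
theorem sum_face_le_of_transversal {S : ℝ} (hS0 : 0 ≤ S) (hS : ∀ (T : Finset ℤ) (α : ℝ),
    ∑ t ∈ T, 1 / (1 + ((t : ℝ) + α) ^ 2) ≤ S) {N : ℕ} (hN : 1 ≤ N) {k m : Fin d} (hkm : m ≠ k)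
    (a : ℤ) {θ : Fin d → ℝ} {δ : ℝ} (hδ : 0 < δ) (hδ1 : δ ≤ 1) (hm : δ ≤ |θ m|) :
    ∑ v ∈ face d N k a, 1 / (1 + (∑ i, (v i : ℝ) * θ i) ^ 2) ≤
      S / δ ^ 2 * (3 * N : ℝ) ^ (d - 2) := by
  classical
  set U : Finset (Fin d → ℤ) := Fintype.piFinset fun i =>
    if i = k then {a} else if i = m then {0} else Finset.Icc (-(N : ℤ)) N with hU
  have hmaps : ∀ v ∈ face d N k a, Function.update v m 0 ∈ U := by
    intro v hv
    simp only [face, Finset.mem_filter, Fintype.mem_piFinset] at hv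
    simp only [hU, Fintype.mem_piFinset]
    intro i
    by_cases h1 : i = k
    · subst h1; simp [hv.2, hkm.symm]
    · by_cases h2 : i = m
      · subst h2; simp [h1]
      · simpa [h1, h2] using hv.1 i
  have hcard : (U.card : ℝ) ≤ (3 * N : ℝ) ^ (d - 2) := by
    rw [hU, Fintype.card_piFinset]
    push_cast
    calc ∏ i, ((if i = k then ({a} : Finset ℤ) else if i = m then {0} else
          Finset.Icc (-(N : ℤ)) N).card : ℝ)
        ≤ ∏ i, (if i = k ∨ i = m then (1:ℝ) else 3 * N) := by
          refine Finset.prod_le_prod (fun _ _ => by positivity) fun i _ => ?_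
          by_cases h1 : i = k
          · simp [h1]
          · by_cases h2 : i = m
            · subst h2; simp [h1]
            · simp only [h1, h2, if_false, or_self]
              exact card_Icc_le hN
      _ = _ := by
          rw [Finset.prod_ite]
          simp only [Finset.prod_const_one, one_mul, Finset.prod_const]
          congr 1
          have : (Finset.univ.filter fun i => ¬ (i = k ∨ i = m)) = (Finset.univ.erase k).erase m := by
            ext i; simp; tauto
          rw [this, Finset.card_erase_of_mem (by simp [hkm]),
            Finset.card_erase_of_mem (Finset.mem_univ _)]
          simp; omega
  rw [← Finset.sum_fiberwise_of_maps_to hmaps]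
  have hfib : ∀ u ∈ U, ∑ v ∈ face d N k a with Function.update v m 0 = u,
      1 / (1 + (∑ i, (v i : ℝ) * θ i) ^ 2) ≤ S / δ ^ 2 := by
    intro u _
    set F := (face d N k a).filter fun v => Function.update v m 0 = u with hF
    set b := ∑ i, (u i : ℝ) * θ i with hb
    have hθ : θ m ≠ 0 := abs_pos.1 (hδ.trans_le hm)
    have hv : ∀ v ∈ F, v = Function.update u m (v m) := by
      intro v hv
      rw [← (Finset.mem_filter.1 hv).2]; simp
    have hval : ∀ v ∈ F, ∑ i, (v i : ℝ) * θ i = (v m : ℝ) * θ m + b := by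
      intro v hv'
      have h1 := (Finset.mem_filter.1 hv').2
      rw [hb, ← h1, ← Finset.add_sum_erase _ _ (Finset.mem_univ m),
        ← Finset.add_sum_erase Finset.univ (fun i => ((Function.update v m 0 i : ℤ) : ℝ) * θ i)
          (Finset.mem_univ m)]
      simp only [Function.update_self, Int.cast_zero, zero_mul, zero_add]
      congr 1
      refine Finset.sum_congr rfl fun i hi => ?_
      rw [Function.update_of_ne (Finset.ne_of_mem_erase hi)]
    have hinj : Set.InjOn (fun v : Fin d → ℤ => v m) F := by
      intro v hv' w hw' h
      rw [hv v hv', hv w hw', show v m = w m from h]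
    calc ∑ v ∈ F, 1 / (1 + (∑ i, (v i : ℝ) * θ i) ^ 2)
        ≤ ∑ v ∈ F, (1 / δ ^ 2) * (1 / (1 + ((v m : ℝ) + b / θ m) ^ 2)) := by
          refine Finset.sum_le_sum fun v hv' => ?_
          rw [hval v hv', one_div_mul_one_div]
          apply one_div_le_one_div_of_le (by positivity)
          have h1 : (v m : ℝ) * θ m + b = θ m * ((v m : ℝ) + b / θ m) := by field_simp
          rw [h1, mul_pow, ← sq_abs (θ m)]
          have h2 : δ ^ 2 ≤ |θ m| ^ 2 := by gcongr
          have h3 : δ ^ 2 ≤ 1 := pow_le_one₀ hδ.le hδ1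
          nlinarith [sq_nonneg ((v m : ℝ) + b / θ m)]
      _ = (1 / δ ^ 2) * ∑ t ∈ F.image (fun v : Fin d → ℤ => (v m : ℤ)), (1 / (1 + (((t : ℤ) : ℝ) + b / θ m) ^ 2)) := by
          rw [← Finset.mul_sum, Finset.sum_image hinj]
      _ ≤ (1 / δ ^ 2) * S := by gcongr; exact hS _ _
      _ = _ := by ring
  calc _ ≤ ∑ u ∈ U, S / δ ^ 2 := Finset.sum_le_sum hfib
    _ = S / δ ^ 2 * U.card := by simp [mul_comm]
    _ ≤ _ := by gcongr

theorem exists_sum_bdry_le (hd : 2 ≤ d) : ∃ W : ℝ, 0 < W ∧ ∀ N : ℕ, 1 ≤ N → ∀ θ : Rd d, ‖θ‖ = 1 →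
    ∑ v ∈ bdry d N, 1 / (1 + (∑ i, (v i : ℝ) * θ i) ^ 2) ≤ W * (N : ℝ) ^ (d - 2) := by
  obtain ⟨S, hS0, hS⟩ := exists_sum_inv_one_add_sq_le
  set D : ℝ := 4 * d ^ 2 with hD
  have hd0 : (2:ℝ) ≤ d := by exact_mod_cast hd
  have hface : ∀ N : ℕ, 1 ≤ N → ∀ θ : Rd d, ‖θ‖ = 1 → ∀ k : Fin d, ∀ a : ℤ, |a| = N →
      ∑ v ∈ face d N k a, 1 / (1 + (∑ i, (v i : ℝ) * θ i) ^ 2) ≤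
        (S * D + 48) * (3 * N : ℝ) ^ (d - 2) := by
    intro N hN θ hθ k a ha
    have hN1 : (1:ℝ) ≤ N := by exact_mod_cast hN
    set δ : ℝ := 1 / (2 * d) with hδ
    have hδ0 : 0 < δ := by positivity
    have hδ1 : δ ≤ 1 := by rw [hδ, div_le_one (by positivity)]; linarith
    by_cases h : ∃ m, m ≠ k ∧ δ ≤ |θ m|
    · obtain ⟨m, hmk, hm⟩ := h
      refine (sum_face_le_of_transversal hS0 hS hN hmk a hδ0 hδ1 hm).trans ?_
      gcongr
      have : S / δ ^ 2 = S * D := by rw [hδ, hD]; field_simp; norm_num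
      rw [this]; linarith
    · push Not at h
      have h1 : 3 / 4 ≤ θ k ^ 2 := by
        have h2 : ∑ i, θ i ^ 2 = 1 := by
          rw [← EuclideanSpace.real_norm_sq_eq, hθ, one_pow]
        rw [← Finset.add_sum_erase _ _ (Finset.mem_univ k)] at h2
        have h3 : ∑ i ∈ Finset.univ.erase k, θ i ^ 2 ≤ ∑ i ∈ Finset.univ.erase k, δ ^ 2 := by
          refine Finset.sum_le_sum fun i hi => ?_
          rw [← sq_abs]
          have := (h i (Finset.ne_of_mem_erase hi)).le
          gcongr
        have h4 : ∑ i ∈ Finset.univ.erase k, δ ^ 2 ≤ d * δ ^ 2 := by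
          rw [Finset.sum_const, nsmul_eq_mul]
          gcongr
          exact (Finset.card_le_univ _).trans (by simp)
        have h5 : d * δ ^ 2 ≤ 1 / 4 := by
          rw [hδ]
          have : (d:ℝ) * (1 / (2 * d)) ^ 2 = 1 / (4 * d) := by field_simp; norm_num
          rw [this]
          apply one_div_le_one_div_of_le <;> linarith
        linarith
      have h2 : 3 / 4 ≤ |θ k| := by
        have := sq_abs (θ k)
        have h5 : |θ k| ≤ 1 := hθ ▸ PiLp.norm_apply_le θ k
        nlinarith [abs_nonneg (θ k)]
      have hterm : ∀ v ∈ face d N k a, 1 / (1 + (∑ i, (v i : ℝ) * θ i) ^ 2) ≤ 16 / (N:ℝ) ^ 2 := by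
        intro v hv
        simp only [face, Finset.mem_filter, Fintype.mem_piFinset, Finset.mem_Icc] at hv
        have h3 : (N:ℝ) / 4 ≤ |∑ i, (v i : ℝ) * θ i| := by
          rw [← Finset.add_sum_erase _ _ (Finset.mem_univ k)]
          have h4 : |∑ i ∈ Finset.univ.erase k, (v i : ℝ) * θ i| ≤ N / 2 := by
            calc |∑ i ∈ Finset.univ.erase k, (v i : ℝ) * θ i|
                ≤ ∑ i ∈ Finset.univ.erase k, |(v i : ℝ) * θ i| := Finset.abs_sum_le_sum_abs _ _
              _ ≤ ∑ i ∈ Finset.univ.erase k, (N : ℝ) * δ := by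
                  refine Finset.sum_le_sum fun i hi => ?_
                  rw [abs_mul]
                  refine mul_le_mul ?_ (h i (Finset.ne_of_mem_erase hi)).le (abs_nonneg _)
                    (by positivity)
                  have := abs_le.2 (hv.1 i)
                  exact_mod_cast this
              _ ≤ d * (N * δ) := by
                  rw [Finset.sum_const, nsmul_eq_mul]
                  gcongr
                  exact (Finset.card_le_univ _).trans (by simp)
              _ = N / 2 := by rw [hδ]; field_simp
          have h5 : |(v k : ℝ) * θ k| = N * |θ k| := by
            rw [abs_mul, hv.2]
            congr 1
            exact_mod_cast ha
          have h6 := abs_sub_abs_le_abs_add ((v k : ℝ) * θ k)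
            (∑ i ∈ Finset.univ.erase k, (v i : ℝ) * θ i)
          have h7 : (N:ℝ) * (3/4) ≤ N * |θ k| := by gcongr
          linarith
        rw [div_le_div_iff₀ (by positivity) (by positivity), ← sq_abs (∑ i, (v i : ℝ) * θ i)]
        have h4 : ((N:ℝ) / 4) ^ 2 ≤ |∑ i, (v i : ℝ) * θ i| ^ 2 := by gcongr
        nlinarith
      calc _ ≤ ∑ v ∈ face d N k a, 16 / (N:ℝ) ^ 2 := Finset.sum_le_sum hterm
        _ = (face d N k a).card * (16 / (N:ℝ) ^ 2) := by simp
        _ ≤ (3 * N : ℝ) ^ (d - 1) * (16 / (N:ℝ) ^ 2) := by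
            gcongr; exact card_face_le hN k a
        _ = (48 / N) * (3 * N : ℝ) ^ (d - 2) := by
            have : d - 1 = (d - 2) + 1 := by omega
            rw [this, pow_succ]; field_simp; norm_num
        _ ≤ _ := by
            gcongr
            have h8 : 48 / (N:ℝ) ≤ 48 := by rw [div_le_iff₀ (by positivity)]; linarith
            have h9 : 0 ≤ S * D := by positivity
            linarith
  have hSD : 0 ≤ S * D := by positivity
  refine ⟨d * (2 * (S * D + 48)) * 3 ^ (d - 2), by positivity, fun N hN θ hθ => ?_⟩
  have hpos : ∀ v : Fin d → ℤ, 0 ≤ 1 / (1 + (∑ i, (v i : ℝ) * θ i) ^ 2) := fun v => by positivity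
  calc ∑ v ∈ bdry d N, 1 / (1 + (∑ i, (v i : ℝ) * θ i) ^ 2)
      ≤ ∑ v ∈ Finset.univ.biUnion fun k => face d N k N ∪ face d N k (-N),
          1 / (1 + (∑ i, (v i : ℝ) * θ i) ^ 2) :=
        Finset.sum_le_sum_of_subset_of_nonneg (bdry_subset d N) fun v _ _ => hpos v
    _ ≤ ∑ k, ∑ v ∈ face d N k N ∪ face d N k (-N), 1 / (1 + (∑ i, (v i : ℝ) * θ i) ^ 2) :=
        sum_biUnion_le_sum _ _ hpos
    _ ≤ ∑ k : Fin d, 2 * ((S * D + 48) * (3 * N : ℝ) ^ (d - 2)) := by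
        refine Finset.sum_le_sum fun k _ => ?_
        have h1 := hface N hN θ hθ k N (by simp)
        have h2 := hface N hN θ hθ k (-N) (by simp)
        have h3 : ∑ v ∈ face d N k N ∪ face d N k (-N), 1 / (1 + (∑ i, (v i : ℝ) * θ i) ^ 2) ≤
            ∑ v ∈ face d N k N, 1 / (1 + (∑ i, (v i : ℝ) * θ i) ^ 2) +
            ∑ v ∈ face d N k (-N), 1 / (1 + (∑ i, (v i : ℝ) * θ i) ^ 2) := by
          rw [← Finset.sum_union_inter]
          exact le_add_of_nonneg_right (Finset.sum_nonneg fun v _ => hpos v)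
        linarith
    _ = _ := by simp [mul_pow]; ring

end Lattice

section Cones

variable {d : ℕ}

/-- Sup norm on `Rd d`. -/
def snorm (x : Rd d) : ℝ := ‖(fun i => x i : Fin d → ℝ)‖

theorem snorm_nonneg (x : Rd d) : 0 ≤ snorm x := norm_nonneg _

theorem abs_coord_le_snorm (x : Rd d) (i : Fin d) : |x i| ≤ snorm x :=
  norm_le_pi_norm (fun i => x i : Fin d → ℝ) i

theorem snorm_le_norm (x : Rd d) : snorm x ≤ ‖x‖ :=
  (pi_norm_le_iff_of_nonneg (norm_nonneg _)).2 fun i => PiLp.norm_apply_le x i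

theorem norm_le_of_abs_coord_le {x : Rd d} {C : ℝ} (hC : 0 ≤ C) (h : ∀ i, |x i| ≤ C) :
    ‖x‖ ≤ Real.sqrt d * C := by
  rw [EuclideanSpace.norm_eq, Real.sqrt_le_left (by positivity), mul_pow, Real.sq_sqrt (by positivity)]
  calc ∑ i, ‖x i‖ ^ 2 ≤ ∑ _i : Fin d, C ^ 2 :=
        Finset.sum_le_sum fun i _ => by gcongr; exact h i
    _ = _ := by simp

theorem norm_le_snorm (x : Rd d) : ‖x‖ ≤ Real.sqrt d * snorm x :=
  norm_le_of_abs_coord_le (snorm_nonneg x) (abs_coord_le_snorm x)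

theorem snorm_pos {x : Rd d} (hx : x ≠ 0) : 0 < snorm x := by
  refine (snorm_nonneg x).lt_of_ne fun h => hx ?_
  have := norm_le_snorm x
  rw [← h, mul_zero] at this
  exact norm_le_zero_iff.1 this

theorem continuous_snorm : Continuous (snorm (d := d)) :=
  continuous_norm.comp (PiLp.continuous_ofLp 2 _)

theorem snorm_smul {r : ℝ} (hr : 0 < r) (x : Rd d) : snorm (r • x) = r * snorm x := by
  unfold snorm
  have : (fun i => (r • x) i : Fin d → ℝ) = r • (fun i => x i : Fin d → ℝ) := by ext i; simp
  rw [this, norm_smul, Real.norm_of_nonneg hr.le]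

theorem exists_abs_coord_eq_snorm {x : Rd d} (hx : x ≠ 0) : ∃ k, |x k| = snorm x := by
  have : Nonempty (Fin d) := by
    by_contra h
    rw [not_nonempty_iff] at h
    exact hx (Subsingleton.elim _ _)
  obtain ⟨k, -, hk⟩ := Finset.exists_max_image Finset.univ (fun i => |x i|) Finset.univ_nonempty
  exact ⟨k, le_antisymm (abs_coord_le_snorm x k)
    ((pi_norm_le_iff_of_nonneg (abs_nonneg _)).2 fun i => hk i (Finset.mem_univ _))⟩

/-- The index of the cone that contains `x`. -/
def cell (N : ℕ) (x : Rd d) : Fin d → ℤ := fun i => ⌊(N : ℝ) * (x i / snorm x)⌋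

theorem measurable_cell (N : ℕ) : Measurable (cell (d := d) N) := by
  refine measurable_pi_lambda _ fun i => Int.measurable_floor.comp ?_
  have h : Measurable fun x : Rd d => x i := (by fun_prop : Continuous fun x : Rd d => x i).measurable
  exact (h.div continuous_snorm.measurable).const_mul _

theorem cell_smul (N : ℕ) {r : ℝ} (hr : 0 < r) (x : Rd d) : cell N (r • x) = cell N x := by
  ext i
  unfold cell
  rw [snorm_smul hr, PiLp.smul_apply, smul_eq_mul, mul_div_mul_left _ _ hr.ne']

theorem cell_mem_bdry {N : ℕ} {x : Rd d} (hx : x ≠ 0) : cell N x ∈ bdry d N := by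
  have h0 := snorm_pos hx
  simp only [bdry, Finset.mem_filter, Fintype.mem_piFinset, Finset.mem_Icc]
  constructor
  · intro i
    have h1 : |x i / snorm x| ≤ 1 := by
      rw [abs_div, abs_of_pos h0, div_le_one h0]; exact abs_coord_le_snorm x i
    obtain ⟨h2, h3⟩ := abs_le.1 h1
    constructor
    · apply Int.le_floor.2
      push_cast
      nlinarith [(Nat.cast_nonneg N : (0:ℝ) ≤ N)]
    · apply Int.floor_le_iff.2
      push_cast
      nlinarith [(Nat.cast_nonneg N : (0:ℝ) ≤ N)]
  · obtain ⟨k, hk⟩ := exists_abs_coord_eq_snorm hx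
    refine ⟨k, ?_⟩
    unfold cell
    rcases abs_choice (x k) with h | h
    · have : x k / snorm x = 1 := by rw [← hk, h]; exact div_self (by rw [← h, hk]; exact h0.ne')
      rw [this, mul_one, Int.floor_natCast]; simp
    · have h' : x k = - snorm x := by rw [← hk, h]; ring
      have : x k / snorm x = -1 := by rw [h', neg_div, div_self h0.ne']
      rw [this]
      have : (N:ℝ) * (-1) = ((-(N:ℤ) : ℤ) : ℝ) := by push_cast; ring
      rw [this, Int.floor_intCast]; simp

/-- The direction of the cone with index `v`. -/
def cdir (N : ℕ) (v : Fin d → ℤ) : Rd d := WithLp.toLp 2 fun i => (v i : ℝ) / N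

theorem cdir_apply (N : ℕ) (v : Fin d → ℤ) (i : Fin d) : cdir N v i = (v i : ℝ) / N := rfl

theorem norm_cdir_le {N : ℕ} (hN : 1 ≤ N) {v : Fin d → ℤ} (hv : v ∈ bdry d N) :
    ‖cdir N v‖ ≤ Real.sqrt d := by
  have hN1 : (1:ℝ) ≤ N := by exact_mod_cast hN
  rw [← mul_one (Real.sqrt d)]
  refine norm_le_of_abs_coord_le zero_le_one fun i => ?_
  simp only [bdry, Finset.mem_filter, Fintype.mem_piFinset, Finset.mem_Icc] at hv
  rw [cdir_apply, abs_div, Nat.abs_cast, div_le_one (by positivity)]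
  have := abs_le.2 (hv.1 i)
  have h : ((|v i| : ℤ) : ℝ) ≤ ((N : ℤ) : ℝ) := Int.cast_le.2 this
  simpa using h

theorem abs_cdir_sub_le {N : ℕ} (hN : 1 ≤ N) (x : Rd d) (i : Fin d) :
    |cdir N (cell N x) i - x i / snorm x| ≤ 1 / N := by
  have hN1 : (1:ℝ) ≤ N := by exact_mod_cast hN
  have h1 := Int.floor_le ((N:ℝ) * (x i / snorm x))
  have h2 := Int.lt_floor_add_one ((N:ℝ) * (x i / snorm x))
  have h3 : cdir N (cell N x) i - x i / snorm x =
      ((⌊(N:ℝ) * (x i / snorm x)⌋ : ℝ) - (N:ℝ) * (x i / snorm x)) / N := by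
    rw [cdir_apply, cell]; field_simp
  rw [h3, abs_div, Nat.abs_cast]
  gcongr
  rw [abs_le]; constructor <;> linarith

/-- Conic pieces of the truncated kernel. -/
theorem exists_cone_decomp {P Ψ : Rd d → ℝ} {B : ℝ} (hP : Prof d P Ψ B) {N : ℕ} (hN : 1 ≤ N)
    {Om : Rd d → ℝ} (hm : Measurable Om) {A : ℝ} (hA : ∀ x, |Om x| ≤ A) (hom : Homogeneous0 d Om) :
    ∃ (K KΨ : (Fin d → ℤ) → Rd d → ℝ) (Kμ : (Fin d → ℤ) → Fin d → Rd d → ℝ),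
      (∀ x, kOm P Om x = ∑ v ∈ bdry d N, K v x) ∧
      ∀ v, Nice (K v) ∧ Nice (KΨ v) ∧ (∀ μ, Nice (Kμ v μ)) ∧
        (∀ x, |K v x| ≤ A * B) ∧ (∀ x, |KΨ v x| ≤ Real.sqrt d * (A * B)) ∧
        (∀ μ x, |Kμ v μ x| ≤ A * B / N) ∧
        (∀ x, K v x ≠ 0 → ∃ t : ℝ, 0 ≤ t ∧ t ≤ 1 ∧ ‖x - t • cdir N v‖ ≤ Real.sqrt d / N) ∧
        (∀ x, KΨ v x ≠ 0 → ∃ t : ℝ, 0 ≤ t ∧ t ≤ 1 ∧ ‖x - t • cdir N v‖ ≤ Real.sqrt d / N) ∧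
        (∀ μ x, Kμ v μ x ≠ 0 → ∃ t : ℝ, 0 ≤ t ∧ t ≤ 1 ∧ ‖x - t • cdir N v‖ ≤ Real.sqrt d / N) ∧
        ∀ ξ : Rd d, 2 * Real.pi * Complex.I * ((∑ i, cdir N v i * ξ i : ℝ) : ℂ) * ftr (K v) ξ
          = ftr (KΨ v) ξ + ∑ μ, 2 * Real.pi * Complex.I * (ξ μ : ℂ) * ftr (Kμ v μ) ξ := by
  classical
  have hN1 : (1:ℝ) ≤ N := by exact_mod_cast hN
  have hB := hP.B_nonneg
  have hA0 : 0 ≤ A := (abs_nonneg _).trans (hA 0)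
  have hEm : ∀ v, MeasurableSet {x : Rd d | cell N x = v} := fun v =>
    measurable_cell N (measurableSet_singleton v)
  set Omv : (Fin d → ℤ) → Rd d → ℝ := fun v => {x : Rd d | cell N x = v}.indicator Om with hOmv
  have hOm_meas : ∀ v, Measurable (Omv v) := fun v => hm.indicator (hEm v)
  have hOm_le : ∀ v x, |Omv v x| ≤ A := fun v x => by
    by_cases h : cell N x = v
    · rw [hOmv]; simp only [Set.indicator, Set.mem_ofPred_eq, if_pos h]; exact hA x
    · rw [hOmv]; simp only [Set.indicator, Set.mem_ofPred_eq, if_neg h, abs_zero]; exact hA0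
  have hOm_cell : ∀ v x, Omv v x ≠ 0 → cell N x = v := fun v x h => by
    by_contra h'
    exact h (by rw [hOmv]; simp only [Set.indicator, Set.mem_ofPred_eq, if_neg h'])
  have hOm_hom : ∀ v, Homogeneous0 d (Omv v) := fun v x hx r hr => by
    rw [hOmv]; simp only [Set.indicator, Set.mem_ofPred_eq, cell_smul N hr, hom x hx r hr]; congr
  have htube : ∀ v x, Omv v x ≠ 0 → ‖x‖ < 1 / 4 →
      ∃ t : ℝ, 0 ≤ t ∧ t ≤ 1 ∧ ‖x - t • cdir N v‖ ≤ Real.sqrt d / N := by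
    intro v x hv hx
    have hs := snorm_le_norm x
    refine ⟨snorm x, snorm_nonneg x, by linarith, ?_⟩
    rw [div_eq_mul_one_div]
    refine norm_le_of_abs_coord_le (by positivity) fun i => ?_
    rw [← hOm_cell v x hv]
    by_cases hx0 : x = 0
    · subst hx0
      have : snorm (0 : Rd d) = 0 := by
        refine le_antisymm ((snorm_le_norm _).trans_eq norm_zero) (snorm_nonneg _)
      rw [this]; simp
    · have h0 := snorm_pos hx0
      have : (x - snorm x • cdir N (cell N x)) i =
          - (snorm x * (cdir N (cell N x) i - x i / snorm x)) := by
        simp only [PiLp.sub_apply, PiLp.smul_apply, smul_eq_mul]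
        field_simp; ring
      rw [this, abs_neg, abs_mul, abs_of_pos h0]
      have := abs_cdir_sub_le hN x i
      calc _ ≤ 1 * (1 / (N:ℝ)) := by gcongr; linarith
        _ = _ := one_mul _
  set w : Fin d → Rd d → ℝ := fun i x => x i / snorm x with hw
  have hw_meas : ∀ i, Measurable (w i) := fun i =>
    ((by fun_prop : Continuous fun x : Rd d => x i).measurable).div continuous_snorm.measurable
  set M : (Fin d → ℤ) → Rd d → ℝ := fun v x => Omv v x * (‖x‖ / snorm x) with hMdef
  have hM_meas : ∀ v, Measurable (M v) := fun v =>
    (hOm_meas v).mul (measurable_norm.div continuous_snorm.measurable)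
  have hM_le : ∀ v x, |M v x| ≤ Real.sqrt d * A := by
    intro v x
    rw [hMdef]
    simp only [abs_mul]
    rw [mul_comm]
    refine mul_le_mul ?_ (hOm_le v x) (abs_nonneg _) (by positivity)
    rw [abs_div, abs_norm, abs_of_nonneg (snorm_nonneg x)]
    by_cases hx0 : x = 0
    · subst hx0; simp
    · rw [div_le_iff₀ (snorm_pos hx0)]; exact norm_le_snorm x
  have hM_hom : ∀ v, Homogeneous0 d (M v) := fun v x hx r hr => by
    simp only [hMdef]
    rw [hOm_hom v x hx r hr, snorm_smul hr, norm_smul, Real.norm_of_nonneg hr.le,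
      mul_div_mul_left _ _ hr.ne']
  have hKb : ∀ v μ x, |kOm P (Omv v) x * (cdir N v μ - w μ x)| ≤ A * B / N := by
    intro v μ x
    by_cases h : Omv v x = 0
    · have : kOm P (Omv v) x = 0 := by simp [kOm, h]
      rw [this, zero_mul, abs_zero]; positivity
    · have h1 := abs_cdir_sub_le hN x μ
      rw [hOm_cell v x h] at h1
      rw [abs_mul, div_eq_mul_one_div]
      refine mul_le_mul ((hP.abs_kOm_le _ x).trans ?_) h1 (abs_nonneg _) (by positivity)
      exact mul_le_mul_of_nonneg_right (hOm_le v x) hB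
  have hKn : ∀ v μ, Nice (fun x => kOm P (Omv v) x * (cdir N v μ - w μ x)) := by
    intro v μ
    refine Nice.of_bounded_support (C := A * B / N) (R := 1)
      ((hP.measurable_kOm (hOm_meas v)).mul ((hw_meas μ).const_sub _)) (hKb v μ) ?_
    intro x hx
    have hx' : kOm P (Omv v) x * (cdir N v μ - w μ x) ≠ 0 := hx
    linarith [(hP.kOm_supp (left_ne_zero_of_mul hx')).2]
  refine ⟨fun v => kOm P (Omv v), fun v x => M v x * Ψ x,
    fun v μ x => kOm P (Omv v) x * (cdir N v μ - w μ x), ?_, fun v => ⟨?_, ?_, ?_, ?_, ?_, ?_, ?_,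
      ?_, ?_, ?_⟩⟩
  · intro x
    by_cases hx : x = 0
    · subst hx; simp [kOm]
    · simp only [kOm, ← Finset.sum_mul]
      congr 1
      rw [Finset.sum_eq_single (cell N x)]
      · simp [hOmv]
      · intro v _ hv
        by_contra h
        exact hv (hOm_cell v x h).symm
      · intro h; exact absurd (cell_mem_bdry hx) h
  · exact hP.nice_kOm (hOm_meas v) (hOm_le v)
  · exact hP.nice_mul (hM_meas v) (hM_le v)
  · exact hKn v
  · intro x
    exact (hP.abs_kOm_le _ x).trans (mul_le_mul_of_nonneg_right (hOm_le v x) hB)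
  · intro x
    rw [abs_mul, ← mul_assoc]
    exact mul_le_mul (hM_le v x) (hP.bddΨ x) (abs_nonneg _) (by positivity)
  · exact hKb v
  · intro x hx
    exact htube v x (left_ne_zero_of_mul hx) (hP.kOm_supp hx).2
  · intro x hx
    exact htube v x (left_ne_zero_of_mul (left_ne_zero_of_mul hx))
      (hP.suppΨ x (right_ne_zero_of_mul hx)).2
  · intro μ x hx
    exact htube v x (left_ne_zero_of_mul (left_ne_zero_of_mul hx))
      (hP.kOm_supp (left_ne_zero_of_mul hx)).2
  · intro ξ
    have hK : Nice (kOm P (Omv v)) := hP.nice_kOm (hOm_meas v) (hOm_le v)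
    have hKμ := fun μ => (hKn v μ).int
    rw [← hP.rip (M v) _ (hM_meas v) (hM_le v) (hM_hom v) ξ]
    have key : (fun x => M v x * P x * inner ℝ x ξ) = fun x =>
        (∑ i, cdir N v i * ξ i) * kOm P (Omv v) x -
          ∑ μ, ξ μ * (kOm P (Omv v) x * (cdir N v μ - w μ x)) := by
      ext x
      rw [inner_eq_sum_coord, Finset.sum_mul, ← Finset.sum_sub_distrib, Finset.mul_sum]
      refine Finset.sum_congr rfl fun i _ => ?_
      simp only [hMdef, hw, kOm]
      ring
    rw [key, ftr_sub (hK.int.const_mul _) (integrable_finsetSum _ fun μ _ => (hKμ μ).const_mul _),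
      ftr_const_mul, ftr_sum (fun μ _ => (hKμ μ).const_mul _)]
    have e : ∀ μ, ftr (fun x => ξ μ * (kOm P (Omv v) x * (cdir N v μ - w μ x))) ξ =
        ξ μ * ftr (fun x => kOm P (Omv v) x * (cdir N v μ - w μ x)) ξ :=
      fun μ => ftr_const_mul _ _ _
    simp only [e]
    rw [mul_sub, Finset.mul_sum]
    rw [sub_add_eq_add_sub, eq_sub_iff_add_eq]
    congr 1
    · ring
    · refine Finset.sum_congr rfl fun μ _ => by ring

end Cones

section MicroLocal

variable {d : ℕ}

theorem sqR_add_le {f g : Rd d → ℝ} (hf : Measurable f) :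
    sqR (fun x => f x + g x) ≤ 2 * sqR f + 2 * sqR g := by
  unfold sqR
  rw [← lintegral_const_mul _ (by fun_prop), ← lintegral_const_mul' _ _ (by norm_num),
    ← lintegral_add_left (by fun_prop)]
  refine lintegral_mono fun x => ?_
  have h2 : (2 : ℝ≥0∞) = ENNReal.ofReal 2 := by norm_num
  rw [h2, ← ENNReal.ofReal_mul (by norm_num), ← ENNReal.ofReal_mul (by norm_num),
    ← ENNReal.ofReal_add (by positivity) (by positivity)]
  exact ENNReal.ofReal_le_ofReal (by nlinarith [sq_nonneg (f x - g x)])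

theorem norm_sq_sum_bdry_le {N : ℕ} (hN : 1 ≤ N) {W : ℝ} (hW0 : 0 ≤ W)
    (hW : ∀ θ : Rd d, ‖θ‖ = 1 → ∑ v ∈ bdry d N, 1 / (1 + (∑ i, (v i : ℝ) * θ i) ^ 2) ≤ W)
    {F : (Fin d → ℤ) → ℂ} {G : (Fin d → ℤ) → Fin d → ℂ} {ξ : Rd d}
    (h0 : ξ = 0 → ∀ v, F v = 0)
    (hFG : ∀ v, 2 * Real.pi * Complex.I * ((∑ i, cdir N v i * ξ i : ℝ) : ℂ) * F v =
      ∑ μ, 2 * Real.pi * Complex.I * (ξ μ : ℂ) * G v μ) :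
    ‖∑ v ∈ bdry d N, F v‖ ^ 2 ≤
      W * ∑ v ∈ bdry d N, (‖F v‖ ^ 2 + d * N ^ 2 * ∑ μ, ‖G v μ‖ ^ 2) := by
  by_cases hξ : ξ = 0
  · simp only [h0 hξ]
    simp only [Finset.sum_const_zero, norm_zero]
    have : (0:ℝ) ^ 2 = 0 := by norm_num
    rw [this]
    positivity
  have hN0 : (0:ℝ) < N := by exact_mod_cast hN
  have hξ0 : 0 < ‖ξ‖ := norm_pos_iff.2 hξ
  set θ : Rd d := ‖ξ‖⁻¹ • ξ with hθ
  have hθ1 : ‖θ‖ = 1 := norm_smul_inv_norm hξ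
  set a : (Fin d → ℤ) → ℝ := fun v => (∑ i, (v i : ℝ) * θ i) with ha
  have key : ∀ v, a v ^ 2 * ‖F v‖ ^ 2 ≤ d * N ^ 2 * ∑ μ, ‖G v μ‖ ^ 2 := by
    intro v
    have h1 : ((∑ i, cdir N v i * ξ i : ℝ) : ℂ) * F v = ∑ μ, (ξ μ : ℂ) * G v μ := by
      have h2 := hFG v
      have h3 : (2 * Real.pi * Complex.I : ℂ) ≠ 0 := by
        simp [Real.pi_ne_zero]
      apply mul_left_cancel₀ h3
      rw [← mul_assoc, h2, Finset.mul_sum]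
      exact Finset.sum_congr rfl fun μ _ => by ring
    have h4 : (∑ i, cdir N v i * ξ i : ℝ) = ‖ξ‖ / N * a v := by
      rw [ha, Finset.mul_sum]
      refine Finset.sum_congr rfl fun i _ => ?_
      rw [cdir_apply, hθ, PiLp.smul_apply, smul_eq_mul]
      field_simp
    have h5 : ‖ξ‖ / N * |a v| * ‖F v‖ ≤ ‖ξ‖ * ∑ μ, ‖G v μ‖ := by
      calc ‖ξ‖ / N * |a v| * ‖F v‖ = ‖((∑ i, cdir N v i * ξ i : ℝ) : ℂ) * F v‖ := by
            rw [norm_mul, Complex.norm_real, Real.norm_eq_abs, h4, abs_mul,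
              abs_of_nonneg (by positivity : 0 ≤ ‖ξ‖ / N)]
        _ ≤ ∑ μ, ‖(ξ μ : ℂ) * G v μ‖ := by rw [h1]; exact norm_sum_le _ _
        _ ≤ ∑ μ, ‖ξ‖ * ‖G v μ‖ := by
            refine Finset.sum_le_sum fun μ _ => ?_
            rw [norm_mul, Complex.norm_real]
            gcongr
            exact PiLp.norm_apply_le ξ μ
        _ = _ := by rw [Finset.mul_sum]
    have h6 : |a v| * ‖F v‖ ≤ N * ∑ μ, ‖G v μ‖ := by
      have : ‖ξ‖ / N * |a v| * ‖F v‖ = (‖ξ‖ / N) * (|a v| * ‖F v‖) := by ring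
      rw [this, div_mul_eq_mul_div, div_le_iff₀ hN0, mul_assoc] at h5
      have := le_of_mul_le_mul_left h5 hξ0
      linarith
    have h7 : (∑ μ, ‖G v μ‖) ^ 2 ≤ d * ∑ μ, ‖G v μ‖ ^ 2 := by
      have := sq_sum_le_card_mul_sum_sq (s := (Finset.univ : Finset (Fin d))) (f := fun μ => ‖G v μ‖)
      simpa using this
    calc a v ^ 2 * ‖F v‖ ^ 2 = (|a v| * ‖F v‖) ^ 2 := by rw [mul_pow, sq_abs]
      _ ≤ (N * ∑ μ, ‖G v μ‖) ^ 2 := by gcongr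
      _ = N ^ 2 * (∑ μ, ‖G v μ‖) ^ 2 := by ring
      _ ≤ N ^ 2 * (d * ∑ μ, ‖G v μ‖ ^ 2) := by gcongr
      _ = _ := by ring
  calc ‖∑ v ∈ bdry d N, F v‖ ^ 2 ≤ (∑ v ∈ bdry d N, ‖F v‖) ^ 2 := by
        gcongr; exact norm_sum_le _ _
    _ ≤ (∑ v ∈ bdry d N, 1 / (1 + a v ^ 2)) * ∑ v ∈ bdry d N, (1 + a v ^ 2) * ‖F v‖ ^ 2 := by
        apply Finset.sum_sq_le_sum_mul_sum_of_sq_le_mul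
        · intro v _; positivity
        · intro v _; positivity
        · intro v _
          have : 0 < 1 + a v ^ 2 := by positivity
          apply le_of_eq
          field_simp
    _ ≤ W * ∑ v ∈ bdry d N, (‖F v‖ ^ 2 + d * N ^ 2 * ∑ μ, ‖G v μ‖ ^ 2) := by
        refine mul_le_mul (hW θ hθ1) (Finset.sum_le_sum fun v _ => ?_)
          (Finset.sum_nonneg fun v _ => by positivity) hW0
        linarith [key v]

/-- Integrated version of `norm_sq_sum_bdry_le`. -/
theorem sqR_sum_bdry_le {N : ℕ} (hN : 1 ≤ N) {W : ℝ} (hW0 : 0 ≤ W)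
    (hW : ∀ θ : Rd d, ‖θ‖ = 1 → ∑ v ∈ bdry d N, 1 / (1 + (∑ i, (v i : ℝ) * θ i) ^ 2) ≤ W)
    {F : (Fin d → ℤ) → Rd d → ℝ} {G : (Fin d → ℤ) → Fin d → Rd d → ℝ}
    (hF : ∀ v, Nice (F v)) (hG : ∀ v μ, Nice (G v μ))
    (h0 : ∀ v, ftr (F v) 0 = 0)
    (hFG : ∀ v ξ, 2 * Real.pi * Complex.I * ((∑ i, cdir N v i * ξ i : ℝ) : ℂ) * ftr (F v) ξ =
      ∑ μ, 2 * Real.pi * Complex.I * (ξ μ : ℂ) * ftr (G v μ) ξ) :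
    sqR (fun x => ∑ v ∈ bdry d N, F v x) ≤
      ENNReal.ofReal W * ∑ v ∈ bdry d N,
        (sqR (F v) + ENNReal.ofReal (d * N ^ 2) * ∑ μ, sqR (G v μ)) := by
  rw [← sqC_ftr (Nice.sum fun v _ => hF v)]
  have hmF : ∀ v, Measurable fun ξ => ENNReal.ofReal (‖ftr (F v) ξ‖ ^ 2) := fun v =>
    ((continuous_ftr (hF v).int).norm.pow 2).measurable.ennreal_ofReal
  have hmG : ∀ v μ, Measurable fun ξ => ENNReal.ofReal (‖ftr (G v μ) ξ‖ ^ 2) := fun v μ =>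
    ((continuous_ftr (hG v μ).int).norm.pow 2).measurable.ennreal_ofReal
  calc sqC (ftr fun x => ∑ v ∈ bdry d N, F v x)
      ≤ ∫⁻ ξ, ENNReal.ofReal W * ∑ v ∈ bdry d N, (ENNReal.ofReal (‖ftr (F v) ξ‖ ^ 2) +
          ENNReal.ofReal (d * N ^ 2) * ∑ μ, ENNReal.ofReal (‖ftr (G v μ) ξ‖ ^ 2)) := by
        refine lintegral_mono fun ξ => ?_
        have h1 := norm_sq_sum_bdry_le hN hW0 hW (F := fun v => ftr (F v) ξ)
          (G := fun v μ => ftr (G v μ) ξ) (ξ := ξ) (fun h v => by rw [h]; exact h0 v)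
          (fun v => hFG v ξ)
        rw [ftr_sum (fun v _ => (hF v).int)]
        refine (ENNReal.ofReal_le_ofReal h1).trans (le_of_eq ?_)
        rw [ENNReal.ofReal_mul hW0, ENNReal.ofReal_sum_of_nonneg (fun v _ => by positivity)]
        congr 1
        refine Finset.sum_congr rfl fun v _ => ?_
        rw [ENNReal.ofReal_add (by positivity) (by positivity), ENNReal.ofReal_mul (by positivity),
          ENNReal.ofReal_sum_of_nonneg (fun μ _ => by positivity)]
    _ = _ := by
        have hsum : ∀ v ∈ bdry d N, Measurable fun ξ => ENNReal.ofReal (‖ftr (F v) ξ‖ ^ 2) +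
            ENNReal.ofReal (d * N ^ 2) * ∑ μ, ENNReal.ofReal (‖ftr (G v μ) ξ‖ ^ 2) := fun v _ =>
          (hmF v).add ((Finset.measurable_fun_sum _ fun μ _ => hmG v μ).const_mul _)
        rw [lintegral_const_mul' _ _ ENNReal.ofReal_ne_top,
          lintegral_finsetSum _ hsum]
        congr 1
        refine Finset.sum_congr rfl fun v _ => ?_
        rw [lintegral_add_left (hmF v), lintegral_const_mul' _ _ ENNReal.ofReal_ne_top,
          lintegral_finsetSum _ fun μ _ => hmG v μ, ← sqC_ftr (hF v)]
        congr 2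
        exact Finset.sum_congr rfl fun μ _ => (sqC_ftr (hG v μ))

end MicroLocal

section MicroLocalMain

variable {d : ℕ}

theorem dil_sum {ι : Type*} (s : Finset ι) (f : ι → Rd d → ℝ) (j : ℤ) :
    dil j (fun x => ∑ i ∈ s, f i x) = fun x => ∑ i ∈ s, dil j (f i) x := by
  ext x
  unfold dil
  rw [Finset.mul_sum]

/-- The `L²` estimate for `∑ Kₘ₊q * b` with gain `2⁻ᵐ`. -/
theorem exists_sqR_sum_cv_le (hd : 2 ≤ d) {P Ψ : Rd d → ℝ} {B : ℝ} (hP : Prof d P Ψ B) (hB : 0 < B)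
    {ρ : ℝ} (hρ : 0 ≤ ρ) {ι : Type*} :
    ∃ C : ℝ, 0 < C ∧ ∀ (m : ℕ) (s : Finset ι) (q : ι → ℤ) (Q : ι → Set (Rd d)) (c : ι → Rd d),
      Fam s q Q c ρ → ∀ (Om : Rd d → ℝ) (A : ℝ), Measurable Om → (∀ x, |Om x| ≤ A) →
      Homogeneous0 d Om → ∀ b : ι → Rd d → ℝ, (∀ i ∈ s, Nice (b i)) → (∀ i ∈ s, ∫ x, b i x = 0) →
      (∀ i ∈ s, ∀ x, b i x ≠ 0 → x ∈ closedBall (c i) (ρ * (2:ℝ) ^ q i)) → ∀ β : ℝ≥0∞,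
      (∀ i ∈ s, ∫⁻ x, ‖b i x‖ₑ ≤ β * volume (Q i)) →
      sqR (fun x => ∑ i ∈ s, cv (dil (q i + m) (kOm P Om)) (b i) x) ≤
        ENNReal.ofReal (C * A ^ 2 / 2 ^ m) * (β * ∑ i ∈ s, ∫⁻ x, ‖b i x‖ₑ) := by
  obtain ⟨W, hW0, hW⟩ := exists_sum_bdry_le hd
  set κ : ℝ := 2 * Real.sqrt d + 2 * ρ + Real.sqrt d with hκ
  have hd0 : (0:ℝ) < d := by exact_mod_cast (by omega : 0 < d)
  have hκ0 : 0 ≤ κ := by positivity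
  refine ⟨W * (2 * d * 3 ^ (d - 1)) * (2 * B ^ 2 * (3 * (κ ^ d * vb d 1)) ^ 2 *
    (1 + 2 * d ^ 2 * (d * ρ ^ 2 + 1))) + 1, by have := vb_nonneg (d := d) 1; positivity, ?_⟩
  intro m s q Q c hFam Om A hOm hA hom b hb hb0 hbs β hβ
  have hA0 : 0 ≤ A := (abs_nonneg _).trans (hA 0)
  set N : ℕ := 2 ^ m with hN
  have hN1 : 1 ≤ N := Nat.one_le_two_pow
  have hNR : (N:ℝ) = 2 ^ m := by rw [hN]; push_cast; rfl
  obtain ⟨K, KΨ, Kμ, hsum, hK⟩ := exists_cone_decomp hP hN1 hOm hA hom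
  have hex := fun i (hi : i ∈ s) => exists_potential (hb i hi) (hbs i hi) (hb0 i hi)
  choose! h hhI hhs hhb hhf using hex
  set F : (Fin d → ℤ) → Rd d → ℝ := fun v x => ∑ i ∈ s, cv (dil (q i + m) (K v)) (b i) x with hF
  set h' : ι → Fin d → Rd d → ℝ := fun i μ y => (2:ℝ) ^ (-(q i + (m:ℤ))) * h i μ y with hh'
  set G1 : (Fin d → ℤ) → Fin d → Rd d → ℝ := fun v μ x =>
    ∑ i ∈ s, cv (dil (q i + m) (KΨ v)) (h' i μ) x with hG1
  set G2 : (Fin d → ℤ) → Fin d → Rd d → ℝ := fun v μ x =>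
    ∑ i ∈ s, cv (dil (q i + m) (Kμ v μ)) (b i) x with hG2
  have hh'I : ∀ i ∈ s, ∀ μ, IM (h' i μ) := fun i hi μ => (hhI i hi μ).const_mul _
  have nK : ∀ v, Nice (K v) := fun v => (hK v).1
  have nKΨ : ∀ v, Nice (KΨ v) := fun v => (hK v).2.1
  have nKμ : ∀ v μ, Nice (Kμ v μ) := fun v => (hK v).2.2.1
  have nF : ∀ v, Nice (F v) := fun v =>
    Nice.sum fun i hi => Nice.cv_left ((nK v).dil _) (hb i hi).toIM
  have nG1 : ∀ v μ, Nice (G1 v μ) := fun v μ =>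
    Nice.sum fun i hi => Nice.cv_left ((nKΨ v).dil _) (hh'I i hi μ)
  have nG2 : ∀ v μ, Nice (G2 v μ) := fun v μ =>
    Nice.sum fun i hi => Nice.cv_left ((nKμ v μ).dil _) (hb i hi).toIM
  have fF : ∀ v ξ, ftr (F v) ξ = ∑ i ∈ s, ftr (K v) ((2:ℝ) ^ (q i + (m:ℤ)) • ξ) * ftr (b i) ξ := by
    intro v ξ
    rw [hF, ftr_sum fun i hi => (Nice.cv_left ((nK v).dil _) (hb i hi).toIM).int]
    exact Finset.sum_congr rfl fun i hi => by
      rw [ftr_cv ((nK v).dil _).int (hb i hi).int, ftr_dil]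
  have hrepr : (fun x => ∑ i ∈ s, cv (dil (q i + m) (kOm P Om)) (b i) x) =
      fun x => ∑ v ∈ bdry d N, F v x := by
    ext x
    have e1 : kOm P Om = fun x => ∑ v ∈ bdry d N, K v x := funext hsum
    rw [hF, Finset.sum_comm]
    refine Finset.sum_congr rfl fun i hi => ?_
    rw [e1, dil_sum, cv_sum_left (fun v _ => ((nK v).dil _).int) (hb i hi)]
  rw [hrepr]
  refine (sqR_sum_bdry_le hN1 (W := W * (N:ℝ) ^ (d - 2)) (by positivity) (hW N hN1) nF
    (G := fun v μ x => G1 v μ x + G2 v μ x) (fun v μ => (nG1 v μ).add (nG2 v μ)) ?_ ?_).trans ?_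
  · intro v
    rw [fF]
    refine Finset.sum_eq_zero fun i hi => ?_
    rw [hhf i hi]
    simp
  · intro v ξ
    have e : ∀ μ, ftr (fun x => G1 v μ x + G2 v μ x) ξ = ∑ i ∈ s,
        (((2:ℝ) ^ (-(q i + (m:ℤ))) : ℝ) * ftr (KΨ v) ((2:ℝ) ^ (q i + (m:ℤ)) • ξ) * ftr (h i μ) ξ +
          ftr (Kμ v μ) ((2:ℝ) ^ (q i + (m:ℤ)) • ξ) * ftr (b i) ξ) := by
      intro μ
      rw [ftr_add (nG1 v μ).int (nG2 v μ).int, hG1, hG2,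
        ftr_sum fun i hi => (Nice.cv_left ((nKΨ v).dil _) (hh'I i hi μ)).int,
        ftr_sum fun i hi => (Nice.cv_left ((nKμ v μ).dil _) (hb i hi).toIM).int,
        ← Finset.sum_add_distrib]
      refine Finset.sum_congr rfl fun i hi => ?_
      rw [ftr_cv ((nKΨ v).dil _).int (hh'I i hi μ).int, ftr_cv ((nKμ v μ).dil _).int (hb i hi).int,
        ftr_dil, ftr_dil, hh']
      simp only
      rw [ftr_const_mul]
      ring
    simp only [e, fF, Finset.mul_sum]
    rw [Finset.sum_comm]
    refine Finset.sum_congr rfl fun i hi => ?_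
    set η := (2:ℝ) ^ (q i + (m:ℤ)) • ξ with hη
    have hpow : (2:ℝ) ^ (q i + (m:ℤ)) ≠ 0 := by positivity
    have hid := (hK v).2.2.2.2.2.2.2.2.2 η
    have e2 : ∀ μ, ((η μ : ℝ) : ℂ) = (((2:ℝ) ^ (q i + (m:ℤ)) : ℝ) : ℂ) * (ξ μ : ℂ) := fun μ => by
      rw [hη, PiLp.smul_apply, smul_eq_mul]; push_cast; rfl
    have e3 : ((∑ i, cdir N v i * η i : ℝ) : ℂ) = (((2:ℝ) ^ (q i + (m:ℤ)) : ℝ) : ℂ) *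
        ((∑ i, cdir N v i * ξ i : ℝ) : ℂ) := by
      rw [← Complex.ofReal_mul, Finset.mul_sum]
      congr 1
      refine Finset.sum_congr rfl fun μ _ => ?_
      rw [hη, PiLp.smul_apply, smul_eq_mul]; ring
    rw [e3] at hid
    simp only [e2] at hid
    set p : ℂ := (((2:ℝ) ^ (q i + (m:ℤ)) : ℝ) : ℂ) with hp
    have hp0 : p ≠ 0 := by rw [hp]; exact_mod_cast hpow
    have e4 : (((2:ℝ) ^ (-(q i + (m:ℤ))) : ℝ) : ℂ) = p⁻¹ := by
      rw [hp, zpow_neg, Complex.ofReal_inv]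
    rw [e4]
    have e5 : 2 * Real.pi * Complex.I * ((∑ i, cdir N v i * ξ i : ℝ) : ℂ) * ftr (K v) η =
        p⁻¹ * ftr (KΨ v) η + ∑ μ, 2 * Real.pi * Complex.I * (ξ μ : ℂ) * ftr (Kμ v μ) η := by
      have e6 : 2 * Real.pi * Complex.I * ((∑ i, cdir N v i * ξ i : ℝ) : ℂ) * ftr (K v) η =
        p⁻¹ * (2 * Real.pi * Complex.I * (p * ((∑ i, cdir N v i * ξ i : ℝ) : ℂ)) * ftr (K v) η) := by
        field_simp
      rw [e6, hid, mul_add, Finset.mul_sum]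
      congr 1
      refine Finset.sum_congr rfl fun μ _ => ?_
      field_simp
    rw [← mul_assoc, e5, add_mul, Finset.sum_mul]
    simp only [mul_add, Finset.sum_add_distrib]
    congr 1
    · rw [hhf i hi, Finset.mul_sum]
      exact Finset.sum_congr rfl fun μ _ => by ring
    · exact Finset.sum_congr rfl fun μ _ => by ring
  · set S := ∑ i ∈ s, ∫⁻ x, ‖b i x‖ₑ with hS
    set τ : ℝ := 3 * 2 ^ m * ((κ / 2 ^ m) ^ d * vb d 1) with hτ
    have hτ0 : 0 ≤ τ := by have := vb_nonneg (d := d) 1; positivity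
    have bF : ∀ v ∈ bdry d N, sqR (F v) ≤ ENNReal.ofReal (2 * (A * B) ^ 2 * τ ^ 2) * (β * S) := by
      intro v hv
      have := sqR_sum_cv_le_of_tube hFam m (Real.sqrt_nonneg d) (norm_cdir_le hN1 hv) (nK v).meas
        (hK v).2.2.2.1 (hNR ▸ (hK v).2.2.2.2.2.2.1) (fun i hi => (hb i hi).meas) hbs hβ
      rw [mul_assoc] at this
      exact this
    have bh : ∀ i ∈ s, ∀ μ, ∫⁻ x, ‖h' i μ x‖ₑ ≤ ENNReal.ofReal (ρ / N) * ∫⁻ x, ‖b i x‖ₑ := by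
      intro i hi μ
      have e1 : ∫⁻ x, ‖h' i μ x‖ₑ =
          ENNReal.ofReal ((2:ℝ) ^ (-(q i + (m:ℤ)))) * ∫⁻ x, ‖h i μ x‖ₑ := by
        rw [← lintegral_const_mul' _ _ ENNReal.ofReal_ne_top]
        congr 1; ext x
        rw [hh']
        simp only
        rw [enorm_mul, Real.enorm_of_nonneg (by positivity)]
      rw [e1]
      refine (mul_le_mul_right (hhb i hi μ) _).trans (le_of_eq ?_)
      rw [← mul_assoc, ← ENNReal.ofReal_mul (by positivity)]
      congr 2
      rw [hNR, neg_add, zpow_add₀ (by norm_num), zpow_neg, zpow_neg, zpow_natCast]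
      field_simp
    have bG1 : ∀ v ∈ bdry d N, ∀ μ, sqR (G1 v μ) ≤
        ENNReal.ofReal (2 * (Real.sqrt d * (A * B)) ^ 2 * τ ^ 2 * (ρ / N) ^ 2) * (β * S) := by
      intro v hv μ
      have : sqR (G1 v μ) ≤ ENNReal.ofReal (2 * (Real.sqrt d * (A * B)) ^ 2 * τ ^ 2) *
          (ENNReal.ofReal (ρ / N) * β) * ∑ i ∈ s, ∫⁻ x, ‖h' i μ x‖ₑ :=
        sqR_sum_cv_le_of_tube hFam m (Real.sqrt_nonneg d) (norm_cdir_le hN1 hv) (nKΨ v).meas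
        (hK v).2.2.2.2.1 (hNR ▸ (hK v).2.2.2.2.2.2.2.1) (fun i hi => (hh'I i hi μ).meas)
        (fun i hi x hx => hhs i hi μ x (right_ne_zero_of_mul hx)) (β := ENNReal.ofReal (ρ / N) * β)
        (fun i hi => (bh i hi μ).trans (by rw [mul_assoc]; exact mul_le_mul_right (hβ i hi) _))
      refine this.trans ?_
      have hs : ∑ i ∈ s, ∫⁻ x, ‖h' i μ x‖ₑ ≤ ENNReal.ofReal (ρ / N) * S := by
        rw [hS, Finset.mul_sum]; exact Finset.sum_le_sum fun i hi => bh i hi μ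
      refine (mul_le_mul_right hs _).trans (le_of_eq ?_)
      rw [ENNReal.ofReal_mul (p := 2 * (Real.sqrt d * (A * B)) ^ 2 * τ ^ 2) (by positivity), sq (ρ / N),
        ENNReal.ofReal_mul (p := ρ / N) (q := ρ / N) (by positivity)]
      generalize ENNReal.ofReal (2 * (Real.sqrt d * (A * B)) ^ 2 * τ ^ 2) = r₁
      generalize ENNReal.ofReal (ρ / N) = r₂
      ring
    have bG2 : ∀ v ∈ bdry d N, ∀ μ, sqR (G2 v μ) ≤
        ENNReal.ofReal (2 * (A * B / N) ^ 2 * τ ^ 2) * (β * S) := by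
      intro v hv μ
      have := sqR_sum_cv_le_of_tube hFam m (Real.sqrt_nonneg d) (norm_cdir_le hN1 hv) (nKμ v μ).meas
        ((hK v).2.2.2.2.2.1 μ) (hNR ▸ (hK v).2.2.2.2.2.2.2.2.1 μ) (fun i hi => (hb i hi).meas) hbs hβ
      rw [mul_assoc] at this
      exact this
    have hNpos : (0:ℝ) < N := by exact_mod_cast hN1
    have btot : ∀ v ∈ bdry d N, sqR (F v) + ENNReal.ofReal (d * N ^ 2) *
        ∑ μ, sqR (fun x => G1 v μ x + G2 v μ x) ≤
        ENNReal.ofReal (2 * (A * B) ^ 2 * τ ^ 2 * (1 + 2 * d ^ 2 * (d * ρ ^ 2 + 1))) * (β * S) := by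
      intro v hv
      have h1 : ∀ μ, sqR (fun x => G1 v μ x + G2 v μ x) ≤
          ENNReal.ofReal (2 * (2 * (Real.sqrt d * (A * B)) ^ 2 * τ ^ 2 * (ρ / N) ^ 2) +
            2 * (2 * (A * B / N) ^ 2 * τ ^ 2)) * (β * S) := by
        intro μ
        refine (sqR_add_le (nG1 v μ).meas).trans ((add_le_add
          (mul_le_mul_right (bG1 v hv μ) _) (mul_le_mul_right (bG2 v hv μ) _)).trans (le_of_eq ?_))
        rw [ENNReal.ofReal_add (by positivity) (by positivity), ENNReal.ofReal_mul (p := 2) (by norm_num),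
          ENNReal.ofReal_mul (p := 2) (q := 2 * (A * B / N) ^ 2 * τ ^ 2) (by norm_num),
          ENNReal.ofReal_ofNat]
        ring
      calc _ ≤ ENNReal.ofReal (2 * (A * B) ^ 2 * τ ^ 2) * (β * S) + ENNReal.ofReal (d * N ^ 2) *
            ∑ μ : Fin d, ENNReal.ofReal (2 * (2 * (Real.sqrt d * (A * B)) ^ 2 * τ ^ 2 * (ρ / N) ^ 2) +
            2 * (2 * (A * B / N) ^ 2 * τ ^ 2)) * (β * S) :=
            add_le_add (bF v hv) (mul_le_mul_right (Finset.sum_le_sum fun μ _ => h1 μ) _)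
        _ = _ := by
            have hsq : Real.sqrt d ^ 2 = d := Real.sq_sqrt hd0.le
            have hdc : (d : ℝ≥0∞) = ENNReal.ofReal d := by simp
            rw [Finset.sum_const, Finset.card_univ, Fintype.card_fin, nsmul_eq_mul, hdc,
              ← mul_assoc (ENNReal.ofReal (d:ℝ)), ← ENNReal.ofReal_mul (by positivity),
              ← mul_assoc (ENNReal.ofReal _) (ENNReal.ofReal _),
              ← ENNReal.ofReal_mul (by positivity), ← add_mul,
              ← ENNReal.ofReal_add (by positivity) (by positivity)]
            congr 2
            rw [mul_pow (Real.sqrt d), hsq]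
            field_simp
    refine (mul_le_mul_right (Finset.sum_le_sum btot) _).trans ?_
    have hcard := card_bdry_le (d := d) hN1
    rw [Finset.sum_const, nsmul_eq_mul, ← mul_assoc, ← mul_assoc]
    refine mul_le_mul_left ?_ _
    have hcc : (((bdry d N).card : ℕ) : ℝ≥0∞) ≤ ENNReal.ofReal (2 * d * (3 * N : ℝ) ^ (d - 1)) := by
      rw [← ENNReal.ofReal_natCast]; exact ENNReal.ofReal_le_ofReal hcard
    refine (mul_le_mul_left (mul_le_mul_right hcc _) _).trans ?_
    rw [← ENNReal.ofReal_mul (by positivity), ← ENNReal.ofReal_mul (by positivity)]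
    refine ENNReal.ofReal_le_ofReal ?_
    obtain ⟨n, rfl⟩ : ∃ n, d = n + 2 := ⟨d - 2, by omega⟩
    have e1 : n + 2 - 2 = n := by omega
    have e2 : n + 2 - 1 = n + 1 := by omega
    rw [e1, e2, hτ, ← hNR]
    have hvb := vb_nonneg (d := n + 2) 1
    have hx : ∀ a b : ℝ, a = b * A ^ 2 / N → a ≤ (b + 1) * A ^ 2 / N := fun a b h1 => by
      rw [h1]
      gcongr
      linarith
    apply hx
    rw [mul_pow 3 (N:ℝ), div_pow]
    field_simp
    ring

end MicroLocalMain

section Polar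

variable {d : ℕ}

theorem lintegral_polar {G : Rd d → ℝ≥0∞} (hG : ∀ x, x ≠ 0 → ∀ r : ℝ, 0 < r → G (r • x) = G x)
    (hd : 2 ≤ d) (hGm : AEMeasurable (fun θ : sphere (0 : Rd d) 1 => G θ) (sphereMeasure d))
    {h : ℝ → ℝ≥0∞} (hh : Measurable h) :
    ∫⁻ x, G x * h ‖x‖ = (∫⁻ θ : sphere (0 : Rd d) 1, G θ ∂sphereMeasure d) *
      ∫⁻ r, h (r : ℝ) ∂(Measure.volumeIoiPow (Module.finrank ℝ (Rd d) - 1)) := by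
  have : Nontrivial (Rd d) := by
    have : Nonempty (Fin d) := ⟨⟨0, by omega⟩⟩
    infer_instance
  rw [← restrict_compl_singleton (μ := (volume : Measure (Rd d))) (0 : Rd d),
    ← lintegral_subtype_comap (measurableSet_singleton _).compl (fun x => G x * h ‖x‖)]
  have hmp := Measure.measurePreserving_homeomorphUnitSphereProd (volume : Measure (Rd d))
  have := hmp.lintegral_comp_emb (homeomorphUnitSphereProd (Rd d)).measurableEmbedding
    (fun z => G z.1 * h z.2)
  have h3 : AEMeasurable (fun r : Ioi (0:ℝ) => h r)
      (Measure.volumeIoiPow (Module.finrank ℝ (Rd d) - 1)) :=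
    (hh.comp measurable_subtype_coe).aemeasurable
  rw [sphereMeasure] at hGm
  rw [lintegral_prod_mul hGm h3] at this
  rw [sphereMeasure, ← this]
  refine lintegral_congr fun x => ?_
  have hx : (x : Rd d) ≠ 0 := x.2
  rw [homeomorphUnitSphereProd_apply_fst_coe, homeomorphUnitSphereProd_apply_snd_coe,
    hG _ hx _ (by positivity)]

theorem integral_polar {G : Rd d → ℝ} (hG : Homogeneous0 d G) (hd : 2 ≤ d) (h : ℝ → ℝ) :
    ∫ x, G x * h ‖x‖ = (∫ θ : sphere (0 : Rd d) 1, G θ ∂sphereMeasure d) *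
      ∫ r, h (r : ℝ) ∂(Measure.volumeIoiPow (Module.finrank ℝ (Rd d) - 1)) := by
  have : Nontrivial (Rd d) := by
    have : Nonempty (Fin d) := ⟨⟨0, by omega⟩⟩
    infer_instance
  rw [← restrict_compl_singleton (μ := (volume : Measure (Rd d))) (0 : Rd d),
    ← integral_subtype_comap (measurableSet_singleton _).compl (fun x => G x * h ‖x‖)]
  have hmp := Measure.measurePreserving_homeomorphUnitSphereProd (volume : Measure (Rd d))
  have := hmp.integral_comp (homeomorphUnitSphereProd (Rd d)).measurableEmbedding
    (fun z => G z.1 * h z.2)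
  rw [integral_prod_mul (fun θ : sphere (0 : Rd d) 1 => G θ) (fun r : Ioi (0:ℝ) => h r)] at this
  rw [sphereMeasure, ← this]
  refine integral_congr_ae (Filter.Eventually.of_forall fun x => ?_)
  have hx : (x : Rd d) ≠ 0 := x.2
  simp only
  rw [homeomorphUnitSphereProd_apply_fst_coe, homeomorphUnitSphereProd_apply_snd_coe,
    hG _ hx _ (by positivity)]

theorem lintegral_ball_homogeneous_le {G : Rd d → ℝ≥0∞}
    (hG : ∀ x, x ≠ 0 → ∀ r : ℝ, 0 < r → G (r • x) = G x)
    (hd : 2 ≤ d) (hGm : AEMeasurable (fun θ : sphere (0 : Rd d) 1 => G θ) (sphereMeasure d)) :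
    ∫⁻ x in ball (0 : Rd d) 1, G x ≤ ∫⁻ θ : sphere (0 : Rd d) 1, G θ ∂sphereMeasure d := by
  have h1 : ∫⁻ x in ball (0 : Rd d) 1, G x =
      ∫⁻ x, G x * (Iio (1:ℝ)).indicator (fun _ => (1:ℝ≥0∞)) ‖x‖ := by
    rw [← lintegral_indicator measurableSet_ball]
    refine lintegral_congr fun x => ?_
    by_cases hx : ‖x‖ < 1 <;> simp [hx, Set.indicator]
  rw [h1, lintegral_polar hG hd hGm (measurable_const.indicator measurableSet_Iio)]
  refine mul_le_of_le_one_right' ?_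
  have h2 : ∫⁻ r : Ioi (0:ℝ), (Iio (1:ℝ)).indicator (fun _ => (1:ℝ≥0∞)) (r:ℝ)
      ∂(Measure.volumeIoiPow (Module.finrank ℝ (Rd d) - 1)) =
      Measure.volumeIoiPow (Module.finrank ℝ (Rd d) - 1) (Iio ⟨1, mem_Ioi.2 one_pos⟩) := by
    rw [← lintegral_indicator_one measurableSet_Iio]
    refine lintegral_congr fun r => ?_
    simp only [Set.indicator, mem_Iio, ← Subtype.coe_lt_coe]
    rfl
  rw [h2, Measure.volumeIoiPow_apply_Iio]
  refine ENNReal.ofReal_le_one.2 ?_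
  simp only [one_pow]
  rw [div_le_one (by positivity)]
  linarith [(Nat.cast_nonneg (Module.finrank ℝ (Rd d) - 1) : (0:ℝ) ≤ _)]

/-- A function on the sphere null a.e. extends to a homogeneous function null a.e. -/
theorem ae_of_ae_sphere (hd : 2 ≤ d) {p : Rd d → Prop}
    (hp : ∀ x, x ≠ 0 → p (‖x‖⁻¹ • x) → p x)
    (h : ∀ᵐ θ : sphere (0 : Rd d) 1 ∂sphereMeasure d, p θ) : ∀ᵐ x : Rd d, p x := by
  have : Nontrivial (Rd d) := by
    have : Nonempty (Fin d) := ⟨⟨0, by omega⟩⟩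
    infer_instance
  have hmp := Measure.measurePreserving_homeomorphUnitSphereProd (volume : Measure (Rd d))
  have h1 := (Measure.quasiMeasurePreserving_fst
    (μ := (volume : Measure (Rd d)).toSphere)
    (ν := Measure.volumeIoiPow (Module.finrank ℝ (Rd d) - 1))).ae h
  have h2 := hmp.quasiMeasurePreserving.ae h1
  have h3 : ∀ᵐ x : ({0}ᶜ : Set (Rd d)) ∂(volume : Measure (Rd d)).comap (↑), p x := by
    filter_upwards [h2] with x hx
    refine hp _ x.2 ?_
    rw [← homeomorphUnitSphereProd_apply_fst_coe]
    exact hx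
  rw [← restrict_compl_singleton (μ := (volume : Measure (Rd d))) (0 : Rd d)]
  rw [← map_comap_subtype_coe (measurableSet_singleton _).compl]
  exact ((MeasurableEmbedding.subtype_coe (measurableSet_singleton (0 : Rd d)).compl).ae_map_iff).2 h3

end Polar

section Kernel

variable {d : ℕ}

theorem Prof.lintegral_kOm_le {P Ψ : Rd d → ℝ} {B : ℝ} (hP : Prof d P Ψ B) (Om : Rd d → ℝ) :
    ∫⁻ x, ‖kOm P Om x‖ₑ ≤ ENNReal.ofReal B * ∫⁻ x in ball (0 : Rd d) 1, ‖Om x‖ₑ := by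
  rw [← lintegral_const_mul' _ _ ENNReal.ofReal_ne_top, ← lintegral_indicator measurableSet_ball]
  refine lintegral_mono fun x => ?_
  by_cases hx : kOm P Om x = 0
  · simp [hx]
  · have h1 := hP.kOm_supp hx
    have h2 : x ∈ ball (0 : Rd d) 1 := by simp; linarith [h1.2]
    rw [Set.indicator_of_mem h2]
    have h3 := hP.abs_kOm_le Om x
    rw [← ofReal_norm, ← ofReal_norm, ← ENNReal.ofReal_mul hP.B_nonneg,
      Real.norm_eq_abs, Real.norm_eq_abs, mul_comm B]
    exact ENNReal.ofReal_le_ofReal h3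

theorem Prof.im_kOm {P Ψ : Rd d → ℝ} {B : ℝ} (hP : Prof d P Ψ B) {Om : Rd d → ℝ}
    (hm : Measurable Om) (hb : ∫⁻ x in ball (0 : Rd d) 1, ‖Om x‖ₑ ≠ ⊤) : IM (kOm P Om) where
  meas := hP.measurable_kOm hm
  int := ⟨(hP.measurable_kOm hm).aestronglyMeasurable,
    (hP.lintegral_kOm_le Om).trans_lt (ENNReal.mul_lt_top ENNReal.ofReal_lt_top hb.lt_top)⟩

/-- The profile attached to `φ`. -/
def prP (d : ℕ) (φ : Rd d → ℝ) (x : Rd d) : ℝ := φ x * ‖x‖ ^ (-(d : ℤ) - 1)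

theorem kOm_prP (φ Om : Rd d → ℝ) (hd : 2 ≤ d) (x : Rd d) :
    kOm (prP d φ) Om x = φ x * (Om x * ‖x‖ ^ (-(d : ℤ))) := by
  unfold kOm prP
  by_cases hx : ‖x‖ = 0
  · rw [hx, zero_mul, zero_zpow _ (by omega)]; ring
  · rw [zpow_sub_one₀ hx]
    field_simp

theorem Kker_eq_dil {φ Om : Rd d → ℝ} (hd : 2 ≤ d) (hom : Homogeneous0 d Om) (j : ℤ) :
    Kker d φ Om j = dil j (kOm (prP d φ) Om) := by
  ext x
  unfold dil Kker
  rw [kOm_prP _ _ hd]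
  by_cases hx : x = 0
  · simp [hx, zero_zpow (-(d:ℤ)) (by omega)]
  · rw [hom x hx _ (by positivity), norm_smul, mul_zpow, Real.norm_of_nonneg (by positivity)]
    have h2 : ((2:ℝ) ^ (-j)) ^ (-(d:ℤ)) = (((2:ℝ) ^ (-j)) ^ d)⁻¹ := by
      rw [zpow_neg, zpow_natCast]
    rw [h2]
    have : ((2:ℝ) ^ (-j)) ≠ 0 := by positivity
    field_simp

theorem phi_two_terms {φ : Rd d → ℝ} (hφ : AdmissiblePhi d φ) {y : Rd d} (h1 : 1 ≤ ‖y‖)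
    (h2 : ‖y‖ < 2) : φ ((2:ℝ) ^ (-4 : ℤ) • y) + φ ((2:ℝ) ^ (-3 : ℤ) • y) = 1 := by
  have hy : y ≠ 0 := by rintro rfl; simp at h1; linarith
  have hs := hφ.2.2 y hy
  have hz : ∀ j : ℤ, j ∉ ({4, 3} : Finset ℤ) → φ ((2:ℝ) ^ (-j) • y) = 0 := by
    intro j hj
    by_contra hne
    have := hφ.2.1 (subset_tsupport _ hne)
    simp only [Set.mem_ofPred_eq, norm_smul, Real.norm_of_nonneg (by positivity : (0:ℝ) ≤ 2 ^ (-j))] at this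
    obtain ⟨ha, hb⟩ := this
    have hj1 : -j < -2 := by
      by_contra hc
      have : (2:ℝ) ^ (-2:ℤ) ≤ 2 ^ (-j) := zpow_le_zpow_right₀ (by norm_num) (by omega)
      nlinarith [(by positivity : (0:ℝ) < 2 ^ (-j))]
    have hj2 : -5 < -j := by
      by_contra hc
      have h5 : (2:ℝ) ^ (-j) ≤ 2 ^ (-5:ℤ) := zpow_le_zpow_right₀ (by norm_num) (by omega)
      have : (2:ℝ) ^ (-4:ℤ) = 2 ^ (-5:ℤ) * 2 := by norm_num
      nlinarith [(by positivity : (0:ℝ) < 2 ^ (-j))]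
    simp at hj; omega
  have := hs.unique (hasSum_sum_of_ne_finset_zero hz)
  rw [Finset.sum_pair (by norm_num)] at this
  exact this.symm

theorem integral_kOm_eq_zero {φ Ψ : Rd d → ℝ} {B : ℝ} (hφ : AdmissiblePhi d φ) (hd : 2 ≤ d)
    (hP : Prof d (prP d φ) Ψ B) {Om : Rd d → ℝ} (hom : Homogeneous0 d Om)
    (him : IM (kOm (prP d φ) Om))
    (h0 : ∫ θ : sphere (0 : Rd d) 1, Om θ ∂sphereMeasure d = 0) :
    ∫ x, kOm (prP d φ) Om x = 0 := by
  set F : Rd d → ℝ := fun x => Om x * ‖x‖ ^ (-(d : ℤ)) with hF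
  have hFs : ∀ (k : ℤ) (y : Rd d), y ≠ 0 → ((2:ℝ) ^ k) ^ d * F ((2:ℝ) ^ k • y) = F y := by
    intro k y hy
    simp only [hF]
    rw [hom y hy _ (by positivity), norm_smul, mul_zpow, Real.norm_of_nonneg (by positivity)]
    have h2 : ((2:ℝ) ^ k) ^ (-(d:ℤ)) = (((2:ℝ) ^ k) ^ d)⁻¹ := by
      rw [zpow_neg, zpow_natCast]
    rw [h2]
    have : ((2:ℝ) ^ k) ≠ 0 := by positivity
    field_simp
  let An : ℤ → Set (Rd d) := fun k => {x | (2:ℝ) ^ k ≤ ‖x‖ ∧ ‖x‖ < 2 ^ (k + 1)}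
  have hAm : ∀ k, MeasurableSet (An k) := fun k =>
    (measurableSet_le measurable_const measurable_norm).inter
      (measurableSet_lt measurable_norm measurable_const)
  set K := kOm (prP d φ) Om with hK
  have hsc : ∀ (k : ℤ) (y : Rd d), ((2:ℝ) ^ k) ^ d * (An k).indicator K ((2:ℝ) ^ k • y) =
      (An 0).indicator (fun y => φ ((2:ℝ) ^ k • y) * F y) y := by
    intro k y
    have hmem : ((2:ℝ) ^ k • y ∈ An k) ↔ y ∈ An 0 := by
      simp only [An, Set.mem_ofPred_eq, norm_smul, Real.norm_of_nonneg (by positivity : (0:ℝ) ≤ 2 ^ k),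
        zpow_add₀ (two_ne_zero' ℝ), zpow_zero, zpow_one, one_mul]
      have hk : (0:ℝ) < 2 ^ k := by positivity
      rw [mul_lt_mul_iff_right₀ hk, le_mul_iff_one_le_right hk]
    by_cases hy : y ∈ An 0
    · rw [Set.indicator_of_mem hy, Set.indicator_of_mem (hmem.2 hy)]
      have hy0 : y ≠ 0 := by
        rintro rfl
        have := hy.1
        simp at this; linarith
      rw [← hFs k y hy0, hK, kOm_prP _ _ hd]
      simp only [hF]
      ring
    · rw [Set.indicator_of_notMem hy, Set.indicator_of_notMem (fun h => hy (hmem.1 h)), mul_zero]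
  have hint : ∀ k, Integrable ((An k).indicator K) := fun k => him.int.indicator (hAm k)
  have hI : ∀ k : ℤ, ∫ x, (An k).indicator K x =
      ∫ y, (An 0).indicator (fun y => φ ((2:ℝ) ^ k • y) * F y) y := by
    intro k
    rw [← integral_scale ((An k).indicator K) (c := (2:ℝ) ^ k) (by positivity), smul_eq_mul,
      ← integral_const_mul]
    exact integral_congr_ae (Filter.Eventually.of_forall (hsc k))
  have hI' : ∀ k : ℤ, Integrable ((An 0).indicator (fun y => φ ((2:ℝ) ^ k • y) * F y)) := by
    intro k
    have := ((hint k).comp_smul (R := (2:ℝ) ^ k) (by positivity)).const_mul (((2:ℝ) ^ k) ^ d)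
    exact this.congr (Filter.Eventually.of_forall (hsc k))
  have hsplit : ∀ x, K x = (An (-4)).indicator K x + (An (-3)).indicator K x := by
    intro x
    by_cases hx : K x = 0
    · simp [Set.indicator, hx]
    have hs := hP.kOm_supp hx
    by_cases h8 : ‖x‖ < 1 / 8
    · have m1 : x ∈ An (-4) := ⟨by norm_num; linarith, by norm_num; linarith⟩
      have m2 : x ∉ An (-3) := fun h => by have := h.1; norm_num at this; linarith
      rw [Set.indicator_of_mem m1, Set.indicator_of_notMem m2, add_zero]
    · have m1 : x ∉ An (-4) := fun h => by have := h.2; norm_num at this; linarith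
      have m2 : x ∈ An (-3) := ⟨by norm_num; linarith, by norm_num; linarith⟩
      rw [Set.indicator_of_mem m2, Set.indicator_of_notMem m1, zero_add]
  rw [integral_congr_ae (Filter.Eventually.of_forall hsplit), integral_add (hint _) (hint _), hI, hI,
    ← integral_add (hI' _) (hI' _)]
  have hlast : ∀ y, (An 0).indicator (fun y => φ ((2:ℝ) ^ (-4:ℤ) • y) * F y) y +
      (An 0).indicator (fun y => φ ((2:ℝ) ^ (-3:ℤ) • y) * F y) y =
      Om y * (Ico (1:ℝ) 2).indicator (fun r => r ^ (-(d:ℤ))) ‖y‖ := by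
    intro y
    by_cases hy : y ∈ An 0
    · have hy' : ‖y‖ ∈ Ico (1:ℝ) 2 := by simpa [An] using hy
      rw [Set.indicator_of_mem hy, Set.indicator_of_mem hy, Set.indicator_of_mem hy', ← add_mul,
        phi_two_terms hφ hy'.1 hy'.2, one_mul]
    · have hy' : ‖y‖ ∉ Ico (1:ℝ) 2 := by simpa [An] using hy
      rw [Set.indicator_of_notMem hy, Set.indicator_of_notMem hy, Set.indicator_of_notMem hy']
      simp
  rw [integral_congr_ae (Filter.Eventually.of_forall hlast), integral_polar hom hd, h0, zero_mul]

end Kernel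

section OmegaData

variable {d : ℕ}

/-- A measurable homogeneous function with the size, cancellation and tail bounds used below. -/
structure OmData (d : ℕ) (P Om : Rd d → ℝ) (A D : ℝ) : Prop where
  meas : Measurable Om
  hom : Homogeneous0 d Om
  A_pos : 0 < A
  A_le : A ≤ D
  ball : ∫⁻ x in ball (0 : Rd d) 1, ‖Om x‖ₑ ≤ ENNReal.ofReal A
  mean : ∫ x, kOm P Om x = 0
  tails : ∑' k : ℕ, ∫⁻ x in Metric.ball (0 : Rd d) 1,
    {t : ℝ | (5 / 4) ^ k * A < |t|}.indicator (fun t => ‖t‖ₑ) (Om x) ≤ ENNReal.ofReal D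

theorem tsum_tail_le {A : ℝ} (hA : 0 < A) (t : ℝ) :
    ∑' k : ℕ, {t : ℝ | (5 / 4) ^ k * A < |t|}.indicator (fun t => ‖t‖ₑ) t ≤
      ENNReal.ofReal ((1 + (Real.log (5 / 4))⁻¹) * (|t| * (1 + max (Real.log (|t| / A)) 0))) := by
  have hl : 0 < Real.log (5 / 4) := Real.log_pos (by norm_num)
  set y := max (Real.log (|t| / A)) 0 with hy
  have hy0 : 0 ≤ y := le_max_right _ _
  set n := ⌊y / Real.log (5 / 4)⌋₊ + 1 with hn
  rw [tsum_eq_sum (s := Finset.range n)]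
  · refine (Finset.sum_le_card_nsmul _ _ ‖t‖ₑ fun k _ => Set.indicator_le_self _ _ _).trans ?_
    rw [Finset.card_range, nsmul_eq_mul, ← ENNReal.ofReal_natCast, ← ofReal_norm,
      ← ENNReal.ofReal_mul (by positivity), Real.norm_eq_abs]
    refine ENNReal.ofReal_le_ofReal ?_
    have h1 : (n:ℝ) ≤ y / Real.log (5 / 4) + 1 := by
      rw [hn]; push_cast
      linarith [Nat.floor_le (a := y / Real.log (5 / 4)) (by positivity)]
    have h2 : y / Real.log (5 / 4) + 1 ≤ (1 + (Real.log (5 / 4))⁻¹) * (1 + y) := by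
      have : 0 ≤ (Real.log (5 / 4))⁻¹ := by positivity
      rw [div_eq_mul_inv]
      nlinarith
    calc (n:ℝ) * |t| ≤ ((1 + (Real.log (5 / 4))⁻¹) * (1 + y)) * |t| :=
          mul_le_mul_of_nonneg_right (h1.trans h2) (abs_nonneg _)
      _ = _ := by ring
  · intro k hk
    refine Set.indicator_of_notMem (fun h => hk ?_) _
    simp only [Set.mem_ofPred_eq] at h
    rw [Finset.mem_range, hn, Nat.lt_succ_iff]
    refine Nat.le_floor ?_
    rw [le_div_iff₀ hl]
    refine le_trans ?_ (le_max_left _ _)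
    rw [← Real.log_pow]
    refine Real.log_le_log (by positivity) ?_
    rw [le_div_iff₀ hA]
    exact h.le

theorem exists_omData {φ Ψ : Rd d → ℝ} {B : ℝ} (hφ : AdmissiblePhi d φ) (hd : 2 ≤ d)
    (hP : Prof d (prP d φ) Ψ B) {Ω : Rd d → ℝ} (hΩ : OmegaHyp d Ω) (hA : omegaL1 d Ω ≠ 0) :
    ∃ Om : Rd d → ℝ, Om =ᵐ[volume] Ω ∧ OmData d (prP d φ) Om (omegaL1 d Ω)
      ((1 + (Real.log (5 / 4))⁻¹) * constCOmega d Ω) := by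
  obtain ⟨hhom, hint, hzero, hlog⟩ := hΩ
  have hA0 : 0 ≤ omegaL1 d Ω := integral_nonneg fun θ => abs_nonneg _
  have hApos : 0 < omegaL1 d Ω := lt_of_le_of_ne hA0 (Ne.symm hA)
  set A := omegaL1 d Ω with hAdef
  have hl : 0 < Real.log (5 / 4) := Real.log_pos (by norm_num)
  obtain ⟨g, hgm, hg⟩ := (MeasurableEmbedding.subtype_coe
    (isClosed_sphere (x := (0 : Rd d)) (ε := 1)).measurableSet).exists_measurable_extend
      hint.1.stronglyMeasurable_mk.measurable (fun _ => ⟨(0:ℝ)⟩)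
  set Om : Rd d → ℝ := fun x => g (‖x‖⁻¹ • x) with hOm
  have hOmm : Measurable Om := hgm.comp (measurable_norm.inv.smul measurable_id)
  have hOmh : Homogeneous0 d Om := by
    intro x hx r hr
    simp only [hOm]
    congr 1
    rw [norm_smul, Real.norm_of_nonneg hr.le, smul_smul]
    congr 1
    have := norm_ne_zero_iff.2 hx
    field_simp
  have hS : ∀ᵐ θ : sphere (0 : Rd d) 1 ∂sphereMeasure d, Om θ = Ω θ := by
    filter_upwards [hint.1.ae_eq_mk] with θ hθ
    have h1 : ‖(θ : Rd d)‖ = 1 := by simp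
    simp only [hOm, h1, inv_one, one_smul]
    exact (congrFun hg θ).trans hθ.symm
  have hae : Om =ᵐ[volume] Ω := by
    refine ae_of_ae_sphere hd (p := fun x => Om x = Ω x) (fun x hx h => ?_) hS
    have hxi : 0 < ‖x‖⁻¹ := by positivity
    rwa [hOmh x hx _ hxi, hhom x hx _ hxi] at h
  have hOmS : Measurable (fun θ : sphere (0 : Rd d) 1 => Om θ) := hOmm.comp measurable_subtype_coe
  have hball : ∫⁻ x in Metric.ball (0 : Rd d) 1, ‖Om x‖ₑ ≤ ENNReal.ofReal A := by
    refine (lintegral_ball_homogeneous_le (G := fun x => ‖Om x‖ₑ)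
      (fun x hx r hr => by rw [hOmh x hx r hr]) hd hOmS.enorm.aemeasurable).trans (le_of_eq ?_)
    rw [hAdef, omegaL1, sphInt, ofReal_integral_eq_lintegral_ofReal hint.abs
      (Filter.Eventually.of_forall fun _ => abs_nonneg _)]
    refine lintegral_congr_ae ?_
    filter_upwards [hS] with θ hθ
    rw [hθ, ← ofReal_norm, Real.norm_eq_abs]
  have hI2 : Integrable (fun θ : sphere (0 : Rd d) 1 =>
      |Ω θ| * (1 + max (Real.log (|Ω θ| / A)) 0)) (sphereMeasure d) := by
    refine Integrable.mono' (g := fun θ : sphere (0 : Rd d) 1 =>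
      |Ω θ| * (1 + max (-Real.log A) 0) + |Ω θ| * Real.log (2 + |Ω θ|))
      ((hint.abs.mul_const _).add hlog) ?_ (Filter.Eventually.of_forall fun θ => ?_)
    · have h1 : AEMeasurable (fun θ : sphere (0 : Rd d) 1 => |Ω θ|) (sphereMeasure d) :=
        hint.abs.1.aemeasurable
      exact (h1.mul (((Real.measurable_log.comp_aemeasurable (h1.div_const A)).max
        aemeasurable_const).const_add 1)).aestronglyMeasurable
    · have hpos : 0 ≤ |Ω θ| * (1 + max (Real.log (|Ω θ| / A)) 0) := by positivity
      rw [Real.norm_of_nonneg hpos, ← mul_add]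
      refine mul_le_mul_of_nonneg_left ?_ (abs_nonneg _)
      have h2 : 0 ≤ Real.log (2 + |Ω θ|) := Real.log_nonneg (by linarith [abs_nonneg (Ω θ)])
      have h3 : max (Real.log (|Ω θ| / A)) 0 ≤ max (-Real.log A) 0 + Real.log (2 + |Ω θ|) := by
        refine max_le ?_ (by positivity)
        by_cases h0 : |Ω θ| = 0
        · rw [h0]; simp only [zero_div, Real.log_zero]
          have : (0:ℝ) ≤ Real.log (2 + 0) := Real.log_nonneg (by norm_num)
          positivity
        · rw [Real.log_div h0 hA]
          have h4 : Real.log |Ω θ| ≤ Real.log (2 + |Ω θ|) :=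
            Real.log_le_log (by positivity) (by linarith)
          linarith [le_max_left (-Real.log A) 0]
      linarith
  set I2 := ∫ θ : sphere (0 : Rd d) 1, |Ω θ| * (1 + max (Real.log (|Ω θ| / A)) 0) ∂(sphereMeasure d)
    with hI2def
  have hCge : I2 ≤ constCOmega d Ω := by
    have : 0 ≤ omegaLlogL d Ω := integral_nonneg fun θ => mul_nonneg (abs_nonneg _)
      (Real.log_nonneg (by linarith [abs_nonneg (Ω θ)]))
    unfold constCOmega
    change I2 ≤ omegaLlogL d Ω + I2
    linarith
  have hAI : A ≤ I2 := by
    refine integral_mono hint.abs hI2 fun θ => ?_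
    exact le_mul_of_one_le_right (abs_nonneg _) (by linarith [le_max_right (Real.log (|Ω θ| / A)) 0])
  have hfac : 1 ≤ 1 + (Real.log (5 / 4))⁻¹ := by
    have : 0 < (Real.log (5 / 4))⁻¹ := by positivity
    linarith
  refine ⟨Om, hae, hOmm, hOmh, hApos, ?_, hball, ?_, ?_⟩
  · have : 0 ≤ constCOmega d Ω := by linarith
    nlinarith
  · refine integral_kOm_eq_zero hφ hd hP hOmh
      (hP.im_kOm hOmm (ne_top_of_le_ne_top ENNReal.ofReal_ne_top hball)) ?_
    rw [integral_congr_ae hS, hzero]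
  · have hTm : ∀ k : ℕ, Measurable
        ({t : ℝ | (5 / 4) ^ k * A < |t|}.indicator (fun t : ℝ => ‖t‖ₑ)) := fun k =>
      measurable_enorm.indicator (measurableSet_lt measurable_const measurable_id.abs)
    calc _ ≤ ∑' k : ℕ, ∫⁻ θ : sphere (0 : Rd d) 1,
          {t : ℝ | (5 / 4) ^ k * A < |t|}.indicator (fun t => ‖t‖ₑ) (Om θ) ∂sphereMeasure d := by
          refine ENNReal.tsum_le_tsum fun k => ?_
          exact lintegral_ball_homogeneous_le
            (G := fun x => {t : ℝ | (5 / 4) ^ k * A < |t|}.indicator (fun t => ‖t‖ₑ) (Om x))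
            (fun x hx r hr => by rw [hOmh x hx r hr]) hd ((hTm k).comp hOmS).aemeasurable
      _ = ∫⁻ θ : sphere (0 : Rd d) 1, ∑' k : ℕ,
          {t : ℝ | (5 / 4) ^ k * A < |t|}.indicator (fun t => ‖t‖ₑ) (Om θ) ∂sphereMeasure d :=
          (lintegral_tsum fun k => ((hTm k).comp hOmS).aemeasurable).symm
      _ ≤ ∫⁻ θ : sphere (0 : Rd d) 1, ENNReal.ofReal ((1 + (Real.log (5 / 4))⁻¹) *
          (|Ω θ| * (1 + max (Real.log (|Ω θ| / A)) 0))) ∂sphereMeasure d := by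
          refine lintegral_mono_ae ?_
          filter_upwards [hS] with θ hθ
          rw [hθ]
          exact tsum_tail_le hApos _
      _ = ENNReal.ofReal ((1 + (Real.log (5 / 4))⁻¹) * I2) := by
          rw [← ofReal_integral_eq_lintegral_ofReal (hI2.const_mul _)
            (Filter.Eventually.of_forall fun θ => by positivity), integral_const_mul]
      _ ≤ _ := ENNReal.ofReal_le_ofReal (by gcongr)

end OmegaData

section Truncation

variable {d : ℕ}

/-- The part of `Om` below the height `(5/4)ᵏ A`. -/
def lo (A : ℝ) (k : ℕ) (Om : Rd d → ℝ) (x : Rd d) : ℝ :=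
  {t : ℝ | |t| ≤ (5 / 4) ^ k * A}.indicator (fun t => t) (Om x)

/-- The part of `Om` above the height `(5/4)ᵏ A`. -/
def hi (A : ℝ) (k : ℕ) (Om : Rd d → ℝ) (x : Rd d) : ℝ :=
  {t : ℝ | (5 / 4) ^ k * A < |t|}.indicator (fun t => t) (Om x)

theorem lo_add_hi (A : ℝ) (k : ℕ) (Om : Rd d → ℝ) (x : Rd d) : lo A k Om x + hi A k Om x = Om x := by
  unfold lo hi
  by_cases h : Om x ∈ {t : ℝ | |t| ≤ (5 / 4) ^ k * A}
  · have h' : Om x ∉ {t : ℝ | (5 / 4) ^ k * A < |t|} := fun h' => not_lt.2 (show |Om x| ≤ _ from h) h'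
    rw [Set.indicator_of_mem h, Set.indicator_of_notMem h', add_zero]
  · have h' : Om x ∈ {t : ℝ | (5 / 4) ^ k * A < |t|} := by
      rw [Set.mem_ofPred_eq] at h ⊢; exact not_le.1 h
    rw [Set.indicator_of_notMem h, Set.indicator_of_mem h', zero_add]

theorem abs_lo_le {A : ℝ} (hA : 0 ≤ A) (k : ℕ) (Om : Rd d → ℝ) (x : Rd d) :
    |lo A k Om x| ≤ (5 / 4) ^ k * A := by
  unfold lo
  by_cases h : Om x ∈ {t : ℝ | |t| ≤ (5 / 4) ^ k * A}
  · rwa [Set.indicator_of_mem h]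
  · rw [Set.indicator_of_notMem h, abs_zero]; positivity

theorem enorm_lo_le (A : ℝ) (k : ℕ) (Om : Rd d → ℝ) (x : Rd d) : ‖lo A k Om x‖ₑ ≤ ‖Om x‖ₑ := by
  unfold lo
  by_cases h : Om x ∈ {t : ℝ | |t| ≤ (5 / 4) ^ k * A}
  · rw [Set.indicator_of_mem h]
  · rw [Set.indicator_of_notMem h]; simp

theorem enorm_hi_le (A : ℝ) (k : ℕ) (Om : Rd d → ℝ) (x : Rd d) : ‖hi A k Om x‖ₑ ≤ ‖Om x‖ₑ := by
  unfold hi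
  by_cases h : Om x ∈ {t : ℝ | (5 / 4) ^ k * A < |t|}
  · rw [Set.indicator_of_mem h]
  · rw [Set.indicator_of_notMem h]; simp

theorem measurable_lo (A : ℝ) (k : ℕ) {Om : Rd d → ℝ} (h : Measurable Om) : Measurable (lo A k Om) :=
  (measurable_id.indicator (measurableSet_le measurable_id.abs measurable_const)).comp h

theorem measurable_hi (A : ℝ) (k : ℕ) {Om : Rd d → ℝ} (h : Measurable Om) : Measurable (hi A k Om) :=
  (measurable_id.indicator (measurableSet_lt measurable_const measurable_id.abs)).comp h

theorem homogeneous_lo (A : ℝ) (k : ℕ) {Om : Rd d → ℝ} (h : Homogeneous0 d Om) :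
    Homogeneous0 d (lo A k Om) := fun x hx r hr => by
  unfold lo; rw [h x hx r hr]

theorem kOm_lo_add_hi (P : Rd d → ℝ) (A : ℝ) (k : ℕ) (Om : Rd d → ℝ) :
    kOm P Om = fun x => kOm P (lo A k Om) x + kOm P (hi A k Om) x := by
  ext x
  unfold kOm
  rw [← add_mul, lo_add_hi]

variable {P Ψ Om : Rd d → ℝ} {B A D : ℝ}

theorem OmData.D_pos (h : OmData d P Om A D) : 0 < D := h.A_pos.trans_le h.A_le

theorem OmData.lintegral_kOm_le (h : OmData d P Om A D) (hP : Prof d P Ψ B) {m : Rd d → ℝ}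
    (hm : ∀ x, ‖m x‖ₑ ≤ ‖Om x‖ₑ) : ∫⁻ x, ‖kOm P m x‖ₑ ≤ ENNReal.ofReal (B * A) := by
  rw [ENNReal.ofReal_mul hP.B_nonneg]
  exact (hP.lintegral_kOm_le m).trans (mul_le_mul_right ((lintegral_mono fun x => hm x).trans h.ball) _)

theorem OmData.im_kOm (h : OmData d P Om A D) (hP : Prof d P Ψ B) {m : Rd d → ℝ} (hmm : Measurable m)
    (hm : ∀ x, ‖m x‖ₑ ≤ ‖Om x‖ₑ) : IM (kOm P m) :=
  ⟨hP.measurable_kOm hmm, (hP.measurable_kOm hmm).aestronglyMeasurable,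
    (h.lintegral_kOm_le hP hm).trans_lt ENNReal.ofReal_lt_top⟩

theorem OmData.im (h : OmData d P Om A D) (hP : Prof d P Ψ B) : IM (kOm P Om) :=
  h.im_kOm hP h.meas fun _ => le_rfl

theorem OmData.im_lo (h : OmData d P Om A D) (hP : Prof d P Ψ B) (k : ℕ) : IM (kOm P (lo A k Om)) :=
  h.im_kOm hP (measurable_lo A k h.meas) (enorm_lo_le A k Om)

theorem OmData.im_hi (h : OmData d P Om A D) (hP : Prof d P Ψ B) (k : ℕ) : IM (kOm P (hi A k Om)) :=
  h.im_kOm hP (measurable_hi A k h.meas) (enorm_hi_le A k Om)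

theorem OmData.tsum_hi_le (h : OmData d P Om A D) (hP : Prof d P Ψ B) :
    ∑' k : ℕ, ∫⁻ x, ‖kOm P (hi A k Om) x‖ₑ ≤ ENNReal.ofReal (B * D) := by
  rw [ENNReal.ofReal_mul hP.B_nonneg]
  refine le_trans ?_ (mul_le_mul_right h.tails _)
  rw [← ENNReal.tsum_mul_left]
  refine ENNReal.tsum_le_tsum fun k => ?_
  refine (hP.lintegral_kOm_le _).trans (mul_le_mul_right (lintegral_mono fun x => le_of_eq ?_) _)
  unfold hi
  by_cases hx : Om x ∈ {t : ℝ | (5 / 4) ^ k * A < |t|}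
  · rw [Set.indicator_of_mem hx, Set.indicator_of_mem hx]
  · rw [Set.indicator_of_notMem hx, Set.indicator_of_notMem hx, enorm_zero]

end Truncation

section RademacherMenshov

variable {d : ℕ}

/-- Sum of the squares of all dyadic block sums of a sequence of length `2ᵐ`. -/
def blockSq : ℕ → (ℕ → ℝ) → ℝ
  | 0, a => a 0 ^ 2
  | m + 1, a => (∑ r ∈ Finset.range (2 ^ (m + 1)), a r) ^ 2 + blockSq m a +
      blockSq m (fun r => a (2 ^ m + r))

theorem blockSq_nonneg (m : ℕ) : ∀ a : ℕ → ℝ, 0 ≤ blockSq m a := by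
  induction m with
  | zero => intro a; exact sq_nonneg _
  | succ m ih =>
    intro a
    have := ih a
    have := ih (fun r => a (2 ^ m + r))
    unfold blockSq
    positivity

theorem sq_sum_le_blockSq (m : ℕ) (a : ℕ → ℝ) : (∑ r ∈ Finset.range (2 ^ m), a r) ^ 2 ≤ blockSq m a := by
  cases m with
  | zero => simp [blockSq]
  | succ m =>
    unfold blockSq
    have := blockSq_nonneg m a
    have := blockSq_nonneg m (fun r => a (2 ^ m + r))
    linarith

theorem sq_sum_range_le (m : ℕ) : ∀ (a : ℕ → ℝ) (n : ℕ), n ≤ 2 ^ m →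
    (∑ r ∈ Finset.range n, a r) ^ 2 ≤ (m + 1) * blockSq m a := by
  induction m with
  | zero =>
    intro a n hn
    have : n = 0 ∨ n = 1 := by simp at hn; omega
    rcases this with rfl | rfl
    · simp [blockSq]; positivity
    · simp [blockSq]
  | succ m ih =>
    intro a n hn
    have h1 := blockSq_nonneg m a
    have h2 := blockSq_nonneg m (fun r => a (2 ^ m + r))
    have h3 : blockSq m a + blockSq m (fun r => a (2 ^ m + r)) ≤ blockSq (m + 1) a := by
      conv_rhs => unfold blockSq
      have := sq_nonneg (∑ r ∈ Finset.range (2 ^ (m + 1)), a r)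
      linarith
    push_cast
    by_cases hle : n ≤ 2 ^ m
    · have := ih a n hle
      have hm : (0:ℝ) ≤ m := Nat.cast_nonneg m
      nlinarith
    · obtain ⟨k, rfl⟩ : ∃ k, n = 2 ^ m + k := ⟨n - 2 ^ m, by omega⟩
      have hk : k ≤ 2 ^ m := by rw [pow_succ] at hn; omega
      rw [Finset.sum_range_add]
      have hx := sq_sum_le_blockSq m a
      have hy := ih (fun r => a (2 ^ m + r)) k hk
      set x := ∑ r ∈ Finset.range (2 ^ m), a r
      set y := ∑ r ∈ Finset.range k, a (2 ^ m + r)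
      have hm : (0:ℝ) < m + 1 := by positivity
      have hxy : (x + y) ^ 2 ≤ (m + 1 + 1) * (x ^ 2 + y ^ 2 / (m + 1)) := by
        have h5 : (m + 1 + 1) * (x ^ 2 + y ^ 2 / (m + 1)) - (x + y) ^ 2 =
            ((m + 1) * x - y) ^ 2 / (m + 1) := by field_simp; ring
        have h6 : 0 ≤ ((m + 1) * x - y) ^ 2 / (m + 1) := by positivity
        linarith
      have hy' : y ^ 2 / (m + 1) ≤ blockSq m (fun r => a (2 ^ m + r)) := by
        rw [div_le_iff₀ hm]; linarith
      refine hxy.trans (mul_le_mul_of_nonneg_left ?_ (by positivity))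
      linarith

theorem measurable_blockSq {α : Type*} [MeasurableSpace α] (m : ℕ) : ∀ (a : ℕ → α → ℝ),
    (∀ r, Measurable (a r)) → Measurable (fun x => blockSq m (fun r => a r x)) := by
  induction m with
  | zero => intro a ha; exact (ha 0).pow_const 2
  | succ m ih =>
    intro a ha
    exact (((Finset.measurable_sum _ fun r _ => ha r).pow_const 2).add (ih a ha)).add
      (ih (fun r => a (2 ^ m + r)) fun r => ha _)

theorem lintegral_blockSq_le {a : ℕ → Rd d → ℝ} (ha : ∀ r, Measurable (a r)) {c : ℕ → ℝ≥0∞}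
    (h : ∀ I : Finset ℕ, sqR (fun x => ∑ r ∈ I, a r x) ≤ ∑ r ∈ I, c r) (m : ℕ) :
    ∀ o : ℕ, ∫⁻ x, ENNReal.ofReal (blockSq m (fun r => a (o + r) x)) ≤
      (m + 1) * ∑ r ∈ Finset.Ico o (o + 2 ^ m), c r := by
  have hI : ∀ o n, sqR (fun x => ∑ r ∈ Finset.range n, a (o + r) x) ≤
      ∑ r ∈ Finset.Ico o (o + n), c r := by
    intro o n
    have := h (Finset.Ico o (o + n))
    simpa only [Finset.sum_Ico_eq_sum_range, Nat.add_sub_cancel_left] using this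
  induction m with
  | zero =>
    intro o
    have := hI o 1
    simpa [blockSq, sqR] using this
  | succ m ih =>
    intro o
    have h1 := hI o (2 ^ (m + 1))
    have h2 := ih o
    have h3 := ih (o + 2 ^ m)
    have hs : ∑ r ∈ Finset.Ico o (o + 2 ^ (m + 1)), c r =
        ∑ r ∈ Finset.Ico o (o + 2 ^ m), c r +
          ∑ r ∈ Finset.Ico (o + 2 ^ m) (o + 2 ^ m + 2 ^ m), c r := by
      rw [Finset.sum_Ico_consecutive _ (Nat.le_add_right _ _) (Nat.le_add_right _ _)]
      congr 2; rw [pow_succ]; ring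
    have m1 : Measurable fun x => ENNReal.ofReal
        ((∑ r ∈ Finset.range (2 ^ (m + 1)), a (o + r) x) ^ 2) :=
      ((Finset.measurable_sum _ fun r _ => ha _).pow_const 2).ennreal_ofReal
    have m2 : Measurable fun x => ENNReal.ofReal (blockSq m (fun r => a (o + r) x)) :=
      (measurable_blockSq m (fun r => a (o + r)) fun r => ha _).ennreal_ofReal
    calc ∫⁻ x, ENNReal.ofReal (blockSq (m + 1) (fun r => a (o + r) x))
        = ∫⁻ x, (ENNReal.ofReal ((∑ r ∈ Finset.range (2 ^ (m + 1)), a (o + r) x) ^ 2) +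
            ENNReal.ofReal (blockSq m (fun r => a (o + r) x))) +
            ENNReal.ofReal (blockSq m (fun r => a (o + 2 ^ m + r) x)) := by
          refine lintegral_congr fun x => ?_
          rw [← ENNReal.ofReal_add (sq_nonneg _) (blockSq_nonneg _ _), ← ENNReal.ofReal_add
            (add_nonneg (sq_nonneg _) (blockSq_nonneg _ _)) (blockSq_nonneg _ _)]
          simp only [blockSq, add_assoc]
      _ ≤ (∑ r ∈ Finset.Ico o (o + 2 ^ (m + 1)), c r +
            (m + 1) * ∑ r ∈ Finset.Ico o (o + 2 ^ m), c r) +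
            (m + 1) * ∑ r ∈ Finset.Ico (o + 2 ^ m) (o + 2 ^ m + 2 ^ m), c r := by
          rw [lintegral_add_left (f := fun x => ENNReal.ofReal
            ((∑ r ∈ Finset.range (2 ^ (m + 1)), a (o + r) x) ^ 2) +
            ENNReal.ofReal (blockSq m (fun r => a (o + r) x))) (m1.add m2), lintegral_add_left m1]
          exact add_le_add (add_le_add h1 h2) h3
      _ = _ := by
          rw [hs]; push_cast; ring

end RademacherMenshov

theorem cell_eq_of_le {X α : Type*} {cell : ℤ → X → α}
    (nested : ∀ J x y, cell J x = cell J y → cell (J + 1) x = cell (J + 1) y) {J J' : ℤ} (h : J ≤ J')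
    {x y : X} (hxy : cell J x = cell J y) : cell J' x = cell J' y := by
  induction J', h using Int.leInduction with
  | base => exact hxy
  | succ k _ ih => exact nested k x y ih

section Ranks

variable {ι X α : Type*} [DecidableEq α]

/-- The scales `J i`, `i ∈ s`, whose distinguished cell contains `x`. -/
def levels (cell : ℤ → X → α) (s : Finset ι) (J : ι → ℤ) (c : ι → X) (x : X) : Finset ℤ :=
  (s.filter fun i => cell (J i) (c i) = cell (J i) x).image J

/-- The number of distinguished cells of larger scale containing the `i`-th one. -/
def cellRank (cell : ℤ → X → α) (s : Finset ι) (J : ι → ℤ) (c : ι → X) (i : ι) : ℕ :=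
  ((levels cell s J c (c i)).filter fun j => J i < j).card

theorem sum_filter_le_eq_sum_rank {cell : ℤ → X → α}
    (nested : ∀ J x y, cell J x = cell J y → cell (J + 1) x = cell (J + 1) y)
    (s : Finset ι) (J : ι → ℤ) (c : ι → X) (x : X) (a : ι → ℝ)
    (ha : ∀ i ∈ s, a i ≠ 0 → cell (J i) (c i) = cell (J i) x) (L : ℤ) :
    ∑ i ∈ s with L ≤ J i, a i =
      ∑ r ∈ Finset.range ((levels cell s J c x).filter fun j => L ≤ j).card,
        ∑ i ∈ s with cellRank cell s J c i = r, a i := by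
  set R := ((levels cell s J c x).filter fun j => L ≤ j).card with hR
  have h1 : ∑ r ∈ Finset.range R, ∑ i ∈ s with cellRank cell s J c i = r, a i =
      ∑ i ∈ s with cellRank cell s J c i < R, a i := by
    simp only [Finset.sum_filter]
    rw [Finset.sum_comm]
    refine Finset.sum_congr rfl fun i _ => ?_
    simp
  rw [h1, Finset.sum_filter, Finset.sum_filter]
  refine Finset.sum_congr rfl fun i hi => ?_
  by_cases h0 : a i = 0
  · simp [h0]
  have hc := ha i hi h0
  have hrank : cellRank cell s J c i = ((levels cell s J c x).filter fun j => J i < j).card := by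
    unfold cellRank
    congr 1
    ext j
    simp only [Finset.mem_filter, levels, Finset.mem_image]
    refine and_congr_left fun hj => exists_congr fun k => and_congr_left fun hk => ?_
    rw [hk]
    refine and_congr_right fun _ => ?_
    rw [cell_eq_of_le nested hj.le hc]
  have hmem : J i ∈ levels cell s J c x :=
    Finset.mem_image_of_mem _ (Finset.mem_filter.2 ⟨hi, hc⟩)
  have hiff : L ≤ J i ↔ cellRank cell s J c i < R := by
    rw [hrank, hR]
    constructor
    · intro hL
      refine Finset.card_lt_card ⟨fun j hj => ?_, fun hsub => ?_⟩
      · rw [Finset.mem_filter] at hj ⊢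
        exact ⟨hj.1, hL.trans hj.2.le⟩
      · have := hsub (Finset.mem_filter.2 ⟨hmem, hL⟩)
        exact lt_irrefl _ (Finset.mem_filter.1 this).2
    · intro hlt
      by_contra hL
      refine absurd (Finset.card_le_card fun j hj => ?_) (not_le.2 hlt)
      rw [Finset.mem_filter] at hj ⊢
      exact ⟨hj.1, (not_le.1 hL).trans_le hj.2⟩
  simp only [hiff]

theorem sq_sum_filter_le_blockSq {cell : ℤ → X → α}
    (nested : ∀ J x y, cell J x = cell J y → cell (J + 1) x = cell (J + 1) y)
    (s : Finset ι) (J : ι → ℤ) (c : ι → X) (x : X) (a : ι → ℝ)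
    (ha : ∀ i ∈ s, a i ≠ 0 → cell (J i) (c i) = cell (J i) x) {m : ℕ}
    (hm : (s.filter fun i => cell (J i) (c i) = cell (J i) x).card ≤ 2 ^ m) (L : ℤ) :
    (∑ i ∈ s with L ≤ J i, a i) ^ 2 ≤
      (m + 1) * blockSq m (fun r => ∑ i ∈ s with cellRank cell s J c i = r, a i) := by
  rw [sum_filter_le_eq_sum_rank nested s J c x a ha L]
  exact sq_sum_range_le m (fun r => ∑ i ∈ s with cellRank cell s J c i = r, a i) _
    ((Finset.card_filter_le _ _).trans (Finset.card_image_le.trans hm))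

end Ranks

section Grids

variable {d : ℕ}

/-- The offset of a shifted dyadic grid. -/
def gridShift (t : Fin d → Bool) (i : Fin d) : ℝ := if t i then 1 / 3 else 0

/-- Index of the cell of the shifted dyadic grid of side `2ᴶ` containing `x`. -/
def cellIdx (t : Fin d → Bool) (J : ℤ) (x : Rd d) (i : Fin d) : ℤ :=
  ⌊(2:ℝ) ^ (-J) * x i - gridShift t i * (-1) ^ J⌋

theorem cellIdx_nested (t : Fin d → Bool) (J : ℤ) (x y : Rd d) (h : cellIdx t J x = cellIdx t J y) :
    cellIdx t (J + 1) x = cellIdx t (J + 1) y := by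
  ext i
  obtain ⟨e, he⟩ : ∃ e : ℤ, 3 * gridShift t i * (-1) ^ J = (e:ℝ) := by
    unfold gridShift
    split_ifs
    · exact ⟨if Even J then 1 else -1, by
        rcases Int.even_or_odd J with h | h
        · rw [h.neg_one_zpow, if_pos h]; norm_num
        · rw [h.neg_one_zpow, if_neg (Int.not_even_iff_odd.2 h)]; norm_num⟩
    · exact ⟨0, by simp⟩
  have key : ∀ z : Rd d, cellIdx t (J + 1) z i = (cellIdx t J z i + e) / 2 := by
    intro z
    unfold cellIdx
    have h2 : (2:ℝ) ^ (-(J + 1)) * z i - gridShift t i * (-1) ^ (J + 1) =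
        ((2:ℝ) ^ (-J) * z i - gridShift t i * (-1) ^ J + (e:ℝ)) / (2:ℕ) := by
      rw [← he, neg_add, zpow_add₀ (two_ne_zero), zpow_add₀ (by norm_num : (-1:ℝ) ≠ 0)]
      norm_num
      ring
    rw [h2, Int.floor_div_natCast, Int.floor_add_intCast]
    rfl
  rw [key, key, h]

theorem measurable_cellIdx (t : Fin d → Bool) (J : ℤ) : Measurable (cellIdx t J) := by
  refine measurable_pi_lambda _ fun i => Int.measurable_floor.comp ?_
  fun_prop

theorem setOf_cellIdx_eq (t : Fin d → Bool) (J : ℤ) (v : Fin d → ℤ) :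
    {x : Rd d | cellIdx t J x = v} = (MeasurableEquiv.toLp 2 (Fin d → ℝ)).symm ⁻¹'
      (Set.univ.pi fun i => Set.Ico ((2:ℝ) ^ J * (v i + gridShift t i * (-1) ^ J))
        ((2:ℝ) ^ J * (v i + gridShift t i * (-1) ^ J + 1))) := by
  ext x
  have hJ : (0:ℝ) < 2 ^ J := by positivity
  simp only [Set.mem_ofPred_eq, Set.mem_preimage, Set.mem_univ_pi, Set.mem_Ico, funext_iff]
  refine forall_congr' fun i => ?_
  unfold cellIdx
  rw [Int.floor_eq_iff, zpow_neg, inv_mul_eq_div]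
  change _ ↔ _ ≤ x i ∧ x i < _
  rw [mul_comm ((2:ℝ) ^ J), mul_comm ((2:ℝ) ^ J), ← le_div_iff₀ hJ, ← div_lt_iff₀ hJ]
  constructor <;> rintro ⟨h1, h2⟩ <;> constructor <;> linarith

theorem measurableSet_cell (t : Fin d → Bool) (J : ℤ) (v : Fin d → ℤ) :
    MeasurableSet {x : Rd d | cellIdx t J x = v} :=
  measurable_cellIdx t J (measurableSet_singleton v)

theorem volume_cell (t : Fin d → Bool) (J : ℤ) (v : Fin d → ℤ) :
    volume {x : Rd d | cellIdx t J x = v} = ENNReal.ofReal (((2:ℝ) ^ J) ^ d) := by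
  rw [setOf_cellIdx_eq, ((EuclideanSpace.volume_preserving_symm_measurableEquiv_toLp
    (Fin d))).measure_preimage_equiv, Real.volume_pi_Ico]
  have : ∀ i : Fin d, ENNReal.ofReal ((2:ℝ) ^ J * (v i + gridShift t i * (-1) ^ J + 1) -
      (2:ℝ) ^ J * (v i + gridShift t i * (-1) ^ J)) = ENNReal.ofReal ((2:ℝ) ^ J) := by
    intro i; congr 1; ring
  simp only [this, Finset.prod_const, Finset.card_univ, Fintype.card_fin]
  rw [ENNReal.ofReal_pow (by positivity)]

theorem norm_sub_le_of_cellIdx_eq {t : Fin d → Bool} {J : ℤ} {x y : Rd d}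
    (h : cellIdx t J x = cellIdx t J y) : ‖x - y‖ ≤ √d * 2 ^ J := by
  refine norm_le_of_abs_coord_le (by positivity) fun i => ?_
  have hi := Int.abs_sub_lt_one_of_floor_eq_floor (congrFun h i)
  have hJ : (0:ℝ) < 2 ^ J := by positivity
  rw [sub_sub_sub_cancel_right, ← mul_sub, abs_mul, abs_of_pos (by positivity), zpow_neg,
    inv_mul_eq_div, div_lt_one hJ] at hi
  exact hi.le

theorem exists_floor_eq {a e δ : ℝ} (hδ : δ < 1 / 6) (he : e = 1 / 3 ∨ e = -1 / 3) :
    (∀ y, |y - a| ≤ δ → ⌊y⌋ = ⌊a⌋) ∨ (∀ y, |y - a| ≤ δ → ⌊y - e⌋ = ⌊a - e⌋) := by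
  have h1 := Int.floor_le a
  have h2 := Int.lt_floor_add_one a
  have key : ∀ z : ℝ, ∀ k : ℤ, (k:ℝ) + 1 / 6 ≤ z → z ≤ k + 5 / 6 →
      ∀ y, |y - z| ≤ δ → ⌊y⌋ = ⌊z⌋ := by
    intro z k hk1 hk2 y hy
    rw [abs_le] at hy
    rw [(Int.floor_eq_iff.2 ⟨by linarith, by linarith⟩ : ⌊z⌋ = k), Int.floor_eq_iff]
    constructor <;> linarith
  have key' : ∀ k : ℤ, (k:ℝ) + 1 / 6 ≤ a - e → a - e ≤ k + 5 / 6 →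
      ∀ y, |y - a| ≤ δ → ⌊y - e⌋ = ⌊a - e⌋ := fun k hk1 hk2 y hy =>
    key _ k hk1 hk2 _ (by rwa [sub_sub_sub_cancel_right])
  by_cases h3 : (⌊a⌋:ℝ) + 1 / 6 ≤ a
  · by_cases h4 : a ≤ ⌊a⌋ + 5 / 6
    · exact Or.inl (key a _ h3 h4)
    · right
      rcases he with rfl | rfl
      · exact key' ⌊a⌋ (by linarith) (by linarith)
      · exact key' (⌊a⌋ + 1) (by push_cast; linarith) (by push_cast; linarith)
  · right
    rcases he with rfl | rfl
    · exact key' (⌊a⌋ - 1) (by push_cast; linarith) (by push_cast; linarith)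
    · exact key' ⌊a⌋ (by linarith) (by linarith)

theorem exists_cellIdx_eq_on_ball {J : ℤ} {R : ℝ} (hR : R < 2 ^ J / 6) (c : Rd d) :
    ∃ t : Fin d → Bool, ∀ x, ‖x - c‖ ≤ R → cellIdx t J c = cellIdx t J x := by
  have hJ : (0:ℝ) < 2 ^ J := by positivity
  have hd : R / 2 ^ J < 1 / 6 := by rw [div_lt_iff₀ hJ]; linarith
  have h : ∀ i : Fin d, ∃ t : Bool, ∀ y, |y - 2 ^ (-J) * c i| ≤ R / 2 ^ J →
      ⌊y - (if t then 1 / 3 else 0) * (-1) ^ J⌋ =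
        ⌊2 ^ (-J) * c i - (if t then 1 / 3 else 0) * (-1) ^ J⌋ := by
    intro i
    have he : (1 / 3 * (-1) ^ J : ℝ) = 1 / 3 ∨ (1 / 3 * (-1) ^ J : ℝ) = -1 / 3 := by
      rcases Int.even_or_odd J with h | h <;> rw [h.neg_one_zpow] <;> norm_num
    rcases exists_floor_eq (a := 2 ^ (-J) * c i) hd he with h | h
    · exact ⟨false, by simpa using h⟩
    · exact ⟨true, by simpa using h⟩
  choose t ht using h
  refine ⟨t, fun x hx => ?_⟩
  ext i
  refine (ht i _ ?_).symm
  rw [← mul_sub, abs_mul, abs_of_pos (by positivity), zpow_neg, inv_mul_eq_div]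
  gcongr
  refine le_trans ?_ hx
  have := EuclideanSpace.norm_eq (x - c)
  rw [this]
  refine Real.le_sqrt_of_sq_le ?_
  have h1 : |x i - c i| ^ 2 = ‖(x - c) i‖ ^ 2 := by simp [Real.norm_eq_abs]
  rw [h1]
  exact Finset.single_le_sum (f := fun j => ‖(x - c) j‖ ^ 2) (fun j _ => sq_nonneg _) (Finset.mem_univ i)

end Grids

section BadPart

variable {d : ℕ} {ι : Type*}

/-- A family of mean-zero pieces adapted to disjoint dyadic cubes, with averages at most `β`. -/
structure BadFam (s : Finset ι) (q : ι → ℤ) (Q : ι → Set (Rd d)) (c : ι → Rd d) (ρ : ℝ)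
    (b : ι → Rd d → ℝ) (β : ℝ≥0∞) : Prop where
  fam : Fam s q Q c ρ
  nice : ∀ i ∈ s, Nice (b i)
  mean : ∀ i ∈ s, ∫ x, b i x = 0
  supp : ∀ i ∈ s, ∀ x, b i x ≠ 0 → x ∈ closedBall (c i) (ρ * 2 ^ q i)
  l1 : ∀ i ∈ s, ∫⁻ x, ‖b i x‖ₑ ≤ β * volume (Q i)

variable {s t : Finset ι} {q : ι → ℤ} {Q : ι → Set (Rd d)} {c : ι → Rd d} {ρ : ℝ}
  {b : ι → Rd d → ℝ} {β : ℝ≥0∞}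

theorem BadFam.mono (h : BadFam s q Q c ρ b β) (hts : t ⊆ s) : BadFam t q Q c ρ b β :=
  ⟨h.fam.mono hts, fun i hi => h.nice i (hts hi), fun i hi => h.mean i (hts hi),
    fun i hi => h.supp i (hts hi), fun i hi => h.l1 i (hts hi)⟩

theorem exists_of_cv_ne_zero {k g : Rd d → ℝ} {x : Rd d} (h : cv k g x ≠ 0) :
    ∃ y, k (x - y) ≠ 0 ∧ g y ≠ 0 := by
  by_contra hn
  push Not at hn
  refine h (integral_eq_zero_of_ae (Filter.Eventually.of_forall fun y => ?_))
  by_cases hk : k (x - y) = 0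
  · simp [hk]
  · simp [hn y hk]

theorem norm_sub_le_of_cv_dil_ne_zero {P Ψ Om : Rd d → ℝ} {B : ℝ} (hP : Prof d P Ψ B) {j : ℤ}
    {g : Rd d → ℝ} {z : Rd d} {r : ℝ} (hg : ∀ x, g x ≠ 0 → x ∈ closedBall z r) {x : Rd d}
    (h : cv (dil j (kOm P Om)) g x ≠ 0) : ‖x - z‖ ≤ 1 / 4 * 2 ^ j + r := by
  obtain ⟨y, hy, hy'⟩ := exists_of_cv_ne_zero h
  have h1 := mem_closedBall_iff_norm.1 (hg y hy')
  have h2 := (hP.kOm_supp (right_ne_zero_of_mul hy)).2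
  have hj : (0:ℝ) < 2 ^ j := by positivity
  rw [norm_smul, Real.norm_of_nonneg (by positivity), zpow_neg, inv_mul_eq_div, div_lt_iff₀ hj] at h2
  calc ‖x - z‖ = ‖(x - y) + (y - z)‖ := by congr 1; abel
    _ ≤ ‖x - y‖ + ‖y - z‖ := norm_add_le _ _
    _ ≤ _ := add_le_add h2.le h1

/-- The square function controlling all truncations of one generation of bad pieces. -/
theorem exists_truncation_sq_bound (hd : 2 ≤ d) {P Ψ : Rd d → ℝ} {B : ℝ} (hP : Prof d P Ψ B)
    (hB : 0 < B) (hρ : 0 ≤ ρ) : ∃ C : ℝ, 0 < C ∧ ∀ (σ m : ℕ) (J : ι → ℤ) (s : Finset ι) (q : ι → ℤ)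
      (Q : ι → Set (Rd d)) (c : ι → Rd d) (b : ι → Rd d → ℝ) (β : ℝ≥0∞), BadFam s q Q c ρ b β →
      ∀ (Om : Rd d → ℝ) (A : ℝ), Measurable Om → (∀ x, |Om x| ≤ A) → Homogeneous0 d Om →
      ∀ T : Fin d → Bool, (∀ i ∈ s, ∀ x, cv (dil (q i + σ) (kOm P Om)) (b i) x ≠ 0 →
        cellIdx T (J i) (c i) = cellIdx T (J i) x) →
      ∃ G : Rd d → ℝ, Measurable G ∧ (∀ x, 0 ≤ G x) ∧
        (∀ x, (s.filter fun i => cellIdx T (J i) (c i) = cellIdx T (J i) x).card ≤ 2 ^ m → ∀ L : ℤ,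
          (∑ i ∈ s with L ≤ J i, cv (dil (q i + σ) (kOm P Om)) (b i) x) ^ 2 ≤ G x) ∧
        ∫⁻ x, ENNReal.ofReal (G x) ≤
          ENNReal.ofReal ((m + 1) ^ 2 * (C * A ^ 2 / 2 ^ σ)) * (β * ∑ i ∈ s, ∫⁻ x, ‖b i x‖ₑ) := by
  obtain ⟨C, hC, hmain⟩ := exists_sqR_sum_cv_le (ι := ι) hd hP hB hρ
  refine ⟨C, hC, ?_⟩
  intro σ m J s q Q c b β hb Om A hm hA hom T hcell
  set a : ι → Rd d → ℝ := fun i => cv (dil (q i + σ) (kOm P Om)) (b i) with ha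
  have ham : ∀ i ∈ s, Measurable (a i) := fun i hi =>
    measurable_cv (measurable_dil (hP.measurable_kOm hm) _) (hb.nice i hi).meas
  set rk := cellRank (cellIdx T) s J c with hrk
  set u : ℕ → Rd d → ℝ := fun r x => ∑ i ∈ s with rk i = r, a i x with hu
  have hum : ∀ r, Measurable (u r) := fun r =>
    Finset.measurable_sum _ fun i hi => ham i (Finset.mem_filter.1 hi).1
  set cc : ℕ → ℝ≥0∞ := fun r => ENNReal.ofReal (C * A ^ 2 / 2 ^ σ) *
    (β * ∑ i ∈ s with rk i = r, ∫⁻ x, ‖b i x‖ₑ) with hcc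
  have hfib : ∀ (M : Type) [AddCommMonoid M] (I : Finset ℕ) (f : ι → M),
      ∑ r ∈ I, ∑ i ∈ s with rk i = r, f i = ∑ i ∈ s with rk i ∈ I, f i := by
    intro M _ I f
    rw [← Finset.sum_fiberwise_of_maps_to (s := s.filter fun i => rk i ∈ I) (t := I) (g := rk)
      (fun i hi => (Finset.mem_filter.1 hi).2)]
    refine Finset.sum_congr rfl fun r hr => Finset.sum_congr ?_ fun _ _ => rfl
    ext i
    simp only [Finset.mem_filter]
    constructor
    · rintro ⟨h1, rfl⟩; exact ⟨⟨h1, hr⟩, rfl⟩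
    · rintro ⟨⟨h1, _⟩, h2⟩; exact ⟨h1, h2⟩
  have hsub : ∀ I : Finset ℕ, sqR (fun x => ∑ r ∈ I, u r x) ≤ ∑ r ∈ I, cc r := by
    intro I
    have h1 : (fun x => ∑ r ∈ I, u r x) = fun x => ∑ i ∈ s with rk i ∈ I, a i x := by
      ext x; exact hfib ℝ I _
    have h2 : ∑ r ∈ I, cc r = ENNReal.ofReal (C * A ^ 2 / 2 ^ σ) *
        (β * ∑ i ∈ s with rk i ∈ I, ∫⁻ x, ‖b i x‖ₑ) := by
      rw [← hfib, Finset.mul_sum, Finset.mul_sum]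
    rw [h1, h2]
    have hb' := hb.mono (Finset.filter_subset (fun i => rk i ∈ I) s)
    exact hmain σ _ q Q c hb'.fam Om A hm hA hom b hb'.nice hb'.mean hb'.supp β hb'.l1
  refine ⟨fun x => (m + 1) * blockSq m (fun r => u r x),
    (measurable_blockSq m u hum).const_mul _,
    fun x => mul_nonneg (by positivity) (blockSq_nonneg _ _), ?_, ?_⟩
  · intro x hx L
    exact sq_sum_filter_le_blockSq (cellIdx_nested T) s J c x (fun i => a i x)
      (fun i hi h => hcell i hi x h) hx L
  · have h1 := lintegral_blockSq_le hum hsub m 0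
    simp only [zero_add] at h1
    have h2 : ∑ r ∈ Finset.Ico 0 (2 ^ m), cc r ≤
        ENNReal.ofReal (C * A ^ 2 / 2 ^ σ) * (β * ∑ i ∈ s, ∫⁻ x, ‖b i x‖ₑ) := by
      rw [← Finset.mul_sum, ← Finset.mul_sum, hfib]
      gcongr
      exact Finset.filter_subset _ _
    have h3 : ENNReal.ofReal ((m:ℝ) + 1) = (m:ℝ≥0∞) + 1 := by
      rw [ENNReal.ofReal_add (by positivity) zero_le_one, ENNReal.ofReal_natCast, ENNReal.ofReal_one]
    simp only [ENNReal.ofReal_mul (show (0:ℝ) ≤ m + 1 by positivity)]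
    rw [lintegral_const_mul _ (measurable_blockSq m u hum).ennreal_ofReal, pow_two, mul_assoc,
      ENNReal.ofReal_mul (by positivity), ENNReal.ofReal_mul (by positivity), h3]
    calc ((m:ℝ≥0∞) + 1) * ∫⁻ x, ENNReal.ofReal (blockSq m (fun r => u r x))
        ≤ (m + 1) * ((m + 1) * (ENNReal.ofReal (C * A ^ 2 / 2 ^ σ) *
            (β * ∑ i ∈ s, ∫⁻ x, ‖b i x‖ₑ))) :=
          mul_le_mul_right (h1.trans (mul_le_mul_right h2 _)) _
      _ = _ := by ring

theorem volume_overlap_le (T : Fin d → Bool) (J : ι → ℤ) (s : Finset ι) (c : ι → Rd d) (m : ℕ) :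
    (2:ℝ≥0∞) ^ m * volume {x | 2 ^ m < (s.filter fun i =>
      cellIdx T (J i) (c i) = cellIdx T (J i) x).card} ≤
      ∑ i ∈ s, ENNReal.ofReal (((2:ℝ) ^ J i) ^ d) := by
  set f : Rd d → ℝ≥0∞ := fun x => ∑ i ∈ s,
    {y : Rd d | cellIdx T (J i) y = cellIdx T (J i) (c i)}.indicator 1 x with hf
  have hmi : ∀ i, Measurable ({y : Rd d | cellIdx T (J i) y = cellIdx T (J i) (c i)}.indicator
      (1 : Rd d → ℝ≥0∞)) := fun i => measurable_one.indicator (measurableSet_cell T _ _)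
  have hfm : Measurable f := Finset.measurable_sum _ fun i _ => hmi i
  have hcard : ∀ x, f x = ((s.filter fun i => cellIdx T (J i) (c i) = cellIdx T (J i) x).card : ℝ≥0∞) := by
    intro x
    rw [Finset.card_filter, Nat.cast_sum]
    refine Finset.sum_congr rfl fun i _ => ?_
    rw [Set.indicator_apply]
    simp only [Set.mem_ofPred_eq, eq_comm (a := cellIdx T (J i) x), Pi.one_apply]
    split_ifs <;> simp
  refine (mul_le_mul_right (measure_mono (t := {x | 2 ^ m ≤ f x}) fun x hx => ?_) _).trans
    ((mul_meas_ge_le_lintegral hfm (2 ^ m)).trans (le_of_eq ?_))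
  · rw [Set.mem_ofPred_eq] at hx ⊢
    rw [hcard]
    exact_mod_cast hx.le
  · rw [hf, lintegral_finsetSum _ fun i _ => hmi i]
    refine Finset.sum_congr rfl fun i _ => ?_
    rw [lintegral_indicator_one (measurableSet_cell T _ _), volume_cell]

end BadPart

section BadBound

variable {d : ℕ} {ι : Type*}

theorem sum_Icc_eq_sum_shift {l n q : ℤ} {S : ℕ} (hS : n - q ≤ S) {F : ℤ → ℝ}
    (hF : ∀ j ≤ q, F j = 0) :
    ∑ j ∈ Finset.Icc l n, F j =
      ∑ σ ∈ Finset.Icc 1 S with l ≤ q + (σ : ℕ) ∧ q + (σ : ℕ) ≤ n, F (q + (σ : ℕ)) := by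
  have h1 : ∑ j ∈ Finset.Icc l n, F j = ∑ j ∈ Finset.Icc l n with q < j, F j := by
    refine (Finset.sum_filter_of_ne fun j _ hj => ?_).symm
    by_contra h
    exact hj (hF j (not_lt.1 h))
  rw [h1]
  refine Finset.sum_nbij' (fun j => (j - q).toNat) (fun σ => q + σ) ?_ ?_ ?_ ?_ ?_
  · intro j hj
    simp only [Finset.mem_filter, Finset.mem_Icc] at hj ⊢
    omega
  · intro σ hσ
    simp only [Finset.mem_filter, Finset.mem_Icc] at hσ ⊢
    omega
  · intro j hj
    simp only [Finset.mem_filter, Finset.mem_Icc] at hj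
    omega
  · intro σ _
    omega
  · intro j hj
    simp only [Finset.mem_filter, Finset.mem_Icc] at hj
    congr 1
    omega

theorem sum_geometric_Icc_le {r : ℝ} (h0 : 0 ≤ r) (h1 : r < 1) (S : ℕ) :
    ∑ σ ∈ Finset.Icc 1 S, r ^ σ ≤ r / (1 - r) := by
  have h : ∑ σ ∈ Finset.Icc 1 S, r ^ σ = r * ∑ σ ∈ Finset.range S, r ^ σ := by
    rw [← Finset.Ico_add_one_right_eq_Icc, Finset.sum_Ico_eq_sum_range, Finset.mul_sum]
    refine Finset.sum_congr (by simp) fun σ _ => by rw [pow_add, pow_one]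
  rw [h, div_eq_mul_inv]
  refine mul_le_mul_of_nonneg_left ?_ h0
  rw [← tsum_geometric_of_lt_one h0 h1]
  exact (summable_geometric_of_lt_one h0 h1).sum_le_tsum _ fun σ _ => pow_nonneg h0 σ

theorem exists_sum_quadratic_geometric_le (D : ℕ) {r : ℝ} (h0 : 0 ≤ r) (h1 : r < 1) :
    ∃ V : ℝ, 0 < V ∧ ∀ S : Finset ℕ, ∑ σ ∈ S, ((D * σ : ℕ) + 1 : ℝ) ^ 2 * r ^ σ ≤ V := by
  have hr : ‖r‖ < 1 := by rwa [Real.norm_of_nonneg h0]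
  have hs : Summable fun σ : ℕ => ((D * σ : ℕ) + 1 : ℝ) ^ 2 * r ^ σ := by
    have h2 := (summable_pow_mul_geometric_of_norm_lt_one 2 hr).mul_left ((D:ℝ) ^ 2)
    have h3 := (summable_pow_mul_geometric_of_norm_lt_one 1 hr).mul_left (2 * (D:ℝ))
    have h4 := summable_geometric_of_lt_one h0 h1
    refine ((h2.add h3).add h4).congr fun σ => ?_
    push_cast
    ring
  refine ⟨∑' σ : ℕ, ((D * σ : ℕ) + 1 : ℝ) ^ 2 * r ^ σ + 1,
    add_pos_of_nonneg_of_pos (tsum_nonneg fun σ => by positivity) one_pos, fun S => ?_⟩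
  have := hs.sum_le_tsum S fun σ _ => by positivity
  linarith

variable {s : Finset ι} {q : ι → ℤ} {Q : ι → Set (Rd d)} {c : ι → Rd d} {ρ : ℝ}
  {b : ι → Rd d → ℝ} {β : ℝ≥0∞} {P Ψ Om : Rd d → ℝ} {A B D : ℝ}

theorem BadFam.sum_cv_eq (h : BadFam s q Q c ρ b β) (hP : Prof d P Ψ B) (hO : OmData d P Om A D)
    {x : Rd d} (hx : ∀ i ∈ s, (1 / 4 + ρ) * 2 ^ q i < ‖x - c i‖) {n : ℤ} {S : ℕ}
    (hS : ∀ i ∈ s, n - q i ≤ S) (l : ℤ) :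
    ∑ j ∈ Finset.Icc l n, cv (dil j (kOm P Om)) (fun y => ∑ i ∈ s, b i y) x =
      ∑ σ ∈ Finset.Icc 1 S, ∑ i ∈ s with l ≤ q i + (σ : ℕ) ∧ q i + (σ : ℕ) ≤ n,
          cv (dil (q i + σ) (kOm P (lo A σ Om))) (b i) x +
      ∑ σ ∈ Finset.Icc 1 S, ∑ i ∈ s with l ≤ q i + (σ : ℕ) ∧ q i + (σ : ℕ) ≤ n,
          cv (dil (q i + σ) (kOm P (hi A σ Om))) (b i) x := by
  have h1 : ∀ j, cv (dil j (kOm P Om)) (fun y => ∑ i ∈ s, b i y) x =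
      ∑ i ∈ s, cv (dil j (kOm P Om)) (b i) x := fun j =>
    cv_sum_right ((hO.im hP).dil j).int h.nice x
  have h2 : ∀ i ∈ s, ∑ j ∈ Finset.Icc l n, cv (dil j (kOm P Om)) (b i) x =
      ∑ σ ∈ Finset.Icc 1 S with l ≤ q i + (σ : ℕ) ∧ q i + (σ : ℕ) ≤ n,
        cv (dil (q i + (σ : ℕ)) (kOm P Om)) (b i) x := by
    intro i hi
    refine sum_Icc_eq_sum_shift (F := fun j => cv (dil j (kOm P Om)) (b i) x) (hS i hi) fun j hj => ?_
    by_contra hne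
    have h3 := norm_sub_le_of_cv_dil_ne_zero hP (h.supp i hi) hne
    have h4 : (2:ℝ) ^ j ≤ 2 ^ q i := zpow_le_zpow_right₀ one_le_two hj
    have := hx i hi
    linarith
  have h5 : ∀ i ∈ s, ∀ σ : ℕ, cv (dil (q i + (σ : ℕ)) (kOm P Om)) (b i) x =
      cv (dil (q i + σ) (kOm P (lo A σ Om))) (b i) x +
        cv (dil (q i + σ) (kOm P (hi A σ Om))) (b i) x := by
    intro i hi σ
    rw [← cv_add_left ((hO.im_lo hP σ).dil _).int ((hO.im_hi hP σ).dil _).int (h.nice i hi)]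
    congr 1
    ext y
    rw [kOm_lo_add_hi P A σ Om]
    simp only [dil, mul_add]
  simp only [h1]
  rw [Finset.sum_comm, Finset.sum_congr rfl h2, ← Finset.sum_add_distrib]
  simp only [← Finset.sum_add_distrib, Finset.sum_filter]
  rw [Finset.sum_comm]
  refine Finset.sum_congr rfl fun σ _ => Finset.sum_congr rfl fun i hi => ?_
  split_ifs
  · exact h5 i hi σ
  · rw [add_zero]

end BadBound

section BadBound

variable {d : ℕ} {ι : Type*}
variable {s : Finset ι} {q : ι → ℤ} {Q : ι → Set (Rd d)} {c : ι → Rd d} {ρ : ℝ}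
  {b : ι → Rd d → ℝ} {β : ℝ≥0∞} {P Ψ Om : Rd d → ℝ} {A B D : ℝ}

theorem BadFam.volume_enlarged_le (h : BadFam s q Q c ρ b β) :
    volume (⋃ i ∈ s, closedBall (c i) ((1 / 4 + ρ) * 2 ^ q i)) ≤
      ENNReal.ofReal ((1 / 4 + ρ) ^ d * vb d 1) * ∑ i ∈ s, volume (Q i) := by
  have hρ := h.fam.ρ_nonneg
  refine (measure_biUnion_finset_le _ _).trans ?_
  rw [Finset.mul_sum]
  refine Finset.sum_le_sum fun i hi => le_of_eq ?_
  have := vb_nonneg (d := d) 1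
  rw [volume_closedBall_eq _ (by positivity), h.fam.vol i hi, ← ENNReal.ofReal_mul (by positivity)]
  congr 1
  rw [mul_pow]; ring

theorem BadFam.lintegral_hi_le (h : BadFam s q Q c ρ b β) (hP : Prof d P Ψ B)
    (hO : OmData d P Om A D) (S : Finset ℕ) :
    ∫⁻ x, ∑ σ ∈ S, ∑ i ∈ s, ‖cv (dil (q i + (σ:ℕ)) (kOm P (hi A σ Om))) (b i) x‖ₑ ≤
      ENNReal.ofReal (B * D) * ∑ i ∈ s, ∫⁻ x, ‖b i x‖ₑ := by
  have hm : ∀ σ : ℕ, ∀ i ∈ s, Measurable fun x =>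
      ‖cv (dil (q i + σ) (kOm P (hi A σ Om))) (b i) x‖ₑ := fun σ i hi =>
    (measurable_cv ((hO.im_hi hP σ).dil _).meas (h.nice i hi).meas).enorm
  rw [lintegral_finsetSum' _ fun σ _ => (Finset.measurable_sum _ fun i hi => hm σ i hi).aemeasurable]
  refine le_trans (Finset.sum_le_sum (g := fun σ : ℕ => (∫⁻ x, ‖kOm P (hi A σ Om) x‖ₑ) *
    ∑ i ∈ s, ∫⁻ x, ‖b i x‖ₑ) fun σ _ => ?_) ?_
  · rw [lintegral_finsetSum' _ fun i hi => (hm σ i hi).aemeasurable, Finset.mul_sum]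
    refine Finset.sum_le_sum fun i hi => ?_
    refine (lintegral_enorm_cv_le ((hO.im_hi hP σ).dil _).meas (h.nice i hi).meas).trans ?_
    rw [lintegral_enorm_dil]
  · rw [← Finset.sum_mul]
    exact mul_le_mul_left ((ENNReal.sum_le_tsum S).trans (hO.tsum_hi_le hP)) _

theorem exists_bad_bound (hd : 2 ≤ d) (hP : Prof d P Ψ B) (hB : 0 < B) (hρ : 0 ≤ ρ) :
    ∃ C : ℝ, 0 < C ∧ ∀ (s : Finset ι) (q : ι → ℤ) (Q : ι → Set (Rd d)) (c : ι → Rd d)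
      (b : ι → Rd d → ℝ) (β : ℝ≥0∞), BadFam s q Q c ρ b β →
      ∀ (Om : Rd d → ℝ) (A D : ℝ), OmData d P Om A D → ∀ (n : ℤ) (μ : ℝ), 0 < μ →
      volume {x | ∃ l : ℤ, μ < |∑ j ∈ Finset.Icc l n,
        cv (dil j (kOm P Om)) (fun y => ∑ i ∈ s, b i y) x|} ≤
        ENNReal.ofReal C * ∑ i ∈ s, volume (Q i) +
        ENNReal.ofReal (C * D / μ) * (∑ i ∈ s, ∫⁻ x, ‖b i x‖ₑ) +
        ENNReal.ofReal (C * A ^ 2 / μ ^ 2) * (β * ∑ i ∈ s, ∫⁻ x, ‖b i x‖ₑ) := by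
  obtain ⟨C1, hC1, hsq⟩ := exists_truncation_sq_bound (ι := ι) hd hP hB hρ
  obtain ⟨V, hV, hVs⟩ := exists_sum_quadratic_geometric_le (d + 1)
    (by norm_num : (0:ℝ) ≤ 15 / 16) (by norm_num)
  obtain ⟨m0, hm0⟩ : ∃ m0 : ℕ, 6 * (1 / 4 + ρ) < 2 ^ m0 := pow_unbounded_of_one_lt _ one_lt_two
  set CE : ℝ := (1 / 4 + ρ) ^ d * vb d 1 + 2 ^ d * (2 ^ m0) ^ d with hCE
  set CW : ℝ := 2 ^ d * 5 with hCW
  have hvb := vb_nonneg (d := d) 1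
  refine ⟨CE + 2 * B + 4 * (CW * (2 ^ d * (C1 * V))), by positivity, ?_⟩
  intro s q Q c b β hb Om A D hO n μ hμ
  have hA := hO.A_pos
  set S : ℕ := ∑ i ∈ s, (n - q i).toNat with hS
  have hSi : ∀ i ∈ s, n - q i ≤ S := fun i hi => (Int.self_le_toNat _).trans
    (by exact_mod_cast Finset.single_le_sum (f := fun i => (n - q i).toNat) (fun _ _ => Nat.zero_le _) hi)
  set β₁ := ∑ i ∈ s, ∫⁻ x, ‖b i x‖ₑ with hβ₁
  set VQ := ∑ i ∈ s, volume (Q i) with hVQ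
  -- grids
  have hgrid : ∀ (σ : ℕ) (i : ι), ∃ t : Fin d → Bool, ∀ x,
      ‖x - c i‖ ≤ (1 / 4 + ρ) * 2 ^ (q i + σ) →
      cellIdx t (q i + σ + m0) (c i) = cellIdx t (q i + σ + m0) x := by
    intro σ i
    refine exists_cellIdx_eq_on_ball ?_ (c i)
    rw [zpow_add₀ two_ne_zero (q i + σ), zpow_natCast]
    have : (0:ℝ) < 2 ^ (q i + (σ:ℤ)) := by positivity
    nlinarith
  choose tt htt using hgrid
  set sf : ℕ → (Fin d → Bool) → Finset ι := fun σ T =>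
    s.filter fun i => q i + (σ:ℕ) ≤ n ∧ tt σ i = T with hsf
  set J : ℕ → ι → ℤ := fun σ i => q i + σ + m0 with hJ
  have hsfs : ∀ σ T, sf σ T ⊆ s := fun σ T => Finset.filter_subset _ _
  have hG : ∀ (σ : ℕ) (T : Fin d → Bool), ∃ G : Rd d → ℝ, Measurable G ∧ (∀ x, 0 ≤ G x) ∧
      (∀ x, ((sf σ T).filter fun i => cellIdx T (J σ i) (c i) = cellIdx T (J σ i) x).card ≤
          2 ^ ((d + 1) * σ) → ∀ L : ℤ,
        (∑ i ∈ sf σ T with L ≤ J σ i, cv (dil (q i + σ) (kOm P (lo A σ Om))) (b i) x) ^ 2 ≤ G x) ∧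
      ∫⁻ x, ENNReal.ofReal (G x) ≤ ENNReal.ofReal ((((d + 1) * σ : ℕ) + 1) ^ 2 *
        (C1 * ((5 / 4) ^ σ * A) ^ 2 / 2 ^ σ)) * (β * β₁) := by
    intro σ T
    obtain ⟨G, h1, h2, h3, h4⟩ := hsq σ ((d + 1) * σ) (J σ) (sf σ T) q Q c b β (hb.mono (hsfs σ T))
      (lo A σ Om) ((5 / 4) ^ σ * A) (measurable_lo A σ hO.meas) (abs_lo_le hA.le σ Om)
      (homogeneous_lo A σ hO.hom) T (by
        intro i hi x hx
        have hi' := (Finset.mem_filter.1 hi)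
        have h5 := norm_sub_le_of_cv_dil_ne_zero hP (hb.supp i hi'.1) hx
        rw [← hi'.2.2]
        refine htt σ i x (h5.trans ?_)
        have h6 : (2:ℝ) ^ q i ≤ 2 ^ (q i + (σ:ℤ)) := zpow_le_zpow_right₀ one_le_two (by omega)
        nlinarith)
    refine ⟨G, h1, h2, h3, h4.trans ?_⟩
    gcongr
    exact Finset.sum_le_sum_of_subset (hsfs σ T)
  choose G hGm hG0 hGsq hGi using hG
  -- the exceptional sets
  set I := Finset.Icc 1 S ×ˢ (Finset.univ : Finset (Fin d → Bool)) with hI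
  set E : ℕ × (Fin d → Bool) → Set (Rd d) := fun κ => {x | 2 ^ ((d + 1) * κ.1) <
    ((sf κ.1 κ.2).filter fun i =>
      cellIdx κ.2 (J κ.1 i) (c i) = cellIdx κ.2 (J κ.1 i) x).card} with hE
  set H : Rd d → ℝ≥0∞ := fun x => ∑ σ ∈ Finset.Icc 1 S, ∑ i ∈ s,
    ‖cv (dil (q i + (σ:ℕ)) (kOm P (hi A σ Om))) (b i) x‖ₑ with hH
  set Gt : Rd d → ℝ := fun x => ∑ κ ∈ I, CW * (6 / 5) ^ κ.1 * G κ.1 κ.2 x with hGt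
  have hsub : {x | ∃ l : ℤ, μ < |∑ j ∈ Finset.Icc l n,
        cv (dil j (kOm P Om)) (fun y => ∑ i ∈ s, b i y) x|} ⊆
      (((⋃ i ∈ s, closedBall (c i) ((1 / 4 + ρ) * 2 ^ q i)) ∪ ⋃ κ ∈ I, E κ) ∪
        {x | ENNReal.ofReal (μ / 2) ≤ H x}) ∪
        {x | ENNReal.ofReal (μ ^ 2 / 4) ≤ ENNReal.ofReal (Gt x)} := by
    rintro x ⟨l, hl⟩
    by_contra hx
    simp only [Set.mem_union, not_or, Set.mem_iUnion, not_exists, Set.mem_ofPred_eq, not_le] at hx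
    obtain ⟨⟨⟨hx1, hx2⟩, hx3⟩, hx4⟩ := hx
    rw [hb.sum_cv_eq hP hO (fun i hi => by
      have := hx1 i hi
      rwa [mem_closedBall_iff_norm, not_le] at this) hSi l] at hl
    set LO := ∑ σ ∈ Finset.Icc 1 S, ∑ i ∈ s with l ≤ q i + (σ : ℕ) ∧ q i + (σ : ℕ) ≤ n,
          cv (dil (q i + σ) (kOm P (lo A σ Om))) (b i) x with hLO
    set HI := ∑ σ ∈ Finset.Icc 1 S, ∑ i ∈ s with l ≤ q i + (σ : ℕ) ∧ q i + (σ : ℕ) ≤ n,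
          cv (dil (q i + σ) (kOm P (hi A σ Om))) (b i) x with hHI
    have hHI' : |HI| < μ / 2 := by
      have h1 : ENNReal.ofReal |HI| ≤ H x := by
        rw [← Real.norm_eq_abs, ofReal_norm]
        refine (enorm_sum_le _ _).trans (Finset.sum_le_sum fun σ _ => (enorm_sum_le _ _).trans ?_)
        exact Finset.sum_le_sum_of_subset (Finset.filter_subset _ _)
      exact (ENNReal.ofReal_lt_ofReal_iff (by positivity)).1 (h1.trans_lt hx3)
    have hLO' : |LO| ≤ μ / 2 := by
      refine abs_le_of_sq_le_sq (le_trans ?_ (le_trans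
        ((ENNReal.ofReal_lt_ofReal_iff (by positivity)).1 hx4).le (by rw [div_pow]; norm_num)))
        (by positivity)
      have h1 : LO = ∑ κ ∈ I, ∑ i ∈ sf κ.1 κ.2 with l + m0 ≤ J κ.1 i,
          cv (dil (q i + κ.1) (kOm P (lo A κ.1 Om))) (b i) x := by
        rw [hI, Finset.sum_product, hLO]
        refine Finset.sum_congr rfl fun σ _ => ?_
        rw [← Finset.sum_fiberwise _ (tt σ)]
        refine Finset.sum_congr rfl fun T _ => Finset.sum_congr ?_ fun _ _ => rfl
        ext i
        simp only [Finset.mem_filter, hsf, hJ, add_le_add_iff_right]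
        tauto
      rw [h1]
      refine (Finset.sum_sq_le_sum_mul_sum_of_sq_le_mul I (f := fun κ => (5 / 6) ^ κ.1)
        (g := fun κ => (6 / 5) ^ κ.1 * G κ.1 κ.2 x) (fun κ _ => by positivity)
        (fun κ _ => mul_nonneg (by positivity) (hG0 _ _ _)) fun κ hκ => ?_).trans ?_
      · rw [← mul_assoc, ← mul_pow]
        norm_num only [one_pow, one_mul]
        exact hGsq κ.1 κ.2 x (not_lt.1 (hx2 κ hκ)) _
      · rw [hGt]
        simp only [mul_assoc, ← Finset.mul_sum]
        refine mul_le_mul_of_nonneg_right ?_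
          (Finset.sum_nonneg fun κ _ => mul_nonneg (by positivity) (hG0 _ _ _))
        rw [hI, Finset.sum_product_right]
        refine (Finset.sum_le_card_nsmul _ _ 5 fun T _ => ?_).trans ?_
        · exact (sum_geometric_Icc_le (by norm_num) (by norm_num) S).trans (by norm_num)
        · simp [hCW]
    have := abs_add_le LO HI
    linarith
  have hE1 : volume (⋃ κ ∈ I, E κ) ≤ ENNReal.ofReal (2 ^ d * (2 ^ m0) ^ d) * VQ := by
    refine (measure_biUnion_finset_le _ _).trans ?_
    have h1 : ∀ κ ∈ I, volume (E κ) ≤ ENNReal.ofReal ((2 ^ m0) ^ d * (1 / 2) ^ κ.1) * VQ := by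
      intro κ _
      have h2 := volume_overlap_le κ.2 (J κ.1) (sf κ.1 κ.2) c ((d + 1) * κ.1)
      have h3 : ∑ i ∈ sf κ.1 κ.2, ENNReal.ofReal (((2:ℝ) ^ J κ.1 i) ^ d) ≤
          ENNReal.ofReal ((2 ^ (κ.1 + m0)) ^ d) * VQ := by
        refine (Finset.sum_le_sum_of_subset (hsfs _ _)).trans ?_
        rw [hVQ, Finset.mul_sum]
        refine Finset.sum_le_sum fun i hi => le_of_eq ?_
        rw [hb.fam.vol i hi, ← ENNReal.ofReal_mul (by positivity), ← mul_pow]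
        congr 2
        simp only [hJ]
        rw [add_assoc, zpow_add₀ two_ne_zero, mul_comm]
        norm_cast
      have h4 : ENNReal.ofReal ((2 ^ m0) ^ d * (1 / 2) ^ κ.1) * VQ =
          ENNReal.ofReal ((1 / 2) ^ ((d + 1) * κ.1)) *
            (ENNReal.ofReal ((2 ^ (κ.1 + m0)) ^ d) * VQ) := by
        rw [← mul_assoc, ← ENNReal.ofReal_mul (by positivity)]
        congr 2
        have h5 : ((1 / 2 : ℝ) ^ κ.1) ^ d * ((2:ℝ) ^ κ.1) ^ d = 1 := by
          rw [← mul_pow, ← mul_pow]; norm_num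
        rw [pow_add, mul_pow, add_mul, one_mul, pow_add, pow_mul' (1 / 2 : ℝ) d κ.1]
        linear_combination (-((2:ℝ) ^ m0) ^ d * (1 / 2) ^ κ.1) * h5
      rw [h4]
      refine le_trans (le_of_eq ?_) (mul_le_mul_right (h2.trans h3) _)
      have h5 : (2:ℝ≥0∞) ^ ((d + 1) * κ.1) = ENNReal.ofReal (2 ^ ((d + 1) * κ.1)) := by
        rw [ENNReal.ofReal_pow (by norm_num)]; norm_num
      rw [h5, ← mul_assoc, ← ENNReal.ofReal_mul (by positivity), ← mul_pow,
        show (1 / 2 * 2 : ℝ) = 1 by norm_num, one_pow, ENNReal.ofReal_one, one_mul]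
    refine (Finset.sum_le_sum h1).trans ?_
    rw [← Finset.sum_mul, ← ENNReal.ofReal_sum_of_nonneg fun κ _ => by positivity, ← Finset.mul_sum]
    refine mul_le_mul_left (ENNReal.ofReal_le_ofReal ?_) _
    rw [mul_comm ((2:ℝ) ^ d)]
    refine mul_le_mul_of_nonneg_left ?_ (by positivity)
    rw [hI, Finset.sum_product_right]
    refine (Finset.sum_le_card_nsmul _ _ 1 fun T _ => ?_).trans ?_
    · exact (sum_geometric_Icc_le (by norm_num) (by norm_num) S).trans (by norm_num)
    · simp
  have hH1 : volume {x | ENNReal.ofReal (μ / 2) ≤ H x} ≤ ENNReal.ofReal (2 * B * D / μ) * β₁ := by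
    have hm : Measurable H := Finset.measurable_sum _ fun σ _ => Finset.measurable_sum _ fun i hi =>
      (measurable_cv ((hO.im_hi hP σ).dil _).meas (hb.nice i hi).meas).enorm
    have hpos : ENNReal.ofReal (μ / 2) ≠ 0 := by
      simpa using hμ
    refine (meas_ge_le_lintegral_div hm.aemeasurable hpos ENNReal.ofReal_ne_top).trans ?_
    refine (ENNReal.div_le_div_right (hb.lintegral_hi_le hP hO _) _).trans (le_of_eq ?_)
    rw [mul_comm, mul_div_assoc, ← ENNReal.ofReal_div_of_pos (by positivity), mul_comm]
    congr 2
    field_simp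
  have hG1 : volume {x | ENNReal.ofReal (μ ^ 2 / 4) ≤ ENNReal.ofReal (Gt x)} ≤
      ENNReal.ofReal (4 * (CW * (2 ^ d * (C1 * V))) * A ^ 2 / μ ^ 2) * (β * β₁) := by
    have hm : Measurable Gt := Finset.measurable_sum _ fun κ _ => (hGm κ.1 κ.2).const_mul _
    have hpos : ENNReal.ofReal (μ ^ 2 / 4) ≠ 0 := by
      have : 0 < μ ^ 2 / 4 := by positivity
      simpa using this
    refine (meas_ge_le_lintegral_div hm.ennreal_ofReal.aemeasurable hpos ENNReal.ofReal_ne_top).trans ?_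
    have h1 : ∫⁻ x, ENNReal.ofReal (Gt x) ≤
        ENNReal.ofReal ((CW * (2 ^ d * (C1 * V))) * A ^ 2) * (β * β₁) := by
      have h2 : ∀ x, ENNReal.ofReal (Gt x) = ∑ κ ∈ I,
          ENNReal.ofReal (CW * (6 / 5) ^ κ.1) * ENNReal.ofReal (G κ.1 κ.2 x) := by
        intro x
        rw [hGt, ENNReal.ofReal_sum_of_nonneg fun κ _ => mul_nonneg (by positivity) (hG0 _ _ _)]
        exact Finset.sum_congr rfl fun κ _ => ENNReal.ofReal_mul (by positivity)
      simp only [h2]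
      rw [lintegral_finsetSum' _ fun κ _ =>
        ((hGm κ.1 κ.2).ennreal_ofReal.const_mul _).aemeasurable]
      have h3 : ∀ κ ∈ I, ∫⁻ x, ENNReal.ofReal (CW * (6 / 5) ^ κ.1) * ENNReal.ofReal (G κ.1 κ.2 x) ≤
          ENNReal.ofReal ((CW * C1 * A ^ 2) * ((((d + 1) * κ.1 : ℕ) + 1) ^ 2 * (15 / 16) ^ κ.1)) *
            (β * β₁) := by
        intro κ _
        rw [lintegral_const_mul _ (hGm κ.1 κ.2).ennreal_ofReal]
        refine (mul_le_mul_right (hGi κ.1 κ.2) _).trans (le_of_eq ?_)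
        rw [← mul_assoc, ← ENNReal.ofReal_mul (by positivity)]
        congr 2
        have h4 : (15 / 16 : ℝ) ^ κ.1 = (6 / 5) ^ κ.1 * ((5 / 4) ^ κ.1) ^ 2 / 2 ^ κ.1 := by
          rw [← pow_mul, mul_comm κ.1 2, pow_mul, ← mul_pow, ← div_pow]; norm_num
        rw [h4]
        ring
      refine (Finset.sum_le_sum h3).trans ?_
      rw [← Finset.sum_mul, ← ENNReal.ofReal_sum_of_nonneg fun κ _ => by positivity,
        ← Finset.mul_sum]
      refine mul_le_mul_left (ENNReal.ofReal_le_ofReal ?_) _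
      have h5 : ∑ κ ∈ I, ((((d + 1) * κ.1 : ℕ) + 1 : ℝ) ^ 2 * (15 / 16) ^ κ.1) ≤ 2 ^ d * V := by
        rw [hI, Finset.sum_product_right]
        refine (Finset.sum_le_card_nsmul _ _ V fun T _ => hVs _).trans ?_
        simp
      calc _ ≤ CW * C1 * A ^ 2 * (2 ^ d * V) := mul_le_mul_of_nonneg_left h5 (by positivity)
        _ = _ := by ring
    refine (ENNReal.div_le_div_right h1 _).trans (le_of_eq ?_)
    rw [mul_comm, mul_div_assoc, ← ENNReal.ofReal_div_of_pos (by positivity), mul_comm]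
    congr 2
    field_simp
  refine (measure_mono hsub).trans ((measure_union_le _ _).trans (add_le_add
    ((measure_union_le _ _).trans (add_le_add ((measure_union_le _ _).trans
      ((add_le_add hb.volume_enlarged_le hE1).trans ?_)) (hH1.trans ?_))) (hG1.trans ?_)))
  · rw [← add_mul, ← ENNReal.ofReal_add (by positivity) (by positivity)]
    refine mul_le_mul_left (ENNReal.ofReal_le_ofReal ?_) _
    have : 0 ≤ 2 * B + 4 * (CW * (2 ^ d * (C1 * V))) := by positivity
    linarith
  · refine mul_le_mul_left (ENNReal.ofReal_le_ofReal ?_) _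
    have hD := hO.D_pos
    have : 0 ≤ CE + 4 * (CW * (2 ^ d * (C1 * V))) := by positivity
    gcongr
    linarith
  · refine mul_le_mul_left (ENNReal.ofReal_le_ofReal ?_) _
    have : 0 ≤ CE + 2 * B := by positivity
    gcongr
    linarith

end BadBound

section Mollifier

variable {d : ℕ}

/-- A nonnegative Lipschitz function of integral one, supported in the unit ball. -/
structure Bump (χ : Rd d → ℝ) (c : ℝ) : Prop where
  nice : Nice χ
  nonneg : ∀ x, 0 ≤ χ x
  le : ∀ x, χ x ≤ c
  lip : ∀ x y, |χ x - χ y| ≤ c * ‖x - y‖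
  supp : ∀ x, χ x ≠ 0 → ‖x‖ ≤ 1
  integral : ∫ x, χ x = 1

theorem exists_bump (d : ℕ) : ∃ (χ : Rd d → ℝ) (c : ℝ), 0 < c ∧ Bump χ c := by
  set t : Rd d → ℝ := fun x => max (1 - ‖x‖) 0 with ht
  have hcont : Continuous t := by fun_prop
  have h0 : ∀ x, 0 ≤ t x := fun x => le_max_right _ _
  have h1 : ∀ x, t x ≤ 1 := fun x => max_le (by linarith [norm_nonneg x]) zero_le_one
  have hsupp : ∀ x, t x ≠ 0 → ‖x‖ ≤ 1 := by
    intro x hx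
    by_contra! h
    exact hx (max_eq_right (by linarith))
  have hnice : Nice t := Nice.of_bounded_support hcont.measurable
    (fun x => by rw [abs_of_nonneg (h0 x)]; exact h1 x) hsupp
  have hcs : HasCompactSupport t := by
    refine HasCompactSupport.intro (isCompact_closedBall (0 : Rd d) 1) fun x hx => ?_
    by_contra h
    exact hx (mem_closedBall_zero_iff.2 (hsupp x h))
  have hpos : 0 < ∫ x, t x := hcont.integral_pos_of_hasCompactSupport_nonneg_nonzero hcs h0
    (x := 0) (by simp [ht])
  have hc : 0 < (∫ x, t x)⁻¹ := inv_pos.2 hpos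
  refine ⟨fun x => (∫ x, t x)⁻¹ * t x, (∫ x, t x)⁻¹, hc, hnice.const_mul _,
    fun x => mul_nonneg hc.le (h0 x), fun x => mul_le_of_le_one_right hc.le (h1 x),
    fun x y => ?_, fun x hx => hsupp x (right_ne_zero_of_mul hx), ?_⟩
  · rw [← mul_sub, abs_mul, abs_of_pos hc]
    refine mul_le_mul_of_nonneg_left ?_ hc.le
    refine (abs_max_sub_max_le_abs _ _ _).trans ?_ |>.trans (abs_norm_sub_norm_le x y)
    rw [abs_sub_comm]
    exact le_of_eq (congrArg _ (by ring))
  · rw [integral_const_mul, inv_mul_cancel₀ hpos.ne']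

theorem norm_integral_sub_ftr_le {k : Rd d → ℝ} (hk : Integrable k) {R : ℝ}
    (hR : ∀ x, k x ≠ 0 → ‖x‖ ≤ R) (ξ : Rd d) :
    ‖((∫ x, k x : ℝ) : ℂ) - ftr k ξ‖ ≤ 2 * Real.pi * ‖ξ‖ * R * ∫ x, |k x| := by
  have h0 : Integrable fun x => (k x : ℂ) := hk.ofReal
  rw [ftr_apply, ← integral_complex_ofReal, ← integral_sub h0 (integrable_exp_mul hk ξ),
    ← integral_const_mul]
  refine norm_integral_le_of_norm_le (hk.abs.const_mul _) (ae_of_all _ fun x => ?_)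
  have h1 : (k x : ℂ) - Complex.exp (↑(-2 * Real.pi * inner ℝ x ξ) * Complex.I) * k x =
      -(Complex.exp (Complex.I * ↑(-2 * Real.pi * inner ℝ x ξ)) - 1) * k x := by
    rw [mul_comm Complex.I]; ring
  change ‖(k x : ℂ) - Complex.exp (↑(-2 * Real.pi * inner ℝ x ξ) * Complex.I) * k x‖ ≤ _
  rw [h1, norm_mul, norm_neg, Complex.norm_real, Real.norm_eq_abs]
  by_cases hx : k x = 0
  · simp [hx]
  refine mul_le_mul_of_nonneg_right ?_ (abs_nonneg _)
  refine Real.norm_exp_I_mul_ofReal_sub_one_le.trans ?_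
  rw [Real.norm_eq_abs, abs_mul, abs_mul, abs_neg, abs_of_pos Real.pi_pos, abs_two]
  have h2 := abs_real_inner_le_norm x ξ
  have h3 : ‖x‖ * ‖ξ‖ ≤ R * ‖ξ‖ := mul_le_mul_of_nonneg_right (hR x hx) (norm_nonneg _)
  have h4 := mul_le_mul_of_nonneg_left (h2.trans h3) (by positivity : 0 ≤ 2 * Real.pi)
  linarith

theorem Bump.integral_abs {χ : Rd d → ℝ} {c : ℝ} (h : Bump χ c) : ∫ x, |χ x| = 1 := by
  simp_rw [abs_of_nonneg (h.nonneg _)]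
  exact h.integral

theorem Bump.norm_one_sub_ftr_le {χ : Rd d → ℝ} {c : ℝ} (h : Bump χ c) (ξ : Rd d) :
    ‖1 - ftr χ ξ‖ ≤ 2 * Real.pi * ‖ξ‖ := by
  have := norm_integral_sub_ftr_le h.nice.int h.supp ξ
  rw [h.integral, h.integral_abs] at this
  simpa using this

theorem Bump.norm_one_sub_ftr_le_two {χ : Rd d → ℝ} {c : ℝ} (h : Bump χ c) (ξ : Rd d) :
    ‖1 - ftr χ ξ‖ ≤ 2 := by
  refine (norm_sub_le _ _).trans ?_
  have := norm_ftr_le χ ξ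
  rw [h.integral_abs] at this
  rw [norm_one]
  linarith

theorem dil_ne_zero {k : Rd d → ℝ} {R : ℝ} (hR : ∀ x, k x ≠ 0 → ‖x‖ ≤ R) (j : ℤ) {x : Rd d}
    (hx : dil j k x ≠ 0) : ‖x‖ ≤ R * 2 ^ j := by
  have h := hR _ (right_ne_zero_of_mul hx)
  rw [norm_smul, Real.norm_of_nonneg (by positivity), zpow_neg, inv_mul_le_iff₀ (by positivity)] at h
  linarith

theorem Nice.sq {U : Rd d → ℝ} (hU : Nice U) : Nice (fun x => U x ^ 2) := by
  obtain ⟨C, hC⟩ := hU.bdd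
  refine ⟨⟨hU.meas.pow_const 2, ?_⟩, C ^ 2, fun x => ?_⟩
  · have := hU.int.bdd_mul (c := C) hU.meas.aestronglyMeasurable (ae_of_all _ fun x => hC x)
    exact this.congr (ae_of_all _ fun x => (_root_.sq (U x)).symm)
  · rw [abs_pow]
    exact pow_le_pow_left₀ (abs_nonneg _) (hC x) 2

/-- Jensen's inequality for an average. -/
theorem sq_cv_le {k U : Rd d → ℝ} (hk : Nice k) (h0 : ∀ x, 0 ≤ k x) (h1 : ∫ x, k x = 1)
    (hU : Nice U) (x : Rd d) : (cv k U x) ^ 2 ≤ cv k (fun y => U y ^ 2) x := by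
  set a := cv k U x with ha
  have i0 : Integrable fun y => k (x - y) := hk.int.comp_sub_left x
  have i1 : Integrable fun y => k (x - y) * U y := integrable_cv_integrand hk.int hU x
  have i2 : Integrable fun y => k (x - y) * U y ^ 2 := integrable_cv_integrand hk.int hU.sq x
  have e0 : ∫ y, k (x - y) = 1 := by rw [integral_sub_left_eq_self, h1]
  have h : 0 ≤ ∫ y, k (x - y) * (U y - a) ^ 2 :=
    integral_nonneg fun y => mul_nonneg (h0 _) (sq_nonneg _)
  have e : ∫ y, k (x - y) * (U y - a) ^ 2 =
      ∫ y, (k (x - y) * U y ^ 2 - 2 * a * (k (x - y) * U y)) + a ^ 2 * k (x - y) :=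
    integral_congr_ae (ae_of_all _ fun y => by ring)
  have i3 : Integrable fun y => k (x - y) * U y ^ 2 - 2 * a * (k (x - y) * U y) :=
    i2.sub (i1.const_mul _)
  rw [e, integral_add i3 (i0.const_mul _), integral_sub i2 (i1.const_mul _),
    integral_const_mul, integral_const_mul, e0] at h
  have e1 : ∫ y, k (x - y) * U y = a := rfl
  rw [e1] at h
  change a ^ 2 ≤ ∫ y, k (x - y) * U y ^ 2
  linarith [_root_.sq a]

theorem Bump.sq_cv_dil_le {χ U : Rd d → ℝ} {c : ℝ} (hc : 0 < c) (h : Bump χ c) (hU : Nice U)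
    (l : ℤ) (x : Rd d) :
    ENNReal.ofReal ((cv (dil l χ) U x) ^ 2) * volume (closedBall x ((2:ℝ) ^ l)) ≤
      ENNReal.ofReal (c * vb d 1) * ∫⁻ y in closedBall x ((2:ℝ) ^ l), ENNReal.ofReal (U y ^ 2) := by
  have hn := h.nice.dil l
  have h0 : ∀ x, 0 ≤ dil l χ x := fun x => mul_nonneg (by positivity) (h.nonneg _)
  have h1 : cv (dil l χ) (fun y => U y ^ 2) x ≤
      (((2:ℝ) ^ (-l)) ^ d * c) * ∫ y in closedBall x ((2:ℝ) ^ l), U y ^ 2 := by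
    unfold cv
    rw [← integral_const_mul, ← integral_indicator measurableSet_closedBall]
    refine integral_mono (integrable_cv_integrand hn.int hU.sq x)
      ((hU.sq.int.const_mul _).indicator measurableSet_closedBall) fun y => ?_
    by_cases hy : y ∈ closedBall x ((2:ℝ) ^ l)
    · rw [Set.indicator_of_mem hy]
      exact mul_le_mul_of_nonneg_right (mul_le_mul_of_nonneg_left (h.le _) (by positivity))
        (sq_nonneg _)
    · rw [Set.indicator_of_notMem hy]
      have : dil l χ (x - y) = 0 := by
        by_contra hne
        have := dil_ne_zero h.supp l hne
        exact hy (by rw [mem_closedBall_iff_norm, norm_sub_rev]; linarith)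
      simp [this]
  have h2 := (sq_cv_le hn h0 (by rw [integral_dil, h.integral]) hU x).trans h1
  have h3 : ENNReal.ofReal (∫ y in closedBall x ((2:ℝ) ^ l), U y ^ 2) =
      ∫⁻ y in closedBall x ((2:ℝ) ^ l), ENNReal.ofReal (U y ^ 2) :=
    ofReal_integral_eq_lintegral_ofReal hU.sq.int.integrableOn (ae_of_all _ fun y => sq_nonneg _)
  rw [volume_closedBall_eq x (by positivity), ← h3, ← ENNReal.ofReal_mul (sq_nonneg _),
    ← ENNReal.ofReal_mul (mul_nonneg hc.le (vb_nonneg 1))]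
  refine ENNReal.ofReal_le_ofReal ?_
  have h4 := mul_le_mul_of_nonneg_right h2
    (mul_nonneg (by positivity : (0:ℝ) ≤ ((2:ℝ) ^ l) ^ d) (vb_nonneg (d := d) 1))
  refine h4.trans (le_of_eq ?_)
  have h5 : ((2:ℝ) ^ (-l)) ^ d * ((2:ℝ) ^ l) ^ d = 1 := by
    rw [← mul_pow, ← zpow_add₀ two_ne_zero, neg_add_cancel, zpow_zero, one_pow]
  linear_combination (c * (∫ y in closedBall x ((2:ℝ) ^ l), U y ^ 2) * vb d 1) * h5

/-- The maximal averages over a bounded range of dyadic scales are of weak type `(2,2)`. -/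
theorem Bump.exists_maximal_le {χ : Rd d → ℝ} {c : ℝ} (hc : 0 < c) (h : Bump χ c) :
    ∃ C : ℝ, 0 ≤ C ∧ ∀ U : Rd d → ℝ, Nice U → ∀ (N : ℤ) (μ : ℝ), 0 < μ →
      ENNReal.ofReal (μ ^ 2) *
        volume {x | ∃ l : ℤ, l ≤ N ∧ μ < |cv (dil l χ) U x|} ≤ ENNReal.ofReal C * sqR U := by
  refine ⟨5 ^ d * (c * vb d 1), mul_nonneg (by positivity) (mul_nonneg hc.le (vb_nonneg 1)),
    fun U hU N μ hμ => ?_⟩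
  set E := {x | ∃ l : ℤ, l ≤ N ∧ μ < |cv (dil l χ) U x|} with hE
  have hch : ∀ x : Rd d, ∃ l : ℤ, x ∈ E → l ≤ N ∧ μ < |cv (dil l χ) U x| := by
    intro x
    by_cases hx : x ∈ E
    · obtain ⟨l, hl⟩ := hx
      exact ⟨l, fun _ => hl⟩
    · exact ⟨0, fun h => absurd h hx⟩
  choose L hL using hch
  set r : Rd d → ℝ := fun x => (2:ℝ) ^ (L x) with hr
  have hr0 : ∀ x, 0 < r x := fun x => by positivity
  obtain ⟨u, huE, hdisj, hcov⟩ := Vitali.exists_disjoint_subfamily_covering_enlargement_closedBall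
    E (fun x => x) r ((2:ℝ) ^ N) (fun a ha => zpow_le_zpow_right₀ one_le_two (hL a ha).1) 5
    (by norm_num)
  have hcount : u.Countable := hdisj.countable_of_nonempty_interior fun a _ =>
    ⟨a, ball_subset_interior_closedBall (mem_ball_self (hr0 a))⟩
  have hsub : E ⊆ ⋃ b ∈ u, closedBall b (5 * r b) := by
    intro a ha
    obtain ⟨b, hb, hab⟩ := hcov a ha
    exact Set.mem_biUnion hb (hab (mem_closedBall_self (hr0 a).le))
  have hvol : ∀ b : Rd d, volume (closedBall b (5 * r b)) =
      ENNReal.ofReal (5 ^ d) * volume (closedBall b (r b)) := by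
    intro b
    rw [volume_closedBall_eq b (by linarith [hr0 b]), volume_closedBall_eq b (hr0 b).le,
      ← ENNReal.ofReal_mul (by positivity), mul_pow, mul_assoc]
  calc ENNReal.ofReal (μ ^ 2) * volume E
      ≤ ENNReal.ofReal (μ ^ 2) * ∑' b : u, volume (closedBall (b : Rd d) (5 * r b)) :=
        mul_le_mul_right ((measure_mono hsub).trans (measure_biUnion_le _ hcount _)) _
    _ = ENNReal.ofReal (5 ^ d) *
          ∑' b : u, ENNReal.ofReal (μ ^ 2) * volume (closedBall (b : Rd d) (r b)) := by
        simp_rw [hvol, ENNReal.tsum_mul_left]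
        ring
    _ ≤ ENNReal.ofReal (5 ^ d) * ∑' b : u, ENNReal.ofReal (c * vb d 1) *
          ∫⁻ y in closedBall (b : Rd d) (r b), ENNReal.ofReal (U y ^ 2) := by
        refine mul_le_mul_right (ENNReal.tsum_le_tsum fun b => ?_) _
        refine le_trans (mul_le_mul_left (ENNReal.ofReal_le_ofReal ?_) _)
          (h.sq_cv_dil_le hc hU (L b) b)
        rw [← sq_abs (cv _ _ _)]
        exact pow_le_pow_left₀ hμ.le (hL b (huE b.2)).2.le 2
    _ = ENNReal.ofReal (5 ^ d) * (ENNReal.ofReal (c * vb d 1) *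
          ∫⁻ y in ⋃ b ∈ u, closedBall b (r b), ENNReal.ofReal (U y ^ 2)) := by
        rw [ENNReal.tsum_mul_left,
          lintegral_biUnion hcount (fun b _ => measurableSet_closedBall) hdisj]
    _ ≤ ENNReal.ofReal (5 ^ d) * (ENNReal.ofReal (c * vb d 1) * sqR U) :=
        mul_le_mul_right (mul_le_mul_right (setLIntegral_le_lintegral _ _) _) _
    _ = _ := by rw [← mul_assoc, ← ENNReal.ofReal_mul (by positivity)]

end Mollifier

section FourierSums

variable {d : ℕ}

theorem tsum_dyadic_le (F : Rd d → ℝ≥0∞) (u v : ℕ → ℝ≥0∞)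
    (hu : ∀ (k : ℕ) (η : Rd d), (2:ℝ) ^ k ≤ ‖η‖ → F η ≤ u k)
    (hv : ∀ (k : ℕ) (η : Rd d), (1 / 2 : ℝ) ^ (k + 1) ≤ ‖η‖ → ‖η‖ ≤ (1 / 2) ^ k → F η ≤ v k)
    {ξ : Rd d} (hξ : ξ ≠ 0) :
    ∑' j : ℤ, F ((2:ℝ) ^ j • ξ) ≤ ∑' k, u k + ∑' k, v k := by
  obtain ⟨κ, h1, h2⟩ := exists_mem_Ico_zpow (norm_pos_iff.2 hξ) (one_lt_two (α := ℝ))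
  rw [← (Equiv.subRight κ).tsum_eq (fun j : ℤ => F ((2:ℝ) ^ j • ξ))]
  have hs := HasSum.of_nat_of_neg_add_one
    (f := fun j : ℤ => F ((2:ℝ) ^ (Equiv.subRight κ j) • ξ)) ENNReal.summable.hasSum
    ENNReal.summable.hasSum
  rw [hs.tsum_eq]
  have hn : ∀ i : ℤ, (2:ℝ) ^ i ≤ ‖(2:ℝ) ^ (Equiv.subRight κ i) • ξ‖ ∧
      ‖(2:ℝ) ^ (Equiv.subRight κ i) • ξ‖ ≤ 2 ^ (i + 1) := by
    intro i
    have e : (2:ℝ) ^ (Equiv.subRight κ i) = 2 ^ (i - κ) := rfl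
    have e1 : (2:ℝ) ^ (i - κ) * 2 ^ κ = 2 ^ i := by rw [← zpow_add₀ two_ne_zero]; congr 1; ring
    have e2 : (2:ℝ) ^ (i - κ) * 2 ^ (κ + 1) = 2 ^ (i + 1) := by
      rw [← zpow_add₀ two_ne_zero]; congr 1; ring
    rw [norm_smul, e, Real.norm_of_nonneg (by positivity)]
    exact ⟨e1 ▸ mul_le_mul_of_nonneg_left h1 (by positivity),
      e2 ▸ mul_le_mul_of_nonneg_left h2.le (by positivity)⟩
  refine add_le_add (ENNReal.tsum_le_tsum fun k => hu k _ ?_)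
    (ENNReal.tsum_le_tsum fun k => hv k _ ?_ ?_)
  · have := (hn k).1
    rwa [zpow_natCast] at this
  · refine le_trans (le_of_eq ?_) (hn (-((k:ℤ) + 1))).1
    rw [one_div, inv_pow, zpow_neg]
    norm_cast
  · refine (hn (-((k:ℤ) + 1))).2.trans (le_of_eq ?_)
    rw [one_div, inv_pow, show -((k:ℤ) + 1) + 1 = -(k:ℤ) by ring, zpow_neg, zpow_natCast]

theorem tsum_ofReal_mul_pow (a : ℝ) (ha : 0 ≤ a) {r : ℝ} (hr : 0 ≤ r) (hr1 : r < 1) :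
    ∑' k : ℕ, ENNReal.ofReal (a * r ^ k) = ENNReal.ofReal (a * (1 - r)⁻¹) := by
  rw [← ENNReal.ofReal_tsum_of_nonneg (fun k => by positivity)
    ((summable_geometric_of_lt_one hr hr1).mul_left a), tsum_mul_left,
    tsum_geometric_of_lt_one hr hr1]

variable {P Ψ Om : Rd d → ℝ} {B A D : ℝ}

/-- The decay constant in the oscillatory bound. -/
def decayC (d : ℕ) (B : ℝ) : ℝ := (6 * vb d 2 + vb d 1) * B

theorem decayC_nonneg (hB : 0 ≤ B) : 0 ≤ decayC d B :=
  mul_nonneg (by linarith [vb_nonneg (d := d) 2, vb_nonneg (d := d) 1]) hB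

theorem OmData.norm_ftr_lo_sq_le (h : OmData d P Om A D) (hP : Prof d P Ψ B) (k : ℕ) {ξ : Rd d}
    (hξ : ξ ≠ 0) :
    ‖ftr (kOm P (lo A k Om)) ξ‖ ^ 2 ≤ (decayC d B) ^ 2 * ((5 / 4) ^ k * A) ^ 2 / ‖ξ‖ := by
  have h1 := hP.norm_ftr_kOm_le (measurable_lo A k h.meas) (abs_lo_le h.A_pos.le k Om)
    (homogeneous_lo A k h.hom) hξ
  refine (pow_le_pow_left₀ (norm_nonneg _) h1 2).trans (le_of_eq ?_)
  rw [div_pow, Real.sq_sqrt (norm_nonneg _), decayC]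
  ring

theorem OmData.integral_abs_kOm_le (h : OmData d P Om A D) (hP : Prof d P Ψ B) {m : Rd d → ℝ}
    (hm : ∀ x, ‖m x‖ₑ ≤ ‖Om x‖ₑ) (hmm : Measurable m) : ∫ x, |kOm P m x| ≤ B * A := by
  have hA := h.A_pos
  have h1 := h.lintegral_kOm_le hP hm
  have h2 : ∫ x, |kOm P m x| = (∫⁻ x, ‖kOm P m x‖ₑ).toReal :=
    integral_norm_eq_lintegral_enorm (hP.measurable_kOm hmm).aestronglyMeasurable
  rw [h2]
  exact ENNReal.toReal_le_of_le_ofReal (mul_nonneg hP.B_nonneg hA.le) h1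

theorem enorm_ftr_le {k : Rd d → ℝ} (hk : IM k) (ξ : Rd d) : ‖ftr k ξ‖ₑ ≤ ∫⁻ x, ‖k x‖ₑ := by
  rw [← ofReal_norm, ← ofReal_integral_norm_eq_lintegral_enorm hk.int]
  exact ENNReal.ofReal_le_ofReal (norm_ftr_le k ξ)

theorem OmData.ftr_zero (h : OmData d P Om A D) : ftr (kOm P Om) 0 = 0 := by
  rw [ftr_apply]
  simp only [inner_zero_right, mul_zero, Complex.ofReal_zero, zero_mul, Complex.exp_zero, one_mul]
  rw [integral_complex_ofReal, h.mean, Complex.ofReal_zero]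

theorem OmData.norm_ftr_le_mul_norm (h : OmData d P Om A D) (hP : Prof d P Ψ B) (η : Rd d) :
    ‖ftr (kOm P Om) η‖ ≤ 2 * B * A * ‖η‖ := by
  have hA := h.A_pos
  have h1 := norm_integral_sub_ftr_le (h.im hP).int (R := 1 / 4)
    (fun x hx => (hP.kOm_supp hx).2.le) η
  rw [h.mean, Complex.ofReal_zero, zero_sub, norm_neg] at h1
  have h2 := h.integral_abs_kOm_le hP (fun _ => le_rfl) h.meas
  have h3 : 0 ≤ B * A := mul_nonneg hP.B_nonneg hA.le
  calc ‖ftr (kOm P Om) η‖ ≤ 2 * Real.pi * ‖η‖ * (1 / 4) * ∫ x, |kOm P Om x| := h1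
    _ ≤ 2 * Real.pi * ‖η‖ * (1 / 4) * (B * A) := by gcongr
    _ = (Real.pi / 2) * ((B * A) * ‖η‖) := by ring
    _ ≤ 2 * ((B * A) * ‖η‖) := by
        refine mul_le_mul_of_nonneg_right ?_ (by positivity)
        linarith [Real.pi_le_four]
    _ = _ := by ring

theorem OmData.tsum_ftr_le (h : OmData d P Om A D) (hP : Prof d P Ψ B) (ξ : Rd d) :
    ∑' j : ℤ, ‖ftr (dil j (kOm P Om)) ξ‖ₑ ≤ ENNReal.ofReal ((10 * decayC d B + 5 * B) * D) := by
  have hA := h.A_pos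
  have hD := h.D_pos
  have hB := hP.B_nonneg
  have hc := decayC_nonneg (d := d) hB
  simp_rw [ftr_dil]
  by_cases hξ : ξ = 0
  · simp only [hξ, smul_zero, h.ftr_zero, enorm_zero, tsum_zero]
    exact bot_le
  refine (tsum_dyadic_le (fun η => ‖ftr (kOm P Om) η‖ₑ)
    (fun k => ENNReal.ofReal ((decayC d B * A) * (25 / 28) ^ k) + ∫⁻ x, ‖kOm P (hi A k Om) x‖ₑ)
    (fun k => ENNReal.ofReal ((2 * B * A) * (1 / 2) ^ k)) ?_ ?_ hξ).trans ?_
  · intro k η hη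
    have hη0 : 0 < ‖η‖ := lt_of_lt_of_le (by positivity) hη
    rw [kOm_lo_add_hi P A k Om, ftr_add (h.im_lo hP k).int (h.im_hi hP k).int]
    refine (enorm_add_le _ _).trans (add_le_add ?_ (enorm_ftr_le (h.im_hi hP k) η))
    rw [← ofReal_norm]
    refine ENNReal.ofReal_le_ofReal ?_
    refine le_of_sq_le_sq ?_ (by positivity)
    refine (h.norm_ftr_lo_sq_le hP k (norm_pos_iff.1 hη0)).trans ?_
    rw [div_le_iff₀ hη0]
    have e1 : (decayC d B * A * (25 / 28) ^ k) ^ 2 * ‖η‖ ≥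
        (decayC d B * A * (25 / 28) ^ k) ^ 2 * 2 ^ k :=
      mul_le_mul_of_nonneg_left hη (sq_nonneg _)
    refine le_trans ?_ e1
    have e2 : ((25 / 28 : ℝ) ^ k) ^ 2 * 2 ^ k = ((25 / 28) ^ 2 * 2) ^ k := by
      rw [mul_pow, ← pow_mul, ← pow_mul, mul_comm k 2]
    have e3 : ((5 / 4 : ℝ) ^ k) ^ 2 = ((5 / 4) ^ 2) ^ k := by
      rw [← pow_mul, ← pow_mul, mul_comm k 2]
    have e4 : ((5 / 4 : ℝ) ^ 2) ^ k ≤ ((25 / 28) ^ 2 * 2) ^ k :=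
      pow_le_pow_left₀ (by norm_num) (by norm_num) k
    calc decayC d B ^ 2 * ((5 / 4) ^ k * A) ^ 2 = (decayC d B * A) ^ 2 * ((5 / 4) ^ 2) ^ k := by
          rw [← e3]; ring
      _ ≤ (decayC d B * A) ^ 2 * ((25 / 28) ^ 2 * 2) ^ k :=
          mul_le_mul_of_nonneg_left e4 (sq_nonneg _)
      _ = _ := by rw [← e2]; ring
  · intro k η _ hη
    rw [← ofReal_norm]
    refine ENNReal.ofReal_le_ofReal ((h.norm_ftr_le_mul_norm hP η).trans ?_)
    exact mul_le_mul_of_nonneg_left hη (by positivity)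
  · rw [ENNReal.tsum_add, tsum_ofReal_mul_pow _ (by positivity) (by norm_num) (by norm_num),
      tsum_ofReal_mul_pow _ (by positivity) (by norm_num) (by norm_num)]
    refine (add_le_add (add_le_add le_rfl (h.tsum_hi_le hP)) le_rfl).trans ?_
    rw [← ENNReal.ofReal_add (by positivity) (by positivity),
      ← ENNReal.ofReal_add (by positivity) (by positivity)]
    refine ENNReal.ofReal_le_ofReal ?_
    norm_num
    have h1 := mul_le_mul_of_nonneg_left h.A_le hc
    have h2 := mul_le_mul_of_nonneg_left h.A_le hB
    have h3 := mul_nonneg hc hD.le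
    linarith

theorem sum_sqR_le_of_ftr {ι : Type*} {s : Finset ι} {U : ι → Rd d → ℝ} {g : Rd d → ℝ}
    (hU : ∀ i ∈ s, Nice (U i)) (hg : Nice g) {C : ℝ} (hC : 0 ≤ C)
    (h : ∀ ξ, ∑ i ∈ s, ‖ftr (U i) ξ‖ ^ 2 ≤ C * ‖ftr g ξ‖ ^ 2) :
    ∑ i ∈ s, sqR (U i) ≤ ENNReal.ofReal C * sqR g := by
  rw [← sqC_ftr hg, Finset.sum_congr rfl fun i hi => (sqC_ftr (hU i hi)).symm]
  unfold sqC
  rw [← lintegral_finsetSum', ← lintegral_const_mul' _ _ ENNReal.ofReal_ne_top]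
  · refine lintegral_mono fun ξ => ?_
    rw [← ENNReal.ofReal_mul hC, ← ENNReal.ofReal_sum_of_nonneg fun i _ => sq_nonneg _]
    exact ENNReal.ofReal_le_ofReal (h ξ)
  · intro i hi
    exact (((continuous_ftr (hU i hi).int).norm.pow 2).measurable.ennreal_ofReal).aemeasurable

theorem OmData.sqR_sum_le (h : OmData d P Om A D) (hP : Prof d P Ψ B) (s : Finset ℤ) {g : Rd d → ℝ}
    (hg : Nice g) : sqR (fun x => ∑ j ∈ s, cv (dil j (kOm P Om)) g x) ≤
      ENNReal.ofReal (((10 * decayC d B + 5 * B) * D) ^ 2) * sqR g := by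
  have hn : ∀ j ∈ s, Nice (cv (dil j (kOm P Om)) g) := fun j _ => Nice.cv_right ((h.im hP).dil j) hg
  have hc := decayC_nonneg (d := d) hP.B_nonneg
  have hB := hP.B_nonneg
  have hD := h.D_pos
  have := sum_sqR_le_of_ftr (s := {()}) (U := fun _ => fun x => ∑ j ∈ s, cv (dil j (kOm P Om)) g x)
    (fun _ _ => Nice.sum hn) hg (sq_nonneg ((10 * decayC d B + 5 * B) * D)) ?_
  · simpa using this
  · intro ξ
    rw [Finset.sum_singleton, ← mul_pow]
    refine pow_le_pow_left₀ (norm_nonneg _) ?_ 2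
    rw [ftr_sum fun j hj => (hn j hj).int, Finset.sum_congr rfl fun j _ =>
      ftr_cv ((h.im hP).dil j).int hg.int ξ, ← Finset.sum_mul, norm_mul]
    refine mul_le_mul_of_nonneg_right ((norm_sum_le _ _).trans ?_) (norm_nonneg _)
    have h1 := (ENNReal.sum_le_tsum s).trans (h.tsum_ftr_le hP ξ)
    simp_rw [← ofReal_norm] at h1
    rw [← ENNReal.ofReal_sum_of_nonneg fun i _ => norm_nonneg _] at h1
    exact (ENNReal.ofReal_le_ofReal_iff (by positivity)).1 h1

end FourierSums

section GoodPart

variable {d : ℕ}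

theorem cv_apply' (k g : Rd d → ℝ) (x : Rd d) : cv k g x = ∫ y, k y * g (x - y) := by
  rw [cv_comm, cv]
  congr 1; ext y; ring

theorem cv_left_comm {k m g : Rd d → ℝ} (hk : IM k) (hm : IM m) (hg : Nice g) (x : Rd d) :
    cv k (cv m g) x = cv m (cv k g) x := by
  have h1 : ∀ k m : Rd d → ℝ, cv k (cv m g) x = ∫ y, ∫ z, k y * m z * g (x - y - z) := by
    intro k m
    rw [cv_apply']
    congr 1; ext y
    rw [cv_apply', ← integral_const_mul]
    congr 1; ext z; ring
  rw [h1, h1]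
  obtain ⟨C, hC⟩ := hg.bdd
  have hi : Integrable (Function.uncurry fun y z : Rd d => k y * m z * g (x - y - z))
      (volume.prod volume) := by
    have h2 : Integrable (fun p : Rd d × Rd d => k p.1 * m p.2) (volume.prod volume) :=
      hk.int.mul_prod hm.int
    refine h2.mul_bdd (c := C) ?_ (ae_of_all _ fun p => hC _)
    have h3 : Measurable fun p : Rd d × Rd d => x - p.1 - p.2 := by fun_prop
    exact (hg.meas.comp h3).aestronglyMeasurable
  rw [integral_integral_swap hi]
  congr 1; ext z
  congr 1; ext y
  rw [mul_comm (k y), sub_right_comm]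

theorem abs_cv_le_of_lipschitz {k V : Rd d → ℝ} (hk : IM k) (h0 : ∫ x, k x = 0) {R L : ℝ}
    (hL0 : 0 ≤ L) (hR : ∀ x, k x ≠ 0 → ‖x‖ ≤ R) (hV : Nice V)
    (hL : ∀ x y, |V x - V y| ≤ L * ‖x - y‖) (x : Rd d) :
    |cv k V x| ≤ L * R * ∫ y, |k y| := by
  have e0 : ∫ y, k (x - y) = 0 := by rw [integral_sub_left_eq_self, h0]
  have e : cv k V x = ∫ y, k (x - y) * (V y - V x) := by
    have : ∀ y, k (x - y) * (V y - V x) = k (x - y) * V y - k (x - y) * V x := fun y => by ring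
    simp_rw [this]
    rw [integral_sub (integrable_cv_integrand hk.int hV x) ((hk.int.comp_sub_left x).mul_const _),
      integral_mul_const, e0, zero_mul, sub_zero]
    rfl
  rw [e, ← integral_sub_left_eq_self (fun y => |k y|) volume x, ← integral_const_mul]
  refine abs_integral_le_integral_abs.trans (integral_mono_of_nonneg
    (ae_of_all _ fun y => abs_nonneg _) ((hk.int.comp_sub_left x).abs.const_mul _)
    (ae_of_all _ fun y => ?_))
  simp only [abs_mul]
  by_cases hz : k (x - y) = 0
  · simp [hz]
  rw [mul_comm]
  refine mul_le_mul_of_nonneg_right ((hL y x).trans ?_) (abs_nonneg _)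
  rw [norm_sub_rev]
  exact mul_le_mul_of_nonneg_left (hR _ hz) hL0

theorem Bump.integral_abs_sub_translate_le {χ : Rd d → ℝ} {c : ℝ} (h : Bump χ c) (hc : 0 ≤ c)
    (δ : Rd d) : ∫ u, |χ u - χ (u + δ)| ≤ 2 * (c * vb d 1) * ‖δ‖ := by
  have h1 : ∀ r : ℝ, Integrable ((closedBall (0 : Rd d) 1).indicator fun _ => r) := fun r =>
    (integrableOn_const (measure_closedBall_lt_top).ne).integrable_indicator
      measurableSet_closedBall
  have h2 : ∀ r : ℝ, ∫ u, (closedBall (0 : Rd d) 1).indicator (fun _ => r) u = vb d 1 * r := by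
    intro r
    rw [integral_indicator measurableSet_closedBall, setIntegral_const]
    rfl
  set I := (closedBall (0 : Rd d) 1).indicator fun _ => c * ‖δ‖ with hI
  have hI0 : ∀ x, 0 ≤ I x := fun x => Set.indicator_nonneg (fun _ _ => by positivity) x
  have hI1 : ∀ x, χ x ≠ 0 → I x = c * ‖δ‖ := fun x hx =>
    Set.indicator_of_mem (mem_closedBall_zero_iff.2 (h.supp x hx)) _
  have key : ∫ u, |χ u - χ (u + δ)| ≤ ∫ u, I u + I (u + δ) := by
    refine integral_mono_of_nonneg (ae_of_all _ fun u => abs_nonneg _)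
      ((h1 _).add ((h1 _).comp_add_right δ)) (ae_of_all _ fun u => ?_)
    have hl := h.lip u (u + δ)
    rw [show u - (u + δ) = -δ by abel, norm_neg] at hl
    simp only
    by_cases hu : χ u = 0
    · by_cases hv : χ (u + δ) = 0
      · rw [hu, hv, sub_zero, abs_zero]
        exact add_nonneg (hI0 _) (hI0 _)
      · have := hI1 _ hv
        linarith [hI0 u]
    · have := hI1 _ hu
      linarith [hI0 (u + δ)]
  refine key.trans (le_of_eq ?_)
  rw [integral_add (h1 _) ((h1 _).comp_add_right δ), integral_add_right_eq_self, h2]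
  ring

theorem Bump.cv_dil_lipschitz {χ : Rd d → ℝ} {c : ℝ} (h : Bump χ c) (hc : 0 ≤ c) {g : Rd d → ℝ}
    (hg : Nice g) {G : ℝ} (hG : ∀ x, |g x| ≤ G) (l : ℤ) (x y : Rd d) :
    |cv (dil l χ) g x - cv (dil l χ) g y| ≤
      (2 * (c * vb d 1) * G * 2 ^ (-l)) * ‖x - y‖ := by
  have hn := h.nice.dil l
  have hG0 : 0 ≤ G := (abs_nonneg _).trans (hG 0)
  have i1 := integrable_cv_integrand hn.int hg
  have e : cv (dil l χ) g x - cv (dil l χ) g y =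
      ∫ z, (dil l χ (x - z) - dil l χ (y - z)) * g z := by
    unfold cv
    rw [← integral_sub (i1 x) (i1 y)]
    congr 1; ext z; ring
  set δ : Rd d := (2:ℝ) ^ (-l) • (y - x) with hδ
  have e2 : ∫ z, |dil l χ (x - z) - dil l χ (y - z)| = ∫ u, |χ u - χ (u + δ)| := by
    rw [← integral_dil (fun u => |χ u - χ (u + δ)|) l,
      ← integral_sub_left_eq_self (dil l fun u => |χ u - χ (u + δ)|) volume x]
    congr 1; ext z
    have hp : (0:ℝ) ≤ ((2:ℝ) ^ (-l)) ^ d := by positivity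
    simp only [dil]
    rw [← mul_sub, abs_mul, abs_of_nonneg hp, hδ, ← smul_add, show x - z + (y - x) = y - z by abel]
  have h2 := h.integral_abs_sub_translate_le hc δ
  have hδn : ‖δ‖ = 2 ^ (-l) * ‖x - y‖ := by
    rw [hδ, norm_smul, Real.norm_of_nonneg (by positivity), norm_sub_rev]
  have h3 : |cv (dil l χ) g x - cv (dil l χ) g y| ≤
      ∫ z, |dil l χ (x - z) - dil l χ (y - z)| * G := by
    rw [e]
    refine abs_integral_le_integral_abs.trans (integral_mono_of_nonneg
      (ae_of_all _ fun y => abs_nonneg _)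
      (((hn.int.comp_sub_left x).sub (hn.int.comp_sub_left y)).abs.mul_const _)
      (ae_of_all _ fun z => ?_))
    simp only [abs_mul]
    exact mul_le_mul_of_nonneg_left (hG z) (abs_nonneg _)
  rw [integral_mul_const, e2] at h3
  refine h3.trans ((mul_le_mul_of_nonneg_right h2 hG0).trans (le_of_eq ?_))
  rw [hδn]; ring

variable {P Ψ Om : Rd d → ℝ} {B A D : ℝ}

theorem OmData.abs_cv_bump_cv_le (h : OmData d P Om A D) (hP : Prof d P Ψ B) {χ : Rd d → ℝ} {c : ℝ}
    (hχ : Bump χ c) (hc : 0 ≤ c) {g : Rd d → ℝ} (hg : Nice g) {G : ℝ} (hG : ∀ x, |g x| ≤ G)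
    (l j : ℤ) (x : Rd d) :
    |cv (dil l χ) (cv (dil j (kOm P Om)) g) x| ≤
      (c * vb d 1 * B) * A * G * 2 ^ (j - l) := by
  have hA := h.A_pos
  have hB := hP.B_nonneg
  have hG0 : 0 ≤ G := (abs_nonneg _).trans (hG 0)
  have hv := vb_nonneg (d := d) 1
  have hK := (h.im hP).dil j
  rw [cv_left_comm (hχ.nice.dil l).toIM hK hg]
  have h1 := abs_cv_le_of_lipschitz hK (by rw [integral_dil, h.mean])
    (L := 2 * (c * vb d 1) * G * 2 ^ (-l)) (by positivity)
    (fun x hx => dil_ne_zero (fun x hx => (hP.kOm_supp hx).2.le) j hx)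
    (Nice.cv_right (hχ.nice.dil l).toIM hg) (hχ.cv_dil_lipschitz hc hg hG l) x
  rw [integral_abs_dil] at h1
  have h2 := h.integral_abs_kOm_le hP (fun _ => le_rfl) h.meas
  refine h1.trans ((mul_le_mul_of_nonneg_left h2 (by positivity)).trans ?_)
  have e : (2:ℝ) ^ (j - l) = 2 ^ (-l) * 2 ^ j := by
    rw [← zpow_add₀ two_ne_zero]; congr 1; ring
  rw [e]
  have : 0 ≤ c * vb d 1 * B * A * G * (2 ^ (-l) * 2 ^ j) := by positivity
  linarith

theorem sum_Ico_two_zpow_le {a l : ℤ} (h : a ≤ l) : ∑ j ∈ Finset.Ico a l, (2:ℝ) ^ j ≤ 2 ^ l := by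
  induction l, h using Int.leInduction with
  | base => simp; positivity
  | succ n hn ih =>
    have : Finset.Ico a (n + 1) = insert n (Finset.Ico a n) := by
      ext i; simp only [Finset.mem_Ico, Finset.mem_insert]; omega
    rw [this, Finset.sum_insert (by simp), zpow_add_one₀ two_ne_zero]
    linarith

/-- The piece of the difference between a dilated truncated kernel and its mollification. -/
def modPiece (P Om χ : Rd d → ℝ) (k : ℕ) (g : Rd d → ℝ) (l : ℤ) (x : Rd d) : ℝ :=
  cv (dil (l + k) (kOm P Om)) g x - cv (dil l χ) (cv (dil (l + k) (kOm P Om)) g) x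

theorem nice_modPiece {χ : Rd d → ℝ} (hχ : IM χ) {m : Rd d → ℝ} (hm : IM (kOm P m)) {g : Rd d → ℝ}
    (hg : Nice g) (k : ℕ) (l : ℤ) : Nice (modPiece P m χ k g l) :=
  (Nice.cv_right (hm.dil _) hg).sub (Nice.cv_right (hχ.dil l) (Nice.cv_right (hm.dil _) hg))

theorem ftr_modPiece {χ : Rd d → ℝ} (hχ : IM χ) {m : Rd d → ℝ} (hm : IM (kOm P m)) {g : Rd d → ℝ}
    (hg : Nice g) (k : ℕ) (l : ℤ) (ξ : Rd d) : ftr (modPiece P m χ k g l) ξ =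
      (1 - ftr χ ((2:ℝ) ^ l • ξ)) * ftr (kOm P m) ((2:ℝ) ^ k • (2:ℝ) ^ l • ξ) * ftr g ξ := by
  have hc := Nice.cv_right (hm.dil (l + k)) hg
  have e : (2:ℝ) ^ (l + (k:ℤ)) • ξ = (2:ℝ) ^ k • (2:ℝ) ^ l • ξ := by
    rw [smul_smul, ← zpow_natCast, ← zpow_add₀ two_ne_zero, add_comm]
  have h1 : ftr (modPiece P m χ k g l) ξ = ftr (cv (dil (l + k) (kOm P m)) g) ξ -
      ftr (cv (dil l χ) (cv (dil (l + k) (kOm P m)) g)) ξ :=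
    ftr_sub hc.int (Nice.cv_right (hχ.dil l) hc).int ξ
  rw [h1, ftr_cv (hχ.dil l).int hc.int, ftr_cv (hm.dil _).int hg.int, ftr_dil, ftr_dil, e]
  ring

theorem OmData.sum_ftr_modPiece_le (h : OmData d P Om A D) (hP : Prof d P Ψ B) {χ : Rd d → ℝ} {c : ℝ}
    (hχ : Bump χ c) {g : Rd d → ℝ} (hg : Nice g) (k : ℕ) (s : Finset ℤ) (ξ : Rd d) :
    ∑ l ∈ s, ‖ftr (modPiece P (lo A k Om) χ k g l) ξ‖ ^ 2 ≤
      (264 * decayC d B ^ 2 * A ^ 2 * (25 / 32) ^ k) * ‖ftr g ξ‖ ^ 2 := by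
  have hA := h.A_pos
  have hc := decayC_nonneg (d := d) hP.B_nonneg
  simp_rw [ftr_modPiece hχ.nice.toIM (h.im_lo hP k) hg, norm_mul, mul_pow]
  rw [← Finset.sum_mul]
  refine mul_le_mul_of_nonneg_right ?_ (sq_nonneg _)
  by_cases hξ : ξ = 0
  · have h0 : ‖1 - ftr χ 0‖ = 0 := le_antisymm (by simpa using hχ.norm_one_sub_ftr_le 0)
      (norm_nonneg _)
    simp only [hξ, smul_zero, h0]
    rw [Finset.sum_eq_zero fun i _ => by ring]
    positivity
  set F : Rd d → ℝ≥0∞ := fun η => ENNReal.ofReal (‖1 - ftr χ η‖ ^ 2 *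
    ‖ftr (kOm P (lo A k Om)) ((2:ℝ) ^ k • η)‖ ^ 2) with hF
  set a := decayC d B ^ 2 * A ^ 2 * (25 / 32) ^ k with ha
  have ha0 : 0 ≤ a := by positivity
  have hdec : ∀ η : Rd d, 0 < ‖η‖ →
      ‖ftr (kOm P (lo A k Om)) ((2:ℝ) ^ k • η)‖ ^ 2 ≤ a / ‖η‖ := by
    intro η hη
    have hne : (2:ℝ) ^ k • η ≠ 0 := smul_ne_zero (by positivity) (norm_pos_iff.1 hη)
    refine (h.norm_ftr_lo_sq_le hP k hne).trans (le_of_eq ?_)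
    rw [norm_smul, Real.norm_of_nonneg (by positivity), ← div_div]
    congr 1
    rw [div_eq_iff (by positivity), ha]
    have e : ((5 / 4 : ℝ) ^ k) ^ 2 = (25 / 32) ^ k * 2 ^ k := by
      rw [← pow_mul, mul_comm k 2, pow_mul, ← mul_pow]; norm_num
    rw [mul_pow ((5 / 4 : ℝ) ^ k), e]; ring
  have key := tsum_dyadic_le F (fun i => ENNReal.ofReal ((4 * a) * (1 / 2) ^ i))
    (fun i => ENNReal.ofReal ((128 * a) * (1 / 2) ^ i)) ?_ ?_ hξ
  · rw [tsum_ofReal_mul_pow _ (by positivity) (by norm_num) (by norm_num),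
      tsum_ofReal_mul_pow _ (by positivity) (by norm_num) (by norm_num),
      ← ENNReal.ofReal_add (by positivity) (by positivity)] at key
    have h1 := (ENNReal.sum_le_tsum s).trans key
    rw [hF] at h1
    simp only at h1
    rw [← ENNReal.ofReal_sum_of_nonneg fun i _ => by positivity] at h1
    have h2 := (ENNReal.ofReal_le_ofReal_iff (by positivity)).1 h1
    refine h2.trans (le_of_eq ?_)
    rw [ha]; ring
  · intro i η hη
    have hη0 : 0 < ‖η‖ := lt_of_lt_of_le (by positivity) hη
    refine ENNReal.ofReal_le_ofReal ?_
    have h1 : ‖1 - ftr χ η‖ ^ 2 ≤ 2 ^ 2 :=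
      pow_le_pow_left₀ (norm_nonneg _) (hχ.norm_one_sub_ftr_le_two η) 2
    have h2 : a / ‖η‖ ≤ a * (1 / 2) ^ i := by
      rw [one_div, inv_pow, ← div_eq_mul_inv]
      exact div_le_div_of_nonneg_left ha0 (by positivity) hη
    calc _ ≤ 2 ^ 2 * (a * (1 / 2) ^ i) :=
          mul_le_mul h1 ((hdec η hη0).trans h2) (by positivity) (by norm_num)
      _ = _ := by ring
  · intro i η hη hη'
    have hη0 : 0 < ‖η‖ := lt_of_lt_of_le (by positivity) hη
    refine ENNReal.ofReal_le_ofReal ?_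
    have h1 : ‖1 - ftr χ η‖ ^ 2 ≤ (8 * ‖η‖) ^ 2 := by
      refine pow_le_pow_left₀ (norm_nonneg _) ((hχ.norm_one_sub_ftr_le η).trans ?_) 2
      refine mul_le_mul_of_nonneg_right ?_ hη0.le
      linarith [Real.pi_le_four]
    calc _ ≤ (8 * ‖η‖) ^ 2 * (a / ‖η‖) :=
          mul_le_mul h1 (hdec η hη0) (by positivity) (by positivity)
      _ = 64 * a * ‖η‖ := by field_simp; ring
      _ ≤ 64 * a * (1 / 2) ^ i := mul_le_mul_of_nonneg_left hη' (by positivity)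
      _ ≤ _ := by
        refine mul_le_mul_of_nonneg_right ?_ (by positivity)
        linarith

end GoodPart

section GoodBound

variable {d : ℕ} {P Ψ Om : Rd d → ℝ} {B A D : ℝ}

theorem sq_sum_range_le_weighted (w : ℕ → ℝ) {M N : ℕ} (h : M ≤ N) :
    (∑ k ∈ Finset.range M, w k) ^ 2 ≤ 9 * ∑ k ∈ Finset.range N, (9 / 8 : ℝ) ^ k * w k ^ 2 := by
  have h1 : (∑ k ∈ Finset.range M, w k) ^ 2 ≤ (∑ k ∈ Finset.range M, (8 / 9 : ℝ) ^ k) *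
      ∑ k ∈ Finset.range M, (9 / 8 : ℝ) ^ k * w k ^ 2 := by
    refine Finset.sum_sq_le_sum_mul_sum_of_sq_le_mul _ (fun k _ => by positivity)
      (fun k _ => by positivity) fun k _ => le_of_eq ?_
    rw [← mul_assoc, ← mul_pow]
    norm_num
  have h2 : ∑ k ∈ Finset.range M, (8 / 9 : ℝ) ^ k ≤ 9 := by
    refine ((summable_geometric_of_lt_one (by norm_num) (by norm_num)).sum_le_tsum _
      (fun k _ => by positivity)).trans ?_
    rw [tsum_geometric_of_lt_one (by norm_num) (by norm_num)]
    norm_num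
  have h3 : ∑ k ∈ Finset.range M, (9 / 8 : ℝ) ^ k * w k ^ 2 ≤
      ∑ k ∈ Finset.range N, (9 / 8 : ℝ) ^ k * w k ^ 2 :=
    Finset.sum_le_sum_of_subset_of_nonneg (Finset.range_mono h) fun k _ _ => by positivity
  exact h1.trans (mul_le_mul h2 h3 (Finset.sum_nonneg fun k _ => by positivity) (by norm_num))

theorem OmData.volume_modPiece_lo_le (h : OmData d P Om A D) (hP : Prof d P Ψ B) {χ : Rd d → ℝ}
    {c : ℝ} (hχ : Bump χ c) {g : Rd d → ℝ} (hg : Nice g) (s : Finset ℤ) (N : ℕ) {ν : ℝ}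
    (hν : 0 < ν) :
    ENNReal.ofReal (ν ^ 2) * volume {x | ∃ l ∈ s, ∃ M ≤ N,
      ν < |∑ k ∈ Finset.range M, modPiece P (lo A k Om) χ k g l x|} ≤
      ENNReal.ofReal (21384 * decayC d B ^ 2 * A ^ 2) * sqR g := by
  have hc := decayC_nonneg (d := d) hP.B_nonneg
  have hn : ∀ k l, Nice (modPiece P (lo A k Om) χ k g l) := fun k l =>
    nice_modPiece hχ.nice.toIM (h.im_lo hP k) hg k l
  set Z : Rd d → ℝ := fun x => ∑ k ∈ Finset.range N, ∑ l ∈ s,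
    9 * (9 / 8 : ℝ) ^ k * modPiece P (lo A k Om) χ k g l x ^ 2 with hZ
  have hZm : Measurable Z := Finset.measurable_fun_sum _ fun k _ =>
    Finset.measurable_fun_sum _ fun l _ => ((hn k l).meas.pow_const 2).const_mul _
  have hsub : {x | ∃ l ∈ s, ∃ M ≤ N,
      ν < |∑ k ∈ Finset.range M, modPiece P (lo A k Om) χ k g l x|} ⊆
      {x | ENNReal.ofReal (ν ^ 2) ≤ ENNReal.ofReal (Z x)} := by
    rintro x ⟨l, hl, M, hM, hx⟩
    refine ENNReal.ofReal_le_ofReal ?_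
    have h1 := sq_sum_range_le_weighted (fun k => modPiece P (lo A k Om) χ k g l x) hM
    have h2 : ν ^ 2 ≤ (∑ k ∈ Finset.range M, modPiece P (lo A k Om) χ k g l x) ^ 2 := by
      rw [← sq_abs (∑ k ∈ Finset.range M, _)]
      exact pow_le_pow_left₀ hν.le hx.le 2
    refine (h2.trans h1).trans ?_
    rw [hZ]
    simp only
    rw [Finset.mul_sum]
    refine Finset.sum_le_sum fun k _ => ?_
    rw [← mul_assoc]
    exact Finset.single_le_sum
      (f := fun l => 9 * (9 / 8 : ℝ) ^ k * modPiece P (lo A k Om) χ k g l x ^ 2)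
      (fun l _ => by positivity) hl
  refine (mul_le_mul_right (measure_mono hsub) _).trans
    ((mul_meas_ge_le_lintegral hZm.ennreal_ofReal _).trans ?_)
  have e : ∫⁻ x, ENNReal.ofReal (Z x) = ∑ k ∈ Finset.range N,
      ENNReal.ofReal (9 * (9 / 8 : ℝ) ^ k) * ∑ l ∈ s, sqR (modPiece P (lo A k Om) χ k g l) := by
    have e1 : ∀ x, ENNReal.ofReal (Z x) = ∑ k ∈ Finset.range N, ∑ l ∈ s,
        ENNReal.ofReal (9 * (9 / 8 : ℝ) ^ k) *
          ENNReal.ofReal (modPiece P (lo A k Om) χ k g l x ^ 2) := by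
      intro x
      rw [hZ]
      simp only
      rw [ENNReal.ofReal_sum_of_nonneg fun k _ => Finset.sum_nonneg fun l _ => by positivity]
      refine Finset.sum_congr rfl fun k _ => ?_
      rw [ENNReal.ofReal_sum_of_nonneg fun l _ => by positivity]
      exact Finset.sum_congr rfl fun l _ => ENNReal.ofReal_mul (by positivity)
    simp_rw [e1]
    have hm : ∀ k l, Measurable fun x => ENNReal.ofReal (9 * (9 / 8 : ℝ) ^ k) *
        ENNReal.ofReal (modPiece P (lo A k Om) χ k g l x ^ 2) := fun k l =>
      ((hn k l).meas.pow_const 2).ennreal_ofReal.const_mul _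
    rw [lintegral_finsetSum _ fun k _ => Finset.measurable_fun_sum _ fun l _ => hm k l]
    refine Finset.sum_congr rfl fun k _ => ?_
    rw [lintegral_finsetSum _ fun l _ => hm k l, Finset.mul_sum]
    exact Finset.sum_congr rfl fun l _ => lintegral_const_mul' _ _ ENNReal.ofReal_ne_top
  rw [e]
  calc ∑ k ∈ Finset.range N,
      ENNReal.ofReal (9 * (9 / 8 : ℝ) ^ k) * ∑ l ∈ s, sqR (modPiece P (lo A k Om) χ k g l)
      ≤ ∑ k ∈ Finset.range N,
        ENNReal.ofReal ((2376 * decayC d B ^ 2 * A ^ 2) * (225 / 256) ^ k) * sqR g := by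
        refine Finset.sum_le_sum fun k _ => ?_
        refine (mul_le_mul_right (sum_sqR_le_of_ftr (fun l _ => hn k l) hg (by positivity)
          (h.sum_ftr_modPiece_le hP hχ hg k s)) _).trans (le_of_eq ?_)
        rw [← mul_assoc, ← ENNReal.ofReal_mul (by positivity)]
        congr 2
        rw [show (225 / 256 : ℝ) = 9 / 8 * (25 / 32) by norm_num, mul_pow]
        ring
    _ ≤ (∑' k : ℕ, ENNReal.ofReal ((2376 * decayC d B ^ 2 * A ^ 2) * (225 / 256) ^ k)) * sqR g := by
        rw [← Finset.sum_mul]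
        exact mul_le_mul_left (ENNReal.sum_le_tsum _) _
    _ ≤ _ := by
        rw [tsum_ofReal_mul_pow _ (by positivity) (by norm_num) (by norm_num)]
        refine mul_le_mul_left (ENNReal.ofReal_le_ofReal ?_) _
        have : 0 ≤ decayC d B ^ 2 * A ^ 2 := by positivity
        norm_num
        linarith

theorem Bump.integral_abs_dil {χ : Rd d → ℝ} {c : ℝ} (h : Bump χ c) (l : ℤ) :
    ∫ x, |dil l χ x| = 1 := by
  rw [_root_.integral_abs_dil, h.integral_abs]

theorem OmData.abs_sum_modPiece_hi_le (h : OmData d P Om A D) (hP : Prof d P Ψ B) {χ : Rd d → ℝ}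
    {c : ℝ} (hχ : Bump χ c) {g : Rd d → ℝ} {G : ℝ} (hG : ∀ x, |g x| ≤ G)
    (l : ℤ) (M : ℕ) (x : Rd d) :
    |∑ k ∈ Finset.range M, modPiece P (hi A k Om) χ k g l x| ≤ 2 * B * D * G := by
  have hD := h.D_pos
  have hB := hP.B_nonneg
  have hG0 : 0 ≤ G := (abs_nonneg _).trans (hG 0)
  have h1 : ∀ k, |modPiece P (hi A k Om) χ k g l x| ≤ (∫ y, |kOm P (hi A k Om) y|) * (2 * G) := by
    intro k
    have hk := (h.im_hi hP k).dil (l + k)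
    have a1 := fun x => abs_cv_le hk.int hG x
    have a2 := abs_cv_le (hχ.nice.dil l).int a1 x
    rw [hχ.integral_abs_dil, one_mul] at a2
    have a3 := a1 x
    rw [integral_abs_dil] at a2 a3
    refine (abs_sub _ _).trans ?_
    linarith
  have h2 : ∑ k ∈ Finset.range M, ∫ y, |kOm P (hi A k Om) y| ≤ B * D := by
    have h3 := (ENNReal.sum_le_tsum (Finset.range M)).trans (h.tsum_hi_le hP)
    have h4 : ∀ k, ∫⁻ y, ‖kOm P (hi A k Om) y‖ₑ = ENNReal.ofReal (∫ y, |kOm P (hi A k Om) y|) :=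
      fun k => (ofReal_integral_norm_eq_lintegral_enorm (h.im_hi hP k).int).symm
    simp_rw [h4] at h3
    rw [← ENNReal.ofReal_sum_of_nonneg fun i _ => integral_nonneg fun _ => abs_nonneg _] at h3
    exact (ENNReal.ofReal_le_ofReal_iff (by positivity)).1 h3
  calc |∑ k ∈ Finset.range M, modPiece P (hi A k Om) χ k g l x|
      ≤ ∑ k ∈ Finset.range M, |modPiece P (hi A k Om) χ k g l x| := Finset.abs_sum_le_sum_abs _ _
    _ ≤ ∑ k ∈ Finset.range M, (∫ y, |kOm P (hi A k Om) y|) * (2 * G) :=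
        Finset.sum_le_sum fun k _ => h1 k
    _ ≤ (B * D) * (2 * G) := by
        rw [← Finset.sum_mul]
        exact mul_le_mul_of_nonneg_right h2 (by positivity)
    _ = _ := by ring

theorem sum_Icc_eq_sum_range (f : ℤ → ℝ) (l n : ℤ) :
    ∑ j ∈ Finset.Icc l n, f j = ∑ k ∈ Finset.range (n + 1 - l).toNat, f (l + k) := by
  rw [Int.Icc_eq_finset_map, Finset.sum_map]
  rfl

theorem dil_add' (j : ℤ) (k m : Rd d → ℝ) :
    dil j (fun x => k x + m x) = fun x => dil j k x + dil j m x := by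
  ext x; unfold dil; ring

theorem OmData.modPiece_lo_add_hi (h : OmData d P Om A D) (hP : Prof d P Ψ B) {χ : Rd d → ℝ}
    (hχ : IM χ) {g : Rd d → ℝ} (hg : Nice g) (k : ℕ) (l : ℤ) (x : Rd d) :
    modPiece P Om χ k g l x =
      modPiece P (lo A k Om) χ k g l x + modPiece P (hi A k Om) χ k g l x := by
  have h1 := (h.im_lo hP k).dil (l + k)
  have h2 := (h.im_hi hP k).dil (l + k)
  have e : cv (dil (l + k) (kOm P Om)) g = fun x =>
      cv (dil (l + k) (kOm P (lo A k Om))) g x + cv (dil (l + k) (kOm P (hi A k Om))) g x := by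
    ext y
    rw [kOm_lo_add_hi P A k Om, dil_add']
    exact cv_add_left h1.int h2.int hg y
  unfold modPiece
  rw [e, cv_add_right (hχ.dil l).int (Nice.cv_right h1 hg) (Nice.cv_right h2 hg)]
  ring

/-- The truncated sums acting on bounded functions. -/
theorem exists_good_bound (hP : Prof d P Ψ B) (hB : 0 < B) :
    ∃ C : ℝ, 0 < C ∧ ∀ Om A D, OmData d P Om A D → ∀ (n : ℤ) (g : Rd d → ℝ) (G μ : ℝ), Nice g →
      (∀ x, |g x| ≤ G) → 0 < μ →
      ENNReal.ofReal (μ ^ 2) * volume {x | ∃ l : ℤ, -n ≤ l ∧ l ≤ n ∧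
        C * D * G + μ < |∑ j ∈ Finset.Icc l n, cv (dil j (kOm P Om)) g x|} ≤
        ENNReal.ofReal (C * D ^ 2) * sqR g := by
  obtain ⟨χ, c, hc, hχ⟩ := exists_bump d
  obtain ⟨C1, hC1, hHL⟩ := hχ.exists_maximal_le hc
  have hv := vb_nonneg (d := d) 1
  have hde := decayC_nonneg (d := d) hB.le
  set E1 : ℝ := 10 * decayC d B + 5 * B with hE1
  set C : ℝ := c * vb d 1 * B + 2 * B + 4 * C1 * E1 ^ 2 + 4 * (21384 * decayC d B ^ 2) with hC
  have hE0 : 0 ≤ E1 := by positivity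
  refine ⟨C, by positivity, fun Om A D h n g G μ hg hG hμ => ?_⟩
  have hA := h.A_pos
  have hD := h.D_pos
  have hG0 : 0 ≤ G := (abs_nonneg _).trans (hG 0)
  set f : ℤ → Rd d → ℝ := fun j => cv (dil j (kOm P Om)) g with hf
  have hfn : ∀ j, Nice (f j) := fun j => Nice.cv_right ((h.im hP).dil j) hg
  set U : Rd d → ℝ := fun x => ∑ j ∈ Finset.Icc (-n) n, f j x with hU
  have hUn : Nice U := Nice.sum fun j _ => hfn j
  set N : ℕ := (n + 1 - -n).toNat with hN
  set S1 := {x | ∃ l : ℤ, l ≤ n ∧ μ / 2 < |cv (dil l χ) U x|} with hS1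
  set S2 := {x | ∃ l ∈ Finset.Icc (-n) n, ∃ M ≤ N,
      μ / 2 < |∑ k ∈ Finset.range M, modPiece P (lo A k Om) χ k g l x|} with hS2
  have hsub : {x | ∃ l : ℤ, -n ≤ l ∧ l ≤ n ∧
      C * D * G + μ < |∑ j ∈ Finset.Icc l n, f j x|} ⊆ S1 ∪ S2 := by
    rintro x ⟨l, hl1, hl2, hx⟩
    by_contra hcon
    rw [Set.mem_union, not_or] at hcon
    have b1 : |cv (dil l χ) U x| ≤ μ / 2 := not_lt.1 fun hlt => hcon.1 ⟨l, hl2, hlt⟩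
    have b2 : |∑ k ∈ Finset.range (n + 1 - l).toNat, modPiece P (lo A k Om) χ k g l x| ≤ μ / 2 :=
      not_lt.1 fun hlt => hcon.2 ⟨l, Finset.mem_Icc.2 ⟨hl1, hl2⟩, _,
        Int.toNat_le_toNat (by omega), hlt⟩
    have b3 := h.abs_sum_modPiece_hi_le hP hχ hG l (n + 1 - l).toNat x
    have b4 : |∑ j ∈ Finset.Ico (-n) l, cv (dil l χ) (f j) x| ≤ (c * vb d 1 * B) * A * G := by
      refine (Finset.abs_sum_le_sum_abs _ _).trans ?_
      refine (Finset.sum_le_sum fun j _ => h.abs_cv_bump_cv_le hP hχ hc.le hg hG l j x).trans ?_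
      rw [← Finset.mul_sum]
      have : ∑ j ∈ Finset.Ico (-n) l, (2:ℝ) ^ (j - l) ≤ 1 := by
        simp_rw [zpow_sub₀ (two_ne_zero (α := ℝ))]
        rw [← Finset.sum_div, div_le_one (by positivity)]
        exact sum_Ico_two_zpow_le hl1
      exact mul_le_of_le_one_right (by positivity) this
    have e1 : cv (dil l χ) U x = ∑ j ∈ Finset.Ico (-n) l, cv (dil l χ) (f j) x +
        ∑ j ∈ Finset.Icc l n, cv (dil l χ) (f j) x := by
      rw [hU, cv_sum_right (hχ.nice.dil l).int (fun j _ => hfn j)]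
      have : Finset.Icc (-n) n = Finset.Ico (-n) l ∪ Finset.Icc l n := by
        ext i; simp only [Finset.mem_Icc, Finset.mem_union, Finset.mem_Ico]; omega
      rw [this, Finset.sum_union]
      rw [Finset.disjoint_left]
      intro i hi1 hi2
      rw [Finset.mem_Ico] at hi1
      rw [Finset.mem_Icc] at hi2
      omega
    have e2 : ∑ j ∈ Finset.Icc l n, f j x - ∑ j ∈ Finset.Icc l n, cv (dil l χ) (f j) x =
        ∑ k ∈ Finset.range (n + 1 - l).toNat, modPiece P (lo A k Om) χ k g l x +
        ∑ k ∈ Finset.range (n + 1 - l).toNat, modPiece P (hi A k Om) χ k g l x := by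
      rw [← Finset.sum_sub_distrib, sum_Icc_eq_sum_range, ← Finset.sum_add_distrib]
      refine Finset.sum_congr rfl fun k _ => ?_
      exact h.modPiece_lo_add_hi hP hχ.nice.toIM hg k l x
    have hCb : c * vb d 1 * B * A * G + 2 * B * D * G ≤ C * D * G := by
      have t1 : c * vb d 1 * B * A ≤ c * vb d 1 * B * D :=
        mul_le_mul_of_nonneg_left h.A_le (by positivity)
      have t2 : (c * vb d 1 * B + 2 * B) * D ≤ C * D := by
        refine mul_le_mul_of_nonneg_right ?_ hD.le
        rw [hC]
        have : 0 ≤ 4 * C1 * E1 ^ 2 + 4 * (21384 * decayC d B ^ 2) := by positivity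
        linarith
      have t3 := mul_le_mul_of_nonneg_right (t1.trans (le_refl _)) hG0
      have t4 := mul_le_mul_of_nonneg_right t2 hG0
      linarith
    rw [abs_le] at b1 b2 b3 b4
    have : |∑ j ∈ Finset.Icc l n, f j x| ≤ C * D * G + μ := by
      rw [abs_le]; constructor <;> linarith
    linarith
  have v1 := hHL U hUn n (μ / 2) (by positivity)
  have v2 := h.volume_modPiece_lo_le hP hχ hg (Finset.Icc (-n) n) N (ν := μ / 2) (by positivity)
  have v3 := h.sqR_sum_le hP (Finset.Icc (-n) n) hg
  have e4 : ENNReal.ofReal (μ ^ 2) = ENNReal.ofReal 4 * ENNReal.ofReal ((μ / 2) ^ 2) := by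
    rw [← ENNReal.ofReal_mul (by norm_num)]; congr 1; ring
  refine (mul_le_mul_right ((measure_mono hsub).trans (measure_union_le S1 S2)) _).trans ?_
  rw [e4, mul_assoc, mul_add]
  refine (mul_le_mul_right (add_le_add (v1.trans (mul_le_mul_right v3 _)) v2) _).trans ?_
  rw [← mul_assoc, ← ENNReal.ofReal_mul hC1, ← add_mul, ← mul_assoc,
    ← ENNReal.ofReal_add (by positivity) (by positivity), ← ENNReal.ofReal_mul (by norm_num)]
  refine mul_le_mul_left (ENNReal.ofReal_le_ofReal ?_) _
  have t1 : decayC d B ^ 2 * A ^ 2 ≤ decayC d B ^ 2 * D ^ 2 :=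
    mul_le_mul_of_nonneg_left (pow_le_pow_left₀ hA.le h.A_le 2) (sq_nonneg _)
  have t2 : 0 ≤ (c * vb d 1 * B + 2 * B) * D ^ 2 := by positivity
  have t3 : C * D ^ 2 = (c * vb d 1 * B + 2 * B) * D ^ 2 + 4 * (C1 * (E1 * D) ^ 2) +
    4 * (21384 * (decayC d B ^ 2 * D ^ 2)) := by rw [hC]; ring
  rw [t3]
  linarith

end GoodBound

section CellAverage

variable {d : ℕ}

/-- The part of `f` on `E` with mean value removed; `V` is the volume of `E`. -/
def meanFree (E : Set (Rd d)) (V : ℝ) (f : Rd d → ℝ) (x : Rd d) : ℝ :=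
  E.indicator (fun x => f x - (∫ y in E, f y) / V) x

variable {E : Set (Rd d)} {V : ℝ} {f : Rd d → ℝ}

theorem nice_meanFree (hE : MeasurableSet E) (hEf : volume E ≠ ∞) (hf : Nice f) :
    Nice (meanFree E V f) := by
  obtain ⟨C, hC⟩ := hf.bdd
  have h1 : IntegrableOn (fun x => f x - (∫ y in E, f y) / V) E :=
    hf.int.integrableOn.sub (integrableOn_const hEf)
  refine ⟨⟨(hf.meas.sub_const _).indicator hE, (integrable_indicator_iff hE).2 h1⟩,
    C + |(∫ y in E, f y) / V|, fun x => ?_⟩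
  have hC0 : 0 ≤ C := (abs_nonneg _).trans (hC x)
  by_cases hx : x ∈ E
  · rw [meanFree, Set.indicator_of_mem hx]
    exact (abs_sub _ _).trans (by linarith [hC x])
  · rw [meanFree, Set.indicator_of_notMem hx, abs_zero]
    positivity

theorem integral_meanFree (hE : MeasurableSet E) (hV : 0 < V) (hEV : volume E = ENNReal.ofReal V)
    (hf : Integrable f) : ∫ x, meanFree E V f x = 0 := by
  have hEf : volume E ≠ ∞ := by rw [hEV]; exact ENNReal.ofReal_ne_top
  change ∫ x, E.indicator _ x = 0
  rw [integral_indicator hE, integral_sub hf.integrableOn (integrableOn_const hEf),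
    setIntegral_const, measureReal_def, hEV, ENNReal.toReal_ofReal hV.le, smul_eq_mul]
  field_simp
  ring

theorem abs_average_mul_le (hV : 0 < V) :
    ENNReal.ofReal (|(∫ y in E, f y) / V| * V) ≤ ∫⁻ y in E, ‖f y‖ₑ := by
  rw [abs_div, abs_of_pos hV, div_mul_cancel₀ _ hV.ne', ← Real.norm_eq_abs, ofReal_norm]
  exact enorm_integral_le_lintegral_enorm _

theorem abs_average_le (hV : 0 < V) {M : ℝ} (hM : 0 ≤ M)
    (h : ∫⁻ y in E, ‖f y‖ₑ ≤ ENNReal.ofReal M * ENNReal.ofReal V) :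
    |(∫ y in E, f y) / V| ≤ M := by
  have h1 := (abs_average_mul_le hV).trans h
  rw [← ENNReal.ofReal_mul hM, ENNReal.ofReal_le_ofReal_iff (by positivity)] at h1
  exact le_of_mul_le_mul_right h1 hV

theorem lintegral_meanFree_le (hE : MeasurableSet E) (hV : 0 < V)
    (hEV : volume E = ENNReal.ofReal V) (hf : Measurable f) :
    ∫⁻ x, ‖meanFree E V f x‖ₑ ≤ 2 * ∫⁻ x in E, ‖f x‖ₑ := by
  have h1 : ∀ x, ‖meanFree E V f x‖ₑ =
      E.indicator (fun x => ‖f x - (∫ y in E, f y) / V‖ₑ) x := fun x =>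
    enorm_indicator_eq_indicator_enorm _ _
  simp only [h1]
  rw [lintegral_indicator hE]
  calc ∫⁻ x in E, ‖f x - (∫ y in E, f y) / V‖ₑ
      ≤ ∫⁻ x in E, (‖f x‖ₑ + ENNReal.ofReal |(∫ y in E, f y) / V|) := by
        refine lintegral_mono fun x => (enorm_sub_le).trans ?_
        rw [← Real.norm_eq_abs, ofReal_norm]
    _ = (∫⁻ x in E, ‖f x‖ₑ) + ENNReal.ofReal (|(∫ y in E, f y) / V| * V) := by
        rw [lintegral_add_left hf.enorm, setLIntegral_const, hEV,
          ENNReal.ofReal_mul (abs_nonneg _)]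
    _ ≤ _ := by
        rw [two_mul]
        gcongr
        exact abs_average_mul_le hV

end CellAverage

section CalderonZygmund

variable {d : ℕ} {t : Fin d → Bool} {m : ℤ} {f : Rd d → ℝ} {α : ℝ}

/-- Finitely supported functions that are constant on the dyadic cells of side `2ᵐ`. -/
structure StepFn (t : Fin d → Bool) (m : ℤ) (f : Rd d → ℝ) : Prop where
  nice : Nice f
  const : ∀ x y, cellIdx t m x = cellIdx t m y → f x = f y
  fin : {v | ∃ x, cellIdx t m x = v ∧ f x ≠ 0}.Finite

/-- The dyadic cell with scale `p.1` and index `p.2`. -/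
def dyCell (t : Fin d → Bool) (p : ℤ × (Fin d → ℤ)) : Set (Rd d) :=
  {x | cellIdx t p.1 x = p.2}

/-- The average of `|f|` over the cell of scale `q` containing `x` exceeds `α`. -/
def Heavy (t : Fin d → Bool) (f : Rd d → ℝ) (α : ℝ) (q : ℤ) (x : Rd d) : Prop :=
  ENNReal.ofReal α * ENNReal.ofReal (((2:ℝ) ^ q) ^ d) <
    ∫⁻ y in {y | cellIdx t q y = cellIdx t q x}, ‖f y‖ₑ

theorem heavy_congr {q : ℤ} {x y : Rd d} (h : cellIdx t q x = cellIdx t q y) :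
    Heavy t f α q x ↔ Heavy t f α q y := by
  unfold Heavy
  rw [h]

/-- The maximal heavy cells of scale at least `m`. -/
def czCells (t : Fin d → Bool) (m : ℤ) (f : Rd d → ℝ) (α : ℝ) : Set (ℤ × (Fin d → ℤ)) :=
  {p | m ≤ p.1 ∧ ∃ x ∈ dyCell t p, Heavy t f α p.1 x ∧ ∀ q, p.1 < q → ¬ Heavy t f α q x}

theorem czCells_heavy {p : ℤ × (Fin d → ℤ)} (hp : p ∈ czCells t m f α) {y : Rd d}
    (hy : y ∈ dyCell t p) :
    Heavy t f α p.1 y ∧ ∀ q, p.1 < q → ¬ Heavy t f α q y := by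
  obtain ⟨_, x, hx, h1, h2⟩ := hp
  have hxy : cellIdx t p.1 x = cellIdx t p.1 y := by
    rw [show cellIdx t p.1 x = p.2 from hx, show cellIdx t p.1 y = p.2 from hy]
  exact ⟨(heavy_congr hxy).1 h1, fun q hq h =>
    h2 q hq ((heavy_congr (cell_eq_of_le (cellIdx_nested t) hq.le hxy)).2 h)⟩

theorem czCells_eq {p p' : ℤ × (Fin d → ℤ)} (hp : p ∈ czCells t m f α)
    (hp' : p' ∈ czCells t m f α) {y y' : Rd d} (hy : y ∈ dyCell t p) (hy' : y' ∈ dyCell t p')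
    (h : cellIdx t m y = cellIdx t m y') : p = p' := by
  have hc : ∀ q, m ≤ q → cellIdx t q y = cellIdx t q y' := fun q hq =>
    cell_eq_of_le (cellIdx_nested t) hq h
  have h1 := czCells_heavy hp hy
  have h2 := czCells_heavy hp' hy'
  have h12 : p.1 = p'.1 := by
    rcases lt_trichotomy p.1 p'.1 with hlt | heq | hlt
    · exact absurd ((heavy_congr (hc _ hp'.1)).2 h2.1) (h1.2 _ hlt)
    · exact heq
    · exact absurd ((heavy_congr (hc _ hp.1)).1 h1.1) (h2.2 _ hlt)
  refine Prod.ext h12 ?_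
  rw [← show cellIdx t p.1 y = p.2 from hy, ← show cellIdx t p'.1 y' = p'.2 from hy', ← h12]
  exact hc _ hp.1

theorem czCells_lt {p : ℤ × (Fin d → ℤ)} (hp : p ∈ czCells t m f α) :
    ENNReal.ofReal α * ENNReal.ofReal (((2:ℝ) ^ p.1) ^ d) < ∫⁻ y in dyCell t p, ‖f y‖ₑ := by
  obtain ⟨_, x, hx, h1, h2⟩ := hp
  have := h1
  unfold Heavy at this
  rwa [show cellIdx t p.1 x = p.2 from hx] at this

theorem czCells_le {p : ℤ × (Fin d → ℤ)} (hp : p ∈ czCells t m f α) (hα : 0 ≤ α) :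
    ∫⁻ y in dyCell t p, ‖f y‖ₑ ≤
      ENNReal.ofReal (2 ^ d * α) * ENNReal.ofReal (((2:ℝ) ^ p.1) ^ d) := by
  obtain ⟨_, x, hx, h1, h2⟩ := hp
  have h3 := h2 (p.1 + 1) (lt_add_one _)
  unfold Heavy at h3
  rw [not_lt] at h3
  refine (lintegral_mono_set fun y hy => ?_).trans (h3.trans_eq ?_)
  · exact cellIdx_nested t _ _ _
      ((show cellIdx t p.1 y = p.2 from hy).trans (show cellIdx t p.1 x = p.2 from hx).symm)
  · rw [← ENNReal.ofReal_mul hα, ← ENNReal.ofReal_mul (by positivity), zpow_add_one₀ two_ne_zero,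
      mul_pow]
    congr 1
    ring

theorem czCells_finite (hf : StepFn t m f) : (czCells t m f α).Finite := by
  have h1 : ∀ p ∈ czCells t m f α, ∃ y ∈ dyCell t p, f y ≠ 0 := by
    intro p hp
    by_contra! h
    have h2 := czCells_lt hp
    have h3 : ∫⁻ y in dyCell t p, ‖f y‖ₑ = 0 :=
      setLIntegral_eq_zero (measurableSet_cell t _ _) fun y hy => by simp [h y hy]
    rw [h3] at h2
    exact not_lt_zero h2
  choose! y hy hfy using h1
  refine Set.Finite.of_injOn (f := fun p => cellIdx t m (y p)) (fun p hp => ?_) ?_ hf.fin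
  · exact ⟨y p, rfl, hfy p hp⟩
  · intro p hp p' hp' h
    exact czCells_eq hp hp' (hy p hp) (hy p' hp') h

theorem exists_mem_czCells (hd : 1 ≤ d) (hf : StepFn t m f) (hα : 0 < α) {x : Rd d}
    (hx : α < |f x|) : ∃ p ∈ czCells t m f α, x ∈ dyCell t p := by
  have hm : Heavy t f α m x := by
    unfold Heavy
    rw [setLIntegral_congr_fun (g := fun _ => ‖f x‖ₑ) (measurableSet_cell t _ _)
      (fun y hy => by simp only [hf.const y x hy]), setLIntegral_const, volume_cell,
      ← ofReal_norm, Real.norm_eq_abs]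
    have hV : (0:ℝ) < (2 ^ m) ^ d := by positivity
    rw [← ENNReal.ofReal_mul hα.le, ← ENNReal.ofReal_mul (by positivity)]
    exact (ENNReal.ofReal_lt_ofReal_iff (mul_pos (hα.trans hx) hV)).2 (by gcongr)
  have hb : ∃ b : ℤ, ∀ q : ℤ, m ≤ q ∧ Heavy t f α q x → q ≤ b := by
    obtain ⟨N, hN⟩ := exists_nat_gt ((∫ y, ‖f y‖) / α)
    refine ⟨N, fun q ⟨_, hq⟩ => ?_⟩
    by_contra! hlt
    unfold Heavy at hq
    have h1 := hq.trans_le (setLIntegral_le_lintegral _ _)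
    rw [← ofReal_integral_norm_eq_lintegral_enorm hf.nice.int, ← ENNReal.ofReal_mul hα.le,
      ENNReal.ofReal_lt_ofReal_iff_of_nonneg (by positivity)] at h1
    have h2 : (N:ℝ) ≤ ((2:ℝ) ^ q) ^ d := by
      calc (N:ℝ) ≤ (2:ℝ) ^ N := by exact_mod_cast Nat.lt_two_pow_self.le
        _ = (2:ℝ) ^ (N:ℤ) := (zpow_natCast _ _).symm
        _ ≤ (2:ℝ) ^ q := by gcongr; norm_num
        _ ≤ ((2:ℝ) ^ q) ^ d := le_self_pow₀ (one_le_zpow₀ (by norm_num) (by omega)) (by omega)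
    rw [div_lt_iff₀ hα] at hN
    nlinarith
  obtain ⟨q, hq, hmax⟩ := Int.exists_greatest_of_bdd hb ⟨m, le_rfl, hm⟩
  refine ⟨(q, cellIdx t q x), ⟨hq.1, x, rfl, hq.2, fun q' hq' h => ?_⟩, rfl⟩
  exact absurd (hmax q' ⟨hq.1.trans hq'.le, h⟩) (not_le.2 hq')

theorem sum_lintegral_cz_le {s : Finset (ℤ × (Fin d → ℤ))}
    (hs : (s : Set (ℤ × (Fin d → ℤ))).PairwiseDisjoint (dyCell t)) :
    ∑ p ∈ s, ∫⁻ y in dyCell t p, ‖f y‖ₑ ≤ ∫⁻ y, ‖f y‖ₑ := by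
  rw [← lintegral_biUnion_finset hs fun p _ => measurableSet_cell t _ _]
  exact setLIntegral_le_lintegral _ _

/-- Calderón–Zygmund decomposition of a dyadic step function. -/
theorem StepFn.exists_calderonZygmund (hd : 1 ≤ d) (hf : StepFn t m f) (hα : 0 < α) :
    ∃ (s : Finset (ℤ × (Fin d → ℤ))) (c : ℤ × (Fin d → ℤ) → Rd d)
      (b : ℤ × (Fin d → ℤ) → Rd d → ℝ) (g : Rd d → ℝ),
      BadFam s Prod.fst (dyCell t) c √d b (ENNReal.ofReal (2 * (2 ^ d * α))) ∧ Nice g ∧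
      (∀ x, f x = g x + ∑ p ∈ s, b p x) ∧ (∀ x, |g x| ≤ 2 ^ d * α) ∧
      sqR g ≤ ENNReal.ofReal (3 * (2 ^ d * α)) * ∫⁻ x, ‖f x‖ₑ ∧
      ENNReal.ofReal α * ∑ p ∈ s, volume (dyCell t p) ≤ ∫⁻ x, ‖f x‖ₑ ∧
      (∑ p ∈ s, ∫⁻ x, ‖b p x‖ₑ) ≤ 2 * ∫⁻ x, ‖f x‖ₑ := by
  classical
  set s := (czCells_finite (α := α) hf).toFinset with hs
  have hmem : ∀ {p}, p ∈ s ↔ p ∈ czCells t m f α := fun {p} => by simp [hs]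
  have hvol : ∀ p, volume (dyCell t p) = ENNReal.ofReal (((2:ℝ) ^ p.1) ^ d) := fun p =>
    volume_cell t _ _
  have hpos : ∀ p : ℤ × (Fin d → ℤ), 0 < ((2:ℝ) ^ p.1) ^ d := fun p => by positivity
  have hne : ∀ p, (dyCell t p).Nonempty := fun p => by
    refine nonempty_of_measure_ne_zero (μ := volume) ?_
    rw [hvol]
    simpa using hpos p
  choose c hc using hne
  have hmeas : ∀ p, MeasurableSet (dyCell t p) := fun p => measurableSet_cell t _ _
  have hdisj : (s : Set (ℤ × (Fin d → ℤ))).PairwiseDisjoint (dyCell t) := by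
    intro p hp p' hp' hpp
    refine Set.disjoint_left.2 fun x hx hx' => hpp ?_
    exact czCells_eq (hmem.1 hp) (hmem.1 hp') hx hx' rfl
  set b : ℤ × (Fin d → ℤ) → Rd d → ℝ := fun p => meanFree (dyCell t p) (((2:ℝ) ^ p.1) ^ d) f
    with hb
  have hbn : ∀ p, Nice (b p) := fun p =>
    nice_meanFree (hmeas p) (by rw [hvol]; exact ENNReal.ofReal_ne_top) hf.nice
  have hsub : ∀ p, dyCell t p ⊆ closedBall (c p) (√d * (2:ℝ) ^ p.1) := fun p x hx => by
    rw [mem_closedBall_iff_norm]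
    exact norm_sub_le_of_cellIdx_eq
      ((show cellIdx t p.1 x = p.2 from hx).trans (show cellIdx t p.1 (c p) = p.2 from hc p).symm)
  have hl1 : ∀ p, ∫⁻ x, ‖b p x‖ₑ ≤ 2 * ∫⁻ x in dyCell t p, ‖f x‖ₑ := fun p =>
    lintegral_meanFree_le (hmeas p) (hpos p) (hvol p) hf.nice.meas
  have hsum : (∑ p ∈ s, ∫⁻ x, ‖b p x‖ₑ) ≤ 2 * ∫⁻ x, ‖f x‖ₑ := by
    refine (Finset.sum_le_sum fun p _ => hl1 p).trans ?_
    rw [← Finset.mul_sum]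
    gcongr
    exact sum_lintegral_cz_le hdisj
  have hbz : ∀ p x, x ∉ dyCell t p → b p x = 0 := fun p x hx => Set.indicator_of_notMem hx _
  set g : Rd d → ℝ := fun x => f x - ∑ p ∈ s, b p x with hg
  have hgn : Nice g := hf.nice.sub (Nice.sum fun p _ => hbn p)
  have hα2 : α ≤ 2 ^ d * α := by
    have : (1:ℝ) ≤ 2 ^ d := one_le_pow₀ (by norm_num)
    nlinarith
  have hgb : ∀ x, |g x| ≤ 2 ^ d * α := by
    intro x
    by_cases hx : ∃ p ∈ s, x ∈ dyCell t p
    · obtain ⟨p, hp, hxp⟩ := hx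
      have h1 : ∑ p ∈ s, b p x = b p x := by
        refine Finset.sum_eq_single_of_mem p hp fun p' hp' hne => hbz _ _ fun hx' => ?_
        exact Set.disjoint_left.1 (hdisj hp' hp hne) hx' hxp
      have h2 : b p x = f x - (∫ y in dyCell t p, f y) / ((2:ℝ) ^ p.1) ^ d :=
        Set.indicator_of_mem hxp _
      have h3 : g x = (∫ y in dyCell t p, f y) / ((2:ℝ) ^ p.1) ^ d := by
        simp only [hg, h1, h2]; ring
      rw [h3]
      exact abs_average_le (hpos p) (by positivity) (czCells_le (hmem.1 hp) hα.le)
    · have h1 : ∑ p ∈ s, b p x = 0 :=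
        Finset.sum_eq_zero fun p hp => hbz _ _ fun hxp => hx ⟨p, hp, hxp⟩
      simp only [hg, h1, sub_zero]
      by_contra! hlt
      obtain ⟨p, hp, hxp⟩ := exists_mem_czCells hd hf hα (hα2.trans_lt hlt)
      exact hx ⟨p, hmem.2 hp, hxp⟩
  refine ⟨s, c, b, g, ⟨⟨by positivity, fun p _ => hmeas p, hdisj, fun p _ => hvol p,
    fun p _ => hsub p⟩, fun p _ => hbn p, fun p _ => ?_, fun p _ x hx => ?_, fun p hp => ?_⟩, hgn,
    fun x => by simp [hg], hgb, ?_, ?_, hsum⟩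
  · exact integral_meanFree (hmeas p) (hpos p) (hvol p) hf.nice.int
  · exact hsub p (by_contra fun h => hx (hbz p x h))
  · refine (hl1 p).trans ?_
    rw [hvol, ENNReal.ofReal_mul (by norm_num), mul_assoc, ENNReal.ofReal_ofNat]
    gcongr
    exact czCells_le (hmem.1 hp) hα.le
  · have hg1 : ∫⁻ x, ‖g x‖ₑ ≤ 3 * ∫⁻ x, ‖f x‖ₑ := by
      calc ∫⁻ x, ‖g x‖ₑ ≤ ∫⁻ x, (‖f x‖ₑ + ∑ p ∈ s, ‖b p x‖ₑ) := by
            refine lintegral_mono fun x => (enorm_sub_le).trans ?_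
            gcongr
            exact enorm_sum_le _ _
        _ = (∫⁻ x, ‖f x‖ₑ) + ∑ p ∈ s, ∫⁻ x, ‖b p x‖ₑ := by
            rw [lintegral_add_left hf.nice.meas.enorm,
              lintegral_finsetSum _ fun p _ => (hbn p).meas.enorm]
        _ ≤ (∫⁻ x, ‖f x‖ₑ) + 2 * ∫⁻ x, ‖f x‖ₑ := by gcongr
        _ = 3 * ∫⁻ x, ‖f x‖ₑ := by ring
    calc sqR g ≤ ∫⁻ x, ENNReal.ofReal (2 ^ d * α) * ‖g x‖ₑ := by
          refine lintegral_mono fun x => ?_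
          rw [← ofReal_norm, Real.norm_eq_abs, ← ENNReal.ofReal_mul (by positivity), ← sq_abs, sq]
          exact ENNReal.ofReal_le_ofReal
            (mul_le_mul_of_nonneg_right (hgb x) (abs_nonneg _))
      _ = ENNReal.ofReal (2 ^ d * α) * ∫⁻ x, ‖g x‖ₑ := lintegral_const_mul _ hgn.meas.enorm
      _ ≤ ENNReal.ofReal (2 ^ d * α) * (3 * ∫⁻ x, ‖f x‖ₑ) := by gcongr
      _ = _ := by
          rw [ENNReal.ofReal_mul (by norm_num : (0:ℝ) ≤ 3), ENNReal.ofReal_ofNat]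
          generalize ENNReal.ofReal (2 ^ d * α) = a
          ring
  · rw [Finset.mul_sum]
    refine (Finset.sum_le_sum fun p hp => ?_).trans (sum_lintegral_cz_le hdisj)
    rw [hvol]
    exact (czCells_lt (hmem.1 hp)).le

end CalderonZygmund

section StepFunctions

variable {d : ℕ} {P Ψ : Rd d → ℝ} {B : ℝ}

/-- The set where some truncated sum of pieces of the operator exceeds `lam`. -/
def truncSet (P Om : Rd d → ℝ) (n : ℤ) (f : Rd d → ℝ) (lam : ℝ) : Set (Rd d) :=
  {x | ∃ l : ℤ, -n ≤ l ∧ l ≤ n ∧ lam < |∑ j ∈ Finset.Icc l n, cv (dil j (kOm P Om)) f x|}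

theorem ofReal_mul_ofReal_mul {x : ℝ} (hx : 0 ≤ x) (y : ℝ) (Z : ℝ≥0∞) :
    ENNReal.ofReal x * (ENNReal.ofReal y * Z) = ENNReal.ofReal (x * y) * Z := by
  rw [← mul_assoc, ENNReal.ofReal_mul hx]

theorem exists_weak_bound_stepFn (hd : 2 ≤ d) (hP : Prof d P Ψ B) (hB : 0 < B) :
    ∃ C : ℝ, 0 < C ∧ ∀ Om A D, OmData d P Om A D → ∀ t m f, StepFn t m f →
      ∀ (n : ℤ) (lam : ℝ), 0 < lam →
        ENNReal.ofReal lam * volume (truncSet P Om n f lam) ≤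
          ENNReal.ofReal (C * D) * ∫⁻ x, ‖f x‖ₑ := by
  obtain ⟨Cb, hCb, hbad⟩ := exists_bad_bound (ι := ℤ × (Fin d → ℤ)) hd hP hB (ρ := √d)
    (by positivity)
  obtain ⟨Cg, hCg, hgood⟩ := exists_good_bound hP hB
  refine ⟨12 + 4 * Cb * Cg * 2 ^ d + 4 * Cb + 4 * Cb / Cg, by positivity, ?_⟩
  intro Om A D hOm t m f hf n lam hlam
  have hD : 0 < D := hOm.D_pos
  set α := lam / (4 * Cg * D * 2 ^ d) with hαdef
  have hα : 0 < α := by positivity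
  have hG : 2 ^ d * α = lam / (4 * Cg * D) := by rw [hαdef]; field_simp
  obtain ⟨s, c, b, g, hbf, hgn, hfg, hgb, hgs, hV, hb1⟩ :=
    hf.exists_calderonZygmund (by omega) hα
  set F := ∫⁻ x, ‖f x‖ₑ with hF
  set V := ∑ p ∈ s, volume (dyCell t p) with hVdef
  set N := ∑ p ∈ s, ∫⁻ x, ‖b p x‖ₑ with hN
  have h1 := hgood Om A D hOm n g (2 ^ d * α) (lam / 4) hgn hgb (by positivity)
  have h2 := hbad s _ _ _ _ _ hbf Om A D hOm n (lam / 2) (by positivity)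
  set S1 := {x | ∃ l : ℤ, -n ≤ l ∧ l ≤ n ∧ Cg * D * (2 ^ d * α) + lam / 4 <
    |∑ j ∈ Finset.Icc l n, cv (dil j (kOm P Om)) g x|} with hS1
  set S2 := {x | ∃ l : ℤ, lam / 2 <
    |∑ j ∈ Finset.Icc l n, cv (dil j (kOm P Om)) (fun y => ∑ i ∈ s, b i y) x|} with hS2
  have hsub : truncSet P Om n f lam ⊆ S1 ∪ S2 := by
    rintro x ⟨l, hl1, hl2, hx⟩
    have h3 : ∀ j, cv (dil j (kOm P Om)) f x = cv (dil j (kOm P Om)) g x +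
        cv (dil j (kOm P Om)) (fun y => ∑ i ∈ s, b i y) x := by
      intro j
      rw [← cv_add_right ((hOm.im hP).dil j).int hgn (Nice.sum hbf.nice) x]
      congr 1
      exact funext hfg
    simp only [h3, Finset.sum_add_distrib] at hx
    have h4 : Cg * D * (2 ^ d * α) + lam / 4 = lam / 2 := by rw [hG]; field_simp; ring
    by_contra hnot
    rw [Set.mem_union, not_or] at hnot
    have h5 : |∑ j ∈ Finset.Icc l n, cv (dil j (kOm P Om)) g x| ≤ lam / 2 := by
      by_contra! h
      exact hnot.1 ⟨l, hl1, hl2, h4.trans_lt h⟩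
    have h6 : |∑ j ∈ Finset.Icc l n, cv (dil j (kOm P Om)) (fun y => ∑ i ∈ s, b i y) x| ≤
        lam / 2 := by
      by_contra! h
      exact hnot.2 ⟨l, h⟩
    linarith [abs_add_le (∑ j ∈ Finset.Icc l n, cv (dil j (kOm P Om)) g x)
      (∑ j ∈ Finset.Icc l n, cv (dil j (kOm P Om)) (fun y => ∑ i ∈ s, b i y) x)]
  have hg3 : ENNReal.ofReal lam * volume S1 ≤ ENNReal.ofReal (12 * D) * F := by
    calc ENNReal.ofReal lam * volume S1
        = ENNReal.ofReal (16 / lam) * (ENNReal.ofReal ((lam / 4) ^ 2) * volume S1) := by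
          rw [ofReal_mul_ofReal_mul (by positivity)]
          congr 2
          field_simp
          norm_num
      _ ≤ ENNReal.ofReal (16 / lam) * (ENNReal.ofReal (Cg * D ^ 2) *
            (ENNReal.ofReal (3 * (2 ^ d * α)) * F)) := by
          refine mul_le_mul_right (h1.trans ?_) _
          exact mul_le_mul_right hgs _
      _ = ENNReal.ofReal (12 * D) * F := by
          rw [ofReal_mul_ofReal_mul (by positivity), ofReal_mul_ofReal_mul (by positivity), hG]
          congr 2
          field_simp
          norm_num
  have hb3 : ENNReal.ofReal lam * volume S2 ≤ ENNReal.ofReal (4 * Cb * Cg * 2 ^ d * D) * F +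
      ENNReal.ofReal (4 * Cb * D) * F + ENNReal.ofReal (4 * Cb / Cg * D) * F := by
    refine (mul_le_mul_right h2 _).trans ?_
    rw [mul_add, mul_add]
    refine add_le_add (add_le_add ?_ ?_) ?_
    · calc ENNReal.ofReal lam * (ENNReal.ofReal Cb * V)
          = ENNReal.ofReal (4 * Cb * Cg * 2 ^ d * D) * (ENNReal.ofReal α * V) := by
            rw [ofReal_mul_ofReal_mul hlam.le, ofReal_mul_ofReal_mul (by positivity)]
            congr 2
            rw [hαdef]
            field_simp
        _ ≤ _ := mul_le_mul_right hV _
    · calc ENNReal.ofReal lam * (ENNReal.ofReal (Cb * D / (lam / 2)) * N)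
          ≤ ENNReal.ofReal lam * (ENNReal.ofReal (Cb * D / (lam / 2)) * (ENNReal.ofReal 2 * F)) := by
            refine mul_le_mul_right (mul_le_mul_right ?_ _) _
            rwa [ENNReal.ofReal_ofNat]
        _ = _ := by
            rw [ofReal_mul_ofReal_mul (by positivity), ofReal_mul_ofReal_mul (by positivity)]
            congr 2
            field_simp
            norm_num
    · calc ENNReal.ofReal lam * (ENNReal.ofReal (Cb * A ^ 2 / (lam / 2) ^ 2) *
            (ENNReal.ofReal (2 * (2 ^ d * α)) * N))
          ≤ ENNReal.ofReal lam * (ENNReal.ofReal (Cb * A ^ 2 / (lam / 2) ^ 2) *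
            (ENNReal.ofReal (2 * (2 ^ d * α)) * (ENNReal.ofReal 2 * F))) := by
            refine mul_le_mul_right (mul_le_mul_right (mul_le_mul_right ?_ _) _) _
            rwa [ENNReal.ofReal_ofNat]
        _ = ENNReal.ofReal (4 * Cb / Cg * (A ^ 2 / D)) * F := by
            rw [ofReal_mul_ofReal_mul (by positivity), ofReal_mul_ofReal_mul (by positivity),
              ofReal_mul_ofReal_mul (by positivity), hG]
            congr 2
            field_simp
            norm_num
        _ ≤ _ := by
            refine mul_le_mul_left (ENNReal.ofReal_le_ofReal ?_) _
            refine mul_le_mul_of_nonneg_left ?_ (by positivity)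
            rw [div_le_iff₀ hD]
            nlinarith [hOm.A_pos, hOm.A_le]
  calc ENNReal.ofReal lam * volume (truncSet P Om n f lam)
      ≤ ENNReal.ofReal lam * volume S1 + ENNReal.ofReal lam * volume S2 := by
        rw [← mul_add]
        exact mul_le_mul_right ((measure_mono hsub).trans (measure_union_le _ _)) _
    _ ≤ _ := add_le_add hg3 hb3
    _ = _ := by
        rw [← add_mul, ← add_mul, ← add_mul, ← ENNReal.ofReal_add (by positivity) (by positivity),
          ← ENNReal.ofReal_add (by positivity) (by positivity),
          ← ENNReal.ofReal_add (by positivity) (by positivity)]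
        congr 2
        ring

end StepFunctions

section Density

variable {d : ℕ}

/-- The lower corner of the dyadic cell of side `2ᵐ` with index `v`. -/
def corner (m : ℤ) (v : Fin d → ℤ) : Rd d := WithLp.toLp 2 fun i => (2:ℝ) ^ m * v i

theorem cellIdx_corner (m : ℤ) (v : Fin d → ℤ) : cellIdx (fun _ => false) m (corner m v) = v := by
  ext i
  change ⌊(2:ℝ) ^ (-m) * ((2:ℝ) ^ m * v i) - (if false then 1 / 3 else 0) * (-1) ^ m⌋ = v i
  rw [← mul_assoc, ← zpow_add₀ two_ne_zero]
  simp

theorem stepFn_comp_corner {g : Rd d → ℝ} {M R : ℝ} (hM : ∀ x, |g x| ≤ M)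
    (hR : ∀ x, g x ≠ 0 → ‖x‖ ≤ R) (m : ℤ) :
    StepFn (fun _ => false) m fun x => g (corner m (cellIdx (fun _ => false) m x)) := by
  refine ⟨Nice.of_bounded_support (R := R + √d * 2 ^ m) ?_ (fun x => hM _) fun x hx => ?_,
    fun x y h => by rw [h], ?_⟩
  · exact (Measurable.of_discrete (f := fun v => g (corner m v))).comp (measurable_cellIdx _ m)
  · have h1 := hR _ hx
    have h2 := norm_sub_le_of_cellIdx_eq (cellIdx_corner m (cellIdx (fun _ => false) m x)).symm
    linarith [norm_le_norm_add_norm_sub' x (corner m (cellIdx (fun _ => false) m x))]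
  · refine (Set.finite_Icc (fun _ : Fin d => -⌈2 ^ (-m) * R⌉) fun _ => ⌈2 ^ (-m) * R⌉).subset ?_
    rintro v ⟨x, hx, hgx⟩
    rw [hx] at hgx
    have h1 := hR _ hgx
    have h2 : ∀ i, |v i| ≤ ⌈2 ^ (-m) * R⌉ := by
      intro i
      have h3 : |(2:ℝ) ^ m * v i| ≤ ‖corner m v‖ := PiLp.norm_apply_le (corner m v) i
      rw [abs_mul, abs_of_pos (by positivity)] at h3
      have h4 : |(v i : ℝ)| ≤ 2 ^ (-m) * R := by
        rw [zpow_neg, inv_mul_eq_div, le_div_iff₀ (by positivity)]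
        linarith
      exact_mod_cast h4.trans (Int.le_ceil _)
    exact ⟨fun i => (abs_le.1 (h2 i)).1, fun i => (abs_le.1 (h2 i)).2⟩

theorem exists_stepFn_approx {f : Rd d → ℝ} (hf : Integrable f) {ε : ℝ} (hε : 0 < ε) :
    ∃ m h, StepFn (fun _ : Fin d => false) m h ∧ ∫⁻ x, ‖f x - h x‖ₑ ≤ ENNReal.ofReal ε := by
  obtain ⟨g, hgs, hg1, hgc, hgi⟩ := hf.exists_hasCompactSupport_lintegral_sub_le
    (ε := ENNReal.ofReal (ε / 2)) (by simpa using hε)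
  obtain ⟨M, hM⟩ := hgs.exists_bound_of_continuous hgc
  obtain ⟨R, hR0, hR⟩ := hgs.isCompact.isBounded.subset_closedBall_lt 0 0
  have hR' : ∀ x, g x ≠ 0 → ‖x‖ ≤ R := fun x hx => by
    simpa using hR (subset_tsupport _ hx)
  set W := (volume (closedBall (0 : Rd d) (R + √d))).toReal with hW
  set δ := ε / 2 / (W + 1) with hδ
  have hW0 : 0 ≤ W := ENNReal.toReal_nonneg
  have hδ0 : 0 < δ := by positivity
  obtain ⟨η, hη, hgη⟩ := Metric.uniformContinuous_iff.1
    (hgs.uniformContinuous_of_continuous hgc) δ hδ0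
  obtain ⟨N, hN⟩ := exists_pow_lt_of_lt_one (show 0 < η / (√d + 1) by positivity)
    (by norm_num : (1/2 : ℝ) < 1)
  have h2N : (2:ℝ) ^ (-(N:ℤ)) = (1 / 2) ^ N := by simp
  have hdη : √d * (2:ℝ) ^ (-(N:ℤ)) < η := by
    rw [h2N]
    rw [lt_div_iff₀ (by positivity)] at hN
    nlinarith [show (0:ℝ) < (1 / 2) ^ N by positivity]
  have hd1 : √d * (2:ℝ) ^ (-(N:ℤ)) ≤ √d := by
    rw [h2N]
    exact mul_le_of_le_one_right (by positivity) (pow_le_one₀ (by norm_num) (by norm_num))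
  have hst := stepFn_comp_corner (g := g) (M := M) (R := R) hM hR' (-(N:ℤ))
  refine ⟨-(N:ℤ), _, hst, ?_⟩
  set h := fun x => g (corner (-(N:ℤ)) (cellIdx (fun _ => false) (-(N:ℤ)) x)) with hh
  have hgh : ∀ x, ‖g x - h x‖ₑ ≤
      (closedBall (0 : Rd d) (R + √d)).indicator (fun _ => ENNReal.ofReal δ) x := by
    intro x
    have h2 := norm_sub_le_of_cellIdx_eq
      (cellIdx_corner (-(N:ℤ)) (cellIdx (fun _ => false) (-(N:ℤ)) x)).symm
    by_cases hx : x ∈ closedBall (0 : Rd d) (R + √d)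
    · rw [Set.indicator_of_mem hx, ← ofReal_norm]
      refine ENNReal.ofReal_le_ofReal ?_
      rw [← dist_eq_norm]
      refine (hgη ?_).le
      rw [dist_eq_norm]
      exact h2.trans_lt hdη
    · rw [mem_closedBall_zero_iff, not_le] at hx
      have h3 : g x = 0 := by
        by_contra h
        linarith [hR' x h, Real.sqrt_nonneg d]
      have h4 : h x = 0 := by
        by_contra h
        linarith [hR' _ h,
          norm_le_norm_add_norm_sub' x (corner (-(N:ℤ)) (cellIdx (fun _ => false) (-(N:ℤ)) x))]
      simp [h3, h4]
  have hgh1 : ∫⁻ x, ‖g x - h x‖ₑ ≤ ENNReal.ofReal (ε / 2) := by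
    refine (lintegral_mono hgh).trans ?_
    rw [lintegral_indicator measurableSet_closedBall, setLIntegral_const,
      ← ENNReal.ofReal_toReal (measure_closedBall_lt_top (x := (0 : Rd d)) (r := R + √d)).ne,
      ← ENNReal.ofReal_mul hδ0.le]
    refine ENNReal.ofReal_le_ofReal ?_
    change δ * W ≤ ε / 2
    rw [hδ, div_mul_eq_mul_div, div_le_iff₀ (by positivity)]
    nlinarith
  calc ∫⁻ x, ‖f x - h x‖ₑ ≤ ∫⁻ x, (‖f x - g x‖ₑ + ‖g x - h x‖ₑ) := by
        refine lintegral_mono fun x => ?_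
        rw [show f x - h x = (f x - g x) + (g x - h x) by ring]
        exact enorm_add_le _ _
    _ = (∫⁻ x, ‖f x - g x‖ₑ) + ∫⁻ x, ‖g x - h x‖ₑ :=
        lintegral_add_right _ (hgc.measurable.sub hst.nice.meas).enorm
    _ ≤ ENNReal.ofReal (ε / 2) + ENNReal.ofReal (ε / 2) := add_le_add hg1 hgh1
    _ = ENNReal.ofReal ε := by
        rw [← ENNReal.ofReal_add (by positivity) (by positivity), add_halves]

theorem ae_integrable_cv_integrand {k f : Rd d → ℝ} (hk : Integrable k) (hf : Integrable f) :
    ∀ᵐ x, Integrable fun y => k (x - y) * f y := by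
  filter_upwards [hf.ae_convolution_exists (ContinuousLinearMap.mul ℝ ℝ) hk] with x hx
  refine hx.congr (ae_of_all _ fun y => ?_)
  simp [mul_comm]

variable {P Ψ Om : Rd d → ℝ} {A B D : ℝ}

theorem truncSet_subset_ae (hP : Prof d P Ψ B) (hOm : OmData d P Om A D) {f h : Rd d → ℝ}
    (hf : IM f) (hh : IM h) (n : ℤ) (lam : ℝ) :
    volume (truncSet P Om n f lam) ≤ volume (truncSet P Om n h (lam / 2)) +
      volume {x | lam / 2 <
        ∑ j ∈ Finset.Icc (-n) n, |cv (dil j (kOm P Om)) (fun y => f y - h y) x|} := by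
  have hK : ∀ j, Integrable (dil j (kOm P Om)) := fun j => ((hOm.im hP).dil j).int
  have h1 : ∀ᵐ x, ∀ j, cv (dil j (kOm P Om)) f x = cv (dil j (kOm P Om)) h x +
      cv (dil j (kOm P Om)) (fun y => f y - h y) x := by
    rw [ae_all_iff]
    intro j
    filter_upwards [ae_integrable_cv_integrand (hK j) hf.int,
      ae_integrable_cv_integrand (hK j) hh.int] with x hx hx'
    unfold cv
    simp only [mul_sub]
    rw [integral_sub hx hx']
    ring
  refine (measure_mono_ae ?_).trans (measure_union_le _ _)
  filter_upwards [h1] with x hx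
  rintro ⟨l, hl1, hl2, hlam⟩
  simp only [hx, Finset.sum_add_distrib] at hlam
  by_contra hnot
  have hnot' := not_or.1 hnot
  have h5 : |∑ j ∈ Finset.Icc l n, cv (dil j (kOm P Om)) h x| ≤ lam / 2 := by
    by_contra! h
    exact hnot'.1 ⟨l, hl1, hl2, h⟩
  have h6 : ∑ j ∈ Finset.Icc (-n) n, |cv (dil j (kOm P Om)) (fun y => f y - h y) x| ≤ lam / 2 := by
    by_contra! h
    exact hnot'.2 h
  have h7 : |∑ j ∈ Finset.Icc l n, cv (dil j (kOm P Om)) (fun y => f y - h y) x| ≤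
      ∑ j ∈ Finset.Icc (-n) n, |cv (dil j (kOm P Om)) (fun y => f y - h y) x| :=
    (Finset.abs_sum_le_sum_abs _ _).trans (Finset.sum_le_sum_of_subset_of_nonneg
      (Finset.Icc_subset_Icc_left hl1) fun _ _ _ => abs_nonneg _)
  linarith [abs_add_le (∑ j ∈ Finset.Icc l n, cv (dil j (kOm P Om)) h x)
    (∑ j ∈ Finset.Icc l n, cv (dil j (kOm P Om)) (fun y => f y - h y) x)]

theorem mul_volume_sum_abs_cv_le (hP : Prof d P Ψ B) (hOm : OmData d P Om A D) {u : Rd d → ℝ}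
    (hu : IM u) (n : ℤ) (μ : ℝ) :
    ENNReal.ofReal μ * volume {x | μ < ∑ j ∈ Finset.Icc (-n) n, |cv (dil j (kOm P Om)) u x|} ≤
      (Finset.Icc (-n) n).card * (ENNReal.ofReal (B * A) * ∫⁻ x, ‖u x‖ₑ) := by
  have hK : ∀ j, Measurable (dil j (kOm P Om)) := fun j => ((hOm.im hP).dil j).meas
  have hm : ∀ j, Measurable fun x => ‖cv (dil j (kOm P Om)) u x‖ₑ := fun j =>
    (measurable_cv (hK j) hu.meas).enorm
  calc _ ≤ ENNReal.ofReal μ * volume {x | ENNReal.ofReal μ ≤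
        ∑ j ∈ Finset.Icc (-n) n, ‖cv (dil j (kOm P Om)) u x‖ₑ} := by
        refine mul_le_mul_right (measure_mono fun x hx => ?_) _
        have h1 := ENNReal.ofReal_le_ofReal (le_of_lt hx)
        rw [ENNReal.ofReal_sum_of_nonneg fun _ _ => abs_nonneg _] at h1
        simp only [← Real.norm_eq_abs, ofReal_norm] at h1
        exact h1
    _ ≤ ∫⁻ x, ∑ j ∈ Finset.Icc (-n) n, ‖cv (dil j (kOm P Om)) u x‖ₑ :=
        mul_meas_ge_le_lintegral (Finset.measurable_fun_sum _ fun j _ => hm j) _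
    _ = ∑ j ∈ Finset.Icc (-n) n, ∫⁻ x, ‖cv (dil j (kOm P Om)) u x‖ₑ :=
        lintegral_finsetSum _ fun j _ => hm j
    _ ≤ ∑ j ∈ Finset.Icc (-n) n, ENNReal.ofReal (B * A) * ∫⁻ x, ‖u x‖ₑ := by
        refine Finset.sum_le_sum fun j _ => (lintegral_enorm_cv_le (hK j) hu.meas).trans ?_
        rw [lintegral_enorm_dil]
        exact mul_le_mul_left (hOm.lintegral_kOm_le hP fun x => le_rfl) _
    _ = _ := by rw [Finset.sum_const, nsmul_eq_mul]

theorem exists_weak_bound (hd : 2 ≤ d) (hP : Prof d P Ψ B) (hB : 0 < B) :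
    ∃ C : ℝ, 0 < C ∧ ∀ Om A D, OmData d P Om A D → ∀ f, IM f → ∀ (n : ℤ) (lam : ℝ), 0 < lam →
        ENNReal.ofReal lam * volume (truncSet P Om n f lam) ≤
          ENNReal.ofReal (C * D) * ∫⁻ x, ‖f x‖ₑ := by
  obtain ⟨C, hC, hstep⟩ := exists_weak_bound_stepFn hd hP hB
  refine ⟨2 * C, by positivity, fun Om A D hOm f hf n lam hlam => ?_⟩
  have hD : 0 < D := hOm.D_pos
  have hA : 0 < A := hOm.A_pos
  set M : ℝ := 2 * C * D + 2 * ((Finset.Icc (-n) n).card * (B * A)) with hM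
  have hM0 : 0 < M := by positivity
  set F := ∫⁻ x, ‖f x‖ₑ with hF
  refine ENNReal.le_of_forall_pos_le_add fun ε hε _ => ?_
  have hε' : (0:ℝ) < ε := hε
  obtain ⟨m, h, hh, hfh⟩ := exists_stepFn_approx hf.int (show 0 < ε / M by positivity)
  have h1 := hstep Om A D hOm _ m h hh n (lam / 2) (by positivity)
  have h2 := mul_volume_sum_abs_cv_le hP hOm (hf.sub hh.nice.toIM) n (lam / 2)
  have hh1 : ∫⁻ x, ‖h x‖ₑ ≤ F + ENNReal.ofReal (ε / M) := by
    calc ∫⁻ x, ‖h x‖ₑ ≤ ∫⁻ x, (‖f x‖ₑ + ‖f x - h x‖ₑ) := by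
          refine lintegral_mono fun x => ?_
          rw [show h x = f x - (f x - h x) by ring]
          refine (enorm_sub_le).trans_eq ?_
          rw [sub_sub_cancel]
      _ = F + ∫⁻ x, ‖f x - h x‖ₑ := lintegral_add_left hf.meas.enorm _
      _ ≤ _ := by gcongr
  have hl2 : ENNReal.ofReal lam = ENNReal.ofReal 2 * ENNReal.ofReal (lam / 2) := by
    rw [← ENNReal.ofReal_mul (by norm_num)]
    congr 1
    ring
  calc ENNReal.ofReal lam * volume (truncSet P Om n f lam)
      ≤ ENNReal.ofReal 2 * (ENNReal.ofReal (lam / 2) * volume (truncSet P Om n h (lam / 2)) +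
        ENNReal.ofReal (lam / 2) * volume {x | lam / 2 <
          ∑ j ∈ Finset.Icc (-n) n, |cv (dil j (kOm P Om)) (fun y => f y - h y) x|}) := by
        rw [hl2, mul_assoc, ← mul_add]
        exact mul_le_mul_right (mul_le_mul_right
          (truncSet_subset_ae hP hOm hf hh.nice.toIM n lam) _) _
    _ ≤ ENNReal.ofReal 2 * (ENNReal.ofReal (C * D) * (F + ENNReal.ofReal (ε / M)) +
        (Finset.Icc (-n) n).card * (ENNReal.ofReal (B * A) * ENNReal.ofReal (ε / M))) := by
        refine mul_le_mul_right (add_le_add (h1.trans ?_) (h2.trans ?_)) _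
        · exact mul_le_mul_right hh1 _
        · exact mul_le_mul_right (mul_le_mul_right hfh _) _
    _ = ENNReal.ofReal (2 * C * D) * F + ε := by
        rw [mul_add, mul_add, mul_add, add_assoc, ofReal_mul_ofReal_mul (by norm_num)]
        congr 1
        · rw [mul_assoc]
        · rw [← ENNReal.ofReal_natCast, ← ENNReal.ofReal_mul (by positivity),
            ← ENNReal.ofReal_mul (by positivity), ← ENNReal.ofReal_mul (by positivity),
            ← ENNReal.ofReal_mul (by positivity), ← ENNReal.ofReal_mul (by positivity),
            ← ENNReal.ofReal_add (by positivity) (by positivity), ← ENNReal.ofReal_coe_nnreal]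
          congr 1
          have : (ε:ℝ) = M * (ε / M) := by field_simp
          conv_rhs => rw [this]
          rw [hM]
          ring

end Density

section WeakType

variable {d : ℕ} {φ : Rd d → ℝ}

theorem Tj_congr {Om Ω f f' : Rd d → ℝ} (h : Om =ᵐ[volume] Ω) (hf : f' =ᵐ[volume] f) (j : ℤ)
    (x : Rd d) : Tj d φ Ω j f x = Tj d φ Om j f' x := by
  refine integral_congr_ae ?_
  have h1 := (quasiMeasurePreserving_sub_left_of_right_invariant volume x).ae h
  filter_upwards [h1, hf] with y hy hfy
  simp only [Kker, hy, hfy]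

theorem exists_eventually_lt_of_lt_TStar {Ω f : Rd d → ℝ} {lam : ℝ} (hlam : 0 < lam) {x : Rd d}
    (hx : ENNReal.ofReal lam < TStar d φ Ω f x) :
    ∃ l : ℤ, ∀ᶠ n : ℕ in Filter.atTop,
      lam < |∑ j ∈ Finset.Icc l (n:ℤ), Tj d φ Ω j f x| := by
  obtain ⟨l, hl⟩ := lt_iSup_iff.1 hx
  have hl' := (ENNReal.ofReal_lt_ofReal_iff_of_nonneg hlam.le).1 hl
  have hs : Summable fun j : {j : ℤ // l ≤ j} => Tj d φ Ω (j : ℤ) f x := by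
    by_contra hns
    rw [tsum_eq_zero_of_not_summable hns, abs_zero] at hl'
    exact lt_asymm hlam hl'
  have ht : Filter.Tendsto (fun n : ℕ => (Finset.Icc l (n:ℤ)).subtype (l ≤ ·)) Filter.atTop
      Filter.atTop := by
    refine Filter.tendsto_atTop_finset_of_monotone (fun a b hab => ?_) fun j => ?_
    · exact Finset.subtype_mono (Finset.Icc_subset_Icc_right (by exact_mod_cast hab))
    · refine ⟨(j : ℤ).toNat, ?_⟩
      rw [Finset.mem_subtype, Finset.mem_Icc]
      exact ⟨j.2, Int.self_le_toNat _⟩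
  have h1 := (hs.hasSum.comp ht).abs
  refine ⟨l, (h1.eventually (lt_mem_nhds hl')).mono fun n hn => ?_⟩
  refine hn.trans_eq ?_
  congr 1
  simp only [Function.comp_apply]
  rw [Finset.sum_subtype_eq_sum_filter (f := fun j => Tj d φ Ω j f x)]
  refine Finset.sum_congr (Finset.filter_true_of_mem fun j hj => (Finset.mem_Icc.1 hj).1) ?_
  exact fun _ _ => rfl

theorem volume_TStar_le {Ω f Om f' : Rd d → ℝ} {lam : ℝ} (hlam : 0 < lam) {K : ℝ≥0∞} (hd : 2 ≤ d)
    (hom : Homogeneous0 d Om) (hΩ : Om =ᵐ[volume] Ω) (hf : f' =ᵐ[volume] f)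
    (h : ∀ n : ℤ, ENNReal.ofReal lam * volume (truncSet (prP d φ) Om n f' lam) ≤ K) :
    ENNReal.ofReal lam * volume {x | ENNReal.ofReal lam < TStar d φ Ω f x} ≤ K := by
  set E : ℕ → Set (Rd d) := fun n => truncSet (prP d φ) Om n f' lam with hE
  have hsub : {x | ENNReal.ofReal lam < TStar d φ Ω f x} ⊆ ⋃ N : ℕ, ⋂ n ≥ N, E n := by
    intro x hx
    obtain ⟨l, hl⟩ := exists_eventually_lt_of_lt_TStar hlam hx
    obtain ⟨N, hN⟩ := Filter.eventually_atTop.1 hl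
    refine Set.mem_iUnion.2 ⟨max N l.natAbs, Set.mem_iInter₂.2 fun n hn => ?_⟩
    refine ⟨l, by omega, by omega, ?_⟩
    have h1 := hN n (by omega)
    have h2 : ∀ j, Tj d φ Ω j f x = cv (dil j (kOm (prP d φ) Om)) f' x := fun j => by
      rw [Tj_congr hΩ hf, ← Kker_eq_dil hd hom]
      rfl
    simpa only [h2] using h1
  have hmono : Monotone fun N : ℕ => ⋂ n ≥ N, E n := fun a b hab =>
    Set.biInter_mono (fun n hn => le_trans hab hn) fun _ _ => le_rfl
  refine (mul_le_mul_right (measure_mono hsub) _).trans ?_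
  rw [hmono.measure_iUnion, ENNReal.mul_iSup]
  exact iSup_le fun N => (mul_le_mul_right (measure_mono (Set.biInter_subset_of_mem
    (show N ≥ N from le_rfl))) _).trans (h N)

theorem ae_eq_zero_of_omegaL1_eq_zero (hd : 2 ≤ d) {Ω : Rd d → ℝ} (hΩ : OmegaHyp d Ω)
    (hA : omegaL1 d Ω = 0) : (0 : Rd d → ℝ) =ᵐ[volume] Ω := by
  obtain ⟨hhom, hint, -, -⟩ := hΩ
  have h1 := (integral_eq_zero_iff_of_nonneg (fun θ => abs_nonneg _) hint.abs).1 hA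
  refine ae_of_ae_sphere hd (p := fun x => (0 : Rd d → ℝ) x = Ω x) (fun x hx h => ?_) ?_
  · rw [hhom x hx _ (by positivity)] at h
    exact h
  · filter_upwards [h1] with θ hθ
    exact (abs_eq_zero.1 hθ).symm

end WeakType

/-- The maximal dyadic truncated operator `T_*` is of weak type `(1,1)`. -/
theorem weak_type_one_one_TStar :
    ∀ d : ℕ, 2 ≤ d →
    ∀ φ : Rd d → ℝ, AdmissiblePhi d φ →
    ∃ C : ℝ, 0 < C ∧
      ∀ Ω : Rd d → ℝ, OmegaHyp d Ω →
      ∀ f : Rd d → ℝ, Integrable f →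
      ∀ lam : ℝ, 0 < lam →
        ENNReal.ofReal lam * volume {x : Rd d | ENNReal.ofReal lam < TStar d φ Ω f x} ≤
          ENNReal.ofReal (C * constCOmega d Ω * ∫ x : Rd d, |f x|) := by
  intro d hd φ hφ
  obtain ⟨Ψ, B, hB, hP'⟩ := exists_prof hφ
  have hP : Prof d (prP d φ) Ψ B := hP'
  obtain ⟨C, hC, hweak⟩ := exists_weak_bound hd hP hB
  have hlog : 0 < Real.log (5 / 4) := Real.log_pos (by norm_num)
  refine ⟨C * (1 + (Real.log (5 / 4))⁻¹), by positivity, fun Ω hΩ f hf lam hlam => ?_⟩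
  by_cases hA : omegaL1 d Ω = 0
  · refine le_of_eq_of_le ?_ zero_le
    have h0 : ∀ x, TStar d φ Ω f x = 0 := by
      intro x
      have h1 : ∀ j, Tj d φ Ω j f x = 0 := by
        intro j
        rw [Tj_congr (ae_eq_zero_of_omegaL1_eq_zero hd hΩ hA) (Filter.EventuallyEq.refl _ f)]
        simp [Tj, Kker]
      simp [TStar, h1]
    simp [h0]
  · obtain ⟨Om, hOm, hdat⟩ := exists_omData hφ hd hP hΩ hA
    have hmk : hf.aestronglyMeasurable.mk f =ᵐ[volume] f := hf.aestronglyMeasurable.ae_eq_mk.symm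
    have him : IM (hf.aestronglyMeasurable.mk f) := ⟨hf.aestronglyMeasurable.stronglyMeasurable_mk.measurable, hf.congr hmk.symm⟩
    have hL : ∫⁻ x, ‖hf.aestronglyMeasurable.mk f x‖ₑ = ENNReal.ofReal (∫ x, |f x|) := by
      refine (lintegral_congr_ae (hmk.fun_comp fun t : ℝ => ‖t‖ₑ)).trans ?_
      exact (ofReal_integral_norm_eq_lintegral_enorm hf).symm
    refine volume_TStar_le hlam hd hdat.hom hOm hmk fun n => ?_
    refine (hweak Om _ _ hdat _ him n lam hlam).trans_eq ?_
    rw [hL, ← ENNReal.ofReal_mul (mul_nonneg hC.le hdat.D_pos.le), ← mul_assoc C]
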